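/- Let H ∈ (0,1/2), a ∈ ℝ, t ∈ (0,∞), and let (ε_n) be any sequence of positive numbers with ε_n → 0. Then lim_{n→∞} ε_n^{1/H − 1} U_{0,t}(ε_n, B − a) = (c_H/2) · L_t(a) almost surely, where c_H is the constant from the convergence of the (1/H)-th variation along uniform Lebesgue partitions. -/

import Mathlib

open MeasureTheory ProbabilityTheory Filter Set ENNReal Asymptotics
open scoped NNReal Classical Topology

noncomputable section

/-- The grid `εℤ` of levels. -/
def lvGrid (ε : ℝ) : Set ℝ := {x | ∃ k : ℤ, x = ε * k}

/-- The successive times at which the path `w` crosses to a new point of the grid `εℤ`,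
with values in `ℝ≥0∞` (`∞` meaning "never", corresponding to the convention `inf ∅ = +∞`). -/
def hitT (ε : ℝ) (w : ℝ → ℝ) : ℕ → ℝ≥0∞
  | 0 => 0
  | n + 1 =>
      ⨅ (r : ℝ) (_ : hitT ε w n < ENNReal.ofReal r ∧ w r ∈ lvGrid ε ∧
          w r ≠ w ((hitT ε w n).toReal)), ENNReal.ofReal r

/-- `K_{s,t}(ε,w)`: the number of `ε`-level crossings of `w` in the interval `[s,t]`,
namely `#{n ≥ 2 : T_n(ε, w_{s+·}) ≤ t-s} + 1_{w_s ∈ εℤ}·1_{T_1(ε, w_{s+·}) ≤ t-s}`,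
as an extended natural number. -/
def crossK (ε : ℝ) (w : ℝ → ℝ) (s t : ℝ) : ℕ∞ :=
  {n : ℕ | 2 ≤ n ∧ hitT ε (fun r => w (s + r)) n ≤ ENNReal.ofReal (t - s)}.encard
    + (if w s ∈ lvGrid ε ∧ hitT ε (fun r => w (s + r)) 1 ≤ ENNReal.ofReal (t - s)
        then 1 else 0)

/-- `K_{s,t}(ε,w)` as an extended nonnegative real. -/
def crossKe (ε : ℝ) (w : ℝ → ℝ) (s t : ℝ) : ℝ≥0∞ := (crossK ε w s t : ℝ≥0∞)

/-- `K_{s,t}(ε,w)` as a real number (junk value `0` if the count is infinite). -/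
def crossKR (ε : ℝ) (w : ℝ → ℝ) (s t : ℝ) : ℝ := (crossKe ε w s t).toReal

/-- The averaged crossing count `K̄_{s,t}(ε,w) = ε⁻¹ ∫_{-ε/2}^{ε/2} K_{s,t}(ε, w+ρ) dρ`. -/
def avgK (ε : ℝ) (w : ℝ → ℝ) (s t : ℝ) : ℝ≥0∞ :=
  ENNReal.ofReal ε⁻¹ * ∫⁻ ρ in Set.Ioo (-(ε / 2)) (ε / 2), crossKe ε (fun r => w r + ρ) s t

/-- `B` is a fractional Brownian motion with Hurst parameter `H` under `P`:
a centered Gaussian process with continuous paths, `B 0 = 0`, and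
`E[(B_t - B_s)^2] = a_H |t-s|^(2H)` for some constant `a_H > 0`. -/
def IsFBM {Ω : Type*} [MeasurableSpace Ω] (H : ℝ) (P : Measure Ω) (B : ℝ → Ω → ℝ) : Prop :=
  (∀ ω, Continuous fun t => B t ω) ∧ (∀ ω, B 0 ω = 0) ∧ (∀ t, Measurable (B t)) ∧
  (∀ (n : ℕ) (t : Fin n → ℝ) (c : Fin n → ℝ), ∃ v : ℝ≥0,
      Measure.map (fun ω => ∑ i, c i * B (t i) ω) P = gaussianReal 0 v) ∧
  (∃ aH : ℝ, 0 < aH ∧ ∀ s t : ℝ, ∫ ω, (B t ω - B s ω) ^ 2 ∂P = aH * |t - s| ^ (2 * H))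

/-- The constant `c_H = sup_{t>0} t⁻¹ E[K̄_{0,t}(1,B)] (= lim_{t→∞} t⁻¹ E[K̄_{0,t}(1,B)]`,
the limit existing by superadditivity and Fekete's lemma), as an extended nonnegative real. -/
def cHe {Ω : Type*} [MeasurableSpace Ω] (P : Measure Ω) (B : ℝ → Ω → ℝ) : ℝ≥0∞ :=
  ⨆ (t : ℝ) (_ : 0 < t), (ENNReal.ofReal t)⁻¹ * ∫⁻ ω, avgK 1 (fun r => B r ω) 0 t ∂P

/-- The constant `c_H` as a real number. -/
def cH {Ω : Type*} [MeasurableSpace Ω] (P : Measure Ω) (B : ℝ → Ω → ℝ) : ℝ :=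
  (cHe P B).toReal

/-- The set of pairs (u,v) realizing an upcrossing of the interval `[0,ε]` by `w`
during `[s,t]`. -/
def upSet (ε : ℝ) (w : ℝ → ℝ) (s t : ℝ) : Set (ℝ × ℝ) :=
  {p | p.1 ∈ Set.Icc s t ∧ p.2 ∈ Set.Icc s t ∧ p.1 < p.2 ∧ w p.1 = 0 ∧ w p.2 = ε ∧
    ∀ r ∈ Set.Ioo p.1 p.2, w r ∈ Set.Ioo 0 ε}

/-- `U_{s,t}(ε,w)`: the number of upcrossings of `[0,ε]` by `w` during `[s,t]`. -/
def upE (ε : ℝ) (w : ℝ → ℝ) (s t : ℝ) : ℕ∞ := (upSet ε w s t).encard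

/-- `U_{s,t}(ε,w)` as a real number (junk value `0` if the count is infinite). -/
def upR (ε : ℝ) (w : ℝ → ℝ) (s t : ℝ) : ℝ := ((upE ε w s t : ℝ≥0∞)).toReal

set_option linter.unusedVariables false
set_option linter.unusedSimpArgs false
set_option linter.deprecated false
set_option linter.unusedSectionVars false
section



/-- `UpN D α β w n T`: at least `n` upcrossings of `[α,β]` along `D` before time `T`. -/
def UpN (D : Set ℝ) (α β : ℝ) (w : ℝ → ℝ) : ℕ → ℝ → Prop
  | 0, _ => True
  | n + 1, T => ∃ q ∈ D, q ≤ T ∧ β ≤ w q ∧ ∃ p ∈ D, p < q ∧ w p ≤ α ∧ UpN D α β w n p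

/-- Number of upcrossings of `[α,β]` along `D`. -/
def Up (D : Set ℝ) (α β : ℝ) (w : ℝ → ℝ) : ℝ≥0∞ :=
  ⨆ (n : ℕ) (_ : ∃ T, UpN D α β w n T), (n : ℝ≥0∞)

lemma UpN_mono {D : Set ℝ} {α β : ℝ} {w : ℝ → ℝ} {n : ℕ} {T T' : ℝ} (h : T ≤ T')
    (hU : UpN D α β w n T) : UpN D α β w n T' := by
  cases n with
  | zero => trivial
  | succ n =>
    obtain ⟨q, hq, hqT, h1⟩ := hU
    exact ⟨q, hq, hqT.trans h, h1⟩

lemma UpN_pred {D : Set ℝ} {α β : ℝ} {w : ℝ → ℝ} {n : ℕ} {T : ℝ}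
    (hU : UpN D α β w (n + 1) T) : UpN D α β w n T := by
  obtain ⟨q, hq, hqT, h1, p, hp, hpq, h2, h3⟩ := hU
  exact UpN_mono (by linarith) h3

lemma UpN_of_le {D : Set ℝ} {α β : ℝ} {w : ℝ → ℝ} {n m : ℕ} {T : ℝ} (h : m ≤ n)
    (hU : UpN D α β w n T) : UpN D α β w m T := by
  induction n, h using Nat.le_induction with
  | base => exact hU
  | succ n hmn ih => exact ih (UpN_pred hU)

lemma le_Up {D : Set ℝ} {α β : ℝ} {w : ℝ → ℝ} {n : ℕ} {T : ℝ}
    (hU : UpN D α β w n T) : (n : ℝ≥0∞) ≤ Up D α β w :=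
  le_iSup₂_of_le (f := fun (n : ℕ) (_ : ∃ T, UpN D α β w n T) => (n : ℝ≥0∞)) n ⟨T, hU⟩ le_rfl

lemma le_Up_iff {D : Set ℝ} {α β : ℝ} {w : ℝ → ℝ} {n : ℕ} :
    (n : ℝ≥0∞) ≤ Up D α β w ↔ ∃ T, UpN D α β w n T := by
  constructor
  · intro h
    cases n with
    | zero => exact ⟨0, trivial⟩
    | succ n =>
      have h1 : (n : ℝ≥0∞) < Up D α β w := lt_of_lt_of_le (by exact_mod_cast Nat.lt_succ_self n) h
      unfold Up at h1
      rw [lt_iSup_iff] at h1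
      obtain ⟨k, hk⟩ := h1
      rw [lt_iSup_iff] at hk
      obtain ⟨⟨T, hT⟩, hk⟩ := hk
      exact ⟨T, UpN_of_le (by exact_mod_cast hk) hT⟩
  · rintro ⟨T, hT⟩
    exact le_Up hT

lemma Up_le {D : Set ℝ} {α β : ℝ} {w : ℝ → ℝ} {x : ℝ≥0∞}
    (h : ∀ n T, UpN D α β w n T → (n : ℝ≥0∞) ≤ x) : Up D α β w ≤ x :=
  iSup₂_le fun n ⟨T, hT⟩ => h n T hT

lemma Up_le_of_map {D D' : Set ℝ} {α β α' β' : ℝ} {w w' : ℝ → ℝ} (φ : ℝ → ℝ)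
    (hφ : StrictMonoOn φ D) (hD : MapsTo φ D D')
    (h1 : ∀ p ∈ D, w p ≤ α → w' (φ p) ≤ α') (h2 : ∀ q ∈ D, β ≤ w q → β' ≤ w' (φ q)) :
    Up D α β w ≤ Up D' α' β' w' := by
  have key : ∀ n, ∀ T ∈ D, UpN D α β w n T → UpN D' α' β' w' n (φ T) := by
    intro n
    induction n with
    | zero => intro T _ _; trivial
    | succ n ih =>
      rintro T hT ⟨q, hq, hqT, hb, p, hp, hpq, ha, hU⟩
      exact ⟨φ q, hD hq, hφ.monotoneOn hq hT hqT, h2 q hq hb, φ p, hD hp, hφ hp hq hpq,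
        h1 p hp ha, ih p hp hU⟩
  refine Up_le fun n T hT => ?_
  cases n with
  | zero => simp
  | succ n =>
    obtain ⟨q, hq, hqT, h⟩ := hT
    exact le_Up (key (n + 1) q hq ⟨q, hq, le_rfl, h⟩)

lemma Up_mono {D D' : Set ℝ} {α β α' β' : ℝ} {w w' : ℝ → ℝ} (hD : D ⊆ D')
    (h1 : ∀ p ∈ D, w p ≤ α → w' p ≤ α') (h2 : ∀ q ∈ D, β ≤ w q → β' ≤ w' q) :
    Up D α β w ≤ Up D' α' β' w' :=
  Up_le_of_map id (fun _ _ _ _ h => h) hD h1 h2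

lemma Up_mono_lev {D : Set ℝ} {α β α' β' : ℝ} {w : ℝ → ℝ} (h1 : α ≤ α') (h2 : β' ≤ β) :
    Up D α β w ≤ Up D α' β' w :=
  Up_mono Subset.rfl (fun _ _ h => h.trans h1) (fun _ _ h => h2.trans h)

lemma Up_congr {D : Set ℝ} {α β : ℝ} {w w' : ℝ → ℝ} (h : ∀ p ∈ D, w p = w' p) :
    Up D α β w = Up D α β w' := by
  apply le_antisymm <;> apply Up_mono Subset.rfl <;> intro p hp <;> rw [h p hp] <;> exact id

lemma Up_pert {D : Set ℝ} {α β η : ℝ} {w w' : ℝ → ℝ} (h : ∀ p ∈ D, |w p - w' p| ≤ η) :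
    Up D α β w ≤ Up D (α + η) (β - η) w' := by
  apply Up_mono Subset.rfl <;> intro p hp h1 <;> have := abs_le.1 (h p hp) <;> linarith

/-- affine change of time and space -/
lemma Up_affine {D : Set ℝ} {α β : ℝ} {w : ℝ → ℝ} {a b c d : ℝ} (ha : 0 < a) (hc : 0 < c) :
    Up ((fun r => a * r + b) '' D) α β w
      = Up D (c * (α - d)) (c * (β - d)) (fun r => c * (w (a * r + b) - d)) := by
  apply le_antisymm
  · apply Up_le_of_map (fun r => (r - b) / a)
    · intro x _ y _ hxy
      simp only
      gcongr
    · rintro _ ⟨r, hr, rfl⟩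
      simp only
      convert hr using 1
      field_simp
      ring
    · rintro _ ⟨r, hr, rfl⟩ h
      have : a * ((a * r + b - b) / a) + b = a * r + b := by field_simp; ring
      simp only [this]
      gcongr
    · rintro _ ⟨r, hr, rfl⟩ h
      have : a * ((a * r + b - b) / a) + b = a * r + b := by field_simp; ring
      simp only [this]
      gcongr
  · apply Up_le_of_map (fun r => a * r + b)
    · intro x _ y _ hxy
      simp only
      gcongr
    · intro r hr
      exact ⟨r, hr, rfl⟩
    · intro p hp h
      simpa using le_of_mul_le_mul_left h hc
    · intro p hp h
      simpa using le_of_mul_le_mul_left h hc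

lemma Up_shift {D : Set ℝ} {α β : ℝ} {w : ℝ → ℝ} (y : ℝ) :
    Up D α β (fun r => w r + y) = Up D (α - y) (β - y) w := by
  apply le_antisymm <;> apply Up_mono Subset.rfl <;> intro p hp h <;> linarith

section split
variable {D1 D2 : Set ℝ} {α β s : ℝ} {w : ℝ → ℝ}

lemma UpN_restrict (h1 : D1 ⊆ Iic s) (h2 : D2 ⊆ Ici s) (hs1 : s ∈ D1) {n : ℕ} {T : ℝ}
    (hT : T ≤ s) (hU : UpN (D1 ∪ D2) α β w n T) : UpN D1 α β w n T := by
  induction n generalizing T with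
  | zero => trivial
  | succ n ih =>
    obtain ⟨q, hq, hqT, hb, p, hp, hpq, ha, hU⟩ := hU
    have aux : ∀ x ∈ D1 ∪ D2, x ≤ s → x ∈ D1 := by
      rintro x (hx | hx) hxs
      · exact hx
      · have := h2 hx
        rwa [le_antisymm hxs this]
    exact ⟨q, aux q hq (hqT.trans hT), hqT, hb, p, aux p hp (by linarith), hpq, ha, ih (by linarith) hU⟩

lemma Up_split_le (h1 : D1 ⊆ Iic s) (h2 : D2 ⊆ Ici s) (hs1 : s ∈ D1) (hs2 : s ∈ D2) :
    Up (D1 ∪ D2) α β w ≤ Up D1 α β w + Up D2 α β w + (Ioo α β).indicator 1 (w s) := by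
  have key : ∀ n T, UpN (D1 ∪ D2) α β w n T → ∃ k l, UpN D1 α β w k s ∧ UpN D2 α β w l T ∧
      (n ≤ k + l ∨ (n ≤ k + l + 1 ∧ w s ∈ Ioo α β)) := by
    intro n
    induction n with
    | zero => intro T _; exact ⟨0, 0, trivial, trivial, by simp⟩
    | succ n ih =>
      rintro T ⟨q, hq, hqT, hb, p, hp, hpq, ha, hU⟩
      by_cases hps : s ≤ p
      · have hp2 : p ∈ D2 := by
          rcases hp with hp | hp
          · have := h1 hp
            rwa [le_antisymm this hps]
          · exact hp
        have hq2 : q ∈ D2 := by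
          rcases hq with hq | hq
          · have := h1 hq
            simp only [mem_Iic] at this
            linarith
          · exact hq
        obtain ⟨k, l, hk, hl, h⟩ := ih p hU
        refine ⟨k, l + 1, hk, ⟨q, hq2, hqT, hb, p, hp2, hpq, ha, hl⟩, ?_⟩
        rcases h with h | ⟨h, h'⟩
        · left; omega
        · right; exact ⟨by omega, h'⟩
      · push Not at hps
        have hp1 : p ∈ D1 := by
          rcases hp with hp | hp
          · exact hp
          · have := h2 hp
            simp only [mem_Ici] at this
            linarith
        have hU1 := UpN_restrict h1 h2 hs1 hps.le hU
        by_cases hqs : q ≤ s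
        · have hq1 : q ∈ D1 := by
            rcases hq with hq | hq
            · exact hq
            · have := h2 hq
              rwa [le_antisymm hqs this]
          exact ⟨n + 1, 0, ⟨q, hq1, hqs, hb, p, hp1, hpq, ha, hU1⟩, trivial, by simp⟩
        · push Not at hqs
          have hq2 : q ∈ D2 := by
            rcases hq with hq | hq
            · have := h1 hq
              simp only [mem_Iic] at this
              linarith
            · exact hq
          by_cases hw1 : w s ≤ α
          · exact ⟨n, 1, UpN_mono hps.le hU1, ⟨q, hq2, hqT, hb, s, hs2, hqs, hw1, trivial⟩, by simp⟩
          by_cases hw2 : β ≤ w s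
          · exact ⟨n + 1, 0, ⟨s, hs1, le_rfl, hw2, p, hp1, hps, ha, hU1⟩, trivial, by simp⟩
          · push Not at hw1 hw2
            exact ⟨n, 0, UpN_mono hps.le hU1, trivial, by simp [hw1, hw2]⟩
  refine Up_le fun n T hT => ?_
  obtain ⟨k, l, hk, hl, h⟩ := key n T hT
  rcases h with h | ⟨h, h'⟩
  · calc (n : ℝ≥0∞) ≤ (k : ℝ≥0∞) + l := by exact_mod_cast h
      _ ≤ Up D1 α β w + Up D2 α β w := add_le_add (le_Up hk) (le_Up hl)
      _ ≤ _ := le_self_add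
  · rw [indicator_of_mem h']
    calc (n : ℝ≥0∞) ≤ (k : ℝ≥0∞) + l + 1 := by exact_mod_cast h
      _ ≤ _ := by
        simp only [Pi.one_apply]
        gcongr
        · exact le_Up hk
        · exact le_Up hl

lemma Up_split_ge (h1 : D1 ⊆ Iic s) (h2 : D2 ⊆ Ici s) :
    Up D1 α β w + Up D2 α β w ≤ Up (D1 ∪ D2) α β w := by
  have m1 : ∀ n T, UpN D1 α β w n T → UpN (D1 ∪ D2) α β w n s := by
    have : ∀ n T, UpN D1 α β w n T → UpN (D1 ∪ D2) α β w n T := by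
      intro n
      induction n with
      | zero => intro T _; trivial
      | succ n ih =>
        rintro T ⟨q, hq, hqT, hb, p, hp, hpq, ha, hU⟩
        exact ⟨q, Or.inl hq, hqT, hb, p, Or.inl hp, hpq, ha, ih p hU⟩
    intro n T hT
    cases n with
    | zero => trivial
    | succ n =>
      obtain ⟨q, hq, hqT, hb, p, hp, hpq, ha, hU⟩ := hT
      exact ⟨q, Or.inl hq, h1 hq, hb, p, Or.inl hp, hpq, ha, this _ _ hU⟩
  have key : ∀ k T, UpN D1 α β w k T → ∀ l T', s ≤ T' → UpN D2 α β w l T' →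
      UpN (D1 ∪ D2) α β w (k + l) T' := by
    intro k T hk l
    induction l with
    | zero => intro T' hT' _; exact UpN_mono hT' (m1 k T hk)
    | succ l ih =>
      rintro T' hT' ⟨q, hq, hqT, hb, p, hp, hpq, ha, hU⟩
      exact ⟨q, Or.inr hq, hqT, hb, p, Or.inr hp, hpq, ha, ih p (h2 hp) hU⟩
  unfold Up
  refine ENNReal.biSup_add_biSup_le' ?_ ?_ ?_
  · exact ⟨0, 0, trivial⟩
  · exact ⟨0, 0, trivial⟩
  · rintro k ⟨T, hT⟩ l ⟨T', hT'⟩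
    have := le_Up (key k T hT l (max s T') (le_max_left _ _) (UpN_mono (le_max_right _ _) hT'))
    rw [Nat.cast_add] at this
    exact this
end split

/-- block decomposition -/
lemma Up_blocks {D : ℕ → Set ℝ} {s : ℕ → ℝ} {α β : ℝ} {w : ℝ → ℝ}
    (hD : ∀ i, D i ⊆ Icc (s i) (s (i + 1))) (hs0 : ∀ i, s i ∈ D i) (hs1 : ∀ i, s (i + 1) ∈ D i)
    (n : ℕ) :
    ∑ i ∈ Finset.range n, Up (D i) α β w ≤ Up (⋃ i < n, D i) α β w ∧
    Up (⋃ i < n, D i) α β w ≤ ∑ i ∈ Finset.range n, Up (D i) α β w +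
      ∑ i ∈ Finset.range n, (Ioo α β).indicator 1 (w (s i)) := by
  have hmono : Monotone s := monotone_nat_of_le_succ fun i => (hD i (hs0 i)).2
  induction n with
  | zero =>
    simp only [Finset.range_zero, Finset.sum_empty, zero_le, true_and, add_zero]
    refine Up_le fun n T hT => ?_
    cases n with
    | zero => simp
    | succ n =>
      obtain ⟨q, hq, _⟩ := hT
      simp at hq
  | succ n ih =>
    have e : (⋃ i < n + 1, D i) = (⋃ i < n, D i) ∪ D n := by
      ext x; simp only [mem_iUnion, mem_union, exists_prop, Nat.lt_succ_iff]
      constructor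
      · rintro ⟨i, hi, hx⟩
        rcases hi.lt_or_eq with h | rfl
        · exact Or.inl ⟨i, h, hx⟩
        · exact Or.inr hx
      · rintro (⟨i, hi, hx⟩ | hx)
        · exact ⟨i, hi.le, hx⟩
        · exact ⟨n, le_rfl, hx⟩
    have h1 : (⋃ i < n, D i) ⊆ Iic (s n) := by
      simp only [iUnion_subset_iff]
      intro i hi x hx
      exact (hD i hx).2.trans (hmono hi)
    have h2 : D n ⊆ Ici (s n) := fun x hx => (hD n hx).1
    rw [e, Finset.sum_range_succ, Finset.sum_range_succ]
    refine ⟨(add_le_add_left ih.1 _).trans (Up_split_ge h1 h2), ?_⟩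
    rcases Nat.eq_zero_or_pos n with rfl | hn
    · have e0 : (⋃ i < 0, D i) ∪ D 0 = D 0 := by simp
      rw [e0, Finset.range_zero, Finset.sum_empty, zero_add]
      exact le_self_add
    · have h3 : s n ∈ (⋃ i < n, D i) := by
        simp only [mem_iUnion]
        refine ⟨n - 1, by omega, ?_⟩
        have := hs1 (n - 1)
        rwa [Nat.sub_add_cancel hn] at this
      calc _ ≤ _ := Up_split_le h1 h2 h3 (hs0 n)
        _ ≤ _ := by
          refine (add_le_add_left (add_le_add_left ih.2 _) _).trans (le_of_eq ?_)
          ring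

lemma measurableSet_UpN {Z : Type*} [MeasurableSpace Z] {D : Set ℝ} (hD : D.Countable)
    {α β : Z → ℝ} {W : Z → ℝ → ℝ} (hα : Measurable α) (hβ : Measurable β)
    (hW : ∀ p ∈ D, Measurable fun z => W z p) (n : ℕ) (T : ℝ) :
    MeasurableSet {z | UpN D (α z) (β z) (W z) n T} := by
  induction n generalizing T with
  | zero => simp [UpN]
  | succ n ih =>
    have : {z | UpN D (α z) (β z) (W z) (n + 1) T} = ⋃ q ∈ D, ⋃ p ∈ D,
        {z | q ≤ T ∧ p < q} ∩ {z | β z ≤ W z q} ∩ {z | W z p ≤ α z} ∩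
          {z | UpN D (α z) (β z) (W z) n p} := by
      ext z
      simp only [UpN, mem_setOf_eq, mem_iUnion, mem_inter_iff, exists_prop]
      constructor
      · rintro ⟨q, hq, hqT, hb, p, hp, hpq, ha, hU⟩
        exact ⟨q, hq, p, hp, ⟨⟨⟨hqT, hpq⟩, hb⟩, ha⟩, hU⟩
      · rintro ⟨q, hq, p, hp, ⟨⟨⟨hqT, hpq⟩, hb⟩, ha⟩, hU⟩
        exact ⟨q, hq, hqT, hb, p, hp, hpq, ha, hU⟩
    rw [this]
    refine MeasurableSet.biUnion hD fun q hq => MeasurableSet.biUnion hD fun p hp => ?_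
    exact (((MeasurableSet.const _).inter (measurableSet_le hβ (hW q hq))).inter
      (measurableSet_le (hW p hp) hα)).inter (ih p)

lemma measurable_Up {Z : Type*} [MeasurableSpace Z] {D : Set ℝ} (hD : D.Countable)
    {α β : Z → ℝ} {W : Z → ℝ → ℝ} (hα : Measurable α) (hβ : Measurable β)
    (hW : ∀ p ∈ D, Measurable fun z => W z p) :
    Measurable fun z => Up D (α z) (β z) (W z) := by
  have : (fun z => Up D (α z) (β z) (W z)) = fun z => ⨆ (n : ℕ),
      ({z | ∃ T : ℕ, UpN D (α z) (β z) (W z) n T}).indicator (fun _ => (n : ℝ≥0∞)) z := by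
    ext z
    unfold Up
    congr 1
    ext n
    by_cases h : ∃ T, UpN D (α z) (β z) (W z) n T
    · rw [indicator_of_mem]
      · simp [h]
      · obtain ⟨T, hT⟩ := h
        obtain ⟨m, hm⟩ := exists_nat_ge T
        exact ⟨m, UpN_mono hm hT⟩
    · rw [indicator_of_notMem]
      · simp [h]
      · rintro ⟨T, hT⟩
        exact h ⟨T, hT⟩
  rw [this]
  refine Measurable.iSup fun n => Measurable.indicator measurable_const ?_
  simp only [setOf_exists]
  exact MeasurableSet.iUnion fun T => measurableSet_UpN hD hα hβ hW n T

end

section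



lemma exists_cross {w : ℝ → ℝ} (hw : Continuous w) {α β p q : ℝ} (hαβ : α < β) (hpq : p < q)
    (hp : w p ≤ α) (hq : β ≤ w q) :
    ∃ u v, p ≤ u ∧ u < v ∧ v ≤ q ∧ w u = α ∧ w v = β ∧ ∀ r ∈ Ioo u v, w r ∈ Ioo α β := by
  -- first time above β
  have hS : IsCompact (Icc p q ∩ w ⁻¹' Ici β) :=
    isCompact_Icc.inter_right (isClosed_Ici.preimage hw)
  obtain ⟨v, hv, hvmin⟩ := hS.exists_isLeast ⟨q, ⟨hpq.le, le_rfl⟩, hq⟩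
  have hpv : p < v := by
    rcases hv.1.1.lt_or_eq with h | h
    · exact h
    · exfalso
      have := hv.2
      rw [← h] at this
      simp only [mem_preimage, mem_Ici] at this
      linarith
  have hlt : ∀ r ∈ Ico p v, w r < β := by
    intro r hr
    by_contra h
    push Not at h
    have := hvmin ⟨⟨hr.1, hr.2.le.trans hv.1.2⟩, h⟩
    linarith [hr.2]
  have hwv : w v = β := by
    apply le_antisymm _ hv.2
    have : v ∈ closure (Ico p v) := by
      rw [closure_Ico hpv.ne]; exact ⟨hpv.le, le_rfl⟩
    exact closure_minimal (fun r hr => (hlt r hr).le : Ico p v ⊆ w ⁻¹' Iic β)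
      (isClosed_Iic.preimage hw) this
  have hS2 : IsCompact (Icc p v ∩ w ⁻¹' Iic α) :=
    isCompact_Icc.inter_right (isClosed_Iic.preimage hw)
  obtain ⟨u, hu, humax⟩ := hS2.exists_isGreatest ⟨p, ⟨le_rfl, hpv.le⟩, hp⟩
  have huv : u < v := by
    rcases hu.1.2.lt_or_eq with h | h
    · exact h
    · exfalso
      have := hu.2
      rw [h] at this
      simp only [mem_preimage, mem_Iic] at this
      linarith
  have hgt : ∀ r ∈ Ioc u v, α < w r := by
    intro r hr
    by_contra h
    push Not at h
    have := humax ⟨⟨hu.1.1.trans hr.1.le, hr.2⟩, h⟩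
    linarith [hr.1]
  have hwu : w u = α := by
    apply le_antisymm hu.2
    have : u ∈ closure (Ioc u v) := by
      rw [closure_Ioc huv.ne]; exact ⟨le_rfl, huv.le⟩
    exact closure_minimal (fun r hr => (hgt r hr).le : Ioc u v ⊆ w ⁻¹' Ici α)
      (isClosed_Ici.preimage hw) this
  exact ⟨u, v, hu.1.1, huv, hv.1.2, hwu, hwv, fun r hr =>
    ⟨hgt r ⟨hr.1, hr.2.le⟩, hlt r ⟨hu.1.1.trans hr.1.le, hr.2⟩⟩⟩

lemma upSet_snd_inj {ε s t : ℝ} {w : ℝ → ℝ} {z z' : ℝ × ℝ} (hz : z ∈ upSet ε w s t)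
    (hz' : z' ∈ upSet ε w s t) (h : z.2 = z'.2) : z = z' := by
  have aux : ∀ z z' : ℝ × ℝ, z ∈ upSet ε w s t → z' ∈ upSet ε w s t → z.2 = z'.2 → z'.1 ≤ z.1 := by
    rintro z z' ⟨_, _, h1, h2, h3, h4⟩ ⟨_, _, h1', h2', h3', h4'⟩ h
    by_contra hc
    push Not at hc
    have := (h4 z'.1 ⟨hc, by rw [h]; exact h1'⟩).1
    linarith
  exact Prod.ext (le_antisymm (aux z' z hz' hz h.symm) (aux z z' hz hz' h)) h

lemma upSet_order {ε s t : ℝ} {w : ℝ → ℝ} {z z' : ℝ × ℝ} (hz : z ∈ upSet ε w s t)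
    (hz' : z' ∈ upSet ε w s t) (h : z.2 < z'.2) : z.2 ≤ z'.1 := by
  obtain ⟨_, _, h1, h2, h3, h4⟩ := hz
  obtain ⟨_, _, h1', h2', h3', h4'⟩ := hz'
  by_contra hc
  push Not at hc
  have := (h4' z.2 ⟨hc, h⟩).2
  linarith

lemma Up_eq_upE {ε s t : ℝ} {w : ℝ → ℝ} (hw : Continuous w) (hε : 0 < ε) :
    Up (Icc s t) 0 ε w = (upE ε w s t : ℝ≥0∞) := by
  unfold upE
  apply le_antisymm
  · have key : ∀ n T, UpN (Icc s t) 0 ε w n T → ∃ F : Finset (ℝ × ℝ), F.card = n ∧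
        (F : Set (ℝ × ℝ)) ⊆ upSet ε w s t ∧ ∀ z ∈ F, z.2 ≤ T := by
      intro n
      induction n with
      | zero => intro T _; exact ⟨∅, by simp⟩
      | succ n ih =>
        rintro T ⟨q, hq, hqT, hb, p, hp, hpq, ha, hU⟩
        obtain ⟨F, hF, hFs, hFT⟩ := ih p hU
        obtain ⟨u, v, hpu, huv, hvq, h0, h1, h2⟩ := exists_cross hw hε hpq ha hb
        have hn : (u, v) ∉ F := by
          intro hmem
          have := hFT _ hmem
          simp only at this
          linarith
        refine ⟨insert (u, v) F, by rw [Finset.card_insert_of_notMem hn, hF], ?_, ?_⟩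
        · intro z hz
          simp only [Finset.coe_insert, mem_insert_iff] at hz
          rcases hz with rfl | hz
          · exact ⟨⟨by linarith [hp.1], by simp only; linarith [hq.2]⟩,
              ⟨by simp only; linarith [hp.1], by simp only; linarith [hq.2]⟩, huv, h0, h1, h2⟩
          · exact hFs hz
        · intro z hz
          simp only [Finset.mem_insert] at hz
          rcases hz with rfl | hz
          · exact hvq.trans hqT
          · linarith [hFT z hz]
    refine Up_le fun n T hT => ?_
    obtain ⟨F, hF, hFs, _⟩ := key n T hT
    have h1 : ((n : ℕ∞)) ≤ (upSet ε w s t).encard := by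
      rw [← hF, ← Set.encard_coe_eq_coe_finsetCard]
      exact Set.encard_le_encard hFs
    calc (n : ℝ≥0∞) = ((n : ℕ∞) : ℝ≥0∞) := by simp
      _ ≤ _ := ENat.toENNReal_le.2 h1
  · have key : ∀ F : Finset (ℝ × ℝ), (F : Set (ℝ × ℝ)) ⊆ upSet ε w s t → ∀ T,
        (∀ z ∈ F, z.2 ≤ T) → UpN (Icc s t) 0 ε w F.card T := by
      intro F
      induction F using Finset.induction_on_max_value (fun z : ℝ × ℝ => z.2) with
      | empty => intro _ T _; trivial
      | insert z F hzF hmax ih =>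
        intro hF T hT
        rw [Finset.coe_insert, insert_subset_iff] at hF
        obtain ⟨hz, hF⟩ := hF
        rw [Finset.card_insert_of_notMem hzF]
        have hz' := hz
        obtain ⟨h1, h2, h3, h4, h5, h6⟩ := hz
        refine ⟨z.2, h2, hT z (Finset.mem_insert_self _ _), h5.ge, z.1, h1, h3, h4.le,
          ih hF _ fun y hy => ?_⟩
        apply upSet_order (hF hy) hz'
        refine lt_of_le_of_ne (hmax y hy) fun h => hzF ?_
        rw [← upSet_snd_inj (hF hy) hz' h]
        exact hy
    have key2 : ∀ n : ℕ, (n : ℕ∞) ≤ (upSet ε w s t).encard →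
        (n : ℝ≥0∞) ≤ Up (Icc s t) 0 ε w := by
      intro n hn
      obtain ⟨S, hS, hSn⟩ := Set.exists_subset_encard_eq hn
      have hfin : S.Finite := Set.finite_of_encard_eq_coe hSn
      have hk := key hfin.toFinset (by simpa using hS) t (fun z hz => by
        have := hS (by simpa using hz)
        exact this.2.1.2)
      have hc : hfin.toFinset.card = n := by
        rw [← Set.ncard_eq_toFinset_card S hfin]
        simp [Set.ncard, hSn]
      rw [hc] at hk
      exact le_Up hk
    cases hE : (upSet ε w s t).encard with
    | top =>
      rw [hE] at key2
      have : Up (Icc s t) 0 ε w = ⊤ := by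
        apply ENNReal.eq_top_of_forall_nnreal_le
        intro r
        obtain ⟨n, hn⟩ := exists_nat_ge r
        refine le_trans ?_ (key2 n le_top)
        exact_mod_cast hn
      rw [this]
      exact le_top
    | coe n =>
      simpa using key2 n hE.ge

/-- passing to subsets with approximation -/
lemma Up_approx {D E : Set ℝ} {α β α' β' : ℝ} {w : ℝ → ℝ} (hαβ : α < β)
    (hA : ∀ p ∈ E, w p ≤ α → ∀ δ > 0, ∃ d ∈ D, |d - p| < δ ∧ w d ≤ α')
    (hB : ∀ p ∈ E, β ≤ w p → ∀ δ > 0, ∃ d ∈ D, |d - p| < δ ∧ β' ≤ w d) :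
    Up E α β w ≤ Up D α' β' w := by
  have key : ∀ n T, UpN E α β w n T → ∀ T' > T, UpN D α' β' w n T' := by
    intro n
    induction n with
    | zero => intros; trivial
    | succ n ih =>
      rintro T ⟨q, hq, hqT, hb, p, hp, hpq, ha, hU⟩ T' hT'
      have : ∃ p0 < p, UpN E α β w n p0 := by
        cases n with
        | zero => exact ⟨p - 1, by linarith, trivial⟩
        | succ m =>
          obtain ⟨q', hq', hqp, hb', h⟩ := hU
          refine ⟨q', lt_of_le_of_ne hqp ?_, q', hq', le_rfl, hb', h⟩
          rintro rfl
          linarith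
      obtain ⟨p0, hp0, hU0⟩ := this
      obtain ⟨dq, hdq, hdq1, hdq2⟩ := hB q hq hb (min (T' - T) ((q - p) / 2))
        (lt_min (by linarith) (by linarith))
      obtain ⟨dp, hdp, hdp1, hdp2⟩ := hA p hp ha (min (p - p0) ((q - p) / 2))
        (lt_min (by linarith) (by linarith))
      have a1 := abs_lt.1 (lt_of_lt_of_le hdq1 (min_le_left _ _))
      have a2 := abs_lt.1 (lt_of_lt_of_le hdq1 (min_le_right _ _))
      have a3 := abs_lt.1 (lt_of_lt_of_le hdp1 (min_le_left _ _))
      have a4 := abs_lt.1 (lt_of_lt_of_le hdp1 (min_le_right _ _))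
      exact ⟨dq, hdq, by linarith, hdq2, dp, hdp, by linarith, hdp2,
        ih p0 hU0 dp (by linarith)⟩
  refine Up_le fun n T hT => ?_
  exact le_Up (key n T hT (T + 1) (by linarith))

lemma dense_near {D : Set ℝ} {s t : ℝ} (hD : Icc s t ⊆ closure D) {w : ℝ → ℝ}
    (hw : Continuous w) {p : ℝ} (hp : p ∈ Icc s t) {δ : ℝ} (hδ : 0 < δ) {O : Set ℝ}
    (hO : IsOpen O) (hpO : w p ∈ O) : ∃ d ∈ D, |d - p| < δ ∧ w d ∈ O := by
  have h1 : IsOpen (Metric.ball p δ ∩ w ⁻¹' O) := Metric.isOpen_ball.inter (hO.preimage hw)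
  obtain ⟨d, hd1, hd2⟩ := mem_closure_iff.1 (hD hp) _ h1 ⟨Metric.mem_ball_self hδ, hpO⟩
  exact ⟨d, hd2, by simpa [Real.dist_eq] using hd1.1, hd1.2⟩

lemma Up_Icc_le_dense {D : Set ℝ} {s t α β η : ℝ} (hD : Icc s t ⊆ closure D) {w : ℝ → ℝ}
    (hw : Continuous w) (hαβ : α < β) (hη : 0 < η) :
    Up (Icc s t) α β w ≤ Up D (α + η) (β - η) w := by
  apply Up_approx hαβ
  · intro p hp hpa δ hδ
    obtain ⟨d, hd, h1, h2⟩ := dense_near hD hw hp hδ (isOpen_Iio (a := α + η))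
      (by simp only [mem_Iio]; linarith)
    exact ⟨d, hd, h1, (mem_Iio.1 h2).le⟩
  · intro p hp hpa δ hδ
    obtain ⟨d, hd, h1, h2⟩ := dense_near hD hw hp hδ (isOpen_Ioi (a := β - η))
      (by simp only [mem_Ioi]; linarith)
    exact ⟨d, hd, h1, (mem_Ioi.1 h2).le⟩

/-- local minimum values -/
def locMinVals (s t : ℝ) (w : ℝ → ℝ) : Set ℝ :=
  range fun ab : ℚ × ℚ => sInf (w '' (Ioo (ab.1 : ℝ) ab.2 ∩ Icc s t))

lemma countable_locMinVals (s t : ℝ) (w : ℝ → ℝ) : (locMinVals s t w).Countable :=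
  countable_range _

lemma approx_below {D : Set ℝ} {s t x : ℝ} (hD : Icc s t ⊆ closure D) {w : ℝ → ℝ}
    (hw : Continuous w) (hx : x ∉ locMinVals s t w) {p : ℝ} (hp : p ∈ Icc s t) (hpx : w p ≤ x)
    {δ : ℝ} (hδ : 0 < δ) : ∃ d ∈ D, |d - p| < δ ∧ w d ≤ x := by
  have : ∃ r ∈ Icc s t, |r - p| < δ / 2 ∧ w r < x := by
    rcases hpx.lt_or_eq with h | h
    · exact ⟨p, hp, by simpa using half_pos hδ, h⟩
    · obtain ⟨a, ha1, ha2⟩ := exists_rat_btwn (show p - δ / 2 < p by linarith)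
      obtain ⟨b, hb1, hb2⟩ := exists_rat_btwn (show p < p + δ / 2 by linarith)
      by_contra hc
      push Not at hc
      apply hx
      refine ⟨(a, b), ?_⟩
      have hl : IsLeast (w '' (Ioo (a : ℝ) b ∩ Icc s t)) x := by
        refine ⟨⟨p, ⟨⟨ha2, hb1⟩, hp⟩, h⟩, ?_⟩
        rintro _ ⟨r, ⟨⟨hr1, hr2⟩, hr3⟩, rfl⟩
        exact hc r hr3 (by rw [abs_lt]; constructor <;> linarith)
      exact hl.csInf_eq
  obtain ⟨r, hr, hrp, hrx⟩ := this
  obtain ⟨d, hd, h1, h2⟩ := dense_near hD hw hr (half_pos hδ) (isOpen_Iio (a := x)) hrx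
  refine ⟨d, hd, ?_, (mem_Iio.1 h2).le⟩
  calc |d - p| = |(d - r) + (r - p)| := by ring_nf
    _ ≤ |d - r| + |r - p| := abs_add_le _ _
    _ < δ := by linarith

/-- averaged number of upcrossings -/
def kap (D : Set ℝ) (ε : ℝ) (w : ℝ → ℝ) : ℝ≥0∞ := ∫⁻ x, Up D x (x + ε) w

lemma kap_dense {D : Set ℝ} {s t ε : ℝ} (hDs : D ⊆ Icc s t) (hD : Icc s t ⊆ closure D)
    {w : ℝ → ℝ} (hw : Continuous w) (hε : 0 < ε) :
    kap (Icc s t) ε w = kap D ε w := by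
  unfold kap
  apply lintegral_congr_ae
  have hc : (locMinVals s t w ∪ (fun x => -x - ε) '' locMinVals s t (fun r => - w r)).Countable :=
    (countable_locMinVals _ _ _).union ((countable_locMinVals _ _ _).image _)
  filter_upwards [(hc.ae_notMem volume)] with x hx
  simp only [mem_union, not_or] at hx
  apply le_antisymm _ (Up_mono hDs (fun _ _ h => h) (fun _ _ h => h))
  apply Up_approx (by linarith)
  · intro p hp hpx δ hδ
    exact approx_below hD hw hx.1 hp hpx hδ
  · intro p hp hpx δ hδ
    have h2 : -(x + ε) ∉ locMinVals s t (fun r => - w r) := by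
      intro h
      exact hx.2 ⟨_, h, by ring⟩
    obtain ⟨d, hd, h3, h4⟩ := approx_below hD hw.neg h2 hp (by simpa using hpx) hδ
    exact ⟨d, hd, h3, by rw [Pi.neg_apply] at h4; linarith⟩

end

section



lemma lvGrid_one : lvGrid 1 = range ((↑) : ℤ → ℝ) := by
  ext x; simp [lvGrid, eq_comm]

lemma isClosed_sub_grid {S : Set ℝ} (hS : S ⊆ lvGrid 1) : IsClosed S := by
  rw [lvGrid_one] at hS
  have : S = ((↑) : ℤ → ℝ) '' (((↑) : ℤ → ℝ) ⁻¹' S) := by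
    rw [image_preimage_eq_inter_range, inter_eq_left.2 hS]
  rw [this]
  exact Int.isClosedEmbedding_coe_real.isClosedMap _ (isClosed_discrete _)

lemma hit_top {w : ℝ → ℝ} {n : ℕ} (h : hitT 1 w n = ⊤) : hitT 1 w (n + 1) = ⊤ := by
  simp [hitT, h]

lemma hit_le {w : ℝ → ℝ} {n : ℕ} (h : hitT 1 w n ≠ ⊤) {r : ℝ} (hr : (hitT 1 w n).toReal ≤ r)
    (h1 : w r ∈ lvGrid 1) (h2 : w r ≠ w (hitT 1 w n).toReal) :
    hitT 1 w (n + 1) ≤ ENNReal.ofReal r := by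
  have hlt : (hitT 1 w n).toReal < r := lt_of_le_of_ne hr (by rintro h; rw [← h] at h2; exact h2 rfl)
  have : hitT 1 w n < ENNReal.ofReal r := by
    rwa [ENNReal.lt_ofReal_iff_toReal_lt h]
  simp only [hitT]
  exact iInf₂_le r ⟨this, h1, h2⟩

lemma hit_fin {w : ℝ → ℝ} (hw : Continuous w) {n : ℕ} (h : hitT 1 w (n + 1) ≠ ⊤) :
    hitT 1 w n ≠ ⊤ ∧ hitT 1 w n < hitT 1 w (n + 1) ∧ w (hitT 1 w (n + 1)).toReal ∈ lvGrid 1 ∧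
    w (hitT 1 w (n + 1)).toReal ≠ w (hitT 1 w n).toReal ∧
    ∀ r, (hitT 1 w n).toReal ≤ r → r < (hitT 1 w (n + 1)).toReal → w r ∈ lvGrid 1 →
      w r = w (hitT 1 w n).toReal := by
  have hn : hitT 1 w n ≠ ⊤ := fun h' => h (hit_top h')
  set τ := (hitT 1 w n).toReal with hτ
  set S : Set ℝ := Ici τ ∩ w ⁻¹' (lvGrid 1 \ {w τ}) with hS
  have hScl : IsClosed S := isClosed_Ici.inter ((isClosed_sub_grid diff_subset).preimage hw)
  have hSb : BddBelow S := ⟨τ, fun r hr => hr.1⟩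
  have hmem : ∀ r, (hitT 1 w n < ENNReal.ofReal r ∧ w r ∈ lvGrid 1 ∧ w r ≠ w τ) ↔ r ∈ S := by
    intro r
    rw [ENNReal.lt_ofReal_iff_toReal_lt hn]
    constructor
    · rintro ⟨h1, h2, h3⟩; exact ⟨h1.le, h2, h3⟩
    · rintro ⟨h1, h2, h3⟩
      refine ⟨lt_of_le_of_ne h1 ?_, h2, h3⟩
      intro h; apply h3; rw [← h]; rfl
  have hSne : S.Nonempty := by
    by_contra hc
    rw [not_nonempty_iff_eq_empty] at hc
    apply h
    simp only [hitT]
    rw [iInf₂_eq_top]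
    intro r hr
    have := (hmem r).1 hr
    rw [hc] at this
    exact this.elim
  have hl := hScl.csInf_mem hSne hSb
  set r0 := sInf S
  have h0 : 0 ≤ r0 := le_trans ENNReal.toReal_nonneg hl.1
  have heq : hitT 1 w (n + 1) = ENNReal.ofReal r0 := by
    apply le_antisymm
    · exact hit_le hn hl.1 hl.2.1 hl.2.2
    · simp only [hitT]
      refine le_iInf₂ fun r hr => ?_
      exact ENNReal.ofReal_le_ofReal (csInf_le hSb ((hmem r).1 hr))
  have htr : (hitT 1 w (n + 1)).toReal = r0 := by rw [heq, ENNReal.toReal_ofReal h0]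
  refine ⟨hn, ?_, by rw [htr]; exact hl.2.1, by rw [htr]; exact hl.2.2, ?_⟩
  · rw [heq]; exact ((hmem r0).2 hl).1
  · intro r hr1 hr2 hr3
    by_contra hc
    rw [htr] at hr2
    exact absurd (csInf_le hSb (⟨hr1, hr3, hc⟩ : r ∈ S)) (not_le.2 hr2)

/-- end times of crossings -/
def crossV (w : ℝ → ℝ) (t : ℝ) : Set ℝ :=
  {v | v ≤ t ∧ ∃ u, 0 ≤ u ∧ u < v ∧ w u ∈ lvGrid 1 ∧ w v ∈ lvGrid 1 ∧ w u ≠ w v ∧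
    ∀ r ∈ Ioo u v, w r ∉ lvGrid 1}

lemma grid_dist {x y : ℝ} (hx : x ∈ lvGrid 1) (hy : y ∈ lvGrid 1) (h : x ≠ y) : 1 ≤ |x - y| := by
  rw [lvGrid_one] at hx hy
  obtain ⟨a, rfl⟩ := hx
  obtain ⟨b, rfl⟩ := hy
  have : a ≠ b := fun h' => h (by rw [h'])
  rw [← Int.cast_sub, ← Int.cast_abs]
  exact_mod_cast Int.one_le_abs (sub_ne_zero.2 this)

lemma hit_image {w : ℝ → ℝ} (hw : Continuous w) (h0 : w 0 ∉ lvGrid 1) {t : ℝ} (ht : 0 ≤ t) :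
    (fun n => (hitT 1 w n).toReal) '' {n : ℕ | 2 ≤ n ∧ hitT 1 w n ≤ ENNReal.ofReal t}
      = crossV w t := by
  have hgrid : ∀ n, 1 ≤ n → hitT 1 w n ≠ ⊤ → w (hitT 1 w n).toReal ∈ lvGrid 1 := by
    intro n hn h
    obtain ⟨m, rfl⟩ : ∃ m, n = m + 1 := ⟨n - 1, by omega⟩
    exact (hit_fin hw h).2.2.1
  apply Subset.antisymm
  · rintro _ ⟨n, ⟨hn, hnt⟩, rfl⟩
    obtain ⟨m, rfl⟩ : ∃ m, n = m + 1 := ⟨n - 1, by omega⟩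
    have hfin : hitT 1 w (m + 1) ≠ ⊤ := ne_top_of_le_ne_top ENNReal.ofReal_ne_top hnt
    obtain ⟨f1, f2, f3, f4, f5⟩ := hit_fin hw hfin
    have f6 := hgrid m (by omega) f1
    have f7 : (hitT 1 w m).toReal < (hitT 1 w (m + 1)).toReal :=
      (ENNReal.toReal_lt_toReal f1 hfin).2 f2
    refine ⟨ENNReal.toReal_le_of_le_ofReal ht hnt, ?_⟩
    set τ := (hitT 1 w m).toReal
    set τ' := (hitT 1 w (m + 1)).toReal
    have hS2 : IsCompact (Icc τ τ' ∩ w ⁻¹' {w τ}) :=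
      isCompact_Icc.inter_right (isClosed_singleton.preimage hw)
    obtain ⟨u, hu, humax⟩ := hS2.exists_isGreatest ⟨τ, ⟨le_rfl, f7.le⟩, rfl⟩
    have hwu : w u = w τ := hu.2
    refine ⟨u, le_trans ENNReal.toReal_nonneg hu.1.1, lt_of_le_of_ne hu.1.2 ?_, by rw [hwu]; exact f6,
      f3, by rw [hwu]; exact f4.symm, ?_⟩
    · intro h; rw [h] at hwu; exact f4 hwu
    · intro r hr hrg
      have := f5 r (hu.1.1.trans hr.1.le) hr.2 hrg
      exact absurd (humax ⟨⟨hu.1.1.trans hr.1.le, hr.2.le⟩, this⟩) (not_le.2 hr.1)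
  · rintro v ⟨hvt, u, hu0, huv, hug, hvg, huv', hno⟩
    have hupos : 0 < u := lt_of_le_of_ne hu0 (by rintro rfl; exact h0 hug)
    have hv0 : 0 ≤ v := by linarith
    have hex : ∃ n, hitT 1 w n = ENNReal.ofReal v := by
      by_contra hc
      push Not at hc
      have hall : ∀ n, hitT 1 w n ≤ ENNReal.ofReal u := by
        intro n
        induction n with
        | zero => simp [hitT]
        | succ n ih =>
          have hfin : hitT 1 w n ≠ ⊤ := ne_top_of_le_ne_top ENNReal.ofReal_ne_top ih
          have hτu : (hitT 1 w n).toReal ≤ u := ENNReal.toReal_le_of_le_ofReal hu0 ih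
          by_cases h1 : w u = w (hitT 1 w n).toReal
          · have h2 := hit_le hfin (hτu.trans huv.le) hvg (by rw [← h1]; exact huv'.symm)
            have hfin' : hitT 1 w (n + 1) ≠ ⊤ := ne_top_of_le_ne_top ENNReal.ofReal_ne_top h2
            have h3 := lt_of_le_of_ne h2 (hc _)
            have h4 : (hitT 1 w (n + 1)).toReal < v := by
              rwa [ENNReal.lt_ofReal_iff_toReal_lt hfin'] at h3
            have h5 := hgrid (n + 1) (by omega) hfin'
            rw [ENNReal.le_ofReal_iff_toReal_le hfin' hu0]
            by_contra h6
            push Not at h6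
            exact hno _ ⟨h6, h4⟩ h5
          · exact hit_le hfin hτu hug h1
      have hfin : ∀ n, hitT 1 w n ≠ ⊤ := fun n =>
        ne_top_of_le_ne_top ENNReal.ofReal_ne_top (hall n)
      have hmono : Monotone fun n => (hitT 1 w n).toReal := monotone_nat_of_le_succ fun n =>
        ((ENNReal.toReal_lt_toReal (hfin n) (hfin (n + 1))).2 (hit_fin hw (hfin (n + 1))).2.1).le
      have hbdd : BddAbove (range fun n => (hitT 1 w n).toReal) := by
        refine ⟨u, ?_⟩
        rintro _ ⟨n, rfl⟩
        exact ENNReal.toReal_le_of_le_ofReal hu0 (hall n)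
      have hlim := tendsto_atTop_ciSup hmono hbdd
      have hlim2 := (hw.tendsto _).comp hlim
      have hcau := hlim2.cauchySeq
      rw [Metric.cauchySeq_iff] at hcau
      obtain ⟨N, hN⟩ := hcau 1 one_pos
      have h1 := hN (N + 1 + 1) (by omega) (N + 1) (by omega)
      rw [Real.dist_eq] at h1
      have h2 := grid_dist (hgrid (N + 1 + 1) (by omega) (hfin _)) (hgrid (N + 1) (by omega) (hfin _))
        (hit_fin hw (hfin (N + 1 + 1))).2.2.2.1
      simp only [Function.comp] at h1
      linarith
    obtain ⟨n, hn⟩ := hex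
    have htr : (hitT 1 w n).toReal = v := by rw [hn, ENNReal.toReal_ofReal hv0]
    refine ⟨n, ⟨?_, by rw [hn]; exact ENNReal.ofReal_le_ofReal hvt⟩, htr⟩
    by_contra h2
    have : n = 0 ∨ n = 1 := by omega
    rcases this with rfl | rfl
    · simp [hitT] at htr; linarith
    · have h3 : hitT 1 w (0 + 1) ≤ ENNReal.ofReal u := hit_le (by simp [hitT]) (by simpa [hitT] using hu0) hug
        (by intro h; rw [h] at hug; simp [hitT] at hug; exact h0 hug)
      have h4 : hitT 1 w (0 + 1) = ENNReal.ofReal v := hn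
      rw [h4, ENNReal.ofReal_le_ofReal_iff hu0] at h3
      linarith

lemma hit_injOn {w : ℝ → ℝ} (hw : Continuous w) {t : ℝ} :
    InjOn (fun n => (hitT 1 w n).toReal) {n : ℕ | 2 ≤ n ∧ hitT 1 w n ≤ ENNReal.ofReal t} := by
  have hfin : ∀ n, hitT 1 w n ≠ ⊤ → ∀ m < n, hitT 1 w m < hitT 1 w n := by
    intro n
    induction n with
    | zero => intro _ m hm; omega
    | succ n ih =>
      intro hn m hm
      have h := hit_fin hw hn
      rcases (Nat.lt_succ_iff.1 hm).lt_or_eq with h1 | rfl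
      · exact (ih h.1 m h1).trans h.2.1
      · exact h.2.1
  rintro n ⟨_, hn⟩ m ⟨_, hm⟩ h
  have hn' : hitT 1 w n ≠ ⊤ := ne_top_of_le_ne_top ENNReal.ofReal_ne_top hn
  have hm' : hitT 1 w m ≠ ⊤ := ne_top_of_le_ne_top ENNReal.ofReal_ne_top hm
  have he := (ENNReal.toReal_eq_toReal_iff' hn' hm').1 h
  rcases lt_trichotomy n m with h1 | h1 | h1
  · exact absurd he (hfin m hm' n h1).ne
  · exact h1
  · exact absurd he (hfin n hn' m h1).ne'

lemma crossKe_eq {w : ℝ → ℝ} (hw : Continuous w) (h0 : w 0 ∉ lvGrid 1) {t : ℝ} (ht : 0 ≤ t) :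
    crossKe 1 w 0 t = ((crossV w t).encard : ℝ≥0∞) := by
  unfold crossKe crossK
  simp only [zero_add, sub_zero, h0, false_and, if_false, add_zero]
  rw [← hit_image hw h0 ht, (hit_injOn hw).encard_image]

lemma encard_iUnion_ennreal {ι : Type*} [Countable ι] {V : ι → Set ℝ}
    (hd : Pairwise (Function.onFun Disjoint V)) :
    ((⋃ i, V i).encard : ℝ≥0∞) = ∑' i, ((V i).encard : ℝ≥0∞) := by
  have h := @measure_iUnion ι ℝ ⊤ (@Measure.count ℝ ⊤) _ V hd (fun i => trivial)
  rw [@Measure.count_apply ℝ ⊤ _ trivial] at h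
  rw [h]
  congr 1
  ext i
  rw [@Measure.count_apply ℝ ⊤ _ trivial]

/-- end points of up-crossings of `[k,k+1]` -/
def upEnds (w : ℝ → ℝ) (t : ℝ) (k : ℤ) : Set ℝ :=
  Prod.snd '' upSet 1 (fun r => w r - k) 0 t

lemma upEnds_encard {w : ℝ → ℝ} (hw : Continuous w) (t : ℝ) (k : ℤ) :
    ((upEnds w t k).encard : ℝ≥0∞) = Up (Icc 0 t) k (k + 1) w := by
  unfold upEnds
  rw [InjOn.encard_image (fun z hz z' hz' h => upSet_snd_inj hz hz' h)]
  rw [← upE, ← Up_eq_upE (by fun_prop) one_pos]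
  apply le_antisymm <;> apply Up_mono Subset.rfl <;> intro p hp h <;> linarith

lemma crossV_eq {w : ℝ → ℝ} (hw : Continuous w) (t : ℝ) :
    crossV w t = ⋃ i : ℤ ⊕ ℤ, Sum.elim (upEnds w t) (upEnds (fun r => - w r) t) i := by
  have aux : ∀ (w : ℝ → ℝ), Continuous w → ∀ u v : ℝ, ∀ j k : ℤ, u < v → w u = j → w v = k → j < k →
      (∀ r ∈ Ioo u v, w r ∉ lvGrid 1) → k = j + 1 ∧ ∀ r ∈ Ioo u v, w r ∈ Ioo (j : ℝ) (j + 1) := by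
    intro w hw u v j k huv hj hk hjk hno
    have h1 : k = j + 1 := by
      by_contra hne
      have h2 : j + 1 < k := by omega
      have h2' : ((j + 1 : ℤ) : ℝ) < k := by exact_mod_cast h2
      have h3' : (j : ℝ) < ((j + 1 : ℤ) : ℝ) := by exact_mod_cast Int.lt_succ j
      have : ((j + 1 : ℤ) : ℝ) ∈ w '' Ioo u v := intermediate_value_Ioo huv.le hw.continuousOn
        (by rw [hj, hk]; exact ⟨h3', h2'⟩)
      obtain ⟨r, hr, hr'⟩ := this
      exact hno r hr (by rw [lvGrid_one]; exact ⟨_, hr'.symm⟩)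
    refine ⟨h1, fun r hr => ⟨?_, ?_⟩⟩
    · by_contra hc
      push Not at hc
      have : (j : ℝ) ∈ w '' Ico r v := intermediate_value_Ico hr.2.le hw.continuousOn
        ⟨hc, by rw [hk]; exact_mod_cast hjk⟩
      obtain ⟨r', hr', h'⟩ := this
      exact hno r' ⟨hr.1.trans_le hr'.1, hr'.2⟩ (by rw [lvGrid_one]; exact ⟨_, h'.symm⟩)
    · by_contra hc
      push Not at hc
      have : (k : ℝ) ∈ w '' Ioc u r := intermediate_value_Ioc hr.1.le hw.continuousOn
        ⟨by rw [hj]; exact_mod_cast hjk, by rw [h1]; push_cast; exact hc⟩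
      obtain ⟨r', hr', h'⟩ := this
      exact hno r' ⟨hr'.1, hr'.2.trans_lt hr.2⟩ (by rw [lvGrid_one]; exact ⟨_, h'.symm⟩)
  have aux2 : ∀ x : ℝ, ∀ j : ℤ, x ∈ Ioo (j : ℝ) (j + 1) → x ∉ lvGrid 1 := by
    intro x j hx h
    rw [lvGrid_one] at h
    obtain ⟨m, rfl⟩ := h
    have h1 : j < m := by exact_mod_cast hx.1
    have h2 : m < j + 1 := by exact_mod_cast hx.2
    omega
  have aux3 : ∀ (w : ℝ → ℝ), ∀ k v, v ∈ upEnds w t k → v ≤ t ∧ ∃ u, 0 ≤ u ∧ u < v ∧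
      w u = k ∧ w v = k + 1 ∧ ∀ r ∈ Ioo u v, w r ∈ Ioo (k : ℝ) (k + 1) := by
    rintro w k _ ⟨⟨u, v⟩, ⟨h1, h2, h3, h4, h5, h6⟩, rfl⟩
    refine ⟨h2.2, u, h1.1, h3, by simpa [sub_eq_zero] using h4, by simp only at h5; linarith,
      fun r hr => ?_⟩
    have := h6 r hr
    exact ⟨by linarith [this.1], by linarith [this.2]⟩
  ext v
  simp only [mem_iUnion, Sum.exists, Sum.elim_inl, Sum.elim_inr]
  constructor
  · rintro ⟨hvt, u, hu0, huv, hug, hvg, huv', hno⟩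
    rw [lvGrid_one] at hug hvg
    obtain ⟨j, hj⟩ := hug
    obtain ⟨k, hk⟩ := hvg
    have hjk : j ≠ k := by rintro rfl; exact huv' (hj.symm.trans hk)
    rcases lt_or_gt_of_ne hjk with h | h
    · left
      obtain ⟨h1, h2⟩ := aux w hw u v j k huv hj.symm hk.symm h hno
      refine ⟨j, (u, v), ⟨⟨hu0, by simp only; linarith⟩, ⟨by simp only; linarith, hvt⟩, huv, ?_, ?_, ?_⟩, rfl⟩
      · simp [← hj]
      · simp [← hk, h1]
      · intro r hr
        have := h2 r hr
        exact ⟨by linarith [this.1], by linarith [this.2]⟩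
    · right
      obtain ⟨h1, h2⟩ := aux (fun r => - w r) hw.neg u v (-j) (-k) huv (by simp [hj]) (by simp [hk])
        (by omega) (by
          intro r hr hg
          rw [lvGrid_one] at hg
          obtain ⟨m, hm⟩ := hg
          exact hno r hr (by rw [lvGrid_one]; exact ⟨-m, by push_cast; linarith⟩))
      refine ⟨-j, (u, v), ⟨⟨hu0, by simp only; linarith⟩, ⟨by simp only; linarith, hvt⟩, huv, ?_, ?_, ?_⟩, rfl⟩
      · simp [← hj]
      · have : ((-k : ℤ) : ℝ) = ((-j + 1 : ℤ) : ℝ) := by rw [h1]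
        push_cast at this
        simp only [← hk]
        push_cast
        linarith
      · intro r hr
        have := h2 r hr
        exact ⟨by linarith [this.1], by linarith [this.2]⟩
  · rintro (⟨k, hk⟩ | ⟨k, hk⟩)
    · obtain ⟨h1, u, h2, h3, h4, h5, h6⟩ := aux3 _ _ _ hk
      refine ⟨h1, u, h2, h3, ?_, ?_, by linarith, fun r hr => aux2 _ k (h6 r hr)⟩
      · rw [lvGrid_one, h4]; exact ⟨_, rfl⟩
      · rw [lvGrid_one, h5]; exact ⟨k + 1, by push_cast; rfl⟩
    · obtain ⟨h1, u, h2, h3, h4, h5, h6⟩ := aux3 _ _ _ hk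
      refine ⟨h1, u, h2, h3, ?_, ?_, by linarith, fun r hr => aux2 _ (-k - 1) ?_⟩
      · rw [lvGrid_one]; exact ⟨-k, by push_cast; linarith⟩
      · rw [lvGrid_one]; exact ⟨-(k + 1), by push_cast; linarith⟩
      · have := h6 r hr
        push_cast
        exact ⟨by linarith [this.2], by linarith [this.1]⟩

lemma upEnds_disj {w : ℝ → ℝ} (t : ℝ) : Pairwise (Function.onFun Disjoint
    (Sum.elim (upEnds w t) (upEnds (fun r => - w r) t))) := by
  rintro (j | j) (k | k) hjk <;> simp only [Function.onFun, Sum.elim_inl, Sum.elim_inr] <;>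
    rw [Set.disjoint_left] <;>
    rintro _ ⟨⟨u, v⟩, ⟨-, -, h3, h4, h5, h6⟩, rfl⟩ ⟨⟨u', v'⟩, ⟨-, -, h3', h4', h5', h6'⟩, hv⟩ <;>
    simp only at * <;> subst hv
  · apply hjk
    have : (j : ℝ) = k := by linarith
    rw [Int.cast_injective this]
  · have h7 := h6 ((max u u' + v') / 2) ⟨by linarith [le_max_left u u'], by linarith [max_lt h3 h3']⟩
    have h8 := h6' ((max u u' + v') / 2) ⟨by linarith [le_max_right u u'], by linarith [max_lt h3 h3']⟩
    obtain ⟨a1, a2⟩ := h7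
    obtain ⟨a3, a4⟩ := h8
    have : (j : ℝ) + 1 = -(k + 1) := by linarith
    linarith
  · have h7 := h6 ((max u u' + v') / 2) ⟨by linarith [le_max_left u u'], by linarith [max_lt h3 h3']⟩
    have h8 := h6' ((max u u' + v') / 2) ⟨by linarith [le_max_right u u'], by linarith [max_lt h3 h3']⟩
    obtain ⟨a1, a2⟩ := h7
    obtain ⟨a3, a4⟩ := h8
    linarith
  · apply hjk
    have : (j : ℝ) = k := by linarith
    rw [Int.cast_injective this]

lemma lintegral_fold {F : ℝ → ℝ≥0∞} (hF : AEMeasurable F) (σ : ℝ) (hσ : σ = 1 ∨ σ = -1) :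
    ∑' k : ℤ, ∫⁻ ρ in Ioo (-(1 / 2 : ℝ)) (1 / 2), F (k + σ * ρ) = ∫⁻ x, F x := by
  have h1 := pairwise_disjoint_Ioc_add_intCast (-(1 / 2) : ℝ)
  have h2 := iUnion_Ioc_add_intCast (-(1 / 2) : ℝ)
  have h3 : ∫⁻ x, F x = ∫⁻ x in ⋃ n : ℤ, Ioc (-(1 / 2) + (n : ℝ)) (-(1 / 2) + n + 1), F x := by
    rw [h2, Measure.restrict_univ]
  rw [h3, lintegral_iUnion (fun _ => measurableSet_Ioc) h1]
  congr 1
  ext k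
  have hmp : MeasurePreserving (fun ρ : ℝ => (k : ℝ) + σ * ρ) volume volume := by
    rcases hσ with rfl | rfl
    · simpa using measurePreserving_add_left volume (k : ℝ)
    · simpa [sub_eq_add_neg] using Measure.measurePreserving_sub_left volume (k : ℝ)
  have hemb : MeasurableEmbedding (fun ρ : ℝ => (k : ℝ) + σ * ρ) := by
    rcases hσ with rfl | rfl
    · simpa using measurableEmbedding_addLeft (k : ℝ)
    · simpa [sub_eq_add_neg] using measurableEmbedding_subLeft (k : ℝ)
  have hpre : Ioo (-(1 / 2 : ℝ)) (1 / 2) = (fun ρ : ℝ => (k : ℝ) + σ * ρ) ⁻¹'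
      Ioo (-(1 / 2) + (k : ℝ)) (-(1 / 2) + k + 1) := by
    ext ρ
    rcases hσ with rfl | rfl <;> simp only [mem_Ioo, mem_preimage] <;>
      constructor <;> rintro ⟨a, b⟩ <;> constructor <;> linarith
  rw [hpre, hmp.setLIntegral_comp_preimage_emb hemb F]
  exact setLIntegral_congr Ioo_ae_eq_Ioc

lemma avgK_eq {w : ℝ → ℝ} (hw : Continuous w) {t : ℝ} (ht : 0 < t) :
    avgK 1 w 0 t = kap (Icc 0 t) 1 w + kap (Icc 0 t) 1 (fun r => - w r) := by
  have hmeas : ∀ w : ℝ → ℝ, Continuous w → AEMeasurable fun x => Up (Icc 0 t) x (x + 1) w := by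
    intro w hw
    obtain ⟨D, hDs, hDc, hDd⟩ := TopologicalSpace.IsSeparable.exists_countable_dense_subset
      (TopologicalSpace.IsSeparable.of_separableSpace (Icc (0 : ℝ) t))
    refine ⟨fun x => Up D x (x + 1) w, ?_, ?_⟩
    · exact measurable_Up hDc (by fun_prop) (by fun_prop) (fun _ _ => measurable_const)
    · have hc : (locMinVals 0 t w ∪ (fun x => -x - 1) '' locMinVals 0 t (fun r => - w r)).Countable :=
        (countable_locMinVals _ _ _).union ((countable_locMinVals _ _ _).image _)
      filter_upwards [(hc.ae_notMem volume)] with x hx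
      simp only [mem_union, not_or] at hx
      refine le_antisymm ?_ (Up_mono hDs (fun _ _ h => h) (fun _ _ h => h))
      apply Up_approx (by linarith)
      · intro p hp hpx δ hδ
        exact approx_below hDd hw hx.1 hp hpx hδ
      · intro p hp hpx δ hδ
        have h2 : -(x + 1) ∉ locMinVals 0 t (fun r => - w r) := by
          intro h
          exact hx.2 ⟨_, h, by ring⟩
        obtain ⟨d, hd, h3, h4⟩ := approx_below hDd hw.neg h2 hp (by simpa using hpx) hδ
        exact ⟨d, hd, h3, by rw [Pi.neg_apply] at h4; linarith⟩
  have h1 : ∀ᵐ ρ ∂(volume.restrict (Ioo (-(1 / 2 : ℝ)) (1 / 2))),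
      crossKe 1 (fun r => w r + ρ) 0 t = ∑' k : ℤ, Up (Icc 0 t) (k + (-1) * ρ) (k + (-1) * ρ + 1) w +
        ∑' k : ℤ, Up (Icc 0 t) (k + 1 * ρ) (k + 1 * ρ + 1) (fun r => - w r) := by
    have hc : ((fun x => x - w 0) '' lvGrid 1).Countable := by
      rw [lvGrid_one]; exact (countable_range _).image _
    refine ae_restrict_of_ae ?_
    filter_upwards [hc.ae_notMem volume] with ρ hρ
    have h0 : (fun r => w r + ρ) 0 ∉ lvGrid 1 := fun h => hρ ⟨_, h, by simp⟩
    have hwc : Continuous (fun r => w r + ρ) := by fun_prop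
    rw [crossKe_eq hwc h0 ht.le, crossV_eq hwc, encard_iUnion_ennreal (upEnds_disj t),
      Summable.tsum_sum ENNReal.summable ENNReal.summable]
    simp only [Sum.elim_inl, Sum.elim_inr]
    congr 1
    · congr 1; ext k
      rw [upEnds_encard hwc]
      rw [Up_shift]
      congr 1 <;> ring
    · congr 1; ext k
      rw [upEnds_encard (w := fun r => -(w r + ρ)) hwc.neg]
      have : (fun r => -(w r + ρ)) = fun r => (fun r => - w r) r + (-ρ) := by ext r; ring
      rw [this, Up_shift]
      congr 1 <;> ring
  unfold avgK
  simp only [inv_one, ENNReal.ofReal_one, one_mul]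
  have hm : ∀ w : ℝ → ℝ, Continuous w → ∀ (σ : ℝ) (hσ : σ = 1 ∨ σ = -1) (k : ℤ), AEMeasurable
      (fun ρ : ℝ => Up (Icc 0 t) (k + σ * ρ) (k + σ * ρ + 1) w) := by
    intro w hw σ hσ k
    have hq : Measure.QuasiMeasurePreserving (fun ρ : ℝ => (k : ℝ) + σ * ρ) volume volume := by
      rcases hσ with rfl | rfl
      · simpa using (measurePreserving_add_left volume (k : ℝ)).quasiMeasurePreserving
      · simpa [sub_eq_add_neg] using (Measure.measurePreserving_sub_left volume (k : ℝ)).quasiMeasurePreserving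
    exact (hmeas w hw).comp_quasiMeasurePreserving hq
  rw [lintegral_congr_ae h1, lintegral_add_left', lintegral_tsum, lintegral_tsum]
  · rw [lintegral_fold (F := fun x => Up (Icc 0 t) x (x + 1) w) (hmeas w hw) (-1) (by simp),
      lintegral_fold (F := fun x => Up (Icc 0 t) x (x + 1) (fun r => - w r)) (hmeas _ hw.neg) 1 (by simp)]
    rfl
  · intro k; exact (hm _ hw.neg 1 (by simp) k).restrict
  · intro k; exact (hm _ hw (-1) (by simp) k).restrict
  · exact AEMeasurable.ennreal_tsum fun k => (hm _ hw (-1) (by simp) k).restrict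

end

section



/-- dyadic points of the unit interval -/
def dya : Set ℝ := {r | ∃ m k : ℕ, k ≤ 2 ^ m ∧ r = (k : ℝ) / 2 ^ m}

lemma dya_countable : dya.Countable := by
  have : dya ⊆ range fun z : ℕ × ℕ => (z.2 : ℝ) / 2 ^ z.1 := by
    rintro r ⟨m, k, _, rfl⟩
    exact ⟨(m, k), rfl⟩
  exact (countable_range _).mono this

lemma dya_sub : dya ⊆ Icc 0 1 := by
  rintro r ⟨m, k, hk, rfl⟩
  refine ⟨by positivity, ?_⟩
  rw [div_le_one (by positivity)]
  exact_mod_cast hk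

lemma zero_mem_dya : (0 : ℝ) ∈ dya := ⟨0, 0, by simp, by simp⟩
lemma one_mem_dya : (1 : ℝ) ∈ dya := ⟨0, 1, by simp, by simp⟩

lemma dya_dense : Icc (0 : ℝ) 1 ⊆ closure dya := by
  intro x hx
  rw [Metric.mem_closure_iff]
  intro ε hε
  obtain ⟨m, hm⟩ := exists_pow_lt_of_lt_one hε (show (1 / 2 : ℝ) < 1 by norm_num)
  have h2 : (0 : ℝ) < 2 ^ m := by positivity
  refine ⟨(⌊x * 2 ^ m⌋₊ : ℝ) / 2 ^ m, ⟨m, ⌊x * 2 ^ m⌋₊, ?_, rfl⟩, ?_⟩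
  · have : ⌊x * 2 ^ m⌋₊ ≤ ⌊((2 ^ m : ℕ) : ℝ)⌋₊ := Nat.floor_mono (by
      push_cast
      nlinarith [hx.2])
    rwa [Nat.floor_natCast] at this
  · rw [Real.dist_eq]
    have h1 := Nat.floor_le (mul_nonneg hx.1 h2.le)
    have h3 := Nat.lt_floor_add_one (x * 2 ^ m)
    have e : x - (⌊x * 2 ^ m⌋₊ : ℝ) / 2 ^ m = (x * 2 ^ m - ⌊x * 2 ^ m⌋₊) * (1 / 2) ^ m := by
      have h5 : (2 : ℝ) ^ m * (1 / 2) ^ m = 1 := by rw [← mul_pow]; norm_num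
      rw [sub_eq_iff_eq_add, ← sub_eq_iff_eq_add', eq_comm, div_eq_iff h2.ne']
      linear_combination (x * 2 ^ m - ⌊x * 2 ^ m⌋₊) * h5
    rw [e, abs_of_nonneg (mul_nonneg (by linarith) (by positivity))]
    calc _ ≤ 1 * (1 / 2 : ℝ) ^ m := by gcongr; linarith
      _ < ε := by simpa using hm

/-- chaining along dyadic points -/
lemma dya_chain (w : ℝ → ℝ) (c : ℕ → ℝ) (hc : ∀ m, 0 ≤ c m) (L a b : ℕ) (hab : a ≤ b)
    (hb : b ≤ 2 ^ L)
    (h : ∀ m k : ℕ, k < 2 ^ m → (a : ℝ) / 2 ^ L ≤ k / 2 ^ m → ((k : ℝ) + 1) / 2 ^ m ≤ b / 2 ^ L →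
      |w ((k + 1) / 2 ^ m) - w (k / 2 ^ m)| ≤ c m) :
    |w (b / 2 ^ L) - w (a / 2 ^ L)| ≤ 2 * ∑ m ∈ Finset.range (L + 1), c m := by
  induction L generalizing a b with
  | zero =>
    rcases hab.lt_or_eq with h1 | rfl
    · have ha0 : a = 0 := by simp at hb; omega
      have hb0 : b = 1 := by simp at hb; omega
      subst ha0 hb0
      have := h 0 0 (by simp) (by simp) (by simp)
      simp at this ⊢
      linarith [hc 0]
    · simp
      exact hc 0
  | succ L ih =>
    have hodd : ∀ x : ℕ, ((2 * x : ℕ) : ℝ) / 2 ^ (L + 1) = x / 2 ^ L := by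
      intro x; push_cast; rw [pow_succ]; field_simp
    rcases hab.lt_or_eq with h1 | rfl
    swap
    · simp
      exact Finset.sum_nonneg fun i _ => hc i
    -- round
    obtain ⟨a', ha'⟩ : ∃ a', a = 2 * a' ∨ a + 1 = 2 * a' := by
      rcases Nat.even_or_odd' a with ⟨x, hx | hx⟩
      · exact ⟨x, Or.inl hx⟩
      · exact ⟨x + 1, Or.inr (by omega)⟩
    obtain ⟨b', hb'⟩ : ∃ b', b = 2 * b' ∨ b = 2 * b' + 1 := by
      rcases Nat.even_or_odd' b with ⟨x, hx⟩
      exact ⟨x, hx⟩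
    have hle : a' ≤ b' := by omega
    have hp : (2 : ℕ) ^ (L + 1) = 2 * 2 ^ L := by ring
    have hA : |w ((a' : ℝ) / 2 ^ L) - w (a / 2 ^ (L + 1))| ≤ c (L + 1) := by
      rcases ha' with h2 | h2
      · rw [h2, hodd]; simp [hc]
      · have h3 := h (L + 1) a (by omega) le_rfl (by gcongr; exact_mod_cast h1)
        rw [← hodd, ← h2]
        push_cast
        exact h3
    have hB : |w ((b : ℝ) / 2 ^ (L + 1)) - w (b' / 2 ^ L)| ≤ c (L + 1) := by
      rcases hb' with h2 | h2
      · rw [h2, hodd]; simp [hc]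
      · have h3 := h (L + 1) (2 * b') (by omega) (by gcongr; exact_mod_cast (by omega : a ≤ 2 * b'))
          (by rw [h2]; push_cast; exact le_rfl)
        rw [hodd] at h3
        rw [h2]
        convert h3 using 4
        push_cast
        rfl
    have hM := ih a' b' hle (by omega) (fun m k hk h2 h3 => by
      refine h m k hk ?_ ?_
      · refine le_trans ?_ h2
        rw [← hodd]
        gcongr
        omega
      · refine h3.trans ?_
        rw [← hodd]
        gcongr
        omega)
    rw [Finset.sum_range_succ]
    calc |w ((b : ℝ) / 2 ^ (L + 1)) - w (a / 2 ^ (L + 1))|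
        = |(w ((b : ℝ) / 2 ^ (L + 1)) - w (b' / 2 ^ L)) + (w (b' / 2 ^ L) - w (a' / 2 ^ L))
          + (w ((a' : ℝ) / 2 ^ L) - w (a / 2 ^ (L + 1)))| := by ring_nf
      _ ≤ c (L + 1) + 2 * ∑ m ∈ Finset.range (L + 1), c m + c (L + 1) :=
          (abs_add_le _ _).trans (add_le_add ((abs_add_le _ _).trans (add_le_add hB hM)) hA)
      _ = _ := by ring

lemma dya_common {p q : ℝ} (hp : p ∈ dya) (hq : q ∈ dya) : ∃ L a b : ℕ, a ≤ 2 ^ L ∧ b ≤ 2 ^ L ∧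
    p = (a : ℝ) / 2 ^ L ∧ q = (b : ℝ) / 2 ^ L := by
  obtain ⟨m, k, hk, rfl⟩ := hp
  obtain ⟨n, l, hl, rfl⟩ := hq
  refine ⟨m + n, k * 2 ^ n, l * 2 ^ m, ?_, ?_, ?_, ?_⟩
  · rw [pow_add]; gcongr
  · rw [pow_add, mul_comm (2 ^ m)]; gcongr
  · push_cast; rw [pow_add]; field_simp
  · push_cast; rw [pow_add]; field_simp

lemma dya_chain' (w : ℝ → ℝ) (c : ℕ → ℝ) (hc : ∀ m, 0 ≤ c m) {p q : ℝ} (hp : p ∈ dya)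
    (hq : q ∈ dya) (hpq : p ≤ q)
    (h : ∀ m k : ℕ, k < 2 ^ m → p ≤ k / 2 ^ m → ((k : ℝ) + 1) / 2 ^ m ≤ q →
      |w ((k + 1) / 2 ^ m) - w (k / 2 ^ m)| ≤ c m) :
    ∃ L : ℕ, |w q - w p| ≤ 2 * ∑ m ∈ Finset.range (L + 1), c m := by
  obtain ⟨L, a, b, ha, hb, rfl, rfl⟩ := dya_common hp hq
  refine ⟨L, dya_chain w c hc L a b ?_ hb h⟩
  rw [div_le_div_iff_of_pos_right (by positivity)] at hpq
  exact_mod_cast hpq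

lemma geom_lt_aux {τ : ℝ} (h0 : 0 < τ) (h1 : τ < 1) (n : ℕ) :
    (1 - τ) * ∑ m ∈ Finset.range n, τ ^ m < 1 := by
  have : (1 - τ) * ∑ m ∈ Finset.range n, τ ^ m = 1 - τ ^ n := by
    have := mul_neg_geom_sum τ n
    linarith
  rw [this]
  have : 0 < τ ^ n := by positivity
  linarith

lemma dya_osc {w : ℝ → ℝ} {τ A : ℝ} (h0 : 0 < τ) (h1 : τ < 1) (hA : 0 ≤ A)
    (h : ∀ m k : ℕ, k < 2 ^ m → |w ((k + 1) / 2 ^ m) - w (k / 2 ^ m)| ≤ A * τ ^ (2 * m))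
    {p q : ℝ} (hp : p ∈ dya) (hq : q ∈ dya) : |w q - w p| ≤ 2 * A / (1 - τ) := by
  wlog hpq : p ≤ q generalizing p q
  · rw [abs_sub_comm]; exact this hq hp (le_of_not_ge hpq)
  obtain ⟨L, hL⟩ := dya_chain' w (fun m => A * τ ^ m) (fun m => by positivity) hp hq hpq
    (fun m k hk _ _ => (h m k hk).trans (by
      apply mul_le_mul_of_nonneg_left _ hA
      exact pow_le_pow_of_le_one h0.le h1.le (by omega)))
  refine hL.trans ?_
  rw [← Finset.mul_sum, le_div_iff₀ (by linarith)]
  have := geom_lt_aux h0 h1 (L + 1)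
  nlinarith

lemma dya_Up {w : ℝ → ℝ} {τ A α β : ℝ} {Q : ℕ} (h0 : 0 < τ) (h1 : τ < 1) (hA : 0 ≤ A)
    (hQ : τ ^ Q ≤ 1 / 2) (hαβ : α < β)
    (h : ∀ m k : ℕ, k < 2 ^ m → |w ((k + 1) / 2 ^ m) - w (k / 2 ^ m)| ≤ A * τ ^ (2 * m)) :
    Up dya α β w ≤ ENNReal.ofReal (2 * (2 * A / ((1 - τ) * (β - α))) ^ Q) := by
  set Y := 2 * A / ((1 - τ) * (β - α)) with hY
  have hd : 0 < (1 - τ) * (β - α) := mul_pos (by linarith) (by linarith)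
  have key : ∀ n T, UpN dya α β w n T → ∃ F : Finset ((_ : ℕ) × ℕ), F.card = n ∧ ∀ z ∈ F,
      z.2 < 2 ^ z.1 ∧ (τ ^ z.1)⁻¹ < Y ∧ ((z.2 : ℝ) + 1) / 2 ^ z.1 ≤ T := by
    intro n
    induction n with
    | zero => intro T _; exact ⟨∅, by simp⟩
    | succ n ih =>
      rintro T ⟨q, hq, hqT, hb, p, hp, hpq, ha, hU⟩
      obtain ⟨F, hF, hFz⟩ := ih p hU
      have : ∃ m k : ℕ, k < 2 ^ m ∧ p ≤ k / 2 ^ m ∧ ((k : ℝ) + 1) / 2 ^ m ≤ q ∧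
          (β - α) * (1 - τ) / 2 * τ ^ m < |w ((k + 1) / 2 ^ m) - w (k / 2 ^ m)| := by
        by_contra hc
        push Not at hc
        obtain ⟨L, hL⟩ := dya_chain' w (fun m => (β - α) * (1 - τ) / 2 * τ ^ m)
          (fun m => mul_nonneg (by nlinarith) (by positivity)) hp hq hpq.le hc
        rw [← Finset.mul_sum] at hL
        have := geom_lt_aux h0 h1 (L + 1)
        have h3 := le_abs_self (w q - w p)
        nlinarith
      obtain ⟨m, k, hk, hpk, hkq, hbig⟩ := this
      have hn : (⟨m, k⟩ : (_ : ℕ) × ℕ) ∉ F := by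
        intro hmem
        have h2 := (hFz _ hmem).2.2
        simp only at h2
        have : (k : ℝ) / 2 ^ m < ((k : ℝ) + 1) / 2 ^ m := by gcongr; linarith
        linarith
      refine ⟨insert ⟨m, k⟩ F, by rw [Finset.card_insert_of_notMem hn, hF], ?_⟩
      intro z hz
      rw [Finset.mem_insert] at hz
      rcases hz with rfl | hz
      · refine ⟨hk, ?_, hkq.trans hqT⟩
        have h2 := hbig.trans_le (h m k hk)
        simp only
        rw [hY, inv_lt_iff_one_lt_mul₀ (by positivity), div_mul_eq_mul_div, lt_div_iff₀ hd, one_mul]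
        have h3 : 0 < τ ^ m := by positivity
        have e : τ ^ (2 * m) = τ ^ m * τ ^ m := by rw [two_mul, pow_add]
        rw [e] at h2
        have : (β - α) * (1 - τ) / 2 < A * τ ^ m := by
          by_contra h4
          push Not at h4
          nlinarith
        nlinarith
      · obtain ⟨a1, a2, a3⟩ := hFz z hz
        exact ⟨a1, a2, by linarith⟩
  refine Up_le fun n T hT => ?_
  obtain ⟨F, hF, hFz⟩ := key n T hT
  rcases F.eq_empty_or_nonempty with rfl | hne
  · simp at hF; simp [← hF]
  obtain ⟨z, hz, hzmax⟩ := F.exists_max_image (fun z => z.1) hne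
  have hsub : F ⊆ (Finset.range (z.1 + 1)).sigma fun m => Finset.range (2 ^ m) := by
    intro y hy
    rw [Finset.mem_sigma, Finset.mem_range, Finset.mem_range]
    exact ⟨Nat.lt_succ_of_le (hzmax y hy), (hFz y hy).1⟩
  have hcard := Finset.card_le_card hsub
  rw [Finset.card_sigma] at hcard
  simp only [Finset.card_range] at hcard
  have hg : ∑ m ∈ Finset.range (z.1 + 1), 2 ^ m < 2 ^ (z.1 + 1) := by
    have := Nat.geomSum_eq (le_refl 2) (z.1 + 1)
    rw [this]
    have : 0 < 2 ^ (z.1 + 1) := by positivity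
    simp
  have hn : (n : ℝ) ≤ 2 * 2 ^ z.1 := by
    have : n ≤ 2 * 2 ^ z.1 := by rw [← hF]; rw [pow_succ] at hg; omega
    exact_mod_cast this
  have hY1 := (hFz z hz).2.1
  have h2 : (2 : ℝ) ^ z.1 ≤ Y ^ Q := by
    have h3 : (2 : ℝ) ≤ (τ ^ Q)⁻¹ := by
      rw [le_inv_comm₀ (by norm_num) (by positivity)]
      linarith
    calc (2 : ℝ) ^ z.1 ≤ ((τ ^ Q)⁻¹) ^ z.1 := by gcongr
      _ = ((τ ^ z.1)⁻¹) ^ Q := by rw [inv_pow, inv_pow, ← pow_mul, ← pow_mul, mul_comm]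
      _ ≤ Y ^ Q := by gcongr
  rw [← ENNReal.ofReal_natCast]
  exact ENNReal.ofReal_le_ofReal (by linarith)

/-- dyadic modulus -/
def Mx (τ : ℝ) (w : ℝ → ℝ) : ℝ≥0∞ :=
  ⨆ (m : ℕ) (k : ℕ) (_ : k < 2 ^ m), ENNReal.ofReal (|w ((k + 1) / 2 ^ m) - w (k / 2 ^ m)| / τ ^ (2 * m))

lemma Mx_spec {τ : ℝ} (h0 : 0 < τ) {w : ℝ → ℝ} (hM : Mx τ w ≠ ⊤) (m k : ℕ) (hk : k < 2 ^ m) :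
    |w ((k + 1) / 2 ^ m) - w (k / 2 ^ m)| ≤ (Mx τ w).toReal * τ ^ (2 * m) := by
  have : ENNReal.ofReal (|w ((k + 1) / 2 ^ m) - w (k / 2 ^ m)| / τ ^ (2 * m)) ≤ Mx τ w :=
    le_iSup_of_le m (le_iSup_of_le k (le_iSup_of_le hk le_rfl))
  rw [ENNReal.ofReal_le_iff_le_toReal hM, div_le_iff₀ (by positivity)] at this
  exact this

lemma Up_le_Mx {w : ℝ → ℝ} {τ α β : ℝ} {Q : ℕ} (h0 : 0 < τ) (h1 : τ < 1)
    (hQ : τ ^ Q ≤ 1 / 2) (hαβ : α < β) :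
    Up dya α β w ≤ 2 * (ENNReal.ofReal (2 / ((1 - τ) * (β - α))) * Mx τ w) ^ Q := by
  have hd : 0 < (1 - τ) * (β - α) := mul_pos (by linarith) (by linarith)
  by_cases hM : Mx τ w = ⊤
  · have hQ0 : Q ≠ 0 := by rintro rfl; norm_num at hQ
    rw [hM, ENNReal.mul_top, ENNReal.top_pow hQ0, ENNReal.mul_top (by norm_num)]
    · exact le_top
    · simp only [ne_eq, ENNReal.ofReal_eq_zero, not_le]
      positivity
  · refine (dya_Up h0 h1 ENNReal.toReal_nonneg hQ hαβ (Mx_spec h0 hM)).trans (le_of_eq ?_)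
    rw [ENNReal.ofReal_mul (by norm_num), ENNReal.ofReal_pow (by positivity)]
    congr 2
    · simp
    · rw [mul_div_right_comm, ENNReal.ofReal_mul (by positivity), ENNReal.ofReal_toReal hM]

lemma osc_le_Mx {w : ℝ → ℝ} {τ : ℝ} (h0 : 0 < τ) (h1 : τ < 1)
    {p q : ℝ} (hp : p ∈ dya) (hq : q ∈ dya) :
    ENNReal.ofReal |w q - w p| ≤ ENNReal.ofReal (2 / (1 - τ)) * Mx τ w := by
  by_cases hM : Mx τ w = ⊤
  · rw [hM, ENNReal.mul_top]
    · exact le_top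
    · simp only [ne_eq, ENNReal.ofReal_eq_zero, not_le]
      exact div_pos (by norm_num) (by linarith)
  · have := dya_osc h0 h1 ENNReal.toReal_nonneg (Mx_spec h0 hM) hp hq
    refine (ENNReal.ofReal_le_ofReal this).trans (le_of_eq ?_)
    rw [mul_div_right_comm, ENNReal.ofReal_mul (div_nonneg (by norm_num) (by linarith)),
      ENNReal.ofReal_toReal hM]

/-- bound for `Up` outside the range -/
lemma Up_eq_zero {D : Set ℝ} {α β : ℝ} {w : ℝ → ℝ}
    (h : (∀ p ∈ D, α < w p) ∨ (∀ q ∈ D, w q < β)) : Up D α β w = 0 := by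
  rw [← nonpos_iff_eq_zero]
  refine Up_le fun n T hT => ?_
  cases n with
  | zero => simp
  | succ n =>
    obtain ⟨q, hq, _, hb, p, hp, _, ha, _⟩ := hT
    rcases h with h | h
    · linarith [h p hp]
    · linarith [h q hq]

lemma kap_le_Mx {w : ℝ → ℝ} {τ θ : ℝ} {Q : ℕ} (h0 : 0 < τ) (h1 : τ < 1)
    (hQ : τ ^ Q ≤ 1 / 2) (hθ : 0 < θ) :
    kap dya θ w ≤ 2 * (ENNReal.ofReal (2 / ((1 - τ) * θ)) * Mx τ w) ^ Q *
      (2 * (ENNReal.ofReal (2 / (1 - τ)) * Mx τ w)) := by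
  by_cases hM : Mx τ w = ⊤
  · have hQ0 : Q ≠ 0 := by rintro rfl; norm_num at hQ
    have e1 : ENNReal.ofReal (2 / ((1 - τ) * θ)) ≠ 0 := by
      simp only [ne_eq, ENNReal.ofReal_eq_zero, not_le]
      exact div_pos (by norm_num) (mul_pos (by linarith) hθ)
    have e2 : ENNReal.ofReal (2 / (1 - τ)) ≠ 0 := by
      simp only [ne_eq, ENNReal.ofReal_eq_zero, not_le]
      exact div_pos (by norm_num) (by linarith)
    rw [hM, ENNReal.mul_top e1, ENNReal.mul_top e2, ENNReal.top_pow hQ0,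
      ENNReal.mul_top (by norm_num), ENNReal.top_mul_top]
    exact le_top
  set O := 2 * (Mx τ w).toReal / (1 - τ) with hO
  have hosc : ∀ p ∈ dya, ∀ q ∈ dya, |w q - w p| ≤ O := fun p hp q hq =>
    dya_osc h0 h1 ENNReal.toReal_nonneg (Mx_spec h0 hM) hp hq
  have hpt : ∀ x, Up dya x (x + θ) w ≤ (Icc (w 0 - O) (w 0 + O)).indicator
      (fun _ => 2 * (ENNReal.ofReal (2 / ((1 - τ) * θ)) * Mx τ w) ^ Q) x := by
    intro x
    by_cases hx : x ∈ Icc (w 0 - O) (w 0 + O)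
    · rw [indicator_of_mem hx]
      have := Up_le_Mx (w := w) h0 h1 hQ (show x < x + θ by linarith)
      simpa using this
    · rw [indicator_of_notMem hx, Up_eq_zero]
      by_cases hx1 : x < w 0 - O
      · left
        intro p hp
        have := abs_le.1 (hosc 0 zero_mem_dya p hp)
        linarith
      · right
        intro p hp
        have := abs_le.1 (hosc 0 zero_mem_dya p hp)
        have : ¬ x ≤ w 0 + O := fun h => hx ⟨by linarith, h⟩
        linarith
  unfold kap
  refine (lintegral_mono hpt).trans (le_of_eq ?_)
  rw [lintegral_indicator measurableSet_Icc, setLIntegral_const, Real.volume_Icc]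
  congr 1
  rw [show w 0 + O - (w 0 - O) = 2 * O by ring, ENNReal.ofReal_mul (by norm_num), hO, mul_div_right_comm,
    ENNReal.ofReal_mul (div_nonneg (by norm_num) (by linarith)), ENNReal.ofReal_toReal hM]
  simp

lemma measurable_Mx {Z : Type*} [MeasurableSpace Z] {W : Z → ℝ → ℝ} (τ : ℝ)
    (hW : ∀ p ∈ dya, Measurable fun z => W z p) : Measurable fun z => Mx τ (W z) := by
  unfold Mx
  refine Measurable.iSup fun m => Measurable.iSup fun k => Measurable.iSup fun hk => ?_
  have h1 : Measurable fun z => W z (((k : ℝ) + 1) / 2 ^ m) :=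
    hW _ ⟨m, k + 1, hk, by push_cast; rfl⟩
  have h2 : Measurable fun z => W z ((k : ℝ) / 2 ^ m) := hW _ ⟨m, k, hk.le, rfl⟩
  exact (((h1.sub h2).norm).div_const _).ennreal_ofReal

lemma moment_Mx {Ω : Type*} [MeasurableSpace Ω] {P : Measure Ω} {W : Ω → ℝ → ℝ} {τ : ℝ}
    (h0 : 0 < τ) (hW : ∀ p ∈ dya, Measurable fun z => W z p) (p : ℕ) (hp : p ≠ 0) (K x : ℝ≥0∞)
    (h : ∀ m k : ℕ, k < 2 ^ m →
      ∫⁻ ω, ENNReal.ofReal (|W ω ((k + 1) / 2 ^ m) - W ω (k / 2 ^ m)|) ^ p ∂P ≤ K * x ^ m) :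
    ∫⁻ ω, Mx τ (W ω) ^ p ∂P ≤ K * ∑' m : ℕ, (2 * x * ENNReal.ofReal (τ ^ (2 * p))⁻¹) ^ m := by
  set f : ℕ → ℕ → Ω → ℝ≥0∞ := fun m k ω =>
    ENNReal.ofReal (|W ω ((k + 1) / 2 ^ m) - W ω (k / 2 ^ m)| / τ ^ (2 * m)) ^ p with hf
  have hmf : ∀ m k, k < 2 ^ m → Measurable (f m k) := by
    intro m k hk
    have h1 : Measurable fun z => W z (((k : ℝ) + 1) / 2 ^ m) :=
      hW _ ⟨m, k + 1, hk, by push_cast; rfl⟩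
    have h2 : Measurable fun z => W z ((k : ℝ) / 2 ^ m) := hW _ ⟨m, k, hk.le, rfl⟩
    exact (((h1.sub h2).norm).div_const _).ennreal_ofReal.pow_const p
  have hle : ∀ ω, Mx τ (W ω) ^ p ≤ ∑' m : ℕ, ∑ k ∈ Finset.range (2 ^ m), f m k ω := by
    intro ω
    set S := ∑' m : ℕ, ∑ k ∈ Finset.range (2 ^ m), f m k ω
    have hp' : (0 : ℝ) < p := by positivity
    have : Mx τ (W ω) ≤ S ^ (1 / (p : ℝ)) := by
      refine iSup_le fun m => iSup_le fun k => iSup_le fun hk => ?_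
      rw [one_div, ENNReal.le_rpow_inv_iff hp', ENNReal.rpow_natCast]
      calc f m k ω ≤ ∑ k ∈ Finset.range (2 ^ m), f m k ω :=
            Finset.single_le_sum (f := fun k => f m k ω) (fun _ _ => zero_le) (Finset.mem_range.2 hk)
        _ ≤ S := ENNReal.le_tsum (f := fun m => ∑ k ∈ Finset.range (2 ^ m), f m k ω) m
    rwa [one_div, ENNReal.le_rpow_inv_iff hp', ENNReal.rpow_natCast] at this
  calc ∫⁻ ω, Mx τ (W ω) ^ p ∂P ≤ ∫⁻ ω, ∑' m : ℕ, ∑ k ∈ Finset.range (2 ^ m), f m k ω ∂P :=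
        lintegral_mono hle
    _ = ∑' m : ℕ, ∑ k ∈ Finset.range (2 ^ m), ∫⁻ ω, f m k ω ∂P := by
        rw [lintegral_tsum]
        · congr 1; ext m
          exact lintegral_finsetSum' _ fun k hk => (hmf m k (Finset.mem_range.1 hk)).aemeasurable
        · intro m
          exact (Finset.measurable_sum _ fun k hk => hmf m k (Finset.mem_range.1 hk)).aemeasurable
    _ ≤ ∑' m : ℕ, K * (2 * x * ENNReal.ofReal (τ ^ (2 * p))⁻¹) ^ m := by
        refine ENNReal.tsum_le_tsum fun m => ?_
        have : ∀ k ∈ Finset.range (2 ^ m), ∫⁻ ω, f m k ω ∂P ≤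
            K * x ^ m * ENNReal.ofReal (τ ^ (2 * p))⁻¹ ^ m := by
          intro k hk
          have hk := Finset.mem_range.1 hk
          have e : ∀ ω, f m k ω = ENNReal.ofReal (|W ω ((k + 1) / 2 ^ m) - W ω (k / 2 ^ m)|) ^ p *
              ENNReal.ofReal (τ ^ (2 * p))⁻¹ ^ m := by
            intro ω
            simp only [hf]
            rw [div_eq_mul_inv, ENNReal.ofReal_mul (abs_nonneg _), mul_pow,
              ← ENNReal.ofReal_pow (by positivity), ← ENNReal.ofReal_pow (by positivity)
              , ← ENNReal.ofReal_pow (by positivity)]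
            congr 2
            rw [inv_pow, inv_pow, ← pow_mul, ← pow_mul]
            congr 2
            ring
          simp_rw [e]
          rw [lintegral_mul_const']
          · gcongr
            exact h m k hk
          · exact ENNReal.pow_ne_top ENNReal.ofReal_ne_top
        calc _ ≤ ∑ k ∈ Finset.range (2 ^ m), K * x ^ m * ENNReal.ofReal (τ ^ (2 * p))⁻¹ ^ m :=
              Finset.sum_le_sum this
          _ = _ := by
            rw [Finset.sum_const, Finset.card_range, nsmul_eq_mul, mul_pow, mul_pow]
            push_cast
            ring
    _ = _ := ENNReal.tsum_mul_left

end

section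



/-! ### Gaussian Hilbert spaces -/

def GS {Ω : Type*} [MeasurableSpace Ω] (P : Measure Ω) (G : Submodule ℝ (Lp ℝ 2 P)) : Prop :=
  ∀ x ∈ G, P.map (x : Ω → ℝ) = gaussianReal 0 (‖x‖₊ ^ 2)

section gauss
variable {Ω : Type*} [MeasurableSpace Ω] {P : Measure Ω} [IsProbabilityMeasure P]

lemma Lp_integrable (x : Lp ℝ 2 P) : Integrable x P :=
  (Lp.memLp x).integrable (by norm_num)

lemma Lp_int_sq (x : Lp ℝ 2 P) : ∫ ω, x ω ^ 2 ∂P = ‖x‖ ^ 2 := by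
  rw [← real_inner_self_eq_norm_sq, L2.inner_def]
  refine integral_congr_ae (Eventually.of_forall fun ω => ?_)
  simp [sq]

lemma Lp_inner (x y : Lp ℝ 2 P) : ∫ ω, x ω * y ω ∂P = inner ℝ x y := by
  rw [L2.inner_def]
  refine integral_congr_ae (Eventually.of_forall fun ω => ?_)
  simp [mul_comm]

lemma Lp_int_abs (x : Lp ℝ 2 P) : ∫ ω, |x ω| ∂P ≤ ‖x‖ := by
  have h1 := eLpNorm_le_eLpNorm_of_exponent_le (μ := P) (p := 1) (q := 2) (by norm_num)
    (Lp.aestronglyMeasurable x)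
  have h2 : ∫ ω, |x ω| ∂P = (eLpNorm x 1 P).toReal := by
    have := integral_norm_eq_lintegral_enorm (Lp.aestronglyMeasurable x)
    rw [eLpNorm_one_eq_lintegral_enorm, ← this]
    rfl
  rw [h2, Lp.norm_def]
  exact ENNReal.toReal_mono (Lp.eLpNorm_ne_top x) h1

lemma charFun_cont (t : ℝ) : Continuous fun x : Lp ℝ 2 P => charFun (P.map (x : Ω → ℝ)) t := by
  have key : ∀ x : Lp ℝ 2 P, charFun (P.map (x : Ω → ℝ)) t
      = ∫ ω, Complex.exp (t * x ω * Complex.I) ∂P := by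
    intro x
    rw [charFun_apply_real, integral_map (Lp.aestronglyMeasurable x).aemeasurable]
    exact Measurable.aestronglyMeasurable (by fun_prop)
  have hntg : ∀ x : Lp ℝ 2 P, Integrable (fun ω => Complex.exp (t * x ω * Complex.I)) P := by
    intro x
    refine Integrable.of_bound (C := 1) ?_ (Eventually.of_forall fun ω => ?_)
    · have h := (Lp.aestronglyMeasurable x).aemeasurable
      exact AEMeasurable.aestronglyMeasurable (by fun_prop)
    · rw [← Complex.ofReal_mul, Complex.norm_exp_ofReal_mul_I]
  have hL : LipschitzWith (Real.toNNReal |t|)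
      fun x : Lp ℝ 2 P => charFun (P.map (x : Ω → ℝ)) t := by
    refine LipschitzWith.of_dist_le_mul fun x y => ?_
    rw [dist_eq_norm, dist_eq_norm, key, key, ← integral_sub (hntg x) (hntg y),
      Real.coe_toNNReal _ (abs_nonneg t)]
    calc _ ≤ ∫ ω, ‖Complex.exp (t * x ω * Complex.I) - Complex.exp (t * y ω * Complex.I)‖ ∂P :=
          norm_integral_le_integral_norm _
      _ ≤ ∫ ω, |t| * |(x - y : Lp ℝ 2 P) ω| ∂P := by
          refine integral_mono_ae ((hntg x).sub (hntg y)).norm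
            (((Lp_integrable (x - y)).abs).const_mul _) ?_
          filter_upwards [Lp.coeFn_sub x y] with ω hω
          rw [hω]
          simp only [Pi.sub_apply]
          have e : Complex.exp (t * x ω * Complex.I) - Complex.exp (t * y ω * Complex.I)
            = Complex.exp (((t * y ω : ℝ) : ℂ) * Complex.I) *
              (Complex.exp (Complex.I * ((t * (x ω - y ω) : ℝ) : ℂ)) - 1) := by
            rw [mul_sub, ← Complex.exp_add, mul_one]
            congr 2 <;> push_cast <;> ring
          rw [e, norm_mul, Complex.norm_exp_ofReal_mul_I, one_mul]
          refine (Real.norm_exp_I_mul_ofReal_sub_one_le).trans ?_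
          rw [Real.norm_eq_abs, abs_mul]
      _ ≤ |t| * ‖x - y‖ := by
          rw [integral_const_mul]
          gcongr
          exact Lp_int_abs _
  exact hL.continuous

lemma GS_closure {G : Submodule ℝ (Lp ℝ 2 P)} (hG : GS P G) : GS P G.topologicalClosure := by
  intro x hx
  have hm : ∀ y : Lp ℝ 2 P, IsProbabilityMeasure (P.map (y : Ω → ℝ)) := fun y =>
    Measure.isProbabilityMeasure_map (Lp.aestronglyMeasurable y).aemeasurable
  have := hm x
  refine Measure.ext_of_charFun (funext fun t => ?_)
  have hcl : IsClosed {x : Lp ℝ 2 P | charFun (P.map (x : Ω → ℝ)) t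
      = charFun (gaussianReal 0 (‖x‖₊ ^ 2)) t} := by
    refine isClosed_eq (charFun_cont t) ?_
    simp only [charFun_gaussianReal]
    fun_prop
  have hsub : (G : Set (Lp ℝ 2 P)) ⊆ {x : Lp ℝ 2 P | charFun (P.map (x : Ω → ℝ)) t
      = charFun (gaussianReal 0 (‖x‖₊ ^ 2)) t} := fun y hy => by
    simp only [mem_setOf_eq]; rw [hG y hy]
  exact closure_minimal hsub hcl hx

lemma Lp_coe_sum {ι : Type*} (s : Finset ι) (c : ι → ℝ) (x : ι → Lp ℝ 2 P) (X : ι → Ω → ℝ)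
    (h : ∀ i, X i =ᵐ[P] x i) :
    (fun ω => ∑ i ∈ s, c i * X i ω) =ᵐ[P] (∑ i ∈ s, c i • x i : Lp ℝ 2 P) := by
  induction s using Finset.induction_on with
  | empty =>
    simp only [Finset.sum_empty]
    exact (Lp.coeFn_zero ℝ 2 P).symm
  | insert a s ha ih =>
    rw [Finset.sum_insert ha]
    filter_upwards [ih, h a, Lp.coeFn_add (c a • x a) (∑ i ∈ s, c i • x i),
      Lp.coeFn_smul (c a) (x a)] with ω h1 h2 h3 h4
    rw [Finset.sum_insert ha, h3, h1, h2]
    simp [h4]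

lemma GS_map_restrict {T : Type*} {G : Submodule ℝ (Lp ℝ 2 P)} (hG : GS P G) {X : T → Ω → ℝ}
    (mX : ∀ t, AEMeasurable (X t) P) {x : T → Lp ℝ 2 P} (hx : ∀ t, x t ∈ G)
    (hX : ∀ t, X t =ᵐ[P] x t) (I : Finset T) (L : StrongDual ℝ (I → ℝ)) :
    (P.map (fun ω => I.restrict (X · ω))).map L = gaussianReal 0
      (‖∑ i : I, (L (Pi.single i 1)) • x i‖₊ ^ 2) := by
  have hm : AEMeasurable (fun ω => I.restrict (X · ω)) P := by
    refine aemeasurable_pi_lambda _ fun i => ?_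
    exact mX i
  rw [AEMeasurable.map_map_of_aemeasurable (by fun_prop) hm]
  have h1 := Lp_coe_sum Finset.univ (fun i : I => L (Pi.single i 1)) (fun i => x i)
    (fun i => X i) (fun i => hX i)
  have h2 := hG (∑ i : I, L (Pi.single i 1) • x i)
    (Submodule.sum_mem _ fun i _ => Submodule.smul_mem _ _ (hx i))
  rw [← h2, ← Measure.map_congr h1]
  congr 1
  funext ω
  simp only [Function.comp_apply]
  have h3 := LinearMap.pi_apply_eq_sum_univ L.toLinearMap (I.restrict fun t => X t ω)
  simp only [ContinuousLinearMap.coe_coe] at h3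
  rw [h3]
  refine Finset.sum_congr rfl fun i _ => ?_
  simp only [smul_eq_mul, Finset.restrict]
  rw [mul_comm]
  congr 2
  funext j
  simp [Pi.single_apply, eq_comm]

lemma GS_process {T : Type*} {G : Submodule ℝ (Lp ℝ 2 P)} (hG : GS P G) {X : T → Ω → ℝ}
    (mX : ∀ t, AEMeasurable (X t) P) {x : T → Lp ℝ 2 P} (hx : ∀ t, x t ∈ G)
    (hX : ∀ t, X t =ᵐ[P] x t) : IsGaussianProcess X P := by
  refine ⟨fun I => ⟨⟨fun L => ?_⟩⟩⟩
  have h := GS_map_restrict hG mX hx hX I L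
  have hL : Measurable L := by fun_prop
  have e1 : (P.map fun ω => I.restrict (X · ω))[L] = 0 := by
    have := integral_map (μ := (P.map fun ω => I.restrict (X · ω))) (φ := L) hL.aemeasurable
      (f := fun x => x) (by fun_prop)
    rw [h] at this
    rw [← this]
    simp [integral_id_gaussianReal]
  have e2 : Var[L; P.map fun ω => I.restrict (X · ω)] =
      ((‖∑ i : I, (L (Pi.single i 1)) • x i‖₊ ^ 2 : ℝ≥0) : ℝ) := by
    have := variance_map (μ := (P.map fun ω => I.restrict (X · ω))) (Y := L) (X := fun x => x)
      (by fun_prop) hL.aemeasurable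
    rw [h] at this
    rw [show (L : (I → ℝ) → ℝ) = (fun x => x) ∘ L from rfl, ← this]
    exact variance_fun_id_gaussianReal
  rw [e1, e2, Real.toNNReal_coe]
  exact h

lemma GS_law {T : Type*} {G : Submodule ℝ (Lp ℝ 2 P)} (hG : GS P G) {X Y : T → Ω → ℝ}
    (mX : ∀ t, Measurable (X t)) (mY : ∀ t, Measurable (Y t))
    {x y : T → Lp ℝ 2 P} (hx : ∀ t, x t ∈ G) (hy : ∀ t, y t ∈ G)
    (hX : ∀ t, X t =ᵐ[P] x t) (hY : ∀ t, Y t =ᵐ[P] y t)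
    (h : ∀ s t, inner ℝ (x s) (x t) = inner ℝ (y s) (y t)) :
    P.map (fun ω t => X t ω) = P.map (fun ω t => Y t ω) := by
  rw [map_eq_iff_forall_finset_map_restrict_eq (measurable_pi_lambda _ mX).aemeasurable
    (measurable_pi_lambda _ mY).aemeasurable]
  intro I
  have i1 : IsProbabilityMeasure (P.map fun ω => I.restrict (X · ω)) :=
    Measure.isProbabilityMeasure_map (aemeasurable_pi_lambda _ fun i => (mX i).aemeasurable)
  have i2 : IsProbabilityMeasure (P.map fun ω => I.restrict (Y · ω)) :=
    Measure.isProbabilityMeasure_map (aemeasurable_pi_lambda _ fun i => (mY i).aemeasurable)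
  refine Measure.ext_of_charFunDual (funext fun L => ?_)
  rw [charFunDual_eq_charFun_map_one, charFunDual_eq_charFun_map_one,
    GS_map_restrict hG (fun t => (mX t).aemeasurable) hx hX,
    GS_map_restrict hG (fun t => (mY t).aemeasurable) hy hY]
  congr 3
  rw [← NNReal.coe_inj]
  push_cast
  rw [← sq_eq_sq₀ (norm_nonneg _) (norm_nonneg _), ← real_inner_self_eq_norm_sq,
    ← real_inner_self_eq_norm_sq]
  simp only [sum_inner, inner_sum, inner_smul_left, inner_smul_right, h]

lemma GS_mean {G : Submodule ℝ (Lp ℝ 2 P)} (hG : GS P G) {x : Lp ℝ 2 P} (hx : x ∈ G) :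
    ∫ ω, x ω ∂P = 0 := by
  have := integral_map (μ := P) (φ := x) (Lp.aestronglyMeasurable x).aemeasurable
      (f := fun x => x) (by fun_prop)
  rw [hG x hx] at this
  rw [← this]
  simp [integral_id_gaussianReal]

lemma GS_indep {S T : Type*} {G : Submodule ℝ (Lp ℝ 2 P)} (hG : GS P G) {X : S → Ω → ℝ}
    {Y : T → Ω → ℝ} (mX : ∀ t, AEMeasurable (X t) P) (mY : ∀ t, AEMeasurable (Y t) P)
    {x : S → Lp ℝ 2 P} {y : T → Lp ℝ 2 P} (hx : ∀ t, x t ∈ G) (hy : ∀ t, y t ∈ G)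
    (hX : ∀ t, X t =ᵐ[P] x t) (hY : ∀ t, Y t =ᵐ[P] y t)
    (h : ∀ s t, inner ℝ (x s) (y t) = 0) :
    IndepFun (fun ω s => X s ω) (fun ω t => Y t ω) P := by
  refine IsGaussianProcess.indepFun_of_covariance_eq_zero ?_ mX mY ?_
  · refine GS_process hG (x := Sum.elim x y) ?_ ?_ ?_
    · rintro (s | t)
      exacts [mX s, mY t]
    · rintro (s | t)
      exacts [hx s, hy t]
    · rintro (s | t)
      exacts [hX s, hY t]
  · intro s t
    have hX' := hX s
    have hY' := hY t
    have m1 : MemLp (X s) 2 P := (memLp_congr_ae hX').2 (Lp.memLp _)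
    have m2 : MemLp (Y t) 2 P := (memLp_congr_ae hY').2 (Lp.memLp _)
    rw [covariance_eq_sub m1 m2, integral_congr_ae hX', GS_mean hG (hx s), zero_mul, sub_zero,
      ← h s t, ← Lp_inner]
    refine integral_congr_ae ?_
    filter_upwards [hX', hY'] with ω h1 h2
    simp [h1, h2]

end gauss

end

section



/-! ### Fractional Brownian motion: Hilbert space structure and laws -/

/-- absolute moments of the standard Gaussian -/
def gm (p : ℕ) : ℝ≥0∞ := ∫⁻ y, ENNReal.ofReal |y| ^ p ∂(gaussianReal 0 1)

lemma gm_lt_top (p : ℕ) : gm p < ⊤ := by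
  have h : MemLp id (p : ℝ≥0) (gaussianReal 0 1) := memLp_id_gaussianReal' (p : ℝ≥0∞) (by simp)
  rcases Nat.eq_zero_or_pos p with rfl | hp
  · simp [gm]
  have h2 := lintegral_rpow_enorm_lt_top_of_eLpNorm_lt_top (p := (p : ℝ≥0∞)) (f := (id : ℝ → ℝ))
    (μ := gaussianReal 0 1) (by simp; omega) (by simp) h.2
  unfold gm
  convert h2 using 3 with y
  simp [Real.enorm_eq_ofReal_abs]

section fbm
variable {Ω : Type*} [MeasurableSpace Ω] {P : Measure Ω} [IsProbabilityMeasure P]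

lemma GS_moment {G : Submodule ℝ (Lp ℝ 2 P)} (hG : GS P G) {X : Ω → ℝ} {x : Lp ℝ 2 P} (hx : x ∈ G)
    (hX : X =ᵐ[P] x) (p : ℕ) :
    ∫⁻ ω, ENNReal.ofReal |X ω| ^ p ∂P = ENNReal.ofReal ‖x‖ ^ p * gm p := by
  have e : gaussianReal 0 (‖x‖₊ ^ 2) = (gaussianReal 0 1).map (fun y => ‖x‖ * y) := by
    rw [gaussianReal_map_const_mul]
    congr 1
    · simp
    · ext; simp
  have h1 : ∫⁻ ω, ENNReal.ofReal |X ω| ^ p ∂P = ∫⁻ ω, ENNReal.ofReal |x ω| ^ p ∂P := by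
    refine lintegral_congr_ae ?_
    filter_upwards [hX] with ω h
    rw [h]
  have h2 := lintegral_map' (μ := P) (f := fun y : ℝ => ENNReal.ofReal |y| ^ p) (g := x)
    (by fun_prop) (Lp.aestronglyMeasurable x).aemeasurable
  rw [h1, ← h2, hG x hx, e, lintegral_map (by fun_prop) (by fun_prop)]
  simp only [abs_mul, abs_norm]
  rw [gm, ← lintegral_const_mul _ (by fun_prop)]
  refine lintegral_congr fun y => ?_
  rw [ENNReal.ofReal_mul (norm_nonneg _), mul_pow]

variable {H : ℝ} {B : ℝ → Ω → ℝ}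

lemma fbm_meas (hB : IsFBM H P B) (t : ℝ) : Measurable (B t) := hB.2.2.1 t

lemma fbm_memLp (hB : IsFBM H P B) (t : ℝ) : MemLp (B t) 2 P := by
  obtain ⟨v, hv⟩ := hB.2.2.2.1 1 (fun _ => t) (fun _ => 1)
  simp only [Finset.univ_unique, one_mul, Finset.sum_const, Finset.card_singleton, one_smul] at hv
  have h : MemLp id 2 (P.map (B t)) := by
    have e : (fun ω => B t ω) = B t := rfl
    rw [e] at hv
    rw [hv]; exact memLp_id_gaussianReal' 2 (by simp)
  exact (memLp_map_measure_iff (by fun_prop) (fbm_meas hB t).aemeasurable).1 h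

/-- the `L²` class of `B t` -/
def fL (hB : IsFBM H P B) (t : ℝ) : Lp ℝ 2 P := (fbm_memLp hB t).toLp

lemma fL_ae (hB : IsFBM H P B) (t : ℝ) : B t =ᵐ[P] fL hB t := (fbm_memLp hB t).coeFn_toLp.symm

/-- the Gaussian space of `B` -/
def fG (hB : IsFBM H P B) : Submodule ℝ (Lp ℝ 2 P) :=
  (Submodule.span ℝ (range (fL hB))).topologicalClosure

lemma fL_mem (hB : IsFBM H P B) (t : ℝ) : fL hB t ∈ fG hB :=
  Submodule.le_topologicalClosure _ (Submodule.subset_span ⟨t, rfl⟩)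

lemma fG_GS (hB : IsFBM H P B) : GS P (fG hB) := by
  refine GS_closure fun x hx => ?_
  rw [Finsupp.mem_span_range_iff_exists_finsupp] at hx
  obtain ⟨c, rfl⟩ := hx
  set x := c.sum fun i a => a • fL hB i with hxdef
  let e := (c.support.equivFin).symm
  obtain ⟨v, hv⟩ := hB.2.2.2.1 _ (fun i => (e i : ℝ)) (fun i => c (e i))
  have h1 := Lp_coe_sum c.support c (fL hB) B (fun t => fL_ae hB t)
  have h2 : (fun ω => ∑ i, c (e i) * B (e i) ω) = fun ω => ∑ i ∈ c.support, c i * B i ω := by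
    funext ω
    rw [← Finset.sum_coe_sort c.support]
    exact Equiv.sum_comp e fun i => c i * B i ω
  rw [h2, Measure.map_congr h1] at hv
  change P.map x = gaussianReal 0 v at hv
  rw [hv]
  congr 1
  have h3 : ∫ ω, x ω ^ 2 ∂P = v := by
    have h4 := integral_map (μ := P) (φ := x) (Lp.aestronglyMeasurable x).aemeasurable
      (f := fun y : ℝ => y ^ 2) (by fun_prop)
    rw [← h4, hv]
    have h5 := variance_fun_id_gaussianReal (μ := 0) (v := v)
    rw [variance_of_integral_eq_zero (by fun_prop) (by simp [integral_id_gaussianReal])] at h5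
    exact h5
  rw [Lp_int_sq] at h3
  ext
  simp [h3]

lemma Lp_norm_sq {X : Ω → ℝ} {x : Lp ℝ 2 P} (h : X =ᵐ[P] x) : ∫ ω, X ω ^ 2 ∂P = ‖x‖ ^ 2 := by
  rw [← Lp_int_sq]
  refine integral_congr_ae ?_
  filter_upwards [h] with ω h
  rw [h]

lemma ae_sub {X Y : Ω → ℝ} {x y : Lp ℝ 2 P} (hX : X =ᵐ[P] x) (hY : Y =ᵐ[P] y) :
    (fun ω => X ω - Y ω) =ᵐ[P] (x - y : Lp ℝ 2 P) := by
  filter_upwards [hX, hY, Lp.coeFn_sub x y] with ω h1 h2 h3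
  rw [h3, h1, h2, Pi.sub_apply]

lemma ae_smul {X : Ω → ℝ} {x : Lp ℝ 2 P} (hX : X =ᵐ[P] x) (c : ℝ) :
    (fun ω => c * X ω) =ᵐ[P] (c • x : Lp ℝ 2 P) := by
  filter_upwards [hX, Lp.coeFn_smul c x] with ω h1 h2
  simp [h1, h2]

/-- variance constant -/
def fa (hB : IsFBM H P B) : ℝ := Classical.choose hB.2.2.2.2

lemma fa_pos (hB : IsFBM H P B) : 0 < fa hB := (Classical.choose_spec hB.2.2.2.2).1

lemma fL_norm (hB : IsFBM H P B) (s t : ℝ) :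
    ‖fL hB t - fL hB s‖ ^ 2 = fa hB * |t - s| ^ (2 * H) := by
  rw [fa, ← (Classical.choose_spec hB.2.2.2.2).2 s t, ← Lp_norm_sq (ae_sub (fL_ae hB t) (fL_ae hB s))]

lemma fL_zero (hB : IsFBM H P B) : fL hB 0 = 0 := by
  rw [← norm_eq_zero, ← sq_eq_zero_iff, ← Lp_norm_sq (fL_ae hB 0)]
  simp [hB.2.1]

lemma fL_inner_inc (hB : IsFBM H P B) (s t u : ℝ) :
    inner ℝ (fL hB s - fL hB u) (fL hB t - fL hB u) =
      fa hB / 2 * (|s - u| ^ (2 * H) + |t - u| ^ (2 * H) - |s - t| ^ (2 * H)) := by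
  have h := norm_sub_sq_real (fL hB s - fL hB u) (fL hB t - fL hB u)
  rw [sub_sub_sub_cancel_right, fL_norm, fL_norm, fL_norm] at h
  linarith

lemma fbm_law_block (hB : IsFBM H P B) (s : ℝ) {c : ℝ} (hc : 0 < c) :
    P.map (fun ω r => c⁻¹ ^ H * (B (s + c * r) ω - B s ω)) = P.map (fun ω r => B r ω) := by
  refine GS_law (fG_GS hB) (X := fun r ω => c⁻¹ ^ H * (B (s + c * r) ω - B s ω)) (Y := B)
    (x := fun r => c⁻¹ ^ H • (fL hB (s + c * r) - fL hB s))
    (y := fun r => fL hB r) ?_ (fbm_meas hB) ?_ (fL_mem hB) ?_ (fL_ae hB) ?_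
  · intro t
    exact ((fbm_meas hB _).sub (fbm_meas hB _)).const_mul _
  · intro t
    exact Submodule.smul_mem _ _ (Submodule.sub_mem _ (fL_mem hB _) (fL_mem hB _))
  · intro t
    exact ae_smul (ae_sub (fL_ae hB _) (fL_ae hB _)) _
  · intro p q
    have h2 := fL_inner_inc hB p q 0
    rw [fL_zero, sub_zero, sub_zero] at h2
    rw [inner_smul_left, inner_smul_right, fL_inner_inc, h2]
    have e : ∀ z : ℝ, |c * z| ^ (2 * H) = (c ^ H) ^ 2 * |z| ^ (2 * H) := by
      intro z
      rw [abs_mul, abs_of_pos hc, Real.mul_rpow hc.le (abs_nonneg z), ← Real.rpow_natCast,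
        ← Real.rpow_mul hc.le]
      norm_num [mul_comm]
    have e2 : s + c * p - (s + c * q) = c * (p - q) := by ring
    rw [e2, add_sub_cancel_left, add_sub_cancel_left, e, e, e, Real.inv_rpow hc.le]
    have : 0 < c ^ H := by positivity
    simp only [conj_trivial, sub_zero]
    field_simp

lemma fbm_law_neg (hB : IsFBM H P B) :
    P.map (fun ω r => - B r ω) = P.map (fun ω r => B r ω) := by
  refine GS_law (fG_GS hB) (X := fun r ω => - B r ω) (Y := B)
    (x := fun r => - (fL hB r)) (y := fun r => fL hB r) ?_ (fbm_meas hB) ?_ (fL_mem hB) ?_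
      (fL_ae hB) ?_
  · intro t
    exact (fbm_meas hB _).neg
  · intro t
    exact Submodule.neg_mem _ (fL_mem hB _)
  · intro t
    filter_upwards [fL_ae hB t, Lp.coeFn_neg (fL hB t)] with ω h1 h2
    rw [h1, h2, Pi.neg_apply]
  · intro p q
    simp

/-- transfer of expectations through equality of laws -/
lemma law_lintegral {X Y : Ω → ℝ → ℝ} (mX : ∀ t, Measurable fun ω => X ω t)
    (mY : ∀ t, Measurable fun ω => Y ω t)
    (h : P.map X = P.map Y) {Φ : (ℝ → ℝ) → ℝ≥0∞} (hΦ : Measurable Φ) :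
    ∫⁻ ω, Φ (X ω) ∂P = ∫⁻ ω, Φ (Y ω) ∂P := by
  rw [← lintegral_map hΦ (measurable_pi_lambda _ mX), h,
    lintegral_map hΦ (measurable_pi_lambda _ mY)]

end fbm

end

section



/-! ### Power kernels -/

/-- positive part power -/
def pw (e x : ℝ) : ℝ := if 0 < x then x ^ e else 0

lemma pw_pos {e x : ℝ} (h : 0 < x) : pw e x = x ^ e := if_pos h
lemma pw_neg {e x : ℝ} (h : x ≤ 0) : pw e x = 0 := if_neg h.not_gt
lemma pw_nonneg (e x : ℝ) : 0 ≤ pw e x := by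
  unfold pw; split_ifs with h
  · positivity
  · exact le_rfl

@[fun_prop]
lemma measurable_pw (e : ℝ) : Measurable (pw e) :=
  Measurable.ite measurableSet_Ioi (by fun_prop) measurable_const

lemma pw_mul {e c x : ℝ} (hc : 0 < c) : pw e (c * x) = c ^ e * pw e x := by
  rcases lt_or_ge 0 x with h | h
  · rw [pw_pos h, pw_pos (mul_pos hc h), Real.mul_rpow hc.le h.le]
  · rw [pw_neg h, pw_neg (mul_nonpos_of_nonneg_of_nonpos hc.le h), mul_zero]

lemma rpow_sub_le {e y z : ℝ} (he : e < 1) (hy : 0 < y) (hz : y ≤ z) :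
    |z ^ e - y ^ e| ≤ |e| * y ^ (e - 1) * (z - y) := by
  have := (convex_Icc y z).norm_image_sub_le_of_norm_hasDerivWithin_le (f := fun x => x ^ e)
    (f' := fun x => e * x ^ (e - 1)) (C := |e| * y ^ (e - 1))
    (fun x hx => (Real.hasDerivAt_rpow_const (Or.inl (by linarith [hx.1]))).hasDerivWithinAt) ?_
    (left_mem_Icc.2 hz) (right_mem_Icc.2 hz)
  · rwa [Real.norm_eq_abs, Real.norm_eq_abs, abs_of_nonneg (sub_nonneg.2 hz)] at this
  · intro x hx
    have hx0 : 0 < x := by linarith [hx.1]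
    rw [Real.norm_eq_abs, abs_mul, abs_of_pos (Real.rpow_pos_of_pos hx0 _)]
    exact mul_le_mul_of_nonneg_left
      (Real.rpow_le_rpow_of_nonpos hy hx.1 (by linarith)) (abs_nonneg e)

lemma pw_int_base {e : ℝ} (h1 : -(1 / 2) < e) (h2 : e < 1 / 2) :
    Integrable fun y : ℝ => (pw e (1 + y) - pw e y) ^ 2 := by
  have i1 : IntegrableOn (fun y : ℝ => 2 * y ^ (2 * e)) (Ioc 0 2) := by
    refine Integrable.const_mul ?_ 2
    exact (intervalIntegral.intervalIntegrable_rpow' (by linarith)).1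
  have i1' : IntegrableOn (fun y : ℝ => 2 * (y + 1) ^ (2 * e)) (Ioc (-1) 1) := by
    have h := (intervalIntegral.intervalIntegrable_rpow' (a := 0) (b := 2)
      (r := 2 * e) (by linarith)).comp_add_right 1
    norm_num at h
    exact (h.1).const_mul 2
  have i2 : IntegrableOn (fun y : ℝ => 2 * y ^ (2 * e)) (Ioc 0 1) :=
    i1.mono_set (Ioc_subset_Ioc_right (by norm_num))
  have i3 : IntegrableOn (fun y : ℝ => e ^ 2 * y ^ (2 * (e - 1))) (Ioi 1) :=
    (integrableOn_Ioi_rpow_of_lt (by linarith) one_pos).const_mul _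
  have I := ((i1'.integrable_indicator measurableSet_Ioc).add
    (i2.integrable_indicator measurableSet_Ioc)).add (i3.integrable_indicator measurableSet_Ioi)
  refine I.mono' (by fun_prop) (Eventually.of_forall fun y => ?_)
  rw [Real.norm_eq_abs, abs_of_nonneg (sq_nonneg _)]
  simp only [Pi.add_apply, indicator_apply, mem_Ioc, mem_Ioi]
  have key : ∀ x : ℝ, 0 < x → x ^ (2 * e) = (x ^ e) ^ 2 := fun x hx => by
    rw [← Real.rpow_natCast, ← Real.rpow_mul hx.le]; norm_num [mul_comm]
  rcases le_or_gt y (-1) with h | h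
  · rw [pw_neg (by linarith), pw_neg (by linarith), if_neg (by rintro ⟨a, b⟩; linarith),
      if_neg (by rintro ⟨a, b⟩; linarith), if_neg (by intro a; linarith)]
    norm_num
  rcases le_or_gt y 0 with h0 | h0
  · rw [pw_pos (by linarith), pw_neg (by linarith), if_pos ⟨h, by linarith⟩,
      if_neg (by rintro ⟨a, b⟩; linarith), if_neg (by intro a; linarith), add_comm y,
      key _ (by linarith)]
    nlinarith [sq_nonneg ((1 + y) ^ e)]
  rcases le_or_gt y 1 with hy1 | hy1
  · rw [pw_pos (by linarith), pw_pos h0, if_pos ⟨h, by linarith⟩,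
      if_pos ⟨h0, hy1⟩, if_neg (by intro a; linarith), add_comm y,
      key _ (by linarith), key _ h0]
    nlinarith [sq_nonneg ((1 + y) ^ e + y ^ e)]
  · rw [pw_pos (by linarith), pw_pos h0, if_neg (by rintro ⟨a, b⟩; linarith),
      if_neg (by rintro ⟨a, b⟩; linarith), if_pos hy1, zero_add, zero_add]
    have h3 := rpow_sub_le (e := e) (y := y) (z := 1 + y) (by linarith) h0 (by linarith)
    rw [add_sub_cancel_right, mul_one] at h3
    have h4 : y ^ (2 * (e - 1)) = (y ^ (e - 1)) ^ 2 := by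
      rw [← Real.rpow_natCast, ← Real.rpow_mul h0.le]; norm_num [mul_comm]
    calc _ = |(1 + y) ^ e - y ^ e| ^ 2 := (sq_abs _).symm
      _ ≤ (|e| * y ^ (e - 1)) ^ 2 := by gcongr
      _ = _ := by rw [mul_pow, sq_abs, h4]

/-- normalising constant -/
def pA (e : ℝ) : ℝ := ∫ y : ℝ, (pw e (1 + y) - pw e y) ^ 2

lemma pA_pos {e : ℝ} (h1 : -(1 / 2) < e) (h2 : e < 1 / 2) : 0 < pA e := by
  unfold pA
  rw [integral_pos_iff_support_of_nonneg (fun y => sq_nonneg _) (pw_int_base h1 h2)]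
  have : Ioo (-1 : ℝ) 0 ⊆ Function.support fun y : ℝ => (pw e (1 + y) - pw e y) ^ 2 := by
    intro y hy
    have h3 : 0 < 1 + y := by linarith [hy.1]
    simp only [Function.mem_support]
    rw [pw_pos h3, pw_neg hy.2.le, sub_zero]
    positivity
  refine lt_of_lt_of_le ?_ (measure_mono this)
  simp

/-- translated and scaled kernel -/
lemma pw_int {e : ℝ} (h1 : -(1 / 2) < e) (h2 : e < 1 / 2) (r s : ℝ) :
    Integrable (fun x : ℝ => (pw e (r - x) - pw e (s - x)) ^ 2) ∧
    ∫ x : ℝ, (pw e (r - x) - pw e (s - x)) ^ 2 = pA e * |r - s| ^ (2 * e + 1) := by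
  wlog hrs : s < r generalizing r s
  · rcases eq_or_lt_of_le (not_lt.1 hrs) with rfl | h
    · simp only [sub_self]
      rw [abs_zero, Real.zero_rpow (by linarith)]
      simp
    · have := this s r h
      rw [abs_sub_comm]
      have e : ∀ x, (pw e (r - x) - pw e (s - x)) ^ 2 = (pw e (s - x) - pw e (r - x)) ^ 2 :=
        fun x => by ring
      simp only [e]
      exact this
  have hL : 0 < r - s := sub_pos.2 hrs
  have key : ∀ x : ℝ, (pw e (r - x) - pw e (s - x)) ^ 2 = (r - s) ^ (2 * e) *
      (fun y => (pw e (1 + y) - pw e y) ^ 2) ((r - s)⁻¹ * (s - x)) := by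
    intro x
    have e1 : r - x = (r - s) * (1 + (r - s)⁻¹ * (s - x)) := by field_simp; ring
    have e2 : s - x = (r - s) * ((r - s)⁻¹ * (s - x)) := by field_simp
    simp only
    conv_lhs => rw [e1, e2]
    have e3 : (r - s) * ((r - s)⁻¹ * (s - x)) = s - x := by field_simp
    rw [e3]
    rw [pw_mul hL, show pw e (s - x) = (r - s) ^ e * pw e ((r - s)⁻¹ * (s - x)) by
      rw [← pw_mul hL, e3]]
    have h4 : (r - s) ^ (2 * e) = ((r - s) ^ e) ^ 2 := by
      rw [← Real.rpow_natCast, ← Real.rpow_mul hL.le]; norm_num [mul_comm]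
    rw [h4]; ring
  have hb := pw_int_base h1 h2
  simp only [key]
  constructor
  · refine Integrable.const_mul ?_ _
    exact (hb.comp_mul_left' (inv_ne_zero hL.ne')).comp_sub_left s
  · rw [integral_const_mul]
    rw [integral_sub_left_eq_self (fun x => (fun y => (pw e (1 + y) - pw e y) ^ 2)
      ((r - s)⁻¹ * x)) volume s, Measure.integral_comp_mul_left (fun y => (pw e (1 + y) - pw e y) ^ 2)]
    rw [inv_inv, abs_of_pos hL, smul_eq_mul, Real.rpow_add hL, Real.rpow_one, pA]
    ring

/-- beta type integral -/
def pB (e : ℝ) : ℝ := ∫ x : ℝ, pw e x * pw (-e) (1 - x)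

lemma pB_int {e : ℝ} (h1 : 0 < e) (h2 : e < 1) :
    Integrable fun x : ℝ => pw e x * pw (-e) (1 - x) := by
  have i1 : IntegrableOn (fun y : ℝ => (1 - y) ^ (-e)) (Ioc 0 1) := by
    have h := (intervalIntegral.intervalIntegrable_rpow' (a := 0) (b := 1)
      (r := -e) (by linarith)).comp_sub_left 1
    norm_num at h
    exact h.symm.1
  refine (i1.integrable_indicator measurableSet_Ioc).mono' (by fun_prop)
    (Eventually.of_forall fun x => ?_)
  rw [Real.norm_eq_abs, abs_of_nonneg (mul_nonneg (pw_nonneg _ _) (pw_nonneg _ _)), indicator_apply]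
  by_cases h : x ∈ Ioc (0 : ℝ) 1
  · rw [if_pos h, pw_pos h.1]
    have h3 : x ^ e ≤ 1 := Real.rpow_le_one h.1.le h.2 h1.le
    rcases h.2.lt_or_eq with h4 | rfl
    · rw [pw_pos (by linarith)]
      have : 0 ≤ (1 - x) ^ (-e) := Real.rpow_nonneg (by linarith) _
      nlinarith
    · rw [pw_neg (by linarith), mul_zero]
      exact Real.rpow_nonneg (by linarith) _
  · rw [if_neg h]
    rw [mem_Ioc, not_and_or, not_lt, not_le] at h
    rcases h with h | h
    · rw [pw_neg h, zero_mul]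
    · rw [pw_neg (x := 1 - x) (by linarith), mul_zero]

lemma pB_pos {e : ℝ} (h1 : 0 < e) (h2 : e < 1) : 0 < pB e := by
  unfold pB
  rw [integral_pos_iff_support_of_nonneg (fun y => mul_nonneg (pw_nonneg _ _) (pw_nonneg _ _))
    (pB_int h1 h2)]
  have : Ioo (0 : ℝ) 1 ⊆ Function.support fun x : ℝ => pw e x * pw (-e) (1 - x) := by
    intro y hy
    have h3 : 0 < 1 - y := by linarith [hy.2]
    have h4 : 0 < y := hy.1
    simp only [Function.mem_support]
    rw [pw_pos h3, pw_pos h4]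
    positivity
  refine lt_of_lt_of_le ?_ (measure_mono this)
  simp

lemma pB_scale {e : ℝ} (h1 : 0 < e) (h2 : e < 1) (u r : ℝ) :
    Integrable (fun x : ℝ => pw e (x - u) * pw (-e) (r - x)) ∧
    ∫ x : ℝ, pw e (x - u) * pw (-e) (r - x) = pB e * max (r - u) 0 := by
  rcases le_or_gt r u with h | h
  · have : (fun x : ℝ => pw e (x - u) * pw (-e) (r - x)) = fun x => 0 := by
      funext x
      rcases le_or_gt x u with h3 | h3
      · rw [pw_neg (by linarith), zero_mul]
      · rw [pw_neg (x := r - x) (by linarith), mul_zero]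
    rw [this, max_eq_right (by linarith)]
    simp
  · have hL : 0 < r - u := by linarith
    have key : ∀ x : ℝ, pw e (x - u) * pw (-e) (r - x) =
        (fun y => pw e y * pw (-e) (1 - y)) ((r - u)⁻¹ * (x - u)) := by
      intro x
      have e1 : r - x = (r - u) * (1 - (r - u)⁻¹ * (x - u)) := by field_simp; ring
      have e2 : (r - u) * ((r - u)⁻¹ * (x - u)) = x - u := by field_simp
      simp only
      rw [e1, pw_mul hL, show pw e (x - u) = (r - u) ^ e * pw e ((r - u)⁻¹ * (x - u)) by
        rw [← pw_mul hL, e2], Real.rpow_neg hL.le]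
      have : 0 < (r - u) ^ e := by positivity
      field_simp
    simp only [key]
    constructor
    · exact ((pB_int h1 h2).comp_mul_left' (inv_ne_zero hL.ne')).comp_sub_right u
    · rw [integral_sub_right_eq_self (fun x => (fun y => pw e y * pw (-e) (1 - y))
        ((r - u)⁻¹ * x)) u, Measure.integral_comp_mul_left (fun y => pw e y * pw (-e) (1 - y)), inv_inv, abs_of_pos hL, smul_eq_mul,
        max_eq_left hL.le, pB]
      ring

/-- the part of a kernel increment living before time `u` -/
lemma pw_tail {e : ℝ} (h1 : -(1 / 2) < e) (h2 : e < 1 / 2) {u q r : ℝ} (hu : u < q) (hq : q ≤ r) :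
    ∫ x in Iio u, (pw e (r - x) - pw e (q - x)) ^ 2 ≤
      e ^ 2 / (1 - 2 * e) * (r - q) ^ 2 * (q - u) ^ (2 * e - 1) := by
  have i1 : IntegrableOn (fun x : ℝ => (pw e (r - x) - pw e (q - x)) ^ 2) (Iio u) :=
    (pw_int h1 h2 r q).1.integrableOn
  have hqu : 0 < q - u := by linarith
  have i2 : IntegrableOn (fun y : ℝ => y ^ (2 * (e - 1))) (Ioi (q - u)) :=
    integrableOn_Ioi_rpow_of_lt (by linarith) hqu
  have e3 : ∫ y in Ioi (q - u), y ^ (2 * (e - 1)) = (q - u) ^ (2 * e - 1) / (1 - 2 * e) := by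
    rw [integral_Ioi_rpow_of_lt (by linarith) hqu]
    rw [show 2 * (e - 1) + 1 = 2 * e - 1 by ring, ← neg_div_neg_eq, neg_neg, neg_sub]
  have e4 : ∀ f : ℝ → ℝ, ∫ x in Iio u, f x = ∫ y in Ioi (q - u), f (q - y) := by
    intro f
    rw [← integral_indicator measurableSet_Iio, ← integral_indicator measurableSet_Ioi,
      ← integral_sub_left_eq_self _ volume q]
    refine integral_congr_ae (Eventually.of_forall fun y => ?_)
    simp only [indicator_apply, mem_Iio, mem_Ioi]
    congr 1
    simp only [eq_iff_iff]
    constructor <;> intro <;> linarith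
  have i3 : IntegrableOn (fun y : ℝ => (pw e (r - (q - y)) - pw e (q - (q - y))) ^ 2)
      (Ioi (q - u)) := ((pw_int h1 h2 r q).1.comp_sub_left q).integrableOn
  rw [e4]
  calc _ ≤ ∫ y in Ioi (q - u), e ^ 2 * (r - q) ^ 2 * y ^ (2 * (e - 1)) := by
        refine setIntegral_mono_on i3 (i2.const_mul _) measurableSet_Ioi fun y hy => ?_
        have hy0 : 0 < y := lt_trans hqu hy
        rw [pw_pos (by linarith), pw_pos (by linarith), show r - (q - y) = y + (r - q) by ring,
          _root_.sub_sub_cancel]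
        have h3 := rpow_sub_le (e := e) (y := y) (z := y + (r - q)) (by linarith) hy0 (by linarith)
        rw [add_sub_cancel_left] at h3
        have h4 : y ^ (2 * (e - 1)) = (y ^ (e - 1)) ^ 2 := by
          rw [← Real.rpow_natCast, ← Real.rpow_mul hy0.le]; norm_num [mul_comm]
        calc _ = |(y + (r - q)) ^ e - y ^ e| ^ 2 := (sq_abs _).symm
          _ ≤ (|e| * y ^ (e - 1) * (r - q)) ^ 2 := by gcongr
          _ = _ := by rw [mul_pow, mul_pow, sq_abs, h4]; ring
    _ = _ := by rw [integral_const_mul, e3]; ring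

end

section



/-! ### Shift law and projection lemma -/

section iso
variable {E F : Type*} [NormedAddCommGroup E] [InnerProductSpace ℝ E] [CompleteSpace E]
  [NormedAddCommGroup F] [InnerProductSpace ℝ F] [CompleteSpace F]

lemma iso_lemma {ι : Type*} (b : ι → E) (k : ι → F)
    (hbk : ∀ i j, (inner ℝ (b i) (b j) : ℝ) = inner ℝ (k i) (k j)) (h : F) :
    ∃ X ∈ (Submodule.span ℝ (range b)).topologicalClosure,
      (∀ i, (inner ℝ X (b i) : ℝ) = inner ℝ h (k i)) ∧ ‖X‖ ≤ 2 * ‖h‖ := by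
  let V := WithLp 2 (E × F)
  let g : ι → V := fun i => WithLp.toLp 2 (b i, k i)
  let W : Submodule ℝ V := (Submodule.span ℝ (range g)).topologicalClosure
  haveI : CompleteSpace W := (Submodule.isClosed_topologicalClosure _).completeSpace_coe
  let y : V := WithLp.toLp 2 ((0 : E), (2 : ℝ) • h)
  let z := W.starProjection y
  have hgW : ∀ i, g i ∈ W := fun i =>
    Submodule.le_topologicalClosure _ (Submodule.subset_span ⟨i, rfl⟩)
  have hzW : z ∈ W := Submodule.starProjection_apply_mem _ _
  have cf : Continuous fun v : V => v.fst := by fun_prop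
  have cs : Continuous fun v : V => v.snd := by fun_prop
  have h1 : ∀ i, ∀ v ∈ W, (inner ℝ v.fst (b i) : ℝ) = inner ℝ v.snd (k i) := by
    intro i
    have hcl : IsClosed {v : V | (inner ℝ v.fst (b i) : ℝ) = inner ℝ v.snd (k i)} :=
      isClosed_eq (cf.inner continuous_const) (cs.inner continuous_const)
    have hsub : (Submodule.span ℝ (range g) : Set V) ⊆
        {v : V | (inner ℝ v.fst (b i) : ℝ) = inner ℝ v.snd (k i)} := by
      intro v hv
      refine Submodule.span_induction (p := fun v _ => (inner ℝ v.fst (b i) : ℝ) =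
        inner ℝ v.snd (k i)) ?_ ?_ ?_ ?_ hv
      · rintro _ ⟨j, rfl⟩
        exact hbk j i
      · simp
      · intro x y _ _ hx hy
        change inner ℝ (x.fst + y.fst) (b i) = inner ℝ (x.snd + y.snd) (k i)
        rw [inner_add_left, inner_add_left, hx, hy]
      · intro c x _ hx
        change inner ℝ (c • x.fst) (b i) = inner ℝ (c • x.snd) (k i)
        rw [inner_smul_left, inner_smul_left, hx]
    intro v hv
    have := closure_minimal hsub hcl
    exact this hv
  have h2 : ∀ v ∈ W, v.fst ∈ (Submodule.span ℝ (range b)).topologicalClosure := by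
    have hcl : IsClosed {v : V | v.fst ∈ (Submodule.span ℝ (range b)).topologicalClosure} :=
      (Submodule.isClosed_topologicalClosure _).preimage cf
    have hsub : (Submodule.span ℝ (range g) : Set V) ⊆
        {v : V | v.fst ∈ (Submodule.span ℝ (range b)).topologicalClosure} := by
      intro v hv
      refine Submodule.span_induction (p := fun v _ => v.fst ∈
        (Submodule.span ℝ (range b)).topologicalClosure) ?_ ?_ ?_ ?_ hv
      · rintro _ ⟨j, rfl⟩
        exact Submodule.le_topologicalClosure _ (Submodule.subset_span ⟨j, rfl⟩)
      · simp
      · intro x y _ _ hx hy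
        exact Submodule.add_mem _ hx hy
      · intro c x _ hx
        exact Submodule.smul_mem _ _ hx
    intro v hv
    exact closure_minimal hsub hcl hv
  refine ⟨z.fst, h2 z hzW, fun i => ?_, ?_⟩
  · have h3 := Submodule.starProjection_inner_eq_zero (K := W) y (g i) (hgW i)
    rw [inner_sub_left, WithLp.prod_inner_apply, WithLp.prod_inner_apply] at h3
    have h4 := h1 i z hzW
    have e1 : (inner ℝ y.fst (g i).fst : ℝ) = 0 := by simp [y]
    have e2 : (inner ℝ y.snd (g i).snd : ℝ) = 2 * inner ℝ h (k i) := by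
      simp [y, g, inner_smul_left]
    have e3 : (inner ℝ z.fst (g i).fst : ℝ) = inner ℝ z.fst (b i) := rfl
    have e4 : (inner ℝ z.snd (g i).snd : ℝ) = inner ℝ z.snd (k i) := rfl
    change inner ℝ y.fst (g i).fst + inner ℝ y.snd (g i).snd -
      (inner ℝ z.fst (g i).fst + inner ℝ z.snd (g i).snd) = 0 at h3
    rw [e1, e2, e3, e4] at h3
    linarith
  · have h5 : ‖z‖ ≤ ‖y‖ := Submodule.norm_starProjection_apply_le _ _
    have h6 := WithLp.prod_norm_sq_eq_of_L2 z
    have h7 := WithLp.prod_norm_sq_eq_of_L2 y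
    have e1 : ‖y.fst‖ = 0 := by simp [y]
    have e2 : ‖y.snd‖ = 2 * ‖h‖ := by simp [y, norm_smul]
    rw [e1, e2] at h7
    have h8 : ‖z‖ ^ 2 ≤ ‖y‖ ^ 2 := by gcongr
    refine le_of_sq_le_sq ?_ (by positivity)
    nlinarith [sq_nonneg ‖z.snd‖]

end iso

section kern
variable {Ω : Type*} [MeasurableSpace Ω] {P : Measure Ω} [IsProbabilityMeasure P]
variable {H : ℝ} {B : ℝ → Ω → ℝ}

lemma kL_memLp {e : ℝ} (h1 : -(1 / 2) < e) (h2 : e < 1 / 2) (c r s : ℝ) :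
    MemLp (fun x => c * (pw e (r - x) - pw e (s - x))) 2 volume := by
  rw [memLp_two_iff_integrable_sq (by fun_prop)]
  have := ((pw_int h1 h2 r s).1.const_mul (c ^ 2))
  refine this.congr (Eventually.of_forall fun x => ?_)
  simp only; ring

/-- kernel scaling -/
def kc (hB : IsFBM H P B) : ℝ := √(fa hB / pA (H - 1 / 2))

lemma kc_sq (hB : IsFBM H P B) (hH : H ∈ Ioo (0 : ℝ) (1 / 2)) :
    kc hB ^ 2 = fa hB / pA (H - 1 / 2) :=
  Real.sq_sqrt (div_nonneg (fa_pos hB).le (pA_pos (by linarith [hH.1]) (by linarith [hH.2])).le)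

lemma kc_pos (hB : IsFBM H P B) (hH : H ∈ Ioo (0 : ℝ) (1 / 2)) : 0 < kc hB :=
  Real.sqrt_pos.2 (div_pos (fa_pos hB) (pA_pos (by linarith [hH.1]) (by linarith [hH.2])))

/-- kernel function of the moving average representation -/
def kL (hB : IsFBM H P B) (hH : H ∈ Ioo (0 : ℝ) (1 / 2)) (r : ℝ) : Lp ℝ 2 (volume : Measure ℝ) :=
  (kL_memLp (e := H - 1 / 2) (by linarith [hH.1]) (by linarith [hH.2]) (kc hB) r 0).toLp

lemma kL_ae (hB : IsFBM H P B) (hH : H ∈ Ioo (0 : ℝ) (1 / 2)) (r : ℝ) :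
    kL hB hH r =ᵐ[volume] fun x => kc hB * (pw (H - 1 / 2) (r - x) - pw (H - 1 / 2) (0 - x)) :=
  MemLp.coeFn_toLp _

lemma kL_sub_ae (hB : IsFBM H P B) (hH : H ∈ Ioo (0 : ℝ) (1 / 2)) (r s : ℝ) :
    (kL hB hH r - kL hB hH s : Lp ℝ 2 (volume : Measure ℝ)) =ᵐ[volume]
      fun x => kc hB * (pw (H - 1 / 2) (r - x) - pw (H - 1 / 2) (s - x)) := by
  filter_upwards [Lp.coeFn_sub (kL hB hH r) (kL hB hH s), kL_ae hB hH r, kL_ae hB hH s]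
    with x h1 h2 h3
  rw [h1, Pi.sub_apply, h2, h3]; ring

lemma L2_norm_sq {f : ℝ → ℝ} {x : Lp ℝ 2 (volume : Measure ℝ)} (h : x =ᵐ[volume] f) :
    ‖x‖ ^ 2 = ∫ t, f t ^ 2 := by
  rw [← real_inner_self_eq_norm_sq, L2.inner_def]
  refine integral_congr_ae ?_
  filter_upwards [h] with t h
  simp [h, sq]

lemma L2_inner {f g : ℝ → ℝ} {x y : Lp ℝ 2 (volume : Measure ℝ)} (h : x =ᵐ[volume] f)
    (h' : y =ᵐ[volume] g) : (inner ℝ x y : ℝ) = ∫ t, f t * g t := by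
  rw [L2.inner_def]
  refine integral_congr_ae ?_
  filter_upwards [h, h'] with t h h'
  simp [h, h', mul_comm]

lemma kL_norm (hB : IsFBM H P B) (hH : H ∈ Ioo (0 : ℝ) (1 / 2)) (r s : ℝ) :
    ‖kL hB hH r - kL hB hH s‖ ^ 2 = ‖fL hB r - fL hB s‖ ^ 2 := by
  rw [L2_norm_sq (kL_sub_ae hB hH r s), fL_norm]
  simp_rw [mul_pow]
  rw [integral_const_mul, kc_sq hB hH, (pw_int (by linarith [hH.1]) (by linarith [hH.2]) r s).2]
  have := pA_pos (e := H - 1 / 2) (by linarith [hH.1]) (by linarith [hH.2])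
  have e : 2 * (H - 1 / 2) + 1 = 2 * H := by ring
  rw [e]
  generalize pA (H - 1 / 2) = z at this ⊢
  field_simp

lemma kL_zero (hB : IsFBM H P B) (hH : H ∈ Ioo (0 : ℝ) (1 / 2)) : kL hB hH 0 = 0 := by
  rw [← norm_eq_zero, ← sq_eq_zero_iff, L2_norm_sq (kL_ae hB hH 0)]
  simp

lemma inner_of_norms {E : Type*} [NormedAddCommGroup E] [InnerProductSpace ℝ E] (x y : E) :
    (inner ℝ x y : ℝ) = (‖x‖ ^ 2 + ‖y‖ ^ 2 - ‖x - y‖ ^ 2) / 2 := by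
  have := norm_sub_sq_real x y
  linarith

lemma kL_inner (hB : IsFBM H P B) (hH : H ∈ Ioo (0 : ℝ) (1 / 2)) (r s : ℝ) :
    (inner ℝ (fL hB r) (fL hB s) : ℝ) = inner ℝ (kL hB hH r) (kL hB hH s) := by
  rw [inner_of_norms, inner_of_norms (kL hB hH r), kL_norm]
  have h1 := kL_norm hB hH r 0
  have h2 := kL_norm hB hH s 0
  rw [kL_zero, fL_zero, sub_zero, sub_zero] at h1 h2
  rw [h1, h2]

end kern

end

section



section shift
variable {Ω : Type*} [MeasurableSpace Ω] {P : Measure Ω} [IsProbabilityMeasure P]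
variable {H : ℝ} {B : ℝ → Ω → ℝ}

/-- the ramp function going from `0` at `u` to `1` at `s` -/
def ramp (u s r : ℝ) : ℝ := (max (r - u) 0 - max (r - s) 0) / (s - u)

lemma ramp_le {u s r : ℝ} (hus : u < s) (h : r ≤ u) : ramp u s r = 0 := by
  rw [ramp, max_eq_right (by linarith), max_eq_right (by linarith)]; simp

lemma ramp_ge {u s r : ℝ} (hus : u < s) (h : s ≤ r) : ramp u s r = 1 := by
  rw [ramp, max_eq_left (by linarith), max_eq_left (by linarith)]
  have : s - u ≠ 0 := by linarith
  field_simp; ring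

lemma hs_memLp {e : ℝ} (h1 : -(1 / 2) < e) (h2 : e < 1 / 2) (u s : ℝ) :
    MemLp (fun x => pw e (x - u) - pw e (x - s)) 2 volume ∧
    ∫ x, (pw e (x - u) - pw e (x - s)) ^ 2 = pA e * |s - u| ^ (2 * e + 1) := by
  have hh := pw_int h1 h2 (-u) (-s)
  have hi := hh.1.comp_neg
  constructor
  · rw [memLp_two_iff_integrable_sq (by fun_prop)]
    refine hi.congr (Eventually.of_forall fun x => ?_)
    simp only
    ring_nf
  · have e2 : -u - -s = s - u := by ring
    rw [← e2, ← hh.2, ← integral_neg_eq_self]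
    congr 1
    funext x
    ring_nf

lemma shift_X (hB : IsFBM H P B) (hH : H ∈ Ioo (0 : ℝ) (1 / 2)) {u s : ℝ} (hu : 0 ≤ u)
    (hus : u < s) : ∃ X ∈ fG hB, (∀ r, (inner ℝ X (fL hB r) : ℝ) =
      kc hB * pB (1 / 2 - H) * (s - u) * ramp u s r) ∧
      ‖X‖ ^ 2 ≤ 4 * (pA (1 / 2 - H) * (s - u) ^ (2 - 2 * H)) := by
  have hm := hs_memLp (e := 1 / 2 - H) (by linarith [hH.2]) (by linarith [hH.1]) u s
  obtain ⟨X, hX, h1, h2⟩ := iso_lemma (fL hB) (kL hB hH) (fun i j => kL_inner hB hH i j) hm.1.toLp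
  refine ⟨X, hX, fun r => ?_, ?_⟩
  · rw [h1, L2_inner hm.1.coeFn_toLp (kL_ae hB hH r)]
    have e : H - 1 / 2 = -(1 / 2 - H) := by ring
    rw [e]
    have p := fun a b => pB_scale (e := 1 / 2 - H) (by linarith [hH.2]) (by linarith [hH.1]) a b
    have : ∀ x, (pw (1 / 2 - H) (x - u) - pw (1 / 2 - H) (x - s)) *
        (kc hB * (pw (-(1 / 2 - H)) (r - x) - pw (-(1 / 2 - H)) (0 - x))) =
        kc hB * ((pw (1 / 2 - H) (x - u) * pw (-(1 / 2 - H)) (r - x) -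
          pw (1 / 2 - H) (x - u) * pw (-(1 / 2 - H)) (0 - x)) -
          (pw (1 / 2 - H) (x - s) * pw (-(1 / 2 - H)) (r - x) -
          pw (1 / 2 - H) (x - s) * pw (-(1 / 2 - H)) (0 - x))) := by
      intro x; ring
    simp_rw [this]
    rw [integral_const_mul]
    refine (congrArg (kc hB * ·) (integral_sub ((p u r).1.sub (p u 0).1)
      ((p s r).1.sub (p s 0).1))).trans ?_
    simp only [Pi.sub_apply]
    rw [integral_sub (p u r).1 (p u 0).1, integral_sub (p s r).1 (p s 0).1, (p u r).2, (p u 0).2,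
      (p s r).2, (p s 0).2, max_eq_right (a := 0 - u) (by linarith),
      max_eq_right (a := 0 - s) (by linarith), ramp]
    have : s - u ≠ 0 := by linarith
    field_simp
    ring
  · have h3 := hm.2
    have hsu : |s - u| = s - u := abs_of_pos (by linarith)
    rw [← L2_norm_sq hm.1.coeFn_toLp] at h3
    simp only [hsu] at h3
    have e : 2 * (1 / 2 - H) + 1 = 2 - 2 * H := by ring
    rw [← e, ← h3]
    nlinarith [norm_nonneg X]

/-- constant of the shift law -/
def shc (hB : IsFBM H P B) : ℝ := (kc hB * pB (1 / 2 - H)) ^ 2 / (4 * pA (1 / 2 - H))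

lemma shc_pos (hB : IsFBM H P B) (hH : H ∈ Ioo (0 : ℝ) (1 / 2)) : 0 < shc hB := by
  have := kc_pos hB hH
  have := pB_pos (e := 1 / 2 - H) (by linarith [hH.2]) (by linarith [hH.1])
  have := pA_pos (e := 1 / 2 - H) (by linarith [hH.2]) (by linarith [hH.1])
  unfold shc
  positivity

lemma shift_law (hB : IsFBM H P B) (hH : H ∈ Ioo (0 : ℝ) (1 / 2)) {u s : ℝ} (hu : 0 ≤ u)
    (hus : u < s) : ∃ (R : ℝ → Ω → ℝ) (v : ℝ≥0), (∀ r, Measurable (R r)) ∧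
      shc hB * (s - u) ^ (2 * H) ≤ v ∧
      P.map (fun ω r => B r ω) =
        (P.prod (gaussianReal 0 v)).map (fun z r => R r z.1 + ramp u s r * z.2) := by
  obtain ⟨X, hX, h1, h2⟩ := shift_X hB hH hu hus
  have hkc := kc_pos hB hH
  have hpB := pB_pos (e := 1 / 2 - H) (by linarith [hH.2]) (by linarith [hH.1])
  have hpA := pA_pos (e := 1 / 2 - H) (by linarith [hH.2]) (by linarith [hH.1])
  have hsu : 0 < s - u := by linarith
  set c1 := kc hB * pB (1 / 2 - H) with hc1
  have hc1p : 0 < c1 := by positivity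
  have hX0 : 0 < ‖X‖ := by
    rw [norm_pos_iff]
    rintro rfl
    have := h1 s
    rw [ramp_ge hus le_rfl, inner_zero_left] at this
    have : 0 < c1 * (s - u) * 1 := by positivity
    linarith
  set α := c1 * (s - u) / ‖X‖ ^ 2 with hα
  set x : Lp ℝ 2 P := α • X with hx
  have hxG : x ∈ fG hB := Submodule.smul_mem _ _ hX
  let R : ℝ → Ω → ℝ := fun r ω => B r ω - ramp u s r * x ω
  have mx : Measurable (x : Ω → ℝ) := (Lp.stronglyMeasurable x).measurable
  have mR : ∀ r, Measurable (R r) := fun r => (fbm_meas hB r).sub (mx.const_mul _)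
  refine ⟨R, ‖x‖₊ ^ 2, mR, ?_, ?_⟩
  · have e1 : ((‖x‖₊ ^ 2 : ℝ≥0) : ℝ) = c1 ^ 2 * (s - u) ^ 2 / ‖X‖ ^ 2 := by
      push_cast
      rw [hx, norm_smul, mul_pow, Real.norm_eq_abs, sq_abs, hα]
      field_simp
    rw [e1, shc, ← hc1, le_div_iff₀ (by positivity), div_mul_eq_mul_div, div_mul_eq_mul_div,
      div_le_iff₀ (by positivity)]
    have e2 : (s - u) ^ (2 * H) * (s - u) ^ (2 - 2 * H) = (s - u) ^ 2 := by
      rw [← Real.rpow_add hsu, ← Real.rpow_natCast]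
      congr 1; push_cast; ring
    calc c1 ^ 2 * (s - u) ^ (2 * H) * ‖X‖ ^ 2
        ≤ c1 ^ 2 * (s - u) ^ (2 * H) * (4 * (pA (1 / 2 - H) * (s - u) ^ (2 - 2 * H))) := by gcongr
      _ = c1 ^ 2 * (4 * pA (1 / 2 - H)) * ((s - u) ^ (2 * H) * (s - u) ^ (2 - 2 * H)) := by ring
      _ = _ := by rw [e2]; ring
  · have hind : IndepFun (fun ω r => R r ω) (fun ω (_ : Unit) => x ω) P := by
      refine GS_indep (fG_GS hB) (X := R) (Y := fun _ => x) (x := fun r => fL hB r - ramp u s r • x)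
        (y := fun _ => x) (fun r => (mR r).aemeasurable) (fun _ => mx.aemeasurable) ?_ (fun _ => hxG) ?_ (fun _ => ae_eq_refl _) ?_
      · intro r
        exact Submodule.sub_mem _ (fL_mem hB r) (Submodule.smul_mem _ _ hxG)
      · intro r
        exact ae_sub (fL_ae hB r) (ae_smul (ae_eq_refl _) _)
      · intro r _
        rw [inner_sub_left, inner_smul_left, hx, inner_smul_right, inner_smul_left,
          inner_smul_right, real_inner_comm, h1, real_inner_self_eq_norm_sq, hα]
        simp only [conj_trivial]
        field_simp
        ring
    have hind2 : IndepFun (fun ω r => R r ω) (x : Ω → ℝ) P := by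
      exact hind.comp (φ := id) (ψ := fun g : Unit → ℝ => g ()) measurable_id (by fun_prop)
    have hR : Measurable fun ω r => R r ω := measurable_pi_lambda _ mR
    rw [indepFun_iff_map_prod_eq_prod_map_map hR.aemeasurable mx.aemeasurable] at hind2
    have hg := fG_GS hB x hxG
    rw [hg] at hind2
    have hT : Measurable fun (z : (ℝ → ℝ) × ℝ) r => z.1 r + ramp u s r * z.2 := by
      refine measurable_pi_lambda _ fun r => ?_
      exact ((measurable_pi_apply r).comp measurable_fst).add (measurable_snd.const_mul _)
    have e3 : (fun ω r => B r ω) = (fun (z : (ℝ → ℝ) × ℝ) r => z.1 r + ramp u s r * z.2) ∘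
        (fun ω => ((fun r => R r ω), x ω)) := by
      funext ω r
      simp [R]
    have e4 : (fun (z : Ω × ℝ) r => R r z.1 + ramp u s r * z.2) =
        (fun (z : (ℝ → ℝ) × ℝ) r => z.1 r + ramp u s r * z.2) ∘
          (Prod.map (fun ω r => R r ω) id) := by
      funext ω r
      simp
    rw [e3, ← Measure.map_map hT (hR.prodMk mx), hind2, e4,
      ← Measure.map_map hT (hR.prodMap measurable_id), ← Measure.map_prod_map _ _ hR measurable_id,
      Measure.map_id]

end shift

section gauss

lemma gaussPDF_le {v : ℝ≥0} (hv : v ≠ 0) (y : ℝ) : gaussianPDFReal 0 v y ≤ (v : ℝ) ^ (-(1 / 2) : ℝ) := by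
  have hv0 : (0 : ℝ) < v := by positivity
  rw [gaussianPDFReal, Real.rpow_neg hv0.le, ← Real.sqrt_eq_rpow]
  have h1 : Real.exp (-(y - 0) ^ 2 / (2 * v)) ≤ 1 := by
    rw [Real.exp_le_one_iff]
    apply div_nonpos_of_nonpos_of_nonneg <;> nlinarith [sq_nonneg (y - 0)]
  have h2 : √(v : ℝ) ≤ √(2 * Real.pi * v) := by
    apply Real.sqrt_le_sqrt
    nlinarith [Real.pi_gt_three]
  have h3 : (√(2 * Real.pi * v))⁻¹ ≤ (√(v : ℝ))⁻¹ := by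
    gcongr
  calc _ ≤ (√(2 * Real.pi * v))⁻¹ * 1 := by gcongr
    _ ≤ _ := by rw [mul_one]; exact h3

lemma gaussPDF_lip {v : ℝ≥0} (hv : v ≠ 0) (y z : ℝ) :
    |gaussianPDFReal 0 v y - gaussianPDFReal 0 v z| ≤ |y - z| / v := by
  have hv0 : (0 : ℝ) < v := by positivity
  have hd : ∀ x : ℝ, HasDerivAt (fun x => gaussianPDFReal 0 v x)
      ((√(2 * Real.pi * v))⁻¹ * (Real.exp (-(x - 0) ^ 2 / (2 * v)) * (-(2 * (x - 0)) / (2 * v)))) x := by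
    intro x
    unfold gaussianPDFReal
    have h1 : HasDerivAt (fun x : ℝ => -(x - 0) ^ 2 / (2 * (v : ℝ))) (-(2 * (x - 0)) / (2 * v)) x := by
      have := ((((hasDerivAt_id x).sub_const 0).pow 2).neg).div_const (2 * (v : ℝ))
      simpa using this
    exact (h1.exp).const_mul _
  have hb : ∀ x : ℝ, ‖(√(2 * Real.pi * v))⁻¹ * (Real.exp (-(x - 0) ^ 2 / (2 * v)) *
      (-(2 * (x - 0)) / (2 * v)))‖ ≤ 1 / v := by
    intro x
    have hs : 0 < √(2 * Real.pi * v) := Real.sqrt_pos.2 (by positivity)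
    have h3 : |x| ≤ √(2 * Real.pi * v) * Real.exp (x ^ 2 / (2 * v)) := by
      have e1 : x ^ 2 / (2 * v) + 1 ≤ Real.exp (x ^ 2 / (2 * v)) := Real.add_one_le_exp _
      have e2 : √(v : ℝ) * 2 ≤ √(2 * Real.pi * v) := by
        rw [show (2 : ℝ) = √4 by rw [show (4 : ℝ) = 2 ^ 2 by norm_num]; simp,
          ← Real.sqrt_mul hv0.le]
        apply Real.sqrt_le_sqrt
        rw [show √4 = (2 : ℝ) by rw [show (4 : ℝ) = 2 ^ 2 by norm_num]; simp]
        nlinarith [Real.pi_gt_three]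
      have hsv : 0 < √(v : ℝ) := Real.sqrt_pos.2 hv0
      have e4 : |x| ≤ √(v : ℝ) * 2 * (x ^ 2 / (2 * v) + 1) := by
        have hq : √(v : ℝ) ^ 2 = v := Real.sq_sqrt hv0.le
        generalize √(v : ℝ) = w at hq hsv
        rw [← hq]
        have e5 : w * 2 * (x ^ 2 / (2 * w ^ 2) + 1) = (x ^ 2 + 2 * w ^ 2) / w := by
          field_simp
        rw [e5, le_div_iff₀ hsv, ← sq_abs x]
        nlinarith [sq_nonneg (|x| - w), abs_nonneg x, sq_nonneg |x|]
      calc |x| ≤ _ := e4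
        _ ≤ √(2 * Real.pi * v) * Real.exp (x ^ 2 / (2 * v)) := by gcongr
    have h4 : Real.exp (-(x - 0) ^ 2 / (2 * v)) = (Real.exp (x ^ 2 / (2 * v)))⁻¹ := by
      rw [← Real.exp_neg]; congr 1; ring
    rw [h4, norm_mul, norm_mul, Real.norm_eq_abs, Real.norm_eq_abs, Real.norm_eq_abs, abs_inv, abs_inv,
      abs_of_pos hs, abs_of_pos (Real.exp_pos _), abs_div, abs_neg, abs_mul, abs_of_pos (by positivity : (0:ℝ) < 2 * v),
      abs_two, sub_zero]
    have hE := Real.exp_pos (x ^ 2 / (2 * v))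
    generalize Real.exp (x ^ 2 / (2 * v)) = E at *
    rw [show (√(2 * Real.pi * v))⁻¹ * (E⁻¹ * (2 * |x| / (2 * (v : ℝ)))) =
      (|x| / (√(2 * Real.pi * v) * E)) * (1 / v) by field_simp]
    have : |x| / (√(2 * Real.pi * v) * E) ≤ 1 := by
      rw [div_le_one (by positivity)]; exact h3
    calc _ ≤ 1 * (1 / (v : ℝ)) := by gcongr
      _ = _ := one_mul _
  have := Convex.norm_image_sub_le_of_norm_hasDerivWithin_le (s := univ) (f := fun x => gaussianPDFReal 0 v x)
    (C := 1 / v) (fun x _ => (hd x).hasDerivWithinAt) (fun x _ => hb x) convex_univ (mem_univ z) (mem_univ y)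
  rw [Real.norm_eq_abs, Real.norm_eq_abs] at this
  calc _ ≤ _ := this
    _ = _ := by ring

end gauss

end

section



section proj
variable {Ω : Type*} [MeasurableSpace Ω] {P : Measure Ω} [IsProbabilityMeasure P]
variable {H : ℝ} {B : ℝ → Ω → ℝ}

/-- the past Gaussian space -/
def fK (hB : IsFBM H P B) (u : ℝ) : Submodule ℝ (Lp ℝ 2 P) :=
  (Submodule.span ℝ (range fun p : Icc (0 : ℝ) u => fL hB p)).topologicalClosure

instance fK_complete (hB : IsFBM H P B) (u : ℝ) : CompleteSpace (fK hB u) :=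
  (Submodule.isClosed_topologicalClosure _).completeSpace_coe

lemma fK_le (hB : IsFBM H P B) (u : ℝ) : fK hB u ≤ fG hB := by
  refine Submodule.topologicalClosure_mono (Submodule.span_mono ?_)
  rintro _ ⟨p, rfl⟩
  exact ⟨p, rfl⟩

lemma fL_mem_fK (hB : IsFBM H P B) {u p : ℝ} (hp : p ∈ Icc 0 u) : fL hB p ∈ fK hB u :=
  Submodule.le_topologicalClosure _ (Submodule.subset_span ⟨⟨p, hp⟩, rfl⟩)

lemma orth_fK (hB : IsFBM H P B) {u : ℝ} {z : Lp ℝ 2 P}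
    (h : ∀ p ∈ Icc 0 u, (inner ℝ z (fL hB p) : ℝ) = 0) : ∀ y ∈ fK hB u, (inner ℝ z y : ℝ) = 0 := by
  have hcl : IsClosed {v : Lp ℝ 2 P | (inner ℝ z v : ℝ) = 0} :=
    isClosed_eq (continuous_const.inner continuous_id) continuous_const
  have hsub : (Submodule.span ℝ (range fun p : Icc (0 : ℝ) u => fL hB p) : Set (Lp ℝ 2 P)) ⊆
      {v : Lp ℝ 2 P | (inner ℝ z v : ℝ) = 0} := by
    intro v hv
    refine Submodule.span_induction (p := fun v _ => (inner ℝ z v : ℝ) = 0) ?_ ?_ ?_ ?_ hv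
    · rintro _ ⟨⟨p, hp⟩, rfl⟩
      exact h p hp
    · simp
    · intro x y _ _ hx hy
      rw [inner_add_right, hx, hy, add_zero]
    · intro c x _ hx
      rw [inner_smul_right, hx, mul_zero]
  intro y hy
  exact closure_minimal hsub hcl hy

/-- constant in the projection bound -/
def pjc (hB : IsFBM H P B) : ℝ := 2 * (kc hB * √((H - 1 / 2) ^ 2 / (1 - 2 * (H - 1 / 2))))

lemma pjc_nonneg (hB : IsFBM H P B) : 0 ≤ pjc hB := by
  unfold pjc kc; positivity

lemma proj_norm (hB : IsFBM H P B) (hH : H ∈ Ioo (0 : ℝ) (1 / 2)) {u s q r : ℝ}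
    (hus : u < s) (hsq : s ≤ q) (hqr : q ≤ r) :
    ‖(fK hB u).starProjection (fL hB r - fL hB q)‖ ≤ pjc hB * ((r - q) * (s - u) ^ (H - 1)) := by
  have he1 : -(1 / 2) < H - 1 / 2 := by linarith [hH.1]
  have he2 : H - 1 / 2 < 1 / 2 := by linarith [hH.2]
  let f : ℝ → ℝ := fun x => kc hB * (pw (H - 1 / 2) (r - x) - pw (H - 1 / 2) (q - x))
  have hf : MemLp f 2 volume := kL_memLp he1 he2 (kc hB) r q
  have hh : MemLp ((Iio u).indicator f) 2 volume := hf.indicator measurableSet_Iio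
  obtain ⟨X, hX, h1, h2⟩ := iso_lemma (fun p : Icc (0 : ℝ) u => fL hB p)
    (fun p : Icc (0 : ℝ) u => kL hB hH p) (fun i j => kL_inner hB hH i j) hh.toLp
  have h3 : X = (fK hB u).starProjection (fL hB r - fL hB q) := by
    refine (Submodule.eq_starProjection_of_mem_of_inner_eq_zero hX ?_).symm
    refine orth_fK hB fun p hp => ?_
    rw [inner_sub_left, h1 ⟨p, hp⟩, sub_eq_zero, L2_inner hh.coeFn_toLp (kL_ae hB hH p), inner_sub_left,
      kL_inner hB hH, kL_inner hB hH, ← inner_sub_left,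
      L2_inner (kL_sub_ae hB hH r q) (kL_ae hB hH p)]
    congr 1
    funext x
    by_cases hx : x < u
    · rw [indicator_of_mem (show x ∈ Iio u from hx)]
    · push Not at hx
      rw [pw_neg (x := p - x) (by linarith [hp.2]), pw_neg (x := 0 - x) (by linarith [hp.1, hp.2])]
      simp
  have h4 : ‖hh.toLp‖ ^ 2 ≤ (kc hB * √((H - 1 / 2) ^ 2 / (1 - 2 * (H - 1 / 2))) *
      ((r - q) * (s - u) ^ (H - 1))) ^ 2 := by
    rw [L2_norm_sq hh.coeFn_toLp]
    have e1 : ∀ x, (Iio u).indicator f x ^ 2 = (Iio u).indicator (fun x => kc hB ^ 2 *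
        (pw (H - 1 / 2) (r - x) - pw (H - 1 / 2) (q - x)) ^ 2) x := by
      intro x
      by_cases hx : x ∈ Iio u
      · rw [indicator_of_mem hx, indicator_of_mem hx, mul_pow]
      · rw [indicator_of_notMem hx, indicator_of_notMem hx]; simp
    simp_rw [e1]
    rw [integral_indicator measurableSet_Iio, integral_const_mul]
    have h5 := pw_tail he1 he2 (u := u) (q := q) (r := r) (by linarith) hqr
    have h6 : (q - u) ^ (2 * (H - 1 / 2) - 1) ≤ ((s - u) ^ (H - 1)) ^ 2 := by
      rw [← Real.rpow_natCast, ← Real.rpow_mul (by linarith)]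
      have e : (H - 1) * ((2 : ℕ) : ℝ) = 2 * (H - 1 / 2) - 1 := by push_cast; ring
      rw [e]
      exact Real.rpow_le_rpow_of_nonpos (by linarith) (by linarith) (by linarith [hH.2])
    have h7 : 0 ≤ (H - 1 / 2) ^ 2 / (1 - 2 * (H - 1 / 2)) :=
      div_nonneg (sq_nonneg _) (by linarith)
    rw [mul_pow, mul_pow, Real.sq_sqrt h7, mul_pow, mul_assoc]
    gcongr
    refine h5.trans ?_
    rw [mul_assoc]
    gcongr
  have h8 := le_of_sq_le_sq h4 (by
    have := kc_pos hB hH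
    have : 0 ≤ r - q := by linarith
    have : 0 < s - u := by linarith
    positivity)
  rw [← h3, pjc]
  calc ‖X‖ ≤ _ := h2
    _ ≤ 2 * (kc hB * √((H - 1 / 2) ^ 2 / (1 - 2 * (H - 1 / 2))) *
      ((r - q) * (s - u) ^ (H - 1))) := by gcongr
    _ = _ := by ring

lemma ae_add {X Y : Ω → ℝ} {x y : Lp ℝ 2 P} (hX : X =ᵐ[P] x) (hY : Y =ᵐ[P] y) :
    (fun ω => X ω + Y ω) =ᵐ[P] (x + y : Lp ℝ 2 P) := by
  filter_upwards [hX, hY, Lp.coeFn_add x y] with ω h1 h2 h3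
  rw [h3, h1, h2, Pi.add_apply]

lemma proj_lemma (hB : IsFBM H P B) (hH : H ∈ Ioo (0 : ℝ) (1 / 2)) {u s : ℝ} (hu : 0 ≤ u)
    (hus : u < s) : ∃ Y : ℝ → Ω → ℝ, (∀ r, Measurable (Y r)) ∧ (∀ ω, Y s ω = 0) ∧
      IndepFun (fun ω => ((fun r : ℝ => B (max 0 (min r u)) ω), (fun r => Y r ω)))
        (fun ω r => B r ω - B s ω - Y r ω) P ∧
      ∀ q r, s ≤ q → q ≤ r → ∀ p : ℕ, ∫⁻ ω, ENNReal.ofReal |Y r ω - Y q ω| ^ p ∂P ≤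
        ENNReal.ofReal (pjc hB * ((r - q) * (s - u) ^ (H - 1))) ^ p * gm p := by
  let π := (fK hB u).starProjection
  let g : ℝ → Ω → ℝ := fun r => (π (fL hB r) : Lp ℝ 2 P)
  have mg : ∀ r, Measurable (g r) := fun r => (Lp.stronglyMeasurable _).measurable
  let Y : ℝ → Ω → ℝ := fun r ω => g r ω - g s ω
  have mY : ∀ r, Measurable (Y r) := fun r => (mg r).sub (mg s)
  have hY : ∀ r, Y r =ᵐ[P] (π (fL hB r) - π (fL hB s) : Lp ℝ 2 P) := fun r =>
    ae_sub (ae_eq_refl _) (ae_eq_refl _)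
  have hπ : ∀ x, π x ∈ fK hB u := fun x => Submodule.starProjection_apply_mem _ _
  have hYK : ∀ r, π (fL hB r) - π (fL hB s) ∈ fK hB u := fun r =>
    Submodule.sub_mem _ (hπ _) (hπ _)
  have hcl : ∀ r : ℝ, max 0 (min r u) ∈ Icc 0 u := fun r =>
    ⟨le_max_left _ _, max_le hu (min_le_right _ _)⟩
  refine ⟨Y, mY, fun ω => sub_self _, ?_, ?_⟩
  · let XX : ℝ ⊕ ℝ → Ω → ℝ := Sum.elim (fun r => B (max 0 (min r u))) Y
    let xx : ℝ ⊕ ℝ → Lp ℝ 2 P := Sum.elim (fun r => fL hB (max 0 (min r u)))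
      (fun r => π (fL hB r) - π (fL hB s))
    have hxx : ∀ t, xx t ∈ fK hB u := by
      rintro (r | r)
      · exact fL_mem_fK hB (hcl r)
      · exact hYK r
    have h1 : IndepFun (fun ω t => XX t ω) (fun ω r => B r ω - B s ω - Y r ω) P := by
      refine GS_indep (fG_GS hB) (X := XX) (x := xx) (Y := fun r ω => B r ω - B s ω - Y r ω)
        (y := fun r => fL hB r - fL hB s - (π (fL hB r) - π (fL hB s))) ?_ ?_ ?_ ?_ ?_ ?_ ?_
      · rintro (r | r)
        · exact (fbm_meas hB _).aemeasurable
        · exact (mY r).aemeasurable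
      · intro r
        exact (((fbm_meas hB _).sub (fbm_meas hB _)).sub (mY r)).aemeasurable
      · exact fun t => fK_le hB u (hxx t)
      · exact fun r => Submodule.sub_mem _ (Submodule.sub_mem _ (fL_mem hB _) (fL_mem hB _))
          (fK_le hB u (hYK r))
      · rintro (r | r)
        · exact fL_ae hB _
        · exact hY r
      · exact fun r => ae_sub (ae_sub (fL_ae hB _) (fL_ae hB _)) (hY r)
      · intro t r
        rw [← map_sub, real_inner_comm]
        exact Submodule.starProjection_inner_eq_zero _ _ (hxx t)
    refine h1.comp (φ := fun f : ℝ ⊕ ℝ → ℝ => ((fun r => f (Sum.inl r)), (fun r => f (Sum.inr r))))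
      (ψ := id) ?_ measurable_id
    exact (measurable_pi_lambda _ fun r => measurable_pi_apply _).prodMk
      (measurable_pi_lambda _ fun r => measurable_pi_apply _)
  · intro q r hq hr p
    have h1 := GS_moment (fG_GS hB) (X := fun ω => Y r ω - Y q ω)
      (Submodule.sub_mem _ (fK_le hB u (hYK r)) (fK_le hB u (hYK q))) (ae_sub (hY r) (hY q)) p
    rw [h1, _root_.sub_sub_sub_cancel_right, ← map_sub]
    gcongr
    exact proj_norm hB hH hus hq hr

end proj

end

section



/-! ### Blocks -/

lemma lintegral_affine {f : ℝ → ℝ≥0∞} {c d : ℝ} (hc : 0 < c) :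
    ∫⁻ x, f (c * (x - d)) = ENNReal.ofReal c⁻¹ * ∫⁻ y, f y := by
  rw [lintegral_sub_right_eq_self (μ := volume) (fun x => f (c * x)) d]
  have h := (Homeomorph.mulLeft₀ c hc.ne').measurableEmbedding.lintegral_map (μ := volume) f
  have h2 : (volume : Measure ℝ).map (Homeomorph.mulLeft₀ c hc.ne') = ENNReal.ofReal c⁻¹ • volume := by
    have := Real.map_volume_mul_left hc.ne'
    rw [abs_of_pos (inv_pos.2 hc)] at this
    exact this
  rw [h2, lintegral_smul_measure] at h
  simpa using h.symm

lemma kap_affine {D : Set ℝ} {ε a b c d : ℝ} {w : ℝ → ℝ} (ha : 0 < a) (hc : 0 < c) :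
    kap ((fun r => a * r + b) '' D) ε w =
      ENNReal.ofReal c⁻¹ * kap D (c * ε) (fun r => c * (w (a * r + b) - d)) := by
  unfold kap
  rw [← lintegral_affine (d := d) hc]
  refine lintegral_congr fun x => ?_
  rw [Up_affine (d := d) ha hc]
  congr 1
  ring

/-- translated dyadic block -/
def blkD (N i : ℕ) : Set ℝ := (fun r : ℝ => (N : ℝ)⁻¹ * r + i / N) '' dya

/-- the grid -/
def gridD (N : ℕ) : Set ℝ := ⋃ i < N, blkD N i

/-- rescaled path on a block -/
def blk (H : ℝ) (N i : ℕ) (w : ℝ → ℝ) (r : ℝ) : ℝ :=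
  (N : ℝ) ^ H * (w ((N : ℝ)⁻¹ * r + i / N) - w (i / N))

section blkD
variable {N : ℕ}

lemma blkD_sub (hN : 0 < N) (i : ℕ) : blkD N i ⊆ Icc ((i : ℝ) / N) (((i + 1 : ℕ) : ℝ) / N) := by
  rintro _ ⟨r, hr, rfl⟩
  have h := dya_sub hr
  have hN' : (0 : ℝ) < N := by exact_mod_cast hN
  constructor
  · have : 0 ≤ (N : ℝ)⁻¹ * r := by have := h.1; positivity
    simp only; linarith
  · have : (N : ℝ)⁻¹ * r ≤ (N : ℝ)⁻¹ * 1 := by gcongr; exact h.2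
    have e : ((i + 1 : ℕ) : ℝ) / N = (N : ℝ)⁻¹ * 1 + i / N := by push_cast; field_simp; ring
    rw [e]; simp only; linarith

lemma blkD_left (N i : ℕ) : (i : ℝ) / N ∈ blkD N i := ⟨0, zero_mem_dya, by simp⟩

lemma blkD_right (hN : 0 < N) (i : ℕ) : ((i + 1 : ℕ) : ℝ) / N ∈ blkD N i :=
  ⟨1, one_mem_dya, by
    have hN' : (0 : ℝ) < N := by exact_mod_cast hN
    push_cast; field_simp; ring⟩

lemma blkD_countable (N i : ℕ) : (blkD N i).Countable := dya_countable.image _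

lemma gridD_countable (N : ℕ) : (gridD N).Countable :=
  countable_iUnion fun i => countable_iUnion fun _ => blkD_countable N i

lemma gridD_sub (hN : 0 < N) : gridD N ⊆ Icc 0 1 := by
  intro x hx
  simp only [gridD, mem_iUnion] at hx
  obtain ⟨i, hi, hx⟩ := hx
  have h := blkD_sub hN i hx
  have hN' : (0 : ℝ) < N := by exact_mod_cast hN
  refine ⟨le_trans (by positivity) h.1, h.2.trans ?_⟩
  rw [div_le_one hN']
  exact_mod_cast hi

lemma gridD_dense (hN : 0 < N) : Icc (0 : ℝ) 1 ⊆ closure (gridD N) := by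
  intro x hx
  have hN' : (0 : ℝ) < N := by exact_mod_cast hN
  have key : ∃ i < N, (i : ℝ) ≤ N * x ∧ N * x ≤ i + 1 := by
    rcases lt_or_ge (N * x) N with h | h
    · refine ⟨⌊N * x⌋₊, ?_, Nat.floor_le (by have := hx.1; positivity), (Nat.lt_floor_add_one _).le⟩
      rw [Nat.floor_lt (by have := hx.1; positivity)]; exact h
    · have hx1 : x = 1 := le_antisymm hx.2 (by nlinarith)
      refine ⟨N - 1, by omega, ?_, ?_⟩
      · rw [hx1]; push_cast [Nat.cast_sub hN]; linarith
      · rw [hx1]; push_cast [Nat.cast_sub hN]; linarith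
  obtain ⟨i, hi, h1, h2⟩ := key
  have hcont : Continuous fun r : ℝ => (N : ℝ)⁻¹ * r + i / N := by fun_prop
  have h3 : N * x - i ∈ closure dya := dya_dense ⟨by linarith, by linarith⟩
  have h4 := image_closure_subset_closure_image hcont (mem_image_of_mem _ h3)
  have e : (N : ℝ)⁻¹ * (N * x - i) + i / N = x := by field_simp; ring
  simp only [e] at h4
  refine closure_mono ?_ h4
  exact subset_iUnion₂_of_subset i hi subset_rfl

lemma Up_grid (hN : 0 < N) (α β : ℝ) (w : ℝ → ℝ) :
    ∑ i ∈ Finset.range N, Up (blkD N i) α β w ≤ Up (gridD N) α β w ∧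
    Up (gridD N) α β w ≤ ∑ i ∈ Finset.range N, Up (blkD N i) α β w +
      ∑ i ∈ Finset.range N, (Ioo α β).indicator 1 (w ((i : ℝ) / N)) :=
  Up_blocks (s := fun i => (i : ℝ) / N) (blkD_sub hN) (blkD_left N) (blkD_right hN) N

lemma kap_blk {H : ℝ} (hN : 0 < N) (i : ℕ) (ε : ℝ) (w : ℝ → ℝ) :
    kap (blkD N i) ε w = ENNReal.ofReal ((N : ℝ) ^ H)⁻¹ * kap dya ((N : ℝ) ^ H * ε) (blk H N i w) := by
  have hN' : (0 : ℝ) < N := by exact_mod_cast hN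
  exact kap_affine (inv_pos.2 hN') (by positivity)

lemma measurable_Up_lev {D : Set ℝ} (hD : D.Countable) (ε : ℝ) (w : ℝ → ℝ) :
    Measurable fun x => Up D x (x + ε) w :=
  measurable_Up (Z := ℝ) (W := fun _ => w) hD measurable_id (measurable_id.add_const _)
    (fun _ _ => measurable_const)

lemma lint_ind (ε y : ℝ) (hε : 0 ≤ ε) :
    ∫⁻ x : ℝ, (Ioo x (x + ε)).indicator (1 : ℝ → ℝ≥0∞) y = ENNReal.ofReal ε := by
  have : ∀ x : ℝ, (Ioo x (x + ε)).indicator (1 : ℝ → ℝ≥0∞) y = (Ioo (y - ε) y).indicator 1 x := by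
    intro x
    by_cases h : y ∈ Ioo x (x + ε)
    · rw [indicator_of_mem h, indicator_of_mem (show x ∈ Ioo (y - ε) y from ⟨by linarith [h.2], h.1⟩)]; rfl
    · rw [indicator_of_notMem h, indicator_of_notMem]
      exact fun h' => h ⟨h'.2, by linarith [h'.1]⟩
  simp_rw [this]
  rw [lintegral_indicator_one measurableSet_Ioo, Real.volume_Ioo]
  congr 1; ring

lemma kap_grid (hN : 0 < N) {ε : ℝ} (hε : 0 ≤ ε) (w : ℝ → ℝ) :
    ∑ i ∈ Finset.range N, kap (blkD N i) ε w ≤ kap (gridD N) ε w ∧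
    kap (gridD N) ε w ≤ ∑ i ∈ Finset.range N, kap (blkD N i) ε w + N * ENNReal.ofReal ε := by
  have hm : ∀ i ∈ Finset.range N, Measurable fun x => Up (blkD N i) x (x + ε) w := fun i _ =>
    measurable_Up_lev (blkD_countable N i) ε w
  constructor
  · unfold kap
    rw [← lintegral_finset_sum _ hm]
    exact lintegral_mono fun x => (Up_grid hN _ _ w).1
  · have h1 : kap (gridD N) ε w ≤ ∫⁻ x, (∑ i ∈ Finset.range N, Up (blkD N i) x (x + ε) w +
      ∑ i ∈ Finset.range N, (Ioo x (x + ε)).indicator 1 (w ((i : ℝ) / N))) :=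
      lintegral_mono fun x => (Up_grid hN _ _ w).2
    refine h1.trans ?_
    rw [lintegral_add_left (Finset.measurable_sum _ hm), lintegral_finset_sum _ hm]
    gcongr
    · rfl
    have : ∀ i : ℕ, Measurable fun x : ℝ => (Ioo x (x + ε)).indicator (1 : ℝ → ℝ≥0∞) (w ((i : ℝ) / N)) := by
      intro i
      refine Measurable.ite ?_ measurable_const measurable_const
      exact (measurableSet_lt measurable_id measurable_const).inter
        (measurableSet_lt measurable_const (measurable_id.add_const _))
    rw [lintegral_finset_sum _ fun i _ => this i]
    simp_rw [lint_ind ε _ hε]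
    simp

/-- normalised averaged upcrossing number on the unit interval -/
def ah (H θ : ℝ) (w : ℝ → ℝ) : ℝ≥0∞ := ENNReal.ofReal (θ ^ (1 / H - 1)) * kap dya θ w

lemma measurable_kap {Z : Type*} [MeasurableSpace Z] {D : Set ℝ} (hD : D.Countable) {W : Z → ℝ → ℝ}
    (hW : ∀ p ∈ D, Measurable fun z => W z p) (θ : ℝ) : Measurable fun z => kap D θ (W z) := by
  unfold kap
  refine Measurable.lintegral_prod_right' (f := fun p : Z × ℝ => Up D p.2 (p.2 + θ) (W p.1)) ?_
  exact measurable_Up hD measurable_snd (measurable_snd.add_const _)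
    (fun p hp => (hW p hp).comp measurable_fst)

lemma measurable_ah {Z : Type*} [MeasurableSpace Z] {W : Z → ℝ → ℝ}
    (hW : ∀ p ∈ dya, Measurable fun z => W z p) (H θ : ℝ) : Measurable fun z => ah H θ (W z) :=
  (measurable_kap dya_countable hW θ).const_mul _

lemma ah_blk {H : ℝ} (hH : 0 < H) (hN : 0 < N) (i : ℕ) {ε : ℝ} (hε : 0 < ε) (w : ℝ → ℝ) :
    ENNReal.ofReal (ε ^ (1 / H - 1)) * kap (blkD N i) ε w =
      ENNReal.ofReal (N : ℝ)⁻¹ * ah H (ε * (N : ℝ) ^ H) (blk H N i w) := by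
  have hN' : (0 : ℝ) < N := by exact_mod_cast hN
  rw [kap_blk (H := H) hN, ah, ← mul_assoc, ← mul_assoc, ← ENNReal.ofReal_mul (by positivity),
    ← ENNReal.ofReal_mul (by positivity), mul_comm ((N : ℝ) ^ H) ε]
  congr 2
  rw [Real.mul_rpow hε.le (by positivity), ← Real.rpow_mul hN'.le]
  have : H * (1 / H - 1) = 1 - H := by field_simp
  rw [this, Real.rpow_sub hN', Real.rpow_one]
  field_simp

lemma fekete_path {H : ℝ} (hH : 0 < H) (hN : 0 < N) {ε : ℝ} (hε : 0 < ε) {w : ℝ → ℝ} (hw : Continuous w) :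
    ENNReal.ofReal (N : ℝ)⁻¹ * ∑ i ∈ Finset.range N, ah H (ε * (N : ℝ) ^ H) (blk H N i w) ≤ ah H ε w ∧
    ah H ε w ≤ ENNReal.ofReal (N : ℝ)⁻¹ * ∑ i ∈ Finset.range N, ah H (ε * (N : ℝ) ^ H) (blk H N i w) +
      ENNReal.ofReal ((ε * (N : ℝ) ^ H) ^ (1 / H)) := by
  have hN' : (0 : ℝ) < N := by exact_mod_cast hN
  have h1 : kap dya ε w = kap (gridD N) ε w := by
    rw [← kap_dense dya_sub dya_dense hw hε, ← kap_dense (gridD_sub hN) (gridD_dense hN) hw hε]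
  have h2 := kap_grid hN hε.le w
  have h3 : ENNReal.ofReal (N : ℝ)⁻¹ * ∑ i ∈ Finset.range N, ah H (ε * (N : ℝ) ^ H) (blk H N i w) =
      ENNReal.ofReal (ε ^ (1 / H - 1)) * ∑ i ∈ Finset.range N, kap (blkD N i) ε w := by
    rw [Finset.mul_sum, Finset.mul_sum]
    exact Finset.sum_congr rfl fun i _ => (ah_blk hH hN i hε w).symm
  have h4 : ENNReal.ofReal ((ε * (N : ℝ) ^ H) ^ (1 / H)) =
      ENNReal.ofReal (ε ^ (1 / H - 1)) * (N * ENNReal.ofReal ε) := by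
    rw [← ENNReal.ofReal_natCast N, ← ENNReal.ofReal_mul (by positivity),
      ← ENNReal.ofReal_mul (by positivity), Real.mul_rpow hε.le (by positivity),
      ← Real.rpow_mul hN'.le, mul_one_div_cancel hH.ne', Real.rpow_one, Real.rpow_sub hε, Real.rpow_one]
    congr 1
    field_simp
  rw [h3, h4, ah, h1, ← mul_add]
  exact ⟨by gcongr; exact h2.1, by gcongr; exact h2.2⟩

end blkD

end

section



/-! ### Moments on the unit interval, Fekete, and the constant -/

/-- chaining ratio -/
def tq (H : ℝ) : ℝ := (2 : ℝ) ^ (-(H / 4))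

lemma tq_pos (H : ℝ) : 0 < tq H := by unfold tq; positivity
lemma tq_lt {H : ℝ} (hH : 0 < H) : tq H < 1 :=
  Real.rpow_lt_one_of_one_lt_of_neg (by norm_num) (by linarith)

lemma exists_Q {H : ℝ} (hH : 0 < H) : ∃ Q : ℕ, tq H ^ Q ≤ 1 / 2 := by
  obtain ⟨m, hm⟩ := exists_pow_lt_of_lt_one (show (0 : ℝ) < 1 / 2 by norm_num) (tq_lt hH)
  exact ⟨m, hm.le⟩

/-- chaining exponent -/
def Qq (H : ℝ) : ℕ := sInf {Q : ℕ | tq H ^ Q ≤ 1 / 2}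

lemma Qq_spec {H : ℝ} (hH : 0 < H) : tq H ^ Qq H ≤ 1 / 2 := Nat.sInf_mem (exists_Q hH)

/-- geometric constant in the chaining moments -/
def CM (H : ℝ) (p : ℕ) : ℝ≥0∞ :=
  ∑' m : ℕ, (2 * ENNReal.ofReal (((2 : ℝ) ^ H)⁻¹ ^ p) * ENNReal.ofReal (tq H ^ (2 * p))⁻¹) ^ m

lemma CM_lt_top {H : ℝ} (hH : 0 < H) {p : ℕ} (hp : 2 / H < p) : CM H p < ⊤ := by
  unfold CM
  rw [ENNReal.tsum_geometric, ENNReal.inv_lt_top, tsub_pos_iff_lt,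
    show (2 : ℝ≥0∞) = ENNReal.ofReal 2 by simp, ← ENNReal.ofReal_mul (by positivity),
    ← ENNReal.ofReal_mul (by positivity), ENNReal.ofReal_lt_one]
  have e : 2 * ((2 : ℝ) ^ H)⁻¹ ^ p * (tq H ^ (2 * p))⁻¹ = (2 : ℝ) ^ (1 - H * p / 2) := by
    have h2 : (0 : ℝ) ≤ 2 := by norm_num
    rw [tq, ← Real.rpow_natCast, ← Real.rpow_natCast, ← Real.rpow_neg h2, ← Real.rpow_mul h2,
      ← Real.rpow_mul h2, ← Real.rpow_neg h2]
    nth_rw 1 [← Real.rpow_one 2]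
    rw [← Real.rpow_add (by norm_num), ← Real.rpow_add (by norm_num)]
    congr 1
    push_cast; ring
  rw [e]
  refine Real.rpow_lt_one_of_one_lt_of_neg (by norm_num) ?_
  rw [div_lt_iff₀ hH] at hp
  linarith

section mom
variable {Ω : Type*} [MeasurableSpace Ω] {P : Measure Ω} [IsProbabilityMeasure P]
variable {H : ℝ} {B : ℝ → Ω → ℝ}

lemma Mx_moment_gen {W : Ω → ℝ → ℝ} (hW : ∀ p ∈ dya, Measurable fun z => W z p) {p : ℕ} (hp : p ≠ 0)
    (A : ℝ≥0∞) (h : ∀ q r, 0 ≤ q → q ≤ r → r ≤ 1 →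
      ∫⁻ ω, ENNReal.ofReal |W ω r - W ω q| ^ p ∂P ≤ A * ENNReal.ofReal ((r - q) ^ H) ^ p) :
    ∫⁻ ω, Mx (tq H) (W ω) ^ p ∂P ≤ A * CM H p := by
  refine moment_Mx (tq_pos H) hW p hp A _ fun m k hk => ?_
  have h2 : (0 : ℝ) < 2 ^ m := by positivity
  have := h (k / 2 ^ m) ((k + 1) / 2 ^ m) (by positivity) (by gcongr; linarith) (by
    rw [div_le_one h2]; exact_mod_cast hk)
  refine this.trans (le_of_eq ?_)
  congr 1
  have e : ((k : ℝ) + 1) / 2 ^ m - k / 2 ^ m = ((2 : ℝ)⁻¹) ^ m := by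
    rw [inv_pow]; field_simp; ring
  rw [e, ← ENNReal.ofReal_pow (by positivity), ← ENNReal.ofReal_pow (by positivity)]
  congr 1
  rw [← Real.rpow_natCast (2⁻¹ : ℝ) m, ← Real.rpow_mul (by norm_num), mul_comm, Real.rpow_mul (by norm_num),
    Real.rpow_natCast, Real.inv_rpow (by norm_num), ← pow_mul, ← pow_mul, mul_comm]

lemma pow_le_one_add {x : ℝ≥0∞} {p q : ℕ} (h : p ≤ q) : x ^ p ≤ 1 + x ^ q := by
  rcases le_total x 1 with hx | hx
  · exact (pow_le_one₀ bot_le hx).trans le_self_add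
  · exact (pow_le_pow_right₀ hx h).trans le_add_self

lemma Mx_moment (hB : IsFBM H P B) (hH : 0 < H) (p : ℕ) :
    ∫⁻ ω, Mx (tq H) (fun r => B r ω) ^ p ∂P < ⊤ := by
  obtain ⟨q, hq⟩ := exists_nat_gt (max (2 / H) p)
  have hq1 : 2 / H < q := (le_max_left _ _).trans_lt hq
  have hq2 : p ≤ q := by exact_mod_cast ((le_max_right _ _).trans_lt hq).le
  have hq0 : q ≠ 0 := by
    rintro rfl
    have : 0 < 2 / H := by positivity
    norm_num at hq1; linarith
  have h1 : ∫⁻ ω, Mx (tq H) (fun r => B r ω) ^ q ∂P ≤ (ENNReal.ofReal √(fa hB) ^ q * gm q) * CM H q := by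
    refine Mx_moment_gen (fun r _ => fbm_meas hB r) hq0 _ fun s t hs hst ht => ?_
    rw [GS_moment (fG_GS hB) (Submodule.sub_mem _ (fL_mem hB t) (fL_mem hB s))
      (ae_sub (fL_ae hB t) (fL_ae hB s))]
    have e : ‖fL hB t - fL hB s‖ = √(fa hB) * (t - s) ^ H := by
      rw [← Real.sqrt_sq (norm_nonneg (fL hB t - fL hB s)), fL_norm, Real.sqrt_mul (fa_pos hB).le,
        abs_of_nonneg (by linarith), mul_comm 2 H, Real.rpow_mul (by linarith)]
      norm_cast
      rw [Real.sqrt_sq (by have : 0 ≤ t - s := by linarith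
                           positivity)]
    rw [e, ENNReal.ofReal_mul (by positivity), mul_pow]
    exact le_of_eq (by ring)
  have h2 : ∫⁻ ω, Mx (tq H) (fun r => B r ω) ^ q ∂P < ⊤ :=
    h1.trans_lt (ENNReal.mul_lt_top (ENNReal.mul_lt_top (by simp) (gm_lt_top q)) (CM_lt_top hH hq1))
  calc ∫⁻ ω, Mx (tq H) (fun r => B r ω) ^ p ∂P ≤ ∫⁻ ω, (1 + Mx (tq H) (fun r => B r ω) ^ q) ∂P :=
        lintegral_mono fun ω => pow_le_one_add hq2
    _ = 1 + ∫⁻ ω, Mx (tq H) (fun r => B r ω) ^ q ∂P := by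
        rw [lintegral_add_left measurable_const]; simp
    _ < ⊤ := ENNReal.add_lt_top.2 ⟨by simp, h2⟩

/-- law of a block -/
lemma blk_law (hB : IsFBM H P B) {N : ℕ} (hN : 0 < N) (i : ℕ) :
    P.map (fun ω => blk H N i (fun r => B r ω)) = P.map (fun ω r => B r ω) := by
  have hN' : (0 : ℝ) < N := by exact_mod_cast hN
  rw [← fbm_law_block hB (i / N) (inv_pos.2 hN')]
  congr 1
  funext ω r
  simp only [blk, inv_inv, add_comm]

lemma blk_meas (hB : IsFBM H P B) (N i : ℕ) (r : ℝ) :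
    Measurable fun ω => blk H N i (fun r => B r ω) r :=
  ((fbm_meas hB _).sub (fbm_meas hB _)).const_mul _

lemma blk_lint (hB : IsFBM H P B) {N : ℕ} (hN : 0 < N) (i : ℕ) {Φ : (ℝ → ℝ) → ℝ≥0∞} (hΦ : Measurable Φ) :
    ∫⁻ ω, Φ (blk H N i (fun r => B r ω)) ∂P = ∫⁻ ω, Φ (fun r => B r ω) ∂P :=
  law_lintegral (blk_meas hB N i) (fbm_meas hB) (blk_law hB hN i) hΦ

/-- expectation of the normalised averaged upcrossing number -/
def gE (H : ℝ) (P : Measure Ω) (B : ℝ → Ω → ℝ) (θ : ℝ) : ℝ≥0∞ := ∫⁻ ω, ah H θ (fun r => B r ω) ∂P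

/-- the limiting constant -/
def bE (H : ℝ) (P : Measure Ω) (B : ℝ → Ω → ℝ) : ℝ≥0∞ := ⨆ (θ : ℝ) (_ : 0 < θ), gE H P B θ

lemma meas_ah_pi (H θ : ℝ) : Measurable fun w : ℝ → ℝ => ah H θ w :=
  measurable_ah (W := fun w : ℝ → ℝ => w) (fun p _ => measurable_pi_apply p) H θ

lemma avg_const {N : ℕ} (hN : 0 < N) (c : ℝ≥0∞) :
    ENNReal.ofReal (N : ℝ)⁻¹ * ∑ i ∈ Finset.range N, c = c := by
  have hN' : (0 : ℝ) < N := by exact_mod_cast hN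
  rw [Finset.sum_const, Finset.card_range, nsmul_eq_mul, ← mul_assoc, ENNReal.ofReal_inv_of_pos hN',
    ENNReal.ofReal_natCast, ENNReal.inv_mul_cancel (by simp; omega) (by simp), one_mul]

lemma gE_fekete (hB : IsFBM H P B) (hH : 0 < H) {N : ℕ} (hN : 0 < N) {ε : ℝ} (hε : 0 < ε) :
    gE H P B (ε * (N : ℝ) ^ H) ≤ gE H P B ε ∧
    gE H P B ε ≤ gE H P B (ε * (N : ℝ) ^ H) + ENNReal.ofReal ((ε * (N : ℝ) ^ H) ^ (1 / H)) := by
  have hm : ∀ i, Measurable fun ω => ah H (ε * (N : ℝ) ^ H) (blk H N i (fun r => B r ω)) := fun i =>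
    measurable_ah (fun p _ => blk_meas hB N i p) _ _
  have h1 : ∫⁻ ω, ENNReal.ofReal (N : ℝ)⁻¹ * ∑ i ∈ Finset.range N,
      ah H (ε * (N : ℝ) ^ H) (blk H N i (fun r => B r ω)) ∂P = gE H P B (ε * (N : ℝ) ^ H) := by
    rw [lintegral_const_mul _ (Finset.measurable_sum _ fun i _ => hm i),
      lintegral_finset_sum _ fun i _ => hm i]
    rw [← avg_const hN (gE H P B (ε * (N : ℝ) ^ H))]
    congr 1
    exact Finset.sum_congr rfl fun i _ => blk_lint hB hN i (meas_ah_pi H _)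
  constructor
  · rw [← h1]
    exact lintegral_mono fun ω => (fekete_path hH hN hε (hB.1 ω)).1
  · rw [← h1]
    calc gE H P B ε ≤ _ := lintegral_mono fun ω => (fekete_path hH hN hε (hB.1 ω)).2
      _ = _ := by rw [lintegral_add_right _ measurable_const]; simp

lemma kap_anti {D : Set ℝ} {ε ε' : ℝ} (h : ε ≤ ε') (w : ℝ → ℝ) : kap D ε' w ≤ kap D ε w :=
  lintegral_mono fun x => Up_mono_lev le_rfl (by linarith)

lemma ah_le {θ θ' : ℝ} (hθ : 0 < θ) (h : θ ≤ θ') (w : ℝ → ℝ) :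
    ah H θ' w ≤ ENNReal.ofReal ((θ' / θ) ^ (1 / H - 1)) * ah H θ w := by
  unfold ah
  rw [← mul_assoc, ← ENNReal.ofReal_mul (by have := hθ.trans_le h; positivity),
    Real.div_rpow (hθ.trans_le h).le hθ.le, div_mul_cancel₀ _ (by positivity)]
  gcongr
  exact kap_anti h w

lemma gE_le {θ θ' : ℝ} (hB : IsFBM H P B) (hθ : 0 < θ) (h : θ ≤ θ') :
    gE H P B θ' ≤ ENNReal.ofReal ((θ' / θ) ^ (1 / H - 1)) * gE H P B θ := by
  unfold gE
  rw [← lintegral_const_mul _ (measurable_ah (fun p _ => fbm_meas hB p) _ _)]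
  exact lintegral_mono fun ω => ah_le hθ h _

lemma bE_le (hB : IsFBM H P B) (hH : H ∈ Ioo (0 : ℝ) (1 / 2)) {θ : ℝ} (hθ : 0 < θ) :
    bE H P B ≤ gE H P B θ + ENNReal.ofReal (θ ^ (1 / H)) := by
  have hH0 := hH.1
  refine iSup₂_le fun ε hε => ?_
  have hex : 0 < 1 / H - 1 := by
    rw [sub_pos, lt_div_iff₀ hH0]; linarith [hH.2]
  have key : ∀ N : ℕ, 0 < N → gE H P B ε ≤
      ENNReal.ofReal (((θ ^ (1 / H) + ε ^ (1 / H) / N) ^ H / θ) ^ (1 / H - 1)) * gE H P B θ +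
        ENNReal.ofReal (θ ^ (1 / H) + ε ^ (1 / H) / N) := by
    intro N hN
    have hN' : (0 : ℝ) < N := by exact_mod_cast hN
    set ε' := ε * ((N : ℝ) ^ H)⁻¹ with hε'
    have hε'0 : 0 < ε' := by positivity
    have e1 : ε' * (N : ℝ) ^ H = ε := by rw [hε']; field_simp
    have h1 := (gE_fekete hB hH0 hN hε'0).1
    rw [e1] at h1
    set M := ⌈(θ / ε') ^ (1 / H)⌉₊ with hM
    have hM0 : 0 < M := Nat.ceil_pos.2 (by positivity)
    have hM1 : (θ / ε') ^ (1 / H) ≤ M := Nat.le_ceil _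
    have hM2 : (M : ℝ) ≤ (θ / ε') ^ (1 / H) + 1 := (Nat.ceil_lt_add_one (by positivity)).le
    have h2 := (gE_fekete hB hH0 hM0 hε'0).2
    have hHi : 1 / H * H = 1 := by field_simp
    have hHi' : H * (1 / H) = 1 := by field_simp
    have pw1 : ∀ x : ℝ, 0 ≤ x → (x ^ (1 / H)) ^ H = x := fun x hx => by
      rw [← Real.rpow_mul hx, hHi, Real.rpow_one]
    have pw2 : ∀ x : ℝ, 0 ≤ x → (x ^ H) ^ (1 / H) = x := fun x hx => by
      rw [← Real.rpow_mul hx, hHi', Real.rpow_one]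
    have b1 : θ ≤ ε' * (M : ℝ) ^ H := by
      have : ((θ / ε') ^ (1 / H)) ^ H ≤ (M : ℝ) ^ H := by gcongr
      rw [pw1 _ (by positivity), div_le_iff₀ hε'0] at this
      linarith
    have b2 : (ε' * (M : ℝ) ^ H) ^ (1 / H) ≤ θ ^ (1 / H) + ε ^ (1 / H) / N := by
      rw [Real.mul_rpow hε'0.le (by positivity), pw2 _ (by positivity)]
      have e2 : ε' ^ (1 / H) = ε ^ (1 / H) / N := by
        rw [hε', Real.mul_rpow hε.le (by positivity), Real.inv_rpow (by positivity), pw2 _ hN'.le]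
        rfl
      calc ε' ^ (1 / H) * M ≤ ε' ^ (1 / H) * ((θ / ε') ^ (1 / H) + 1) := by gcongr
        _ = θ ^ (1 / H) + ε' ^ (1 / H) := by
            rw [Real.div_rpow hθ.le hε'0.le]; field_simp
        _ = _ := by rw [e2]
    have b3 : ε' * (M : ℝ) ^ H ≤ (θ ^ (1 / H) + ε ^ (1 / H) / N) ^ H := by
      rw [← pw1 (ε' * (M : ℝ) ^ H) (by positivity)]
      gcongr
    refine h1.trans (h2.trans ?_)
    have h3 := gE_le hB hθ b1
    refine add_le_add (h3.trans ?_) (ENNReal.ofReal_le_ofReal b2)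
    gcongr
  have l0 : Tendsto (fun N : ℕ => θ ^ (1 / H) + ε ^ (1 / H) / (N : ℝ)) atTop (𝓝 (θ ^ (1 / H))) := by
    have := tendsto_const_div_atTop_nhds_zero_nat (ε ^ (1 / H))
    simpa using this.const_add (θ ^ (1 / H))
  have l1 : Tendsto (fun N : ℕ => ((θ ^ (1 / H) + ε ^ (1 / H) / (N : ℝ)) ^ H / θ) ^ (1 / H - 1)) atTop
      (𝓝 1) := by
    have a1 := (l0.rpow_const (p := H) (Or.inr hH0.le)).div_const θ
    have e : (θ ^ (1 / H)) ^ H / θ = 1 := by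
      rw [← Real.rpow_mul hθ.le, one_div_mul_cancel hH0.ne', Real.rpow_one, div_self hθ.ne']
    rw [e] at a1
    have a2 := a1.rpow_const (p := 1 / H - 1) (Or.inr hex.le)
    simpa using a2
  have l2 := ENNReal.tendsto_ofReal l1
  rw [ENNReal.ofReal_one] at l2
  have l3 : Tendsto (fun N : ℕ => ENNReal.ofReal (((θ ^ (1 / H) + ε ^ (1 / H) / (N : ℝ)) ^ H / θ) ^
      (1 / H - 1)) * gE H P B θ + ENNReal.ofReal (θ ^ (1 / H) + ε ^ (1 / H) / N)) atTop
      (𝓝 (1 * gE H P B θ + ENNReal.ofReal (θ ^ (1 / H)))) :=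
    (ENNReal.Tendsto.mul_const l2 (Or.inl one_ne_zero)).add (ENNReal.tendsto_ofReal l0)
  rw [one_mul] at l3
  exact ge_of_tendsto l3 ((eventually_gt_atTop 0).mono key)

end mom

end

section



/-! ### Identification of the constant; uniform fourth moments -/

section P13
variable {Ω : Type*} [MeasurableSpace Ω] {P : Measure Ω} [IsProbabilityMeasure P]
variable {H : ℝ} {B : ℝ → Ω → ℝ}

lemma kap_T {w : ℝ → ℝ} (hw : Continuous w) {T c : ℝ} (hT : 0 < T) (hc : 0 < c) :
    kap (Icc 0 T) 1 w = ENNReal.ofReal c⁻¹ * kap dya c (fun r => c * (w (0 + T * r) - w 0)) := by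
  have h1 : (fun r : ℝ => T * r + 0) '' dya ⊆ Icc 0 T := by
    rintro _ ⟨r, hr, rfl⟩
    have := dya_sub hr
    simp only [mem_Icc, add_zero] at this ⊢
    exact ⟨by nlinarith [this.1], by nlinarith [this.2]⟩
  have h2 : Icc 0 T ⊆ closure ((fun r : ℝ => T * r + 0) '' dya) := by
    intro x hx
    refine image_closure_subset_closure_image (by fun_prop) ⟨x / T, dya_dense ⟨?_, ?_⟩, ?_⟩
    · exact div_nonneg hx.1 hT.le
    · rw [div_le_one hT]; exact hx.2
    · simp only [add_zero]; field_simp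
  rw [kap_dense h1 h2 hw one_pos, kap_affine (c := c) (d := w 0) hT hc, mul_one]
  congr 2
  funext r
  simp only [add_zero, zero_add]

lemma meas_kap_pi (θ : ℝ) : Measurable fun w : ℝ → ℝ => kap dya θ w :=
  measurable_kap (W := fun w : ℝ → ℝ => w) dya_countable (fun p _ => measurable_pi_apply p) θ

lemma meas_kap_neg (θ : ℝ) : Measurable fun w : ℝ → ℝ => kap dya θ (fun r => - w r) :=
  measurable_kap (W := fun w : ℝ → ℝ => fun r => - w r) dya_countable
    (fun p _ => (measurable_pi_apply p).neg) θ

lemma avgK_E (hB : IsFBM H P B) {T : ℝ} (hT : 0 < T) (hH : 0 < H) :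
    (ENNReal.ofReal T)⁻¹ * ∫⁻ ω, avgK 1 (fun r => B r ω) 0 T ∂P = 2 * gE H P B (T⁻¹ ^ H) := by
  have hc : 0 < T⁻¹ ^ H := by positivity
  set c := T⁻¹ ^ H with hcdef
  have mX : ∀ t, Measurable fun ω => c * (B (0 + T * t) ω - B 0 ω) := fun t =>
    ((fbm_meas hB _).sub (fbm_meas hB _)).const_mul _
  have h1 : ∀ ω, avgK 1 (fun r => B r ω) 0 T = ENNReal.ofReal c⁻¹ *
      (kap dya c (fun r => c * (B (0 + T * r) ω - B 0 ω)) +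
        kap dya c (fun r => - (c * (B (0 + T * r) ω - B 0 ω)))) := by
    intro ω
    rw [avgK_eq (hB.1 ω) hT, kap_T (hB.1 ω) hT hc, kap_T (w := fun r => - B r ω) (hB.1 ω).neg hT hc, mul_add]
    congr 3
    funext r; ring
  have hlaw := fbm_law_block hB 0 hT
  have k1 : ∫⁻ ω, kap dya c (fun r => c * (B (0 + T * r) ω - B 0 ω)) ∂P =
      ∫⁻ ω, kap dya c (fun r => B r ω) ∂P :=
    law_lintegral mX (fbm_meas hB) hlaw (meas_kap_pi c)
  have k2 : ∫⁻ ω, kap dya c (fun r => - (c * (B (0 + T * r) ω - B 0 ω))) ∂P =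
      ∫⁻ ω, kap dya c (fun r => B r ω) ∂P := by
    rw [law_lintegral mX (fbm_meas hB) hlaw (meas_kap_neg c)]
    exact law_lintegral (fun t => (fbm_meas hB t).neg) (fbm_meas hB) (fbm_law_neg hB) (meas_kap_pi c)
  simp_rw [h1]
  have m1 : Measurable fun ω => kap dya c (fun r => c * (B (0 + T * r) ω - B 0 ω)) :=
    measurable_kap dya_countable (fun p _ => mX p) c
  have m2 : Measurable fun ω => kap dya c (fun r => - (c * (B (0 + T * r) ω - B 0 ω))) :=
    measurable_kap dya_countable (fun p _ => (mX p).neg) c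
  have m3 : Measurable fun ω => kap dya c (fun r => B r ω) :=
    measurable_kap dya_countable (fun p _ => fbm_meas hB p) c
  rw [lintegral_const_mul' _ _ ENNReal.ofReal_ne_top, lintegral_add_left m1, k1, k2, gE]
  unfold ah
  rw [lintegral_const_mul _ m3, ← two_mul, ← ENNReal.ofReal_inv_of_pos hT]
  have e : c ^ (1 / H - 1) = T⁻¹ * c⁻¹ := by
    rw [Real.rpow_sub hc, Real.rpow_one, hcdef, ← Real.rpow_mul (by positivity), mul_one_div_cancel hH.ne',
      Real.rpow_one]
    rfl
  rw [e, ENNReal.ofReal_mul (by positivity)]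
  ring

lemma cHe_eq (hB : IsFBM H P B) (hH : 0 < H) : cHe P B = 2 * bE H P B := by
  unfold cHe bE
  simp_rw [ENNReal.mul_iSup]
  apply le_antisymm
  · refine iSup₂_le fun T hT => ?_
    rw [avgK_E hB hT hH]
    exact le_iSup₂_of_le (T⁻¹ ^ H) (by positivity) le_rfl
  · refine iSup₂_le fun θ hθ => ?_
    refine le_iSup₂_of_le ((θ ^ (1 / H))⁻¹) (by positivity) ?_
    rw [avgK_E hB (by positivity) hH, inv_inv, ← Real.rpow_mul hθ.le, one_div_mul_cancel hH.ne', Real.rpow_one]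

lemma ah_le_Mx (hH : 0 < H) : ∃ C : ℝ≥0∞, C < ⊤ ∧ ∀ w : ℝ → ℝ, ∀ θ : ℝ, 1 ≤ θ → θ ≤ 2 → H < 1 →
    ah H θ w ≤ C * Mx (tq H) w ^ (Qq H + 1) := by
  refine ⟨ENNReal.ofReal (2 ^ (1 / H - 1)) * (2 * ENNReal.ofReal (2 / ((1 - tq H) * 1)) ^ Qq H *
    (2 * ENNReal.ofReal (2 / (1 - tq H)))), ?_, fun w θ h1 h2 hH1 => ?_⟩
  · refine ENNReal.mul_lt_top (by simp) (ENNReal.mul_lt_top (ENNReal.mul_lt_top (by simp) ?_)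
      (ENNReal.mul_lt_top (by simp) (by simp)))
    exact ENNReal.pow_lt_top (by simp)
  · have hex : 0 ≤ 1 / H - 1 := by
      rw [sub_nonneg, le_div_iff₀ hH]; linarith
    have := kap_le_Mx (w := w) (tq_pos H) (tq_lt hH) (Qq_spec hH) one_pos
    unfold ah
    calc _ ≤ ENNReal.ofReal (2 ^ (1 / H - 1)) * kap dya 1 w := by
          gcongr
          exact kap_anti h1 w
      _ ≤ _ := by
          refine (mul_le_mul_right this _).trans (le_of_eq ?_)
          rw [mul_pow]; ring

lemma ah_moment_one (hB : IsFBM H P B) (hH : H ∈ Ioo (0 : ℝ) (1 / 2)) (p : ℕ) :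
    ∃ M : ℝ≥0∞, M < ⊤ ∧ ∀ θ : ℝ, 1 ≤ θ → θ ≤ 2 → ∫⁻ ω, ah H θ (fun r => B r ω) ^ p ∂P ≤ M := by
  obtain ⟨C, hC, h⟩ := ah_le_Mx hH.1
  refine ⟨C ^ p * ∫⁻ ω, Mx (tq H) (fun r => B r ω) ^ ((Qq H + 1) * p) ∂P,
    ENNReal.mul_lt_top (ENNReal.pow_lt_top hC) (Mx_moment hB hH.1 _), fun θ h1 h2 => ?_⟩
  rw [← lintegral_const_mul' _ _ (ENNReal.pow_lt_top hC).ne]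
  refine lintegral_mono fun ω => ?_
  refine (pow_le_pow_left₀ bot_le (h _ θ h1 h2 (by linarith [hH.2])) p).trans (le_of_eq ?_)
  rw [mul_pow, pow_mul]

lemma bE_lt_top (hB : IsFBM H P B) (hH : H ∈ Ioo (0 : ℝ) (1 / 2)) : bE H P B < ⊤ := by
  obtain ⟨M, hM, h⟩ := ah_moment_one hB hH 1
  refine (bE_le hB hH one_pos).trans_lt (ENNReal.add_lt_top.2 ⟨?_, by simp⟩)
  have := h 1 le_rfl (by norm_num)
  simp only [pow_one] at this
  exact this.trans_lt hM

lemma avg_pow {N : ℕ} (hN : 0 < N) (z : ℕ → ℝ≥0∞) {p : ℕ} (hp : 1 ≤ p) :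
    (ENNReal.ofReal (N : ℝ)⁻¹ * ∑ i ∈ Finset.range N, z i) ^ p ≤
      ENNReal.ofReal (N : ℝ)⁻¹ * ∑ i ∈ Finset.range N, z i ^ p := by
  have h1 : ∑ i ∈ Finset.range N, ENNReal.ofReal (N : ℝ)⁻¹ = 1 := by
    have := avg_const hN 1
    rw [Finset.mul_sum] at this
    simpa using this
  have := ENNReal.rpow_arith_mean_le_arith_mean_rpow (Finset.range N) (fun _ => ENNReal.ofReal (N : ℝ)⁻¹)
    z h1 (p := p) (by exact_mod_cast hp)
  simp only [ENNReal.rpow_natCast] at this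
  rw [Finset.mul_sum, Finset.mul_sum]
  exact this

lemma add_pow_four (a b : ℝ≥0∞) : (a + b) ^ 4 ≤ 8 * (a ^ 4 + b ^ 4) := by
  have := ENNReal.rpow_add_le_mul_rpow_add_rpow a b (p := (4 : ℕ)) (by norm_num)
  simp only [ENNReal.rpow_natCast] at this
  refine this.trans (le_of_eq ?_)
  congr 1
  rw [show (((4 : ℕ) : ℝ) - 1) = ((3 : ℕ) : ℝ) by norm_num, ENNReal.rpow_natCast]
  norm_num

lemma ceil_scale (hH : H ∈ Ioo (0 : ℝ) (1 / 2)) {ε : ℝ} (h0 : 0 < ε) (h1 : ε ≤ 1) :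
    ∃ N : ℕ, 0 < N ∧ 1 ≤ ε * (N : ℝ) ^ H ∧ ε * (N : ℝ) ^ H ≤ 2 ∧ (ε * (N : ℝ) ^ H) ^ (1 / H) ≤ 2 := by
  have hH0 := hH.1
  have hx : 1 ≤ ε ^ (-(1 / H)) := Real.one_le_rpow_of_pos_of_le_one_of_nonpos h0 h1
    (by rw [neg_nonpos]; positivity)
  set x := ε ^ (-(1 / H)) with hxd
  refine ⟨⌈x⌉₊, Nat.ceil_pos.2 (by linarith), ?_, ?_, ?_⟩
  all_goals
    have e1 : x ^ H = ε⁻¹ := by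
      rw [hxd, ← Real.rpow_mul h0.le, neg_mul, one_div_mul_cancel hH0.ne', Real.rpow_neg_one]
    have n1 : x ≤ (⌈x⌉₊ : ℝ) := Nat.le_ceil x
    have n2 : (⌈x⌉₊ : ℝ) ≤ 2 * x := by
      have := (Nat.ceil_lt_add_one (show 0 ≤ x by linarith)).le
      linarith
  · have : x ^ H ≤ (⌈x⌉₊ : ℝ) ^ H := by gcongr
    rw [e1] at this
    calc (1 : ℝ) = ε * ε⁻¹ := by field_simp
      _ ≤ _ := by gcongr
  · have : (⌈x⌉₊ : ℝ) ^ H ≤ (2 * x) ^ H := by gcongr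
    rw [Real.mul_rpow (by norm_num) (by linarith), e1] at this
    have h2 : (2 : ℝ) ^ H ≤ 2 := by
      conv_rhs => rw [← Real.rpow_one 2]
      exact Real.rpow_le_rpow_of_exponent_le (by norm_num) (by linarith [hH.2])
    calc ε * (⌈x⌉₊ : ℝ) ^ H ≤ ε * (2 ^ H * ε⁻¹) := by gcongr
      _ = 2 ^ H := by field_simp
      _ ≤ 2 := h2
  · have : (⌈x⌉₊ : ℝ) ^ H ≤ (2 * x) ^ H := by gcongr
    rw [Real.mul_rpow (by norm_num) (by linarith), e1] at this
    have h3 : ε * (⌈x⌉₊ : ℝ) ^ H ≤ 2 ^ H := by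
      calc ε * (⌈x⌉₊ : ℝ) ^ H ≤ ε * (2 ^ H * ε⁻¹) := by gcongr
        _ = 2 ^ H := by field_simp
    calc (ε * (⌈x⌉₊ : ℝ) ^ H) ^ (1 / H) ≤ ((2 : ℝ) ^ H) ^ (1 / H) := by gcongr
      _ = 2 := by rw [← Real.rpow_mul (by norm_num), mul_one_div_cancel hH0.ne', Real.rpow_one]

lemma ah_moment4 (hB : IsFBM H P B) (hH : H ∈ Ioo (0 : ℝ) (1 / 2)) :
    ∃ M : ℝ≥0∞, M < ⊤ ∧ ∀ θ : ℝ, 0 < θ → θ ≤ 1 → ∫⁻ ω, ah H θ (fun r => B r ω) ^ 4 ∂P ≤ M := by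
  obtain ⟨M, hM, h⟩ := ah_moment_one hB hH 4
  refine ⟨8 * (M + 2 ^ 4), ENNReal.mul_lt_top (by simp) (ENNReal.add_lt_top.2 ⟨hM, by norm_num⟩),
    fun ε h0 h1 => ?_⟩
  obtain ⟨N, hN, n1, n2, n3⟩ := ceil_scale hH h0 h1
  have hm : ∀ i, Measurable fun ω => ah H (ε * (N : ℝ) ^ H) (blk H N i (fun r => B r ω)) ^ 4 := fun i =>
    (measurable_ah (fun p _ => blk_meas hB N i p) _ _).pow_const 4
  have hb : ∀ i, ∫⁻ ω, ah H (ε * (N : ℝ) ^ H) (blk H N i (fun r => B r ω)) ^ 4 ∂P ≤ M := fun i => by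
    rw [blk_lint hB hN i (Φ := fun w => ah H (ε * (N : ℝ) ^ H) w ^ 4) ((meas_ah_pi H _).pow_const 4)]
    exact h _ n1 n2
  have hsum : ∫⁻ ω, ENNReal.ofReal (N : ℝ)⁻¹ * ∑ i ∈ Finset.range N,
      ah H (ε * (N : ℝ) ^ H) (blk H N i (fun r => B r ω)) ^ 4 ∂P ≤ M := by
    rw [lintegral_const_mul _ (Finset.measurable_sum _ fun i _ => hm i),
      lintegral_finset_sum _ fun i _ => hm i]
    conv_rhs => rw [← avg_const hN M]
    gcongr
    exact hb _
  calc ∫⁻ ω, ah H ε (fun r => B r ω) ^ 4 ∂P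
      ≤ ∫⁻ ω, 8 * (ENNReal.ofReal (N : ℝ)⁻¹ * ∑ i ∈ Finset.range N,
        ah H (ε * (N : ℝ) ^ H) (blk H N i (fun r => B r ω)) ^ 4 + 2 ^ 4) ∂P := by
        refine lintegral_mono fun ω => ?_
        refine (pow_le_pow_left₀ bot_le (fekete_path hH.1 hN h0 (hB.1 ω)).2 4).trans ?_
        refine (add_pow_four _ _).trans ?_
        gcongr
        · exact avg_pow hN _ (by norm_num)
        · exact (ENNReal.ofReal_le_ofReal n3).trans (by simp)
    _ = 8 * (∫⁻ ω, ENNReal.ofReal (N : ℝ)⁻¹ * ∑ i ∈ Finset.range N,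
        ah H (ε * (N : ℝ) ^ H) (blk H N i (fun r => B r ω)) ^ 4 ∂P + 2 ^ 4) := by
        rw [lintegral_const_mul' _ _ (by norm_num), lintegral_add_right _ measurable_const]
        simp
    _ ≤ _ := by gcongr

end P13

end

section



/-! ### Law of large numbers for block averages -/

section P14
variable {Ω : Type*} [MeasurableSpace Ω] {P : Measure Ω} [IsProbabilityMeasure P]
variable {H : ℝ} {B : ℝ → Ω → ℝ}

lemma kap_pert {D : Set ℝ} {θ η : ℝ} {w w' : ℝ → ℝ} (h : ∀ p ∈ D, |w p - w' p| ≤ η) :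
    kap D θ w ≤ kap D (θ - 2 * η) w' := by
  unfold kap
  rw [← lintegral_add_right_eq_self (fun x => Up D x (x + (θ - 2 * η)) w') η]
  refine lintegral_mono fun x => (Up_pert h).trans (le_of_eq ?_)
  congr 1; ring

lemma kap_congr {D : Set ℝ} {θ : ℝ} {w w' : ℝ → ℝ} (h : ∀ p ∈ D, w p = w' p) :
    kap D θ w = kap D θ w' := lintegral_congr fun x => Up_congr h

lemma ah_congr {θ : ℝ} {w w' : ℝ → ℝ} (h : ∀ p ∈ dya, w p = w' p) :
    ah H θ w = ah H θ w' := by unfold ah; rw [kap_congr h]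

lemma blk_meas_pi (H : ℝ) (N i : ℕ) (p : ℝ) : Measurable fun w : ℝ → ℝ => blk H N i w p := by
  unfold blk; fun_prop

lemma far_G (hB : IsFBM H P B) (hH : H ∈ Ioo (0 : ℝ) (1 / 2)) {N i j : ℕ} (hN : 0 < N) (hij : i + 1 < j)
    {θ ρ : ℝ} (hθ : 0 < θ) (hρ : 0 < ρ) (hρ8 : ρ ≤ 1 / 8) {p : ℕ} (hp : p ≠ 0) :
    ∃ G : Set Ω, MeasurableSet G ∧
      (∫⁻ ω in G, ah H θ (blk H N i (fun r => B r ω)) * ah H θ (blk H N j (fun r => B r ω)) ∂P) * P G ≤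
        ENNReal.ofReal ((1 / (1 - 4 * ρ)) ^ (1 / H - 1)) * bE H P B ^ 2 ∧
      P Gᶜ ≤ ENNReal.ofReal (2 / (1 - tq H) * (pjc hB * (((j : ℝ) - i - 1) ^ (H - 1))) / (ρ * θ)) ^ p *
        gm p * CM H p := by
  have hN' : (0 : ℝ) < N := by exact_mod_cast hN
  have hH0 := hH.1
  have hij' : (0 : ℝ) < (j : ℝ) - i - 1 := by
    have : ((i + 1 : ℕ) : ℝ) < j := by exact_mod_cast hij
    push_cast at this; linarith
  have hus : ((i + 1 : ℕ) : ℝ) / N < (j : ℝ) / N := by gcongr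
  have hC0 : 0 < 2 / (1 - tq H) := div_pos (by norm_num) (by linarith [tq_lt hH0])
  obtain ⟨Y, mY, Y0, hind, hmom⟩ := proj_lemma hB hH (u := ((i + 1 : ℕ) : ℝ) / N) (s := (j : ℝ) / N)
    (by positivity) hus
  set u : ℝ := ((i + 1 : ℕ) : ℝ) / N with hu
  set s : ℝ := (j : ℝ) / N with hs
  have hsu : s - u = ((j : ℝ) - i - 1) / N := by rw [hs, hu]; push_cast; field_simp; ring
  -- functionals on path space
  let Wf : (ℝ → ℝ) → ℝ → ℝ := fun y r => (N : ℝ) ^ H * y ((N : ℝ)⁻¹ * r + s)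
  have mWf : ∀ r, Measurable fun y => Wf y r := fun r => (measurable_pi_apply _).const_mul _
  have mMx : Measurable fun y => Mx (tq H) (Wf y) := measurable_Mx _ fun r _ => mWf r
  let Gs : Set (ℝ → ℝ) := {y | ENNReal.ofReal (2 / (1 - tq H)) * Mx (tq H) (Wf y) ≤ ENNReal.ofReal (ρ * θ)}
  have mGs : MeasurableSet Gs := measurableSet_le (mMx.const_mul _) measurable_const
  have mYp : Measurable fun ω => (fun r => Y r ω) := measurable_pi_lambda _ mY
  let G : Set Ω := (fun ω => (fun r => Y r ω)) ⁻¹' Gs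
  have mG : MeasurableSet G := mYp mGs
  refine ⟨G, mG, ?_, ?_⟩
  · -- comparison on G
    let Zf : Ω → ℝ → ℝ := fun ω r => B r ω - B s ω - Y r ω
    have mZf : Measurable Zf := measurable_pi_lambda _ fun r => ((fbm_meas hB r).sub (fbm_meas hB s)).sub (mY r)
    have hG : ∀ ω ∈ G, ∀ q ∈ dya, |blk H N j (fun r => B r ω) q - Wf (Zf ω) q| ≤ ρ * θ := by
      intro ω hω q hq
      have h1 := (osc_le_Mx (w := Wf (fun r => Y r ω)) (tq_pos H) (tq_lt hH0) zero_mem_dya hq).trans hω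
      rw [ENNReal.ofReal_le_ofReal_iff (by positivity)] at h1
      convert h1 using 2
      simp only [blk, Wf, Zf, mul_zero, zero_add, Y0, ← hs]
      ring
    have hG2 : ∀ ω ∈ G, ∀ q ∈ dya, |Wf (Zf ω) q - blk H N j (fun r => B r ω) q| ≤ ρ * θ := by
      intro ω hω q hq
      rw [abs_sub_comm]; exact hG ω hω q hq
    let at_ : Ω → ℝ≥0∞ := fun ω => ENNReal.ofReal (θ ^ (1 / H - 1)) * kap dya (θ - 2 * (ρ * θ)) (Wf (Zf ω))
    have mkf : Measurable fun y => ENNReal.ofReal (θ ^ (1 / H - 1)) * kap dya (θ - 2 * (ρ * θ)) (Wf y) :=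
      (measurable_kap dya_countable (fun r _ => mWf r) _).const_mul _
    have mat : Measurable at_ := mkf.comp mZf
    let ai : Ω → ℝ≥0∞ := fun ω => ah H θ (blk H N i (fun r => B r ω))
    have mai : Measurable ai := measurable_ah (fun p _ => blk_meas hB N i p) _ _
    have h1 : ∫⁻ ω in G, ai ω * ah H θ (blk H N j (fun r => B r ω)) ∂P ≤ ∫⁻ ω, G.indicator ai ω * at_ ω ∂P := by
      rw [← lintegral_indicator mG]
      refine lintegral_mono fun ω => ?_
      by_cases hω : ω ∈ G
      · simp only [indicator_of_mem hω]
        gcongr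
        exact mul_le_mul_right (kap_pert (hG ω hω)) _
      · simp [indicator_of_notMem hω]
    have h2 : ∫⁻ ω, G.indicator ai ω * at_ ω ∂P = (∫⁻ ω, G.indicator ai ω ∂P) * ∫⁻ ω, at_ ω ∂P := by
      refine lintegral_mul_eq_lintegral_mul_lintegral_of_indepFun'' (mai.indicator mG).aemeasurable
        mat.aemeasurable ?_
      let Φ : (ℝ → ℝ) × (ℝ → ℝ) → ℝ≥0∞ := fun z => Gs.indicator (fun _ => ah H θ (blk H N i z.1)) z.2
      have mΦ : Measurable Φ := by
        have m1 : Measurable fun z : (ℝ → ℝ) × (ℝ → ℝ) => ah H θ (blk H N i z.1) :=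
          measurable_ah (fun p _ => (blk_meas_pi H N i p).comp measurable_fst) _ _
        have : Φ = (Prod.snd ⁻¹' Gs).indicator (fun z : (ℝ → ℝ) × (ℝ → ℝ) => ah H θ (blk H N i z.1)) := by
          funext z; rfl
        rw [this]
        exact m1.indicator (measurable_snd mGs)
      have := hind.comp mΦ mkf
      suffices h : G.indicator ai = Φ ∘ fun ω => (fun r => B (max 0 (min r u)) ω, fun r => Y r ω) by
        rw [h]; exact this
      funext ω
      simp only [Function.comp, Φ]
      have e : ah H θ (blk H N i (fun r => B r ω)) = ah H θ (blk H N i (fun r => B (max 0 (min r u)) ω)) := by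
        refine ah_congr fun q hq => ?_
        have hc : ∀ q ∈ dya, max 0 (min ((N : ℝ)⁻¹ * q + i / N) u) = (N : ℝ)⁻¹ * q + i / N := by
          intro q hq
          have := blkD_sub hN i (mem_image_of_mem _ hq)
          rw [min_eq_left this.2, max_eq_right (le_trans (by positivity) this.1)]
        have h0 := hc 0 zero_mem_dya
        rw [mul_zero, zero_add] at h0
        simp only [blk, hc q hq, h0]
      by_cases hω : ω ∈ G
      · rw [indicator_of_mem hω, indicator_of_mem (show (fun r => Y r ω) ∈ Gs from hω)]
        exact e
      · rw [indicator_of_notMem hω, indicator_of_notMem (show (fun r => Y r ω) ∉ Gs from hω)]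
    have h3 : ∫⁻ ω, G.indicator ai ω ∂P ≤ bE H P B := by
      calc _ ≤ ∫⁻ ω, ai ω ∂P := lintegral_mono fun ω => indicator_le_self _ _ _
        _ = gE H P B θ := blk_lint hB hN i (meas_ah_pi H θ)
        _ ≤ _ := le_iSup₂_of_le θ hθ le_rfl
    have hθ' : 0 < θ - 4 * (ρ * θ) := by nlinarith
    have h4 : (∫⁻ ω, at_ ω ∂P) * P G ≤ ENNReal.ofReal ((1 / (1 - 4 * ρ)) ^ (1 / H - 1)) * bE H P B := by
      have e1 : (∫⁻ ω, at_ ω ∂P) * P G = ∫⁻ ω, G.indicator 1 ω * at_ ω ∂P := by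
        have : IndepFun (G.indicator (1 : Ω → ℝ≥0∞)) at_ P := by
          have := hind.comp (φ := fun z : (ℝ → ℝ) × (ℝ → ℝ) => Gs.indicator (1 : (ℝ → ℝ) → ℝ≥0∞) z.2)
            ((measurable_one.indicator mGs).comp measurable_snd) mkf
          exact this
        rw [lintegral_mul_eq_lintegral_mul_lintegral_of_indepFun''
          (measurable_one.indicator mG).aemeasurable mat.aemeasurable this, lintegral_indicator_one mG, mul_comm]
      have e2 : ENNReal.ofReal (θ ^ (1 / H - 1)) = ENNReal.ofReal ((1 / (1 - 4 * ρ)) ^ (1 / H - 1)) *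
          ENNReal.ofReal ((θ - 4 * (ρ * θ)) ^ (1 / H - 1)) := by
        have h14 : 0 < 1 - 4 * ρ := by linarith
        rw [← ENNReal.ofReal_mul (by positivity), ← Real.mul_rpow (by positivity) hθ'.le]
        congr 2
        field_simp
      rw [e1]
      calc ∫⁻ ω, G.indicator 1 ω * at_ ω ∂P
          ≤ ∫⁻ ω, ENNReal.ofReal ((1 / (1 - 4 * ρ)) ^ (1 / H - 1)) *
              ah H (θ - 4 * (ρ * θ)) (blk H N j (fun r => B r ω)) ∂P := by
            refine lintegral_mono fun ω => ?_
            by_cases hω : ω ∈ G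
            · rw [indicator_of_mem hω, Pi.one_apply, one_mul]
              simp only [at_, ah]
              rw [e2, mul_assoc]
              gcongr
              refine (kap_pert (hG2 ω hω)).trans (le_of_eq ?_)
              congr 1; ring
            · simp [indicator_of_notMem hω]
        _ = ENNReal.ofReal ((1 / (1 - 4 * ρ)) ^ (1 / H - 1)) * gE H P B (θ - 4 * (ρ * θ)) := by
            rw [lintegral_const_mul' _ _ ENNReal.ofReal_ne_top, blk_lint hB hN j (meas_ah_pi H _)]
            rfl
        _ ≤ _ := by
            gcongr
            exact le_iSup₂_of_le _ hθ' le_rfl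
    calc _ ≤ ((∫⁻ ω, G.indicator ai ω ∂P) * ∫⁻ ω, at_ ω ∂P) * P G := by
          rw [← h2]; gcongr
      _ = (∫⁻ ω, G.indicator ai ω ∂P) * ((∫⁻ ω, at_ ω ∂P) * P G) := by ring
      _ ≤ bE H P B * (ENNReal.ofReal ((1 / (1 - 4 * ρ)) ^ (1 / H - 1)) * bE H P B) := by gcongr
      _ = _ := by ring
  · -- probability of the complement
    let MW : Ω → ℝ≥0∞ := fun ω => Mx (tq H) (Wf (fun r => Y r ω))
    have mMW : Measurable MW := measurable_Mx _ fun r _ => (mY ((N : ℝ)⁻¹ * r + s)).const_mul ((N : ℝ) ^ H)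
    have hmm : ∫⁻ ω, MW ω ^ p ∂P ≤
        (ENNReal.ofReal (pjc hB * (((j : ℝ) - i - 1) ^ (H - 1))) ^ p * gm p) * CM H p := by
      refine Mx_moment_gen (fun r _ => (mY _).const_mul _) hp _ fun q r hq hqr hr => ?_
      have h1 := hmom ((N : ℝ)⁻¹ * q + s) ((N : ℝ)⁻¹ * r + s) (by
        have : 0 ≤ (N : ℝ)⁻¹ * q := by positivity
        linarith) (by gcongr) p
      have e : ∀ ω, ENNReal.ofReal |Wf (fun r => Y r ω) r - Wf (fun r => Y r ω) q| ^ p =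
          ENNReal.ofReal ((N : ℝ) ^ H) ^ p *
            ENNReal.ofReal |Y ((N : ℝ)⁻¹ * r + s) ω - Y ((N : ℝ)⁻¹ * q + s) ω| ^ p := by
        intro ω
        simp only [Wf]
        rw [← mul_sub, abs_mul, abs_of_pos (by positivity), ENNReal.ofReal_mul (by positivity), mul_pow]
      rw [lintegral_congr e]
      rw [lintegral_const_mul' _ _ (by simp)]
      calc _ ≤ ENNReal.ofReal ((N : ℝ) ^ H) ^ p * _ := mul_le_mul_right h1 _
        _ = ENNReal.ofReal (pjc hB * (((j : ℝ) - i - 1) ^ (H - 1)) * (r - q)) ^ p * gm p := by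
            rw [← mul_assoc, ← mul_pow, ← ENNReal.ofReal_mul (by positivity)]
            congr 3
            rw [hsu, Real.div_rpow hij'.le hN'.le, Real.rpow_sub hN', Real.rpow_one]
            field_simp
            ring
        _ ≤ ENNReal.ofReal (pjc hB * (((j : ℝ) - i - 1) ^ (H - 1)) * (r - q) ^ H) ^ p * gm p := by
            have := pjc_nonneg hB
            have h2 : r - q ≤ (r - q) ^ H := by
              rcases hqr.eq_or_lt with h | h
              · rw [h, sub_self, Real.zero_rpow hH0.ne']
              · conv_lhs => rw [← Real.rpow_one (r - q)]
                exact Real.rpow_le_rpow_of_exponent_ge (by linarith) (by linarith) (by linarith [hH.2])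
            gcongr
        _ = _ := by
            rw [ENNReal.ofReal_mul (mul_nonneg (pjc_nonneg hB) (by positivity)), mul_pow]; ring
    have hsub : Gᶜ ⊆ {ω | ENNReal.ofReal (ρ * θ) ^ p ≤ (ENNReal.ofReal (2 / (1 - tq H)) * MW ω) ^ p} := by
      intro ω hω
      have : ENNReal.ofReal (ρ * θ) < ENNReal.ofReal (2 / (1 - tq H)) * MW ω := not_le.1 hω
      exact pow_le_pow_left₀ bot_le this.le p
    have hρθ : 0 < ρ * θ := by positivity
    refine (measure_mono hsub).trans ?_
    refine (meas_ge_le_lintegral_div ((mMW.const_mul _).pow_const p).aemeasurable (by simp [hρθ])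
      (by simp)).trans ?_
    simp_rw [mul_pow]
    rw [lintegral_const_mul' _ _ (by simp)]
    calc _ ≤ ENNReal.ofReal (2 / (1 - tq H)) ^ p *
          ((ENNReal.ofReal (pjc hB * (((j : ℝ) - i - 1) ^ (H - 1))) ^ p * gm p) * CM H p) /
            (ENNReal.ofReal (ρ * θ)) ^ p := by
          gcongr
      _ = _ := by
          rw [ENNReal.ofReal_div_of_pos hρθ, ENNReal.ofReal_mul hC0.le, ENNReal.div_eq_inv_mul,
            ENNReal.div_eq_inv_mul, mul_pow, mul_pow, ENNReal.inv_pow]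
          ring

end P14

end

section



section P15
variable {Ω : Type*} [MeasurableSpace Ω] {P : Measure Ω} [IsProbabilityMeasure P]
variable {H : ℝ} {B : ℝ → Ω → ℝ}

lemma mul_le_lam (x y L : ℝ≥0∞) (h0 : L ≠ 0) (h1 : L ≠ ⊤) : x * y ≤ L * (x ^ 4 + y ^ 4) + L⁻¹ := by
  have key : ∀ z : ℝ≥0∞, z * z ≤ L * z ^ 4 + L⁻¹ := by
    intro z
    rcases le_total (z * z * L) 1 with h | h
    · exact (ENNReal.le_inv_iff_mul_le.2 h).trans le_add_self
    · calc z * z = z * z * 1 := by ring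
        _ ≤ z * z * (z * z * L) := by gcongr
        _ = L * z ^ 4 := by ring
        _ ≤ _ := le_self_add
  rcases le_total x y with h | h
  · calc x * y ≤ y * y := by gcongr
      _ ≤ _ := key y
      _ ≤ _ := by gcongr; exact le_add_self
  · calc x * y ≤ x * x := by gcongr
      _ ≤ _ := key x
      _ ≤ _ := by gcongr; exact le_self_add

lemma inv_pow_le {q x : ℝ} (hq : 0 ≤ q) (h0 : 0 ≤ x) (h1 : x ≤ 1) :
    (1 / (1 - 4 * (x / 8))) ^ q ≤ 1 + q * Real.exp q * x := by
  have a1 : 1 / (1 - 4 * (x / 8)) ≤ Real.exp x := by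
    have : 1 / (1 - 4 * (x / 8)) ≤ 1 + x := by
      rw [div_le_iff₀ (by linarith)]; nlinarith
    linarith [Real.add_one_le_exp x]
  have a2 : (1 / (1 - 4 * (x / 8))) ^ q ≤ Real.exp (x * q) := by
    rw [Real.exp_mul]
    exact Real.rpow_le_rpow (by apply div_nonneg <;> linarith) a1 hq
  have a3 : Real.exp (x * q) ≤ 1 + (x * q) * Real.exp (x * q) := by
    have := Real.add_one_le_exp (-(x * q))
    have e : Real.exp (-(x * q)) * Real.exp (x * q) = 1 := by rw [← Real.exp_add]; simp
    nlinarith [Real.exp_pos (x * q)]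
  have a4 : Real.exp (x * q) ≤ Real.exp q := Real.exp_le_exp.2 (by nlinarith)
  have a5 : (x * q) * Real.exp (x * q) ≤ (x * q) * Real.exp q := by gcongr
  nlinarith

lemma ai_moment4 (hB : IsFBM H P B) (hH : H ∈ Ioo (0 : ℝ) (1 / 2)) {M : ℝ≥0∞} {θ : ℝ}
    (h : ∫⁻ ω, ah H θ (fun r => B r ω) ^ 4 ∂P ≤ M) {N : ℕ} (hN : 0 < N) (i : ℕ) :
    ∫⁻ ω, ah H θ (blk H N i (fun r => B r ω)) ^ 4 ∂P ≤ M := by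
  rw [blk_lint hB hN i (Φ := fun w => ah H θ w ^ 4) ((meas_ah_pi H _).pow_const 4)]
  exact h

lemma pair_M2 (hB : IsFBM H P B) (hH : H ∈ Ioo (0 : ℝ) (1 / 2)) {M : ℝ≥0∞} {θ : ℝ}
    (h : ∫⁻ ω, ah H θ (fun r => B r ω) ^ 4 ∂P ≤ M) {N : ℕ} (hN : 0 < N) (i j : ℕ) :
    ∫⁻ ω, ah H θ (blk H N i (fun r => B r ω)) * ah H θ (blk H N j (fun r => B r ω)) ∂P ≤ 2 * M + 1 := by
  have hm : ∀ i, Measurable fun ω => ah H θ (blk H N i (fun r => B r ω)) ^ 4 := fun i =>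
    (measurable_ah (fun p _ => blk_meas hB N i p) _ _).pow_const 4
  calc _ ≤ ∫⁻ ω, (1 * (ah H θ (blk H N i (fun r => B r ω)) ^ 4 + ah H θ (blk H N j (fun r => B r ω)) ^ 4) + 1⁻¹) ∂P :=
        lintegral_mono fun ω => mul_le_lam _ _ 1 one_ne_zero one_ne_top
    _ = (∫⁻ ω, ah H θ (blk H N i (fun r => B r ω)) ^ 4 ∂P) + (∫⁻ ω, ah H θ (blk H N j (fun r => B r ω)) ^ 4 ∂P) + 1 := by
        simp only [one_mul]
        rw [lintegral_add_right _ measurable_const, lintegral_add_left (hm i)]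
        simp
    _ ≤ _ := by
        rw [two_mul]
        exact add_le_add (add_le_add (ai_moment4 hB hH h hN i) (ai_moment4 hB hH h hN j)) le_rfl

lemma far_pair (hB : IsFBM H P B) (hH : H ∈ Ioo (0 : ℝ) (1 / 2)) :
    ∃ C : ℝ≥0∞, C < ⊤ ∧ ∀ (N i j : ℕ) (x : ℝ), 0 < N → 0 < x → x ≤ 1 → x ^ 16 = (N : ℝ)⁻¹ → i + 1 < j →
      (N : ℝ) ≤ ((j : ℝ) - i - 1) ^ 2 →
      ∫⁻ ω, ah H x (blk H N i (fun r => B r ω)) * ah H x (blk H N j (fun r => B r ω)) ∂P ≤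
        bE H P B ^ 2 + C * ENNReal.ofReal x := by
  obtain ⟨M, hM, hM4⟩ := ah_moment4 hB hH
  have hH0 := hH.1
  obtain ⟨p, hp⟩ := exists_nat_gt (max (2 / H) 16)
  have hp1 : 2 / H < p := (le_max_left _ _).trans_lt hp
  have hp2 : 16 ≤ p := by exact_mod_cast ((le_max_right _ _).trans_lt hp).le
  have hC0 : 0 < 2 / (1 - tq H) := div_pos (by norm_num) (by linarith [tq_lt hH0])
  have hpj := pjc_nonneg hB
  set q : ℝ := 1 / H - 1 with hq
  have hq0 : 0 ≤ q := by rw [hq, sub_nonneg, le_div_iff₀ hH0]; linarith [hH.2]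
  set D : ℝ := 2 / (1 - tq H) * pjc hB * 8 with hD
  have hD0 : 0 ≤ D := by positivity
  set Cπ : ℝ≥0∞ := ENNReal.ofReal D ^ p * gm p * CM H p with hCπ
  have hCπt : Cπ < ⊤ := ENNReal.mul_lt_top (ENNReal.mul_lt_top (by simp) (gm_lt_top p)) (CM_lt_top hH0 hp1)
  have hb := bE_lt_top hB hH
  refine ⟨ENNReal.ofReal (q * Real.exp q) * bE H P B ^ 2 + Cπ * (2 * M + 1) + 2 * M + Cπ, ?_, ?_⟩
  · refine ENNReal.add_lt_top.2 ⟨ENNReal.add_lt_top.2 ⟨ENNReal.add_lt_top.2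
      ⟨ENNReal.mul_lt_top (by simp) (ENNReal.pow_lt_top hb), ENNReal.mul_lt_top hCπt ?_⟩,
        ENNReal.mul_lt_top (by simp) hM⟩, hCπt⟩
    exact ENNReal.add_lt_top.2 ⟨ENNReal.mul_lt_top (by simp) hM, by simp⟩
  · intro N i j x hN hx hx1 hxN hij hNm
    have hN' : (0 : ℝ) < N := by exact_mod_cast hN
    have hm0 : (0 : ℝ) < (j : ℝ) - i - 1 := by
      have : ((i + 1 : ℕ) : ℝ) < j := by exact_mod_cast hij
      push_cast at this; linarith
    set m : ℝ := (j : ℝ) - i - 1 with hm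
    obtain ⟨G, mG, hG1, hG2⟩ := far_G hB hH hN hij (θ := x) (ρ := x / 8) hx (by positivity) (by linarith)
      (p := p) (by omega)
    have hmx : m ^ (H - 1) ≤ x ^ 4 := by
      have h1 : x ^ 8 * m ≥ 1 := by
        have : 1 ≤ (x ^ 8 * m) ^ 2 := by
          have e : (x ^ 8 * m) ^ 2 = (N : ℝ)⁻¹ * m ^ 2 := by rw [← hxN]; ring
          rw [e, ← div_eq_inv_mul, le_div_iff₀ hN']; linarith
        exact (one_le_sq_iff₀ (by positivity)).1 this
      have hm1 : 1 ≤ m := by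
        have : x ^ 8 ≤ 1 := pow_le_one₀ hx.le hx1
        nlinarith
      calc m ^ (H - 1) ≤ m ^ (-(1 / 2) : ℝ) := Real.rpow_le_rpow_of_exponent_le hm1 (by linarith [hH.2])
        _ = (m⁻¹) ^ (1 / 2 : ℝ) := by rw [Real.rpow_neg hm0.le, Real.inv_rpow hm0.le]
        _ ≤ (x ^ 8) ^ (1 / 2 : ℝ) := by
            refine Real.rpow_le_rpow (by positivity) ?_ (by norm_num)
            rw [inv_le_iff_one_le_mul₀ hm0]; exact h1
        _ = x ^ 4 := by
            rw [← Real.sqrt_eq_rpow, show x ^ 8 = (x ^ 4) ^ 2 by ring, Real.sqrt_sq (by positivity)]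
    have hx32 : ENNReal.ofReal (x ^ 2) ^ p ≤ ENNReal.ofReal x * ENNReal.ofReal (x ^ 16) := by
      rw [← ENNReal.ofReal_pow (by positivity), ← ENNReal.ofReal_mul hx.le]
      apply ENNReal.ofReal_le_ofReal
      calc (x ^ 2) ^ p = x ^ (2 * p) := by ring
        _ ≤ x ^ 17 := pow_le_pow_of_le_one hx.le hx1 (by omega)
        _ = _ := by ring
    have hπ : P Gᶜ ≤ Cπ * (ENNReal.ofReal x * ENNReal.ofReal (x ^ 16)) := by
      refine hG2.trans ?_
      have : 2 / (1 - tq H) * (pjc hB * m ^ (H - 1)) / (x / 8 * x) ≤ D * x ^ 2 := by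
        rw [div_le_iff₀ (by positivity)]
        calc 2 / (1 - tq H) * (pjc hB * m ^ (H - 1)) ≤ 2 / (1 - tq H) * (pjc hB * x ^ 4) := by gcongr
          _ = _ := by rw [hD]; ring
      calc _ ≤ ENNReal.ofReal (D * x ^ 2) ^ p * gm p * CM H p := by gcongr
        _ = Cπ * ENNReal.ofReal (x ^ 2) ^ p := by
            rw [ENNReal.ofReal_mul hD0, mul_pow, hCπ]; ring
        _ ≤ _ := by gcongr
    set a : ℕ → Ω → ℝ≥0∞ := fun i ω => ah H x (blk H N i (fun r => B r ω)) with ha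
    have hma : ∀ i, Measurable (a i) := fun i => measurable_ah (fun p _ => blk_meas hB N i p) _ _
    have hM4x := hM4 x hx hx1
    have b1 : ∫⁻ ω in G, a i ω * a j ω ∂P ≤ bE H P B ^ 2 + ENNReal.ofReal (q * Real.exp q) * bE H P B ^ 2 * ENNReal.ofReal x
        + Cπ * (2 * M + 1) * ENNReal.ofReal x := by
      have e : ∫⁻ ω in G, a i ω * a j ω ∂P = (∫⁻ ω in G, a i ω * a j ω ∂P) * P G +
          (∫⁻ ω in G, a i ω * a j ω ∂P) * P Gᶜ := by
        rw [← mul_add, prob_add_prob_compl mG, mul_one]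
      rw [e]
      refine add_le_add (hG1.trans ?_) ?_
      · calc _ ≤ ENNReal.ofReal (1 + q * Real.exp q * x) * bE H P B ^ 2 := by
              gcongr
              exact inv_pow_le hq0 hx.le hx1
          _ = _ := by
              rw [ENNReal.ofReal_add (by norm_num) (by positivity), ENNReal.ofReal_one,
                ENNReal.ofReal_mul (by positivity)]
              ring
      · calc _ ≤ (2 * M + 1) * (Cπ * (ENNReal.ofReal x * 1)) := by
              gcongr
              · exact (setLIntegral_le_lintegral _ _).trans (pair_M2 hB hH hM4x hN i j)
              · refine hπ.trans ?_
                gcongr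
                rw [← ENNReal.ofReal_one]
                exact ENNReal.ofReal_le_ofReal (pow_le_one₀ hx.le hx1)
          _ = _ := by ring
    have b2 : ∫⁻ ω in Gᶜ, a i ω * a j ω ∂P ≤ 2 * M * ENNReal.ofReal x + Cπ * ENNReal.ofReal x := by
      have hL0 : ENNReal.ofReal (x ^ 16) ≠ 0 := by
        rw [Ne, ENNReal.ofReal_eq_zero, not_le]; positivity
      calc _ ≤ ∫⁻ ω in Gᶜ, (ENNReal.ofReal (x ^ 16) * (a i ω ^ 4 + a j ω ^ 4) + (ENNReal.ofReal (x ^ 16))⁻¹) ∂P :=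
            lintegral_mono fun ω => mul_le_lam _ _ _ hL0 ENNReal.ofReal_ne_top
        _ = ENNReal.ofReal (x ^ 16) * (∫⁻ ω in Gᶜ, a i ω ^ 4 ∂P + ∫⁻ ω in Gᶜ, a j ω ^ 4 ∂P) +
              (ENNReal.ofReal (x ^ 16))⁻¹ * P Gᶜ := by
            rw [lintegral_add_right _ measurable_const, lintegral_const_mul' _ _ ENNReal.ofReal_ne_top,
              lintegral_add_left ((hma i).pow_const 4)]
            simp
        _ ≤ ENNReal.ofReal x * (M + M) +
              (ENNReal.ofReal (x ^ 16))⁻¹ * (Cπ * (ENNReal.ofReal x * ENNReal.ofReal (x ^ 16))) := by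
            gcongr
            · exact pow_le_of_le_one hx.le hx1 (by norm_num)
            · exact (setLIntegral_le_lintegral _ _).trans (ai_moment4 hB hH hM4x hN i)
            · exact (setLIntegral_le_lintegral _ _).trans (ai_moment4 hB hH hM4x hN j)
        _ = ENNReal.ofReal x * (M + M) +
              ((ENNReal.ofReal (x ^ 16))⁻¹ * ENNReal.ofReal (x ^ 16)) * (Cπ * ENNReal.ofReal x) := by ring
        _ = _ := by
            rw [ENNReal.inv_mul_cancel hL0 ENNReal.ofReal_ne_top]; ring
    rw [← lintegral_add_compl _ mG]
    refine (add_le_add b1 b2).trans (le_of_eq ?_)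
    ring

end P15

end

section



section P16
variable {Ω : Type*} [MeasurableSpace Ω] {P : Measure Ω} [IsProbabilityMeasure P]
variable {H : ℝ} {B : ℝ → Ω → ℝ}

lemma near_count (N K i : ℕ) :
    ∑ j ∈ Finset.range N, (if j ≤ i + K ∧ i ≤ j + K then (1 : ℝ≥0∞) else 0) ≤ (2 * K + 1 : ℕ) := by
  rw [Finset.sum_ite, Finset.sum_const_zero, add_zero, Finset.sum_const, nsmul_eq_mul, mul_one]
  have : (Finset.filter (fun j => j ≤ i + K ∧ i ≤ j + K) (Finset.range N)).card ≤ 2 * K + 1 := by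
    calc _ ≤ (Finset.Icc (i - K) (i + K)).card := by
          apply Finset.card_le_card
          intro j hj
          simp only [Finset.mem_filter, Finset.mem_range, Finset.mem_Icc] at hj ⊢
          omega
      _ ≤ _ := by rw [Nat.card_Icc]; omega
  exact_mod_cast this

lemma LLN_S (hB : IsFBM H P B) (hH : H ∈ Ioo (0 : ℝ) (1 / 2)) :
    ∃ C : ℝ≥0∞, C < ⊤ ∧ ∀ (N : ℕ) (x : ℝ), 0 < N → 0 < x → x ≤ 1 → x ^ 16 = (N : ℝ)⁻¹ →
      ∫⁻ ω, (ENNReal.ofReal (N : ℝ)⁻¹ * ∑ i ∈ Finset.range N, ah H x (blk H N i (fun r => B r ω))) ^ 2 ∂P ≤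
        bE H P B ^ 2 + C * ENNReal.ofReal x := by
  obtain ⟨M, hM, hM4⟩ := ah_moment4 hB hH
  obtain ⟨C, hC, hfar⟩ := far_pair hB hH
  refine ⟨C + 5 * (2 * M + 1), ?_, fun N x hN hx hx1 hxN => ?_⟩
  · refine ENNReal.add_lt_top.2 ⟨hC, ENNReal.mul_lt_top (by simp) (ENNReal.add_lt_top.2
      ⟨ENNReal.mul_lt_top (by simp) hM, by simp⟩)⟩
  have hN' : (0 : ℝ) < N := by exact_mod_cast hN
  set a : ℕ → Ω → ℝ≥0∞ := fun i ω => ah H x (blk H N i (fun r => B r ω)) with ha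
  have hma : ∀ i, Measurable (a i) := fun i => measurable_ah (fun p _ => blk_meas hB N i p) _ _
  set F : ℝ≥0∞ := bE H P B ^ 2 + C * ENNReal.ofReal x with hF
  set K := Nat.sqrt N + 1 with hK
  have hpair : ∀ i j, ∫⁻ ω, a i ω * a j ω ∂P ≤ F + (if j ≤ i + K ∧ i ≤ j + K then 1 else 0) * (2 * M + 1) := by
    have hsq : ∀ i j : ℕ, i + K < j → (N : ℝ) ≤ ((j : ℝ) - i - 1) ^ 2 := by
      intro i j h
      have h1 : N ≤ K ^ 2 := by
        have := Nat.lt_succ_sqrt N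
        rw [hK]; nlinarith
      have h2 : (K : ℝ) ≤ (j : ℝ) - i - 1 := by
        have : ((i + K + 1 : ℕ) : ℝ) ≤ j := by exact_mod_cast h
        push_cast at this; linarith
      calc (N : ℝ) ≤ (K : ℝ) ^ 2 := by exact_mod_cast h1
        _ ≤ _ := by gcongr
    intro i j
    by_cases h : j ≤ i + K ∧ i ≤ j + K
    · rw [if_pos h, one_mul]
      exact (pair_M2 hB hH (hM4 x hx hx1) hN i j).trans le_add_self
    · rw [if_neg h, zero_mul, add_zero]
      rw [not_and_or, not_le, not_le] at h
      rcases h with h | h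
      · exact hfar N i j x hN hx hx1 hxN (by omega) (hsq i j h)
      · refine le_trans (le_of_eq ?_) (hfar N j i x hN hx hx1 hxN (by omega) (hsq j i h))
        exact lintegral_congr fun ω => mul_comm _ _
  have e1 : ∀ ω, (ENNReal.ofReal (N : ℝ)⁻¹ * ∑ i ∈ Finset.range N, a i ω) ^ 2 =
      ENNReal.ofReal (N : ℝ)⁻¹ * ∑ i ∈ Finset.range N, (ENNReal.ofReal (N : ℝ)⁻¹ *
        ∑ j ∈ Finset.range N, a i ω * a j ω) := by
    intro ω
    rw [mul_pow, pow_two (∑ i ∈ Finset.range N, a i ω), Finset.sum_mul_sum, ← Finset.mul_sum]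
    ring
  have hmm : ∀ i j, Measurable (fun ω => a i ω * a j ω) := fun i j => (hma i).mul (hma j)
  rw [lintegral_congr e1, lintegral_const_mul' _ _ ENNReal.ofReal_ne_top, lintegral_finset_sum _ fun i _ =>
    (Finset.measurable_sum _ fun j _ => hmm i j).const_mul _]
  rw [← avg_const hN (bE H P B ^ 2 + (C + 5 * (2 * M + 1)) * ENNReal.ofReal x)]
  gcongr with i hi
  rw [lintegral_const_mul' _ _ ENNReal.ofReal_ne_top, lintegral_finset_sum _ fun j _ => hmm i j]
  calc _ ≤ ENNReal.ofReal (N : ℝ)⁻¹ * ∑ j ∈ Finset.range N,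
        (F + (if j ≤ i + K ∧ i ≤ j + K then 1 else 0) * (2 * M + 1)) := by
        gcongr with j hj
        exact hpair i j
    _ = F + ENNReal.ofReal (N : ℝ)⁻¹ * (∑ j ∈ Finset.range N, if j ≤ i + K ∧ i ≤ j + K then 1 else 0) * (2 * M + 1) := by
        rw [Finset.sum_add_distrib, mul_add, avg_const hN, ← Finset.sum_mul, mul_assoc]
    _ ≤ F + ENNReal.ofReal (5 * x) * (2 * M + 1) := by
        gcongr
        calc ENNReal.ofReal (N : ℝ)⁻¹ * _ ≤ ENNReal.ofReal (N : ℝ)⁻¹ * ENNReal.ofReal ((2 * K + 1 : ℕ) : ℝ) := by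
              gcongr
              rw [ENNReal.ofReal_natCast]
              exact near_count N K i
          _ ≤ _ := by
              rw [← ENNReal.ofReal_mul (by positivity)]
              apply ENNReal.ofReal_le_ofReal
              have h1 : (Nat.sqrt N : ℝ) * x ^ 8 ≤ 1 := by
                have : ((Nat.sqrt N : ℝ) * x ^ 8) ^ 2 ≤ 1 := by
                  have h2 : ((Nat.sqrt N : ℝ)) ^ 2 ≤ N := by exact_mod_cast Nat.sqrt_le' N
                  calc ((Nat.sqrt N : ℝ) * x ^ 8) ^ 2 = (Nat.sqrt N : ℝ) ^ 2 * x ^ 16 := by ring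
                    _ ≤ N * (N : ℝ)⁻¹ := by rw [hxN]; gcongr
                    _ = 1 := by field_simp
                exact (sq_le_one_iff₀ (by positivity)).1 this
              have h3 : x ^ 8 ≤ x := pow_le_of_le_one hx.le hx1 (by norm_num)
              have h4 : x ^ 16 ≤ x := pow_le_of_le_one hx.le hx1 (by norm_num)
              have h5 : (Nat.sqrt N : ℝ) * x ^ 16 ≤ x := by
                calc (Nat.sqrt N : ℝ) * x ^ 16 = ((Nat.sqrt N : ℝ) * x ^ 8) * x ^ 8 := by ring
                  _ ≤ 1 * x := by gcongr
                  _ = x := one_mul x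
              rw [← hxN, hK]; push_cast
              nlinarith
    _ = _ := by
        rw [hF, ENNReal.ofReal_mul (by norm_num)]
        simp only [ENNReal.ofReal_ofNat]
        ring

/-- the constant as a real number -/
def bR (H : ℝ) (P : Measure Ω) (B : ℝ → Ω → ℝ) : ℝ := (bE H P B).toReal

lemma bR_nonneg : 0 ≤ bR H P B := ENNReal.toReal_nonneg
lemma ofReal_bR (hB : IsFBM H P B) (hH : H ∈ Ioo (0 : ℝ) (1 / 2)) : ENNReal.ofReal (bR H P B) = bE H P B :=
  ENNReal.ofReal_toReal (bE_lt_top hB hH).ne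

lemma LLN (hB : IsFBM H P B) (hH : H ∈ Ioo (0 : ℝ) (1 / 2)) :
    ∃ C : ℝ≥0∞, C < ⊤ ∧ ∀ (N : ℕ) (x : ℝ), 0 < N → 0 < x → x ≤ 1 → x ^ 16 = (N : ℝ)⁻¹ →
      ∀ ε : ℝ, 0 < ε → ε * (N : ℝ) ^ H = x →
      ∫⁻ ω, ENNReal.ofReal (((ah H ε (fun r => B r ω)).toReal - bR H P B) ^ 2) ∂P ≤ C * ENNReal.ofReal x := by
  obtain ⟨C, hC, hS⟩ := LLN_S hB hH
  have hH0 := hH.1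
  have hb := bE_lt_top hB hH
  refine ⟨2 * (2 * bE H P B + C) + 2, ?_, fun N x hN hx hx1 hxN ε hε hεx => ?_⟩
  · exact ENNReal.add_lt_top.2 ⟨ENNReal.mul_lt_top (by simp) (ENNReal.add_lt_top.2
      ⟨ENNReal.mul_lt_top (by simp) hb, hC⟩), by simp⟩
  set b := bR H P B with hbdef
  have hb0 : 0 ≤ b := bR_nonneg
  set A : Ω → ℝ≥0∞ := fun ω => ENNReal.ofReal (N : ℝ)⁻¹ *
    ∑ i ∈ Finset.range N, ah H x (blk H N i (fun r => B r ω)) with hA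
  have hma : ∀ i, Measurable fun ω => ah H x (blk H N i (fun r => B r ω)) := fun i =>
    measurable_ah (fun p _ => blk_meas hB N i p) _ _
  have hmA : Measurable A := (Finset.measurable_sum _ fun i _ => hma i).const_mul _
  have hEA : ∫⁻ ω, A ω ∂P = gE H P B x := by
    rw [hA, lintegral_const_mul' _ _ ENNReal.ofReal_ne_top,
      lintegral_finset_sum _ fun i _ => hma i]
    rw [← avg_const hN (gE H P B x)]
    congr 1
    exact Finset.sum_congr rfl fun i _ => blk_lint hB hN i (meas_ah_pi H _)
  have hg : gE H P B x ≤ bE H P B := le_iSup₂_of_le x hx le_rfl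
  have hAfin : ∀ᵐ ω ∂P, A ω < ⊤ := ae_lt_top hmA (by rw [hEA]; exact (hg.trans_lt hb).ne)
  have hxH : x ^ (1 / H) ≤ x := by
    conv_rhs => rw [← Real.rpow_one x]
    refine Real.rpow_le_rpow_of_exponent_ge hx hx1 ?_
    rw [le_div_iff₀ hH0]; linarith [hH.2]
  have hvar : ∫⁻ ω, ENNReal.ofReal (((A ω).toReal - b) ^ 2) ∂P ≤ (2 * bE H P B + C) * ENNReal.ofReal x := by
    have e : ∫⁻ ω, (ENNReal.ofReal (((A ω).toReal - b) ^ 2) + 2 * bE H P B * A ω) ∂P =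
        ∫⁻ ω, (A ω ^ 2 + bE H P B ^ 2) ∂P := by
      apply lintegral_congr_ae
      filter_upwards [hAfin] with ω hω
      rw [← ofReal_bR hB hH, ← hbdef]
      conv_lhs => rw [show A ω = ENNReal.ofReal (A ω).toReal from (ENNReal.ofReal_toReal hω.ne).symm]
      conv_rhs => rw [show A ω = ENNReal.ofReal (A ω).toReal from (ENNReal.ofReal_toReal hω.ne).symm]
      rw [ENNReal.toReal_ofReal ENNReal.toReal_nonneg, show (2 : ℝ≥0∞) = ENNReal.ofReal 2 by simp,
        ← ENNReal.ofReal_mul (by norm_num), ← ENNReal.ofReal_mul (by positivity),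
        ← ENNReal.ofReal_pow (by positivity), ← ENNReal.ofReal_pow (by positivity),
        ← ENNReal.ofReal_add (by positivity) (by positivity), ← ENNReal.ofReal_add (by positivity) (by positivity)]
      congr 1; ring
    rw [lintegral_add_right _ (hmA.const_mul _), lintegral_const_mul _ hmA, hEA,
      lintegral_add_right _ measurable_const] at e
    simp only [lintegral_const, measure_univ, mul_one] at e
    have h1 : bE H P B ≤ gE H P B x + ENNReal.ofReal x :=
      (bE_le hB hH hx).trans (by gcongr)
    have h2 : ∫⁻ ω, A ω ^ 2 ∂P + bE H P B ^ 2 ≤ (2 * bE H P B + C) * ENNReal.ofReal x + 2 * bE H P B * gE H P B x := by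
      calc _ ≤ bE H P B ^ 2 + C * ENNReal.ofReal x + bE H P B ^ 2 := by
            gcongr
            exact hS N x hN hx hx1 hxN
        _ = 2 * bE H P B * bE H P B + C * ENNReal.ofReal x := by ring
        _ ≤ 2 * bE H P B * (gE H P B x + ENNReal.ofReal x) + C * ENNReal.ofReal x := by gcongr
        _ = _ := by ring
    rw [← e] at h2
    exact (ENNReal.add_le_add_iff_right (ENNReal.mul_lt_top (ENNReal.mul_lt_top (by simp) hb)
      (hg.trans_lt hb)).ne).1 h2
  have hpt : ∀ᵐ ω ∂P, ENNReal.ofReal (((ah H ε (fun r => B r ω)).toReal - b) ^ 2) ≤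
      2 * ENNReal.ofReal (((A ω).toReal - b) ^ 2) + 2 * ENNReal.ofReal x := by
    filter_upwards [hAfin] with ω hω
    obtain ⟨f1, f2⟩ := fekete_path hH0 hN hε (hB.1 ω)
    rw [hεx] at f1 f2
    have f3 : ah H ε (fun r => B r ω) ≤ A ω + ENNReal.ofReal x := f2.trans (by gcongr)
    have t1 : (A ω).toReal ≤ (ah H ε (fun r => B r ω)).toReal :=
      ENNReal.toReal_mono ((f3.trans_lt (ENNReal.add_lt_top.2 ⟨hω, by simp⟩)).ne) f1
    have t2 : (ah H ε (fun r => B r ω)).toReal ≤ (A ω).toReal + x := by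
      have := ENNReal.toReal_mono (ENNReal.add_lt_top.2 ⟨hω, by simp⟩).ne f3
      rwa [ENNReal.toReal_add hω.ne ENNReal.ofReal_ne_top, ENNReal.toReal_ofReal hx.le] at this
    rw [show (2 : ℝ≥0∞) = ENNReal.ofReal 2 by simp, ← ENNReal.ofReal_mul (by norm_num),
      ← ENNReal.ofReal_mul (by norm_num), ← ENNReal.ofReal_add (by positivity) (by positivity)]
    apply ENNReal.ofReal_le_ofReal
    set α := (ah H ε (fun r => B r ω)).toReal
    set β := (A ω).toReal
    have : (α - b) ^ 2 ≤ 2 * (β - b) ^ 2 + 2 * (α - β) ^ 2 := by nlinarith [sq_nonneg (β - b - (α - β))]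
    nlinarith
  calc _ ≤ ∫⁻ ω, (2 * ENNReal.ofReal (((A ω).toReal - b) ^ 2) + 2 * ENNReal.ofReal x) ∂P := lintegral_mono_ae hpt
    _ = 2 * ∫⁻ ω, ENNReal.ofReal (((A ω).toReal - b) ^ 2) ∂P + 2 * ENNReal.ofReal x := by
        rw [lintegral_add_right _ measurable_const, lintegral_const_mul' _ _ (by simp)]
        simp
    _ ≤ 2 * ((2 * bE H P B + C) * ENNReal.ofReal x) + 2 * ENNReal.ofReal x := by gcongr
    _ = _ := by ring

end P16

end

section



/-! ### Shift lemmas -/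

section P17
variable {Ω : Type*} [MeasurableSpace Ω] {P : Measure Ω} [IsProbabilityMeasure P]
variable {H : ℝ} {B : ℝ → Ω → ℝ}

/-- shifting a path by a ramp -/
def rsh (u s : ℝ) (w : ℝ → ℝ) (y : ℝ) : ℝ → ℝ := fun r => w r + ramp u s r * y

lemma meas_path (hB : IsFBM H P B) : Measurable fun ω => (fun r => B r ω) :=
  measurable_pi_lambda _ (fbm_meas hB)

lemma rsh_law (hB : IsFBM H P B) (hH : H ∈ Ioo (0 : ℝ) (1 / 2)) {u s : ℝ} (hu : 0 ≤ u) (hus : u < s) :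
    ∃ (R : Ω → ℝ → ℝ) (v : ℝ≥0), Measurable R ∧ shc hB * (s - u) ^ (2 * H) ≤ v ∧
      Measurable (fun z : Ω × ℝ => rsh u s (R z.1) z.2) ∧
      P.map (fun ω r => B r ω) = (P.prod (gaussianReal 0 v)).map (fun z => rsh u s (R z.1) z.2) := by
  obtain ⟨R, v, mR, hv, hlaw⟩ := shift_law hB hH hu hus
  refine ⟨fun ω r => R r ω, v, measurable_pi_lambda _ mR, hv, ?_, hlaw⟩
  refine measurable_pi_lambda _ fun r => ?_
  exact ((mR r).comp measurable_fst).add (measurable_snd.const_mul _)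

lemma shift_pos (hB : IsFBM H P B) (hH : H ∈ Ioo (0 : ℝ) (1 / 2)) {u s : ℝ} (hu : 0 ≤ u) (hus : u < s)
    {F S T : (ℝ → ℝ) → ℝ≥0∞} (mF : Measurable F) (mS : Measurable S) (mT : Measurable T)
    (hS : ∀ w y, S (rsh u s w y) = S w) (hT : ∀ w y, T (rsh u s w y) = T w)
    (h : ∀ w (v : ℝ≥0), shc hB * (s - u) ^ (2 * H) ≤ v → ∫⁻ y, F (rsh u s w y) ∂(gaussianReal 0 v) ≤ S w) :
    ∫⁻ ω, F (fun r => B r ω) * T (fun r => B r ω) ∂P ≤ ∫⁻ ω, S (fun r => B r ω) * T (fun r => B r ω) ∂P := by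
  obtain ⟨R, v, mR, hv, mz, hlaw⟩ := rsh_law hB hH hu hus
  have key : ∀ G : (ℝ → ℝ) → ℝ≥0∞, Measurable G → ∫⁻ ω, G (fun r => B r ω) ∂P =
      ∫⁻ ω, ∫⁻ y, G (rsh u s (R ω) y) ∂(gaussianReal 0 v) ∂P := by
    intro G mG
    have m : Measurable fun z : Ω × ℝ => G (rsh u s (R z.1) z.2) := mG.comp mz
    rw [← lintegral_map mG (meas_path hB), hlaw, lintegral_map mG mz,
      lintegral_prod _ m.aemeasurable]
  rw [key (fun w => F w * T w) (mF.mul mT), key (fun w => S w * T w) (mS.mul mT)]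
  refine lintegral_mono fun ω => ?_
  simp only [hT, hS]
  have m1 : Measurable fun y => F (rsh u s (R ω) y) := mF.comp (mz.comp measurable_prodMk_left)
  rw [lintegral_mul_const _ m1]
  simp only [lintegral_const, measure_univ, mul_one]
  gcongr
  exact h _ _ hv

lemma shift_sgn (hB : IsFBM H P B) (hH : H ∈ Ioo (0 : ℝ) (1 / 2)) {u s : ℝ} (hu : 0 ≤ u) (hus : u < s)
    {F G : (ℝ → ℝ) → ℝ} {T : (ℝ → ℝ) → ℝ≥0∞} (mF : Measurable F) (mG : Measurable G) (mT : Measurable T)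
    (hF : ∀ w y, F (rsh u s w y) = F w) (hT : ∀ w y, T (rsh u s w y) = T w)
    (hntg : Integrable (fun ω => F (fun r => B r ω) * G (fun r => B r ω)) P)
    (h : ∀ w (v : ℝ≥0), shc hB * (s - u) ^ (2 * H) ≤ v →
      ENNReal.ofReal |∫ y, G (rsh u s w y) ∂(gaussianReal 0 v)| ≤ T w) :
    ENNReal.ofReal |∫ ω, F (fun r => B r ω) * G (fun r => B r ω) ∂P| ≤
      ∫⁻ ω, ENNReal.ofReal |F (fun r => B r ω)| * T (fun r => B r ω) ∂P := by
  obtain ⟨R, v, mR, hv, mz, hlaw⟩ := rsh_law hB hH hu hus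
  have mFG : Measurable fun w => F w * G w := mF.mul mG
  have i1 : Integrable (fun w => F w * G w) ((P.prod (gaussianReal 0 v)).map (fun z => rsh u s (R z.1) z.2)) := by
    rw [← hlaw, integrable_map_measure mFG.aestronglyMeasurable (meas_path hB).aemeasurable]
    exact hntg
  rw [integrable_map_measure mFG.aestronglyMeasurable mz.aemeasurable] at i1
  have i1' : Integrable (fun z : Ω × ℝ => F (rsh u s (R z.1) z.2) * G (rsh u s (R z.1) z.2))
      (P.prod (gaussianReal 0 v)) := i1
  have e1 : ∫ ω, F (fun r => B r ω) * G (fun r => B r ω) ∂P =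
      ∫ ω, F (R ω) * ∫ y, G (rsh u s (R ω) y) ∂(gaussianReal 0 v) ∂P := by
    rw [← integral_map (f := fun w => F w * G w) (meas_path hB).aemeasurable mFG.aestronglyMeasurable, hlaw,
      integral_map mz.aemeasurable mFG.aestronglyMeasurable, integral_prod _ i1']
    refine integral_congr_ae (Eventually.of_forall fun ω => ?_)
    simp only [hF]
    rw [integral_const_mul]
  have mAT : Measurable fun w => ENNReal.ofReal |F w| * T w := (measurable_norm.comp mF).ennreal_ofReal.mul mT
  have mAT' : Measurable fun z : Ω × ℝ =>
      ENNReal.ofReal |F (rsh u s (R z.1) z.2)| * T (rsh u s (R z.1) z.2) := mAT.comp mz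
  rw [e1, ← lintegral_map mAT (meas_path hB), hlaw, lintegral_map mAT mz,
      lintegral_prod _ mAT'.aemeasurable, ← Real.norm_eq_abs, ofReal_norm_eq_enorm]
  refine (enorm_integral_le_lintegral_enorm _).trans (lintegral_mono fun ω => ?_)
  simp only [hT, hF, lintegral_const, measure_univ, mul_one]
  rw [enorm_mul, ← ofReal_norm_eq_enorm, ← ofReal_norm_eq_enorm, Real.norm_eq_abs, Real.norm_eq_abs]
  gcongr
  exact h _ _ hv

lemma conv_pos {U : ℝ → ℝ≥0∞} {v : ℝ≥0} {c : ℝ} (hc : 0 < c) (hv : c ≤ v) :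
    ∫⁻ y, U y ∂(gaussianReal 0 v) ≤ ENNReal.ofReal (c ^ (-(1 / 2) : ℝ)) * ∫⁻ y, U y := by
  have hv0 : v ≠ 0 := by rintro rfl; simp at hv; linarith
  rw [gaussianReal_of_var_ne_zero _ hv0]
  refine (lintegral_withDensity_le_lintegral_mul _ (measurable_gaussianPDF _ _) U).trans ?_
  rw [← lintegral_const_mul' _ _ ENNReal.ofReal_ne_top]
  refine lintegral_mono fun y => ?_
  simp only [Pi.mul_apply]
  gcongr
  unfold gaussianPDF
  refine ENNReal.ofReal_le_ofReal ((gaussPDF_le hv0 y).trans ?_)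
  exact Real.rpow_le_rpow_of_nonpos hc hv (by norm_num)

lemma conv_bound {U V : ℝ → ℝ} {v : ℝ≥0} {c y0 ρ1 ρ2 : ℝ} (hc : 0 < c) (hv : c ≤ v)
    (hU : ∀ y, 0 ≤ U y) (hV : ∀ y, 0 ≤ V y) (iU : Integrable U) (iV : Integrable V)
    (hρ1 : 0 ≤ ρ1) (hρ2 : 0 ≤ ρ2)
    (sU : ∀ y, U y ≠ 0 → |y - y0| ≤ ρ1) (sV : ∀ y, V y ≠ 0 → |y - y0| ≤ ρ2) :
    |∫ y, (U y - V y) ∂(gaussianReal 0 v)| ≤ c ^ (-(1 / 2) : ℝ) * |(∫ y, U y) - ∫ y, V y|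
      + c⁻¹ * (ρ1 * (∫ y, U y) + ρ2 * ∫ y, V y) := by
  have hv0 : v ≠ 0 := by rintro rfl; simp at hv; linarith
  rw [integral_gaussianReal_eq_integral_smul hv0]
  set p := gaussianPDFReal 0 v
  have bd : ∀ (W : ℝ → ℝ) (ρ : ℝ), 0 ≤ ρ → (∀ y, 0 ≤ W y) → (∀ y, W y ≠ 0 → |y - y0| ≤ ρ) →
      ∀ y, ‖(p y - p y0) * W y‖ ≤ c⁻¹ * (ρ * W y) := by
    intro W ρ hρ hW sW y
    by_cases h : W y = 0
    · simp [h]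
    rw [norm_mul, Real.norm_eq_abs, Real.norm_eq_abs, abs_of_nonneg (hW y), ← mul_assoc]
    refine mul_le_mul_of_nonneg_right ?_ (hW y)
    refine (gaussPDF_lip hv0 y y0).trans ?_
    rw [div_eq_inv_mul]
    have : (v : ℝ)⁻¹ ≤ c⁻¹ := inv_anti₀ hc hv
    have := sW y h
    have : 0 ≤ (v : ℝ)⁻¹ := by positivity
    gcongr
  have mp : Measurable p := measurable_gaussianPDFReal _ _
  have ii : ∀ (W : ℝ → ℝ) (ρ : ℝ), 0 ≤ ρ → (∀ y, 0 ≤ W y) → Integrable W → (∀ y, W y ≠ 0 → |y - y0| ≤ ρ) →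
      Integrable (fun y => (p y - p y0) * W y) ∧ |∫ y, (p y - p y0) * W y| ≤ c⁻¹ * (ρ * ∫ y, W y) := by
    intro W ρ hρ hW iW sW
    have i2 : Integrable (fun y => c⁻¹ * (ρ * W y)) := (iW.const_mul _).const_mul _
    refine ⟨i2.mono' ((mp.sub_const _).aestronglyMeasurable.mul iW.aestronglyMeasurable)
      (Eventually.of_forall (bd W ρ hρ hW sW)), ?_⟩
    rw [← Real.norm_eq_abs]
    refine (norm_integral_le_of_norm_le i2 (Eventually.of_forall (bd W ρ hρ hW sW))).trans (le_of_eq ?_)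
    rw [integral_const_mul, integral_const_mul]
  obtain ⟨jU, bU⟩ := ii U ρ1 hρ1 hU iU sU
  obtain ⟨jV, bV⟩ := ii V ρ2 hρ2 hV iV sV
  have e : ∀ y, p y • (U y - V y) = ((p y - p y0) * U y - (p y - p y0) * V y) + p y0 * (U y - V y) := by
    intro y; simp only [smul_eq_mul]; ring
  simp_rw [e]
  have k1 : Integrable (fun y => (p y - p y0) * U y - (p y - p y0) * V y) := jU.sub jV
  have k2 : Integrable (fun y => p y0 * (U y - V y)) := (iU.sub iV).const_mul _
  rw [integral_add k1 k2, integral_sub jU jV, integral_const_mul,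
    integral_sub iU iV]
  have h0 : p y0 ≤ c ^ (-(1 / 2) : ℝ) :=
    (gaussPDF_le hv0 y0).trans (Real.rpow_le_rpow_of_nonpos hc hv (by norm_num))
  have h1 : 0 ≤ p y0 := gaussianPDFReal_nonneg _ _ _
  have h2 : |p y0 * ((∫ y, U y) - ∫ y, V y)| ≤ c ^ (-(1 / 2) : ℝ) * |(∫ y, U y) - ∫ y, V y| := by
    rw [abs_mul, abs_of_nonneg h1]; gcongr
  calc _ ≤ |∫ y, (p y - p y0) * U y| + |∫ y, (p y - p y0) * V y| + |p y0 * ((∫ y, U y) - ∫ y, V y)| := by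
        refine (abs_add_le _ _).trans ?_
        gcongr
        exact abs_sub _ _
    _ ≤ _ := by rw [mul_add]; linarith

/-- tent function -/
def tent (η z : ℝ) : ℝ := max 0 (η - |z|) / η ^ 2

lemma tent_nonneg (η z : ℝ) : 0 ≤ tent η z := by unfold tent; positivity

lemma tent_cont (η : ℝ) : Continuous (tent η) := by unfold tent; fun_prop

lemma tent_le {η : ℝ} (h : 0 < η) (z : ℝ) : tent η z ≤ η⁻¹ := by
  unfold tent
  rw [div_le_iff₀ (by positivity)]
  have : η⁻¹ * η ^ 2 = η := by field_simp
  rw [this]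
  exact max_le h.le (by linarith [abs_nonneg z])

lemma tent_supp {η : ℝ} (h : 0 < η) (z : ℝ) (hz : tent η z ≠ 0) : |z| ≤ η := by
  by_contra h2
  push Not at h2
  exact hz (by unfold tent; rw [max_eq_left (by linarith)]; simp)

lemma tent_lip {η : ℝ} (h : 0 < η) (y z : ℝ) : |tent η y - tent η z| ≤ (η ^ 2)⁻¹ * |y - z| := by
  unfold tent
  rw [← sub_div, abs_div, abs_of_pos (by positivity : 0 < η ^ 2), div_eq_inv_mul]
  refine mul_le_mul_of_nonneg_left ?_ (by positivity)
  refine (abs_max_sub_max_le_max 0 (η - |y|) 0 (η - |z|)).trans ?_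
  rw [sub_self, abs_zero]
  refine max_le (abs_nonneg _) ?_
  have : η - |y| - (η - |z|) = |z| - |y| := by ring
  rw [this]
  rw [abs_sub_comm y z]
  exact abs_abs_sub_abs_le z y

lemma tent_int_le {η : ℝ} (h : 0 < η) : Integrable (tent η) := by
  refine (tent_cont η).integrable_of_hasCompactSupport ?_
  refine HasCompactSupport.of_support_subset_isCompact (isCompact_Icc (a := -η) (b := η)) ?_
  intro z hz
  exact abs_le.1 (tent_supp h z hz)

lemma tent_int {η : ℝ} (h : 0 < η) : ∫ z, tent η z = 1 := by
  have e : tent η = fun z => (fun x => max 0 (η - x) / η ^ 2) |z| := rfl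
  rw [e, integral_comp_abs]
  have h1 : ∫ x in Ioi (0 : ℝ), max 0 (η - x) / η ^ 2 = ∫ x in (0 : ℝ)..η, (η - x) / η ^ 2 := by
    rw [intervalIntegral.integral_of_le h.le]
    have : Ioi (0 : ℝ) = Ioc 0 η ∪ Ioi η := (Ioc_union_Ioi_eq_Ioi h.le).symm
    have e2 : ∀ x, x ∈ Ioi η → max 0 (η - x) / η ^ 2 = 0 := by
      intro x hx
      rw [max_eq_left (by have := hx.out; linarith)]; simp
    rw [setIntegral_eq_of_subset_of_forall_diff_eq_zero (s := Ioc 0 η) (t := Ioi 0) measurableSet_Ioi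
      (fun x hx => hx.1)]
    · refine setIntegral_congr_fun measurableSet_Ioc fun x hx => ?_
      show max 0 (η - x) / η ^ 2 = (η - x) / η ^ 2
      rw [max_eq_right (by linarith [hx.2])]
    · intro x hx
      refine e2 x ?_
      by_contra h3
      exact hx.2 ⟨hx.1, not_lt.1 h3⟩
  rw [h1, intervalIntegral.integral_div]
  rw [intervalIntegral.integral_sub (by simp) (by simp)]
  simp
  field_simp
  ring

end P17

end

section



/-! ### Block functionals -/

section P18
variable {Ω : Type*} [MeasurableSpace Ω] {P : Measure Ω} [IsProbabilityMeasure P]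
variable {H : ℝ} {B : ℝ → Ω → ℝ}

lemma Mx_congr {τ : ℝ} {w w' : ℝ → ℝ} (h : ∀ p ∈ dya, w p = w' p) : Mx τ w = Mx τ w' := by
  unfold Mx
  refine iSup_congr fun m => iSup_congr fun k => iSup_congr fun hk => ?_
  have h1 := h (((k : ℝ) + 1) / 2 ^ m) ⟨m, k + 1, hk, by push_cast; rfl⟩
  have h2 := h ((k : ℝ) / 2 ^ m) ⟨m, k, hk.le, rfl⟩
  rw [h1, h2]

lemma meas_Mx_pi (τ : ℝ) : Measurable fun w : ℝ → ℝ => Mx τ w :=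
  measurable_Mx (W := fun w : ℝ → ℝ => w) τ (fun p _ => measurable_pi_apply p)

/-- normalised number of upcrossings in a block -/
def uu (H : ℝ) (N : ℕ) (ε l : ℝ) (i : ℕ) (w : ℝ → ℝ) : ℝ≥0∞ :=
  ENNReal.ofReal (ε ^ (1 / H - 1)) * Up (blkD N i) l (l + ε) w

/-- difference with the tent occupation -/
def dd (H : ℝ) (N : ℕ) (ε l η b : ℝ) (i : ℕ) (w : ℝ → ℝ) : ℝ :=
  (uu H N ε l i w).toReal - b * (N : ℝ)⁻¹ * tent η (w (i / N) - l)

lemma meas_uu (H : ℝ) (N : ℕ) (ε l : ℝ) (i : ℕ) : Measurable (uu H N ε l i) := by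
  unfold uu
  exact (measurable_Up (Z := ℝ → ℝ) (W := fun w => w) (blkD_countable N i) measurable_const measurable_const
    (fun p _ => measurable_pi_apply p)).const_mul _

lemma meas_dd (H : ℝ) (N : ℕ) (ε l η b : ℝ) (i : ℕ) : Measurable (dd H N ε l η b i) := by
  unfold dd
  have h1 := (meas_uu H N ε l i).ennreal_toReal
  have h2 : Measurable fun w : ℝ → ℝ => tent η (w (i / N) - l) :=
    (tent_cont η).measurable.comp (by fun_prop)
  exact h1.sub (h2.const_mul _)

lemma uu_congr {N : ℕ} {ε l : ℝ} {i : ℕ} {w w' : ℝ → ℝ} (h : ∀ p ∈ blkD N i, w p = w' p) :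
    uu H N ε l i w = uu H N ε l i w' := by unfold uu; rw [Up_congr h]

lemma dd_congr {N : ℕ} {ε l η b : ℝ} {i : ℕ} {w w' : ℝ → ℝ} (h : ∀ p ∈ blkD N i, w p = w' p) :
    dd H N ε l η b i w = dd H N ε l η b i w' := by
  unfold dd; rw [uu_congr h, h _ (blkD_left N i)]

lemma rsh_before {N : ℕ} (hN : 0 < N) {i : ℕ} {u s : ℝ} (hus : u < s) (hi : ((i + 1 : ℕ) : ℝ) / N ≤ u)
    (w : ℝ → ℝ) (y : ℝ) : ∀ p ∈ blkD N i, rsh u s w y p = w p := by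
  intro p hp
  unfold rsh
  rw [ramp_le hus (((blkD_sub hN i hp).2).trans hi)]; simp

lemma rsh_after {N : ℕ} (hN : 0 < N) {i : ℕ} {u s : ℝ} (hus : u < s) (hi : s ≤ (i : ℝ) / N)
    (w : ℝ → ℝ) (y : ℝ) : ∀ p ∈ blkD N i, rsh u s w y p = w p + y := by
  intro p hp
  unfold rsh
  rw [ramp_ge hus (hi.trans (blkD_sub hN i hp).1)]; simp

lemma blk_add {N : ℕ} {i : ℕ} {w w' : ℝ → ℝ} {y : ℝ} (h : ∀ p ∈ blkD N i, w' p = w p + y) :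
    ∀ r ∈ dya, blk H N i w' r = blk H N i w r := by
  intro r hr
  unfold blk
  rw [h _ ⟨r, hr, rfl⟩, h _ (blkD_left N i)]
  ring

lemma lint_uu (hH : 0 < H) {N : ℕ} (hN : 0 < N) {ε : ℝ} (hε : 0 < ε) (l : ℝ) (i : ℕ) (w : ℝ → ℝ) :
    ∫⁻ y, uu H N ε l i (fun r => w r + y) =
      ENNReal.ofReal (N : ℝ)⁻¹ * ah H (ε * (N : ℝ) ^ H) (blk H N i w) := by
  rw [← ah_blk hH hN i hε w]
  unfold uu kap
  rw [lintegral_const_mul' _ _ ENNReal.ofReal_ne_top]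
  congr 1
  have e : ∀ y, Up (blkD N i) l (l + ε) (fun r => w r + y) = Up (blkD N i) (l - y) (l - y + ε) w := by
    intro y; rw [Up_shift]; congr 1; ring
  simp_rw [e]
  exact lintegral_sub_left_eq_self (fun x => Up (blkD N i) x (x + ε) w) l

/-- distance to b in the extended sense -/
def eb (b : ℝ) (a : ℝ≥0∞) : ℝ≥0∞ := if a = ⊤ then ⊤ else ENNReal.ofReal |a.toReal - b|

lemma meas_eb (b : ℝ) : Measurable (eb b) := by
  unfold eb
  refine Measurable.ite (measurableSet_singleton _) measurable_const ?_
  have : Measurable fun a : ℝ≥0∞ => a.toReal - b := ENNReal.measurable_toReal.sub_const b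
  exact (measurable_norm.comp this).ennreal_ofReal

lemma osc_blk {N : ℕ} (hN : 0 < N) {i : ℕ} {w : ℝ → ℝ} (hM : Mx (tq H) (blk H N i w) ≠ ⊤) (hH : 0 < H) :
    ∀ p ∈ blkD N i, |w p - w (i / N)| ≤
      ((N : ℝ) ^ H)⁻¹ * (2 / (1 - tq H)) * (Mx (tq H) (blk H N i w)).toReal := by
  rintro _ ⟨r, hr, rfl⟩
  have hN' : (0 : ℝ) < (N : ℝ) ^ H := by have : (0 : ℝ) < N := by exact_mod_cast hN
                                         positivity
  have h1 : 0 < 1 - tq H := by have := tq_lt hH; linarith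
  have h := osc_le_Mx (w := blk H N i w) (tq_pos H) (tq_lt hH) zero_mem_dya hr
  rw [← ENNReal.ofReal_toReal hM, ← ENNReal.ofReal_mul (by positivity),
    ENNReal.ofReal_le_ofReal_iff (by positivity)] at h
  have e : blk H N i w r - blk H N i w 0 = (N : ℝ) ^ H * (w ((N : ℝ)⁻¹ * r + i / N) - w (i / N)) := by
    unfold blk; simp
  rw [e, abs_mul, abs_of_pos hN'] at h
  rw [mul_assoc, ← div_eq_inv_mul, le_div_iff₀ hN']
  simp only
  linarith

/-- bound after conditioning -/
def ZZ (H : ℝ) (N : ℕ) (θ η b : ℝ) (j : ℕ) (w : ℝ → ℝ) : ℝ≥0∞ :=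
  eb b (ah H θ (blk H N j w)) +
    ENNReal.ofReal (((N : ℝ) ^ H)⁻¹ * (2 / (1 - tq H))) *
      (Mx (tq H) (blk H N j w) * ah H θ (blk H N j w)) + ENNReal.ofReal (η * b)

lemma meas_ahb (H θ : ℝ) (N j : ℕ) : Measurable fun w : ℝ → ℝ => ah H θ (blk H N j w) :=
  measurable_ah (fun p _ => blk_meas_pi H N j p) H θ

lemma meas_Mxb (H : ℝ) (N j : ℕ) : Measurable fun w : ℝ → ℝ => Mx (tq H) (blk H N j w) :=
  measurable_Mx _ (fun p _ => blk_meas_pi H N j p)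

lemma meas_ZZ (H : ℝ) (N : ℕ) (θ η b : ℝ) (j : ℕ) : Measurable (ZZ H N θ η b j) := by
  unfold ZZ
  exact (((meas_eb b).comp (meas_ahb H θ N j)).add
    (((meas_Mxb H N j).mul (meas_ahb H θ N j)).const_mul _)).add measurable_const

lemma ZZ_inv {N : ℕ} {θ η b : ℝ} {j : ℕ} {w w' : ℝ → ℝ} {y : ℝ} (h : ∀ p ∈ blkD N j, w' p = w p + y) :
    ZZ H N θ η b j w' = ZZ H N θ η b j w := by
  unfold ZZ
  rw [ah_congr (blk_add h), Mx_congr (blk_add h)]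

lemma cond_dd (hH : 0 < H) {N : ℕ} (hN : 0 < N) {ε : ℝ} (hε : 0 < ε) (l : ℝ) {η b : ℝ} (hη : 0 < η)
    (hb : 0 ≤ b) (j : ℕ) (w : ℝ → ℝ) {c : ℝ} {v : ℝ≥0} (hc : 0 < c) (hv : c ≤ v) :
    ENNReal.ofReal |∫ y, dd H N ε l η b j (fun r => w r + y) ∂(gaussianReal 0 v)| ≤
      ENNReal.ofReal (c ^ (-(1 / 2) : ℝ) + c⁻¹) * (ENNReal.ofReal (N : ℝ)⁻¹ *
        ZZ H N (ε * (N : ℝ) ^ H) η b j w) := by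
  have hN' : (0 : ℝ) < N := by exact_mod_cast hN
  have hcc : 0 < c ^ (-(1 / 2) : ℝ) + c⁻¹ := by positivity
  have t1 : 0 < 1 - tq H := by have := tq_lt hH; linarith
  set a := ah H (ε * (N : ℝ) ^ H) (blk H N j w) with ha
  set m := Mx (tq H) (blk H N j w) with hm
  have top : ZZ H N (ε * (N : ℝ) ^ H) η b j w = ⊤ → ENNReal.ofReal (c ^ (-(1 / 2) : ℝ) + c⁻¹) *
      (ENNReal.ofReal (N : ℝ)⁻¹ * ZZ H N (ε * (N : ℝ) ^ H) η b j w) = ⊤ := by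
    intro h
    rw [h, ENNReal.mul_top (by simpa using hN.ne'), ENNReal.mul_top (by simpa using hcc)]
  by_cases hat : a = ⊤
  · rw [top]
    · exact le_top
    · unfold ZZ eb; rw [← ha, if_pos hat]; simp
  have lU := lint_uu hH hN hε l j w
  rw [← ha] at lU
  have lU' : ∫⁻ y, uu H N ε l j (fun r => w r + y) ≠ ⊤ := by
    rw [lU]; exact ENNReal.mul_ne_top ENNReal.ofReal_ne_top hat
  have mU : Measurable fun y : ℝ => uu H N ε l j (fun r => w r + y) :=
    (meas_uu H N ε l j).comp (by fun_prop)
  have iU := integrable_toReal_of_lintegral_ne_top mU.aemeasurable lU'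
  have eU : ∫ y, (uu H N ε l j (fun r => w r + y)).toReal = (N : ℝ)⁻¹ * a.toReal := by
    rw [integral_toReal mU.aemeasurable (ae_lt_top mU lU'), lU, ENNReal.toReal_mul,
      ENNReal.toReal_ofReal (by positivity)]
  have iV0 : Integrable fun y : ℝ => tent η (w (j / N) + y - l) := by
    have := (tent_int_le hη).comp_add_left (w (j / N) - l)
    refine this.congr (Eventually.of_forall fun y => ?_)
    simp only; congr 1; ring
  have eV0 : ∫ y : ℝ, tent η (w (j / N) + y - l) = 1 := by
    rw [← tent_int hη, ← integral_add_left_eq_self (fun y => tent η y) (w (j / N) - l)]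
    refine integral_congr_ae (Eventually.of_forall fun y => ?_)
    simp only; congr 1; ring
  by_cases hmt : m = ⊤
  · by_cases ha0 : a = 0
    · -- the block gives no crossing for a.e. level; only the tent matters
      have hz : (fun y : ℝ => uu H N ε l j (fun r => w r + y)) =ᵐ[volume] 0 := by
        rw [← lintegral_eq_zero_iff mU, lU, ha0, mul_zero]
      have key := conv_bound (U := fun _ => 0) (V := fun y => b * (N : ℝ)⁻¹ * tent η (w (j / N) + y - l))
        (y0 := l - w (j / N)) (ρ1 := 0) (ρ2 := η) hc hv (fun _ => le_rfl)
        (fun y => by have := tent_nonneg η (w (j / N) + y - l); positivity) (by simp) (iV0.const_mul _) le_rfl hη.le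
        (by simp) (fun y hy => by
          have := tent_supp hη (w (j / N) + y - l) (by intro h; exact hy (by rw [h, mul_zero]))
          convert this using 2; ring)
      have ac : gaussianReal 0 v ≪ volume := gaussianReal_absolutelyContinuous _
        (by rintro rfl; simp at hv; linarith)
      have e0 : ∫ y, dd H N ε l η b j (fun r => w r + y) ∂(gaussianReal 0 v) =
          ∫ y, (0 - b * (N : ℝ)⁻¹ * tent η (w (j / N) + y - l)) ∂(gaussianReal 0 v) := by
        refine integral_congr_ae ?_
        filter_upwards [ac.ae_le hz] with y hy
        unfold dd
        have hy' : uu H N ε l j (fun r => w r + y) = 0 := hy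
        rw [hy']; simp
      rw [e0]
      simp only [integral_const_mul, eV0, integral_zero] at key
      rw [← ENNReal.ofReal_toReal hat] at ha
      refine (ENNReal.ofReal_le_ofReal key).trans ?_
      unfold ZZ
      rw [← ha, ENNReal.ofReal_toReal hat, ha0]
      simp only [eb, ENNReal.zero_ne_top, if_false, ENNReal.toReal_zero, mul_zero, add_zero, zero_add]
      rw [← ENNReal.ofReal_add (by positivity) (by positivity), ← ENNReal.ofReal_mul (by positivity),
        ← ENNReal.ofReal_mul (by positivity)]
      refine ENNReal.ofReal_le_ofReal ?_
      have h1 : |0 - b * (N : ℝ)⁻¹ * 1| = b * (N : ℝ)⁻¹ := by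
        rw [zero_sub, abs_neg, mul_one, abs_of_nonneg (by positivity)]
      have h2 : |0 - b| = b := by rw [zero_sub, abs_neg, abs_of_nonneg hb]
      have p1 : 0 ≤ c ^ (-(1 / 2) : ℝ) := by positivity
      have p2 : 0 ≤ c⁻¹ := by positivity
      have p3 : 0 ≤ (N : ℝ)⁻¹ * b := by positivity
      have p4 : 0 ≤ (N : ℝ)⁻¹ * (η * b) := by positivity
      simp only [mul_zero, zero_mul, zero_add, h1, h2]
      nlinarith [mul_nonneg p1 p4, mul_nonneg p2 p3]
    · rw [top]
      · exact le_top
      · unfold ZZ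
        rw [← ha, ← hm, hmt, ENNReal.top_mul ha0, ENNReal.mul_top]
        · simp
        · simp; positivity
  have key := conv_bound (U := fun y => (uu H N ε l j (fun r => w r + y)).toReal)
    (V := fun y => b * (N : ℝ)⁻¹ * tent η (w (j / N) + y - l))
    (y0 := l - w (j / N)) (ρ1 := ((N : ℝ) ^ H)⁻¹ * (2 / (1 - tq H)) * m.toReal) (ρ2 := η) hc hv
    (fun _ => ENNReal.toReal_nonneg)
    (fun y => by have := tent_nonneg η (w (j / N) + y - l); positivity) iU (iV0.const_mul _) (by positivity) hη.le
    (fun y hy => by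
      by_contra hcon
      apply hy
      have ho := osc_blk hN hmt hH
      have : Up (blkD N j) l (l + ε) (fun r => w r + y) = 0 := by
        apply Up_eq_zero
        by_contra h2
        push Not at h2
        obtain ⟨⟨p, hp, hp2⟩, q, hq, hq2⟩ := h2
        have h3 := abs_le.1 (ho p hp)
        have h4 := abs_le.1 (ho q hq)
        apply hcon
        rw [abs_le]
        constructor <;> linarith
      unfold uu
      rw [this]; simp)
    (fun y hy => by
      have := tent_supp hη (w (j / N) + y - l) (by intro h; exact hy (by rw [h, mul_zero]))
      convert this using 2; ring)
  simp only [integral_const_mul, eV0, eU, mul_one] at key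
  refine (ENNReal.ofReal_le_ofReal key).trans ?_
  unfold ZZ
  rw [← ha, ← hm]
  have e1 : eb b a = ENNReal.ofReal |a.toReal - b| := by unfold eb; rw [if_neg hat]
  have e2 : m * a = ENNReal.ofReal (m.toReal * a.toReal) := by
    rw [ENNReal.ofReal_mul ENNReal.toReal_nonneg, ENNReal.ofReal_toReal hat, ENNReal.ofReal_toReal hmt]
  have pa : 0 ≤ a.toReal := ENNReal.toReal_nonneg
  have pm : 0 ≤ m.toReal := ENNReal.toReal_nonneg
  rw [e1, e2, ← ENNReal.ofReal_mul (by positivity), ← ENNReal.ofReal_add (by positivity) (by positivity),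
    ← ENNReal.ofReal_add (by positivity) (by positivity), ← ENNReal.ofReal_mul (by positivity),
    ← ENNReal.ofReal_mul (by positivity)]
  refine ENNReal.ofReal_le_ofReal ?_
  have h1 : |(N : ℝ)⁻¹ * a.toReal - b * (N : ℝ)⁻¹| = (N : ℝ)⁻¹ * |a.toReal - b| := by
    rw [mul_comm b, ← mul_sub, abs_mul, abs_of_pos (inv_pos.2 hN')]
  rw [h1]
  have p1 : 0 ≤ c ^ (-(1 / 2) : ℝ) := by positivity
  have p2 : 0 ≤ c⁻¹ := by positivity
  have p3 : 0 ≤ (N : ℝ)⁻¹ * |a.toReal - b| := by positivity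
  have p4 : 0 ≤ (N : ℝ)⁻¹ * (((N : ℝ) ^ H)⁻¹ * (2 / (1 - tq H)) * (m.toReal * a.toReal) + η * b) := by positivity
  have := mul_nonneg p1 p4
  have := mul_nonneg p2 p3
  refine le_of_sub_nonneg ?_
  have e3 : (c ^ (-(1 / 2) : ℝ) + c⁻¹) * ((N : ℝ)⁻¹ * (|a.toReal - b| +
      ((N : ℝ) ^ H)⁻¹ * (2 / (1 - tq H)) * (m.toReal * a.toReal) + η * b)) -
      (c ^ (-(1 / 2) : ℝ) * ((N : ℝ)⁻¹ * |a.toReal - b|) +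
        c⁻¹ * (((N : ℝ) ^ H)⁻¹ * (2 / (1 - tq H)) * m.toReal * ((N : ℝ)⁻¹ * a.toReal) + η * (b * (N : ℝ)⁻¹))) =
      c ^ (-(1 / 2) : ℝ) * ((N : ℝ)⁻¹ * (((N : ℝ) ^ H)⁻¹ * (2 / (1 - tq H)) * (m.toReal * a.toReal) + η * b)) +
      c⁻¹ * ((N : ℝ)⁻¹ * |a.toReal - b|) := by ring
  rw [e3]
  positivity

lemma abs_dd_le (hH : 0 < H) {N : ℕ} (hN : 0 < N) {ε : ℝ} (hε : 0 < ε) (l : ℝ) {η b : ℝ} (hη : 0 < η)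
    (hb : 0 ≤ b) (j : ℕ) (w : ℝ → ℝ) {c : ℝ} {v : ℝ≥0} (hc : 0 < c) (hv : c ≤ v) :
    ∫⁻ y, ENNReal.ofReal |dd H N ε l η b j (fun r => w r + y)| ∂(gaussianReal 0 v) ≤
      ENNReal.ofReal (c ^ (-(1 / 2) : ℝ)) * (ENNReal.ofReal (N : ℝ)⁻¹ *
        (ah H (ε * (N : ℝ) ^ H) (blk H N j w) + ENNReal.ofReal b)) := by
  have hN' : (0 : ℝ) < N := by exact_mod_cast hN
  refine (conv_pos hc hv).trans ?_
  gcongr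
  have mU : Measurable fun y : ℝ => uu H N ε l j (fun r => w r + y) :=
    (meas_uu H N ε l j).comp (by fun_prop)
  calc ∫⁻ y, ENNReal.ofReal |dd H N ε l η b j (fun r => w r + y)|
      ≤ ∫⁻ y, (uu H N ε l j (fun r => w r + y) + ENNReal.ofReal (b * (N : ℝ)⁻¹) *
          ENNReal.ofReal (tent η (w (j / N) - l + y))) := by
        refine lintegral_mono fun y => ?_
        unfold dd
        refine (ENNReal.ofReal_le_ofReal (abs_sub _ _)).trans ?_
        refine ENNReal.ofReal_add_le.trans ?_
        have e : w (j / N) + y - l = w (j / N) - l + y := by ring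
        have := tent_nonneg η (w (j / N) - l + y)
        rw [abs_of_nonneg ENNReal.toReal_nonneg, abs_of_nonneg (by rw [e]; positivity), e,
          ENNReal.ofReal_mul (by positivity)]
        gcongr
        exact ENNReal.ofReal_toReal_le
    _ = _ := by
        rw [lintegral_add_left mU, lint_uu hH hN hε, mul_add, lintegral_const_mul' _ _ ENNReal.ofReal_ne_top,
          lintegral_add_left_eq_self (fun y => ENNReal.ofReal (tent η y)) (w (j / N) - l),
          ← ofReal_integral_eq_lintegral_ofReal (tent_int_le hη) (Eventually.of_forall (tent_nonneg η)),
          tent_int hη, ENNReal.ofReal_one, mul_one, mul_comm b, ENNReal.ofReal_mul (by positivity)]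

end P18

end

section



/-! ### Moment estimates for the block functionals -/

section P19
variable {Ω : Type*} [MeasurableSpace Ω] {P : Measure Ω} [IsProbabilityMeasure P]
variable {H : ℝ} {B : ℝ → Ω → ℝ}

lemma amgm_eta (x y : ℝ≥0∞) {η : ℝ} (hη : 0 < η) :
    x * y ≤ ENNReal.ofReal η * x ^ 2 + ENNReal.ofReal η⁻¹ * y ^ 2 := by
  rcases le_total y (ENNReal.ofReal η * x) with h | h
  · calc x * y ≤ x * (ENNReal.ofReal η * x) := by gcongr
      _ = ENNReal.ofReal η * x ^ 2 := by ring
      _ ≤ _ := le_self_add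
  · have : x ≤ ENNReal.ofReal η⁻¹ * y := by
      calc x = ENNReal.ofReal η⁻¹ * (ENNReal.ofReal η * x) := by
            rw [← mul_assoc, ← ENNReal.ofReal_mul (by positivity), inv_mul_cancel₀ hη.ne', ENNReal.ofReal_one, one_mul]
        _ ≤ _ := by gcongr
    calc x * y ≤ ENNReal.ofReal η⁻¹ * y * y := by gcongr
      _ = ENNReal.ofReal η⁻¹ * y ^ 2 := by ring
      _ ≤ _ := le_add_self

lemma mul3_le (x y z : ℝ≥0∞) : x * (y * z) ≤ 1 + (x ^ 4 + y ^ 4 + z ^ 4) := by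
  obtain ⟨m, hx, hy, hz, hm⟩ : ∃ m : ℝ≥0∞, x ≤ m ∧ y ≤ m ∧ z ≤ m ∧ m ^ 4 ≤ x ^ 4 + y ^ 4 + z ^ 4 := by
    refine ⟨max x (max y z), le_max_left _ _, (le_max_left _ _).trans (le_max_right _ _),
      (le_max_right _ _).trans (le_max_right _ _), ?_⟩
    rcases max_choice x (max y z) with h | h <;> rw [h]
    · rw [add_assoc]; exact le_self_add
    · rcases max_choice y z with h | h <;> rw [h]
      · rw [add_right_comm]; exact le_add_self
      · exact le_add_self
  calc x * (y * z) ≤ m * (m * m) := by gcongr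
    _ = m ^ 3 := by ring
    _ ≤ 1 + m ^ 4 := pow_le_one_add (by norm_num)
    _ ≤ _ := by gcongr

lemma XZ_est (hB : IsFBM H P B) (hH : H ∈ Ioo (0 : ℝ) (1 / 2)) {M CL : ℝ≥0∞} {b : ℝ} (hb : 0 ≤ b)
    (hM : M < ⊤) (hCL : CL < ⊤) :
    ∃ C : ℝ≥0∞, C < ⊤ ∧ ∀ (N : ℕ) (η θ : ℝ), 0 < N → 0 < η → η ≤ 1 → ((N : ℝ) ^ H)⁻¹ ≤ η →
      ∫⁻ ω, ah H θ (fun r => B r ω) ^ 4 ∂P ≤ M →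
      ∫⁻ ω, ENNReal.ofReal (((ah H θ (fun r => B r ω)).toReal - b) ^ 2) ∂P ≤ CL * ENNReal.ofReal (η ^ 2) →
      ∀ i j : ℕ, ∫⁻ ω, (ah H θ (blk H N i (fun r => B r ω)) + ENNReal.ofReal b) *
        ZZ H N θ η b j (fun r => B r ω) ∂P ≤ C * ENNReal.ofReal η := by
  have t1 : 0 < 1 - tq H := by have := tq_lt hH.1; linarith
  set Mm := ∫⁻ ω, Mx (tq H) (fun r => B r ω) ^ 4 ∂P with hMm
  have hMm' : Mm < ⊤ := Mx_moment hB hH.1 4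
  set A : ℝ≥0∞ := 1 + 8 * (M + ENNReal.ofReal b ^ 4) with hA
  have hAt : A < ⊤ := by
    refine ENNReal.add_lt_top.2 ⟨by simp, ENNReal.mul_lt_top (by simp) (ENNReal.add_lt_top.2 ⟨hM, ?_⟩)⟩
    exact ENNReal.pow_lt_top ENNReal.ofReal_lt_top
  refine ⟨A + CL + ENNReal.ofReal (2 / (1 - tq H)) * (1 + (A + Mm + M)) + ENNReal.ofReal b * A, ?_, ?_⟩
  · refine ENNReal.add_lt_top.2 ⟨ENNReal.add_lt_top.2 ⟨ENNReal.add_lt_top.2 ⟨hAt, hCL⟩, ?_⟩, ?_⟩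
    · exact ENNReal.mul_lt_top ENNReal.ofReal_lt_top (ENNReal.add_lt_top.2 ⟨by simp,
        ENNReal.add_lt_top.2 ⟨ENNReal.add_lt_top.2 ⟨hAt, hMm'⟩, hM⟩⟩)
    · exact ENNReal.mul_lt_top ENNReal.ofReal_lt_top hAt
  intro N η θ hN hη hη1 hNη h4 hL i j
  set X : Ω → ℝ≥0∞ := fun ω => ah H θ (blk H N i (fun r => B r ω)) + ENNReal.ofReal b with hX
  set a : Ω → ℝ≥0∞ := fun ω => ah H θ (blk H N j (fun r => B r ω)) with ha
  set m : Ω → ℝ≥0∞ := fun ω => Mx (tq H) (blk H N j (fun r => B r ω)) with hm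
  have ma' : ∀ i, Measurable fun ω => ah H θ (blk H N i (fun r => B r ω)) := fun i =>
    measurable_ah (fun p _ => blk_meas hB N i p) H θ
  have ma : Measurable a := ma' j
  have mX : Measurable X := (ma' i).add measurable_const
  have mm : Measurable m := measurable_Mx _ (fun p _ => blk_meas hB N j p)
  have a4 : ∫⁻ ω, a ω ^ 4 ∂P ≤ M := ai_moment4 hB hH h4 hN j
  have m4 : ∫⁻ ω, m ω ^ 4 ∂P = Mm := blk_lint hB hN j (Φ := fun w => Mx (tq H) w ^ 4) ((meas_Mx_pi _).pow_const 4)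
  have X4 : ∫⁻ ω, X ω ^ 4 ∂P ≤ 8 * (M + ENNReal.ofReal b ^ 4) := by
    calc ∫⁻ ω, X ω ^ 4 ∂P ≤ ∫⁻ ω, 8 * (ah H θ (blk H N i (fun r => B r ω)) ^ 4 + ENNReal.ofReal b ^ 4) ∂P :=
          lintegral_mono fun ω => add_pow_four _ _
      _ = 8 * (∫⁻ ω, ah H θ (blk H N i (fun r => B r ω)) ^ 4 ∂P + ENNReal.ofReal b ^ 4) := by
          rw [lintegral_const_mul' _ _ (by simp), lintegral_add_right _ measurable_const]; simp
      _ ≤ _ := by gcongr; exact ai_moment4 hB hH h4 hN i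
  have Xp : ∀ p : ℕ, p ≤ 4 → ∫⁻ ω, X ω ^ p ∂P ≤ A := by
    intro p hp
    calc ∫⁻ ω, X ω ^ p ∂P ≤ ∫⁻ ω, (1 + X ω ^ 4) ∂P := lintegral_mono fun ω => pow_le_one_add hp
      _ = 1 + ∫⁻ ω, X ω ^ 4 ∂P := by rw [lintegral_add_left measurable_const]; simp
      _ ≤ _ := by rw [hA]; gcongr
  have at' : ∀ᵐ ω ∂P, a ω ≠ ⊤ := by
    have := ae_lt_top (ma.pow_const 4) (a4.trans_lt hM).ne
    filter_upwards [this] with ω h h2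
    simp [h2] at h
  have meb : Measurable fun ω => eb b (a ω) := (meas_eb b).comp ma
  have E2 : ∫⁻ ω, eb b (a ω) ^ 2 ∂P ≤ CL * ENNReal.ofReal (η ^ 2) := by
    have e1 : ∫⁻ ω, eb b (a ω) ^ 2 ∂P = ∫⁻ ω, ENNReal.ofReal (((a ω).toReal - b) ^ 2) ∂P := by
      refine lintegral_congr_ae ?_
      filter_upwards [at'] with ω h
      unfold eb
      rw [if_neg h, ← ENNReal.ofReal_pow (abs_nonneg _), sq_abs]
    rw [e1]
    have mm' : Measurable fun w : ℝ → ℝ => ENNReal.ofReal (((ah H θ w).toReal - b) ^ 2) :=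
      (((meas_ah_pi H θ).ennreal_toReal.sub_const b).pow_const 2).ennreal_ofReal
    exact (blk_lint hB hN j mm').trans_le hL
  have T1 : ∫⁻ ω, X ω * eb b (a ω) ∂P ≤ (A + CL) * ENNReal.ofReal η := by
    calc ∫⁻ ω, X ω * eb b (a ω) ∂P ≤ ∫⁻ ω, (ENNReal.ofReal η * X ω ^ 2 + ENNReal.ofReal η⁻¹ * eb b (a ω) ^ 2) ∂P :=
          lintegral_mono fun ω => amgm_eta _ _ hη
      _ = ENNReal.ofReal η * ∫⁻ ω, X ω ^ 2 ∂P + ENNReal.ofReal η⁻¹ * ∫⁻ ω, eb b (a ω) ^ 2 ∂P := by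
          have m1 : Measurable fun ω => ENNReal.ofReal η * X ω ^ 2 := (mX.pow_const 2).const_mul _
          rw [lintegral_add_left m1, lintegral_const_mul' _ _ (by simp), lintegral_const_mul' _ _ (by simp)]
      _ ≤ ENNReal.ofReal η * A + ENNReal.ofReal η⁻¹ * (CL * ENNReal.ofReal (η ^ 2)) := by
          gcongr; exact Xp 2 (by norm_num)
      _ = _ := by
          have : ENNReal.ofReal η⁻¹ * (CL * ENNReal.ofReal (η ^ 2)) = CL * ENNReal.ofReal η := by
            rw [mul_left_comm, ← ENNReal.ofReal_mul (by positivity)]; congr 2; field_simp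
          rw [this]; ring
  have T2 : ∫⁻ ω, X ω * (m ω * a ω) ∂P ≤ 1 + (A + Mm + M) := by
    calc ∫⁻ ω, X ω * (m ω * a ω) ∂P ≤ ∫⁻ ω, (1 + (X ω ^ 4 + m ω ^ 4 + a ω ^ 4)) ∂P :=
          lintegral_mono fun ω => mul3_le _ _ _
      _ = 1 + (∫⁻ ω, X ω ^ 4 ∂P + ∫⁻ ω, m ω ^ 4 ∂P + ∫⁻ ω, a ω ^ 4 ∂P) := by
          have m1 : Measurable fun ω => X ω ^ 4 := mX.pow_const 4
          have m2 : Measurable fun ω => X ω ^ 4 + m ω ^ 4 := m1.add (mm.pow_const 4)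
          rw [lintegral_add_left measurable_const, lintegral_add_left m2, lintegral_add_left m1]; simp
      _ ≤ _ := by
          gcongr
          · exact Xp 4 le_rfl
          · exact m4.le
  have hρ : ENNReal.ofReal (((N : ℝ) ^ H)⁻¹ * (2 / (1 - tq H))) ≤ ENNReal.ofReal (2 / (1 - tq H)) * ENNReal.ofReal η := by
    rw [← ENNReal.ofReal_mul (by positivity), mul_comm]
    refine ENNReal.ofReal_le_ofReal ?_
    gcongr
  calc ∫⁻ ω, X ω * ZZ H N θ η b j (fun r => B r ω) ∂P
      = ∫⁻ ω, (X ω * eb b (a ω) + ENNReal.ofReal (((N : ℝ) ^ H)⁻¹ * (2 / (1 - tq H))) * (X ω * (m ω * a ω)) +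
          X ω * ENNReal.ofReal (η * b)) ∂P := by
        refine lintegral_congr fun ω => ?_
        unfold ZZ
        simp only [ha, hm]
        ring
    _ = ∫⁻ ω, X ω * eb b (a ω) ∂P + ENNReal.ofReal (((N : ℝ) ^ H)⁻¹ * (2 / (1 - tq H))) * ∫⁻ ω, X ω * (m ω * a ω) ∂P +
          (∫⁻ ω, X ω ^ 1 ∂P) * ENNReal.ofReal (η * b) := by
        have m1 : Measurable fun ω => X ω * eb b (a ω) := mX.mul meb
        have m2 : Measurable fun ω => ENNReal.ofReal (((N : ℝ) ^ H)⁻¹ * (2 / (1 - tq H))) * (X ω * (m ω * a ω)) :=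
          (mX.mul (mm.mul ma)).const_mul _
        have m3 : Measurable fun ω => X ω * eb b (a ω) +
          ENNReal.ofReal (((N : ℝ) ^ H)⁻¹ * (2 / (1 - tq H))) * (X ω * (m ω * a ω)) := m1.add m2
        rw [lintegral_add_left m3, lintegral_add_left m1, lintegral_const_mul' _ _ (by simp),
          lintegral_mul_const' _ _ (by simp)]
        simp only [pow_one]
    _ ≤ (A + CL) * ENNReal.ofReal η + ENNReal.ofReal (2 / (1 - tq H)) * ENNReal.ofReal η * (1 + (A + Mm + M)) +
          A * (ENNReal.ofReal η * ENNReal.ofReal b) := by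
        rw [ENNReal.ofReal_mul hη.le]
        gcongr
        exact Xp 1 (by norm_num)
    _ = _ := by ring

lemma far_dd (hB : IsFBM H P B) (hH : H ∈ Ioo (0 : ℝ) (1 / 2)) {N : ℕ} (hN : 0 < N) {ε : ℝ} (hε : 0 < ε)
    (l : ℝ) {η b : ℝ} (hη : 0 < η) (hb : 0 ≤ b) {i j : ℕ} (hi : 1 ≤ i) (hij : i + 2 ≤ j)
    (hntg : Integrable (fun ω => dd H N ε l η b i (fun r => B r ω) * dd H N ε l η b j (fun r => B r ω)) P)
    {c1 c2 : ℝ} (hc1 : c1 = shc hB * ((i : ℝ) / N) ^ (2 * H))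
    (hc2 : c2 = shc hB * ((j : ℝ) / N - ((i + 1 : ℕ) : ℝ) / N) ^ (2 * H)) :
    ENNReal.ofReal |∫ ω, dd H N ε l η b i (fun r => B r ω) * dd H N ε l η b j (fun r => B r ω) ∂P| ≤
      ENNReal.ofReal (c1 ^ (-(1 / 2) : ℝ)) * ENNReal.ofReal (N : ℝ)⁻¹ *
      (ENNReal.ofReal (c2 ^ (-(1 / 2) : ℝ) + c2⁻¹) * ENNReal.ofReal (N : ℝ)⁻¹) *
      ∫⁻ ω, (ah H (ε * (N : ℝ) ^ H) (blk H N i (fun r => B r ω)) + ENNReal.ofReal b) *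
        ZZ H N (ε * (N : ℝ) ^ H) η b j (fun r => B r ω) ∂P := by
  have hN' : (0 : ℝ) < N := by exact_mod_cast hN
  have hs := shc_pos hB hH
  have hi' : (0 : ℝ) < (i : ℝ) / N := by
    have : (0 : ℝ) < i := by exact_mod_cast hi
    positivity
  have hlt : ((i + 1 : ℕ) : ℝ) / N < (j : ℝ) / N := by
    have : ((i + 1 : ℕ) : ℝ) < j := by exact_mod_cast hij
    gcongr
  have c1p : 0 < c1 := by rw [hc1]; positivity
  have c2p : 0 < c2 := by
    have : 0 < (j : ℝ) / N - ((i + 1 : ℕ) : ℝ) / N := by linarith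
    rw [hc2]; positivity
  have hle : (i : ℝ) / N ≤ (j : ℝ) / N := by
    have : (i : ℝ) ≤ j := by exact_mod_cast (by omega : i ≤ j)
    gcongr
  set T : (ℝ → ℝ) → ℝ≥0∞ := fun w => ENNReal.ofReal (c2 ^ (-(1 / 2) : ℝ) + c2⁻¹) * (ENNReal.ofReal (N : ℝ)⁻¹ *
        ZZ H N (ε * (N : ℝ) ^ H) η b j w) with hT
  have mT : Measurable T := ((meas_ZZ H N _ η b j).const_mul _).const_mul _
  have st1 := shift_sgn hB hH (F := dd H N ε l η b i) (G := dd H N ε l η b j) (T := T) (by positivity) hlt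
    (meas_dd H N ε l η b i) (meas_dd H N ε l η b j) mT
    (fun w y => dd_congr (rsh_before hN hlt le_rfl w y))
    (fun w y => by simp only [hT]; rw [ZZ_inv (rsh_after hN hlt le_rfl w y)])
    hntg (fun w v hv => by
      have e : ∀ y, dd H N ε l η b j (rsh (((i + 1 : ℕ) : ℝ) / N) ((j : ℝ) / N) w y) =
          dd H N ε l η b j (fun r => w r + y) := fun y => dd_congr (rsh_after hN hlt le_rfl w y)
      simp_rw [e]
      exact cond_dd hH.1 hN hε l hη hb j w c2p (hc2.trans_le hv))
  refine st1.trans ?_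
  set S : (ℝ → ℝ) → ℝ≥0∞ := fun w => ENNReal.ofReal (c1 ^ (-(1 / 2) : ℝ)) * (ENNReal.ofReal (N : ℝ)⁻¹ *
        (ah H (ε * (N : ℝ) ^ H) (blk H N i w) + ENNReal.ofReal b)) with hS
  have mS : Measurable S := (((meas_ahb H _ N i).add measurable_const).const_mul _).const_mul _
  have mF : Measurable fun w : ℝ → ℝ => ENNReal.ofReal |dd H N ε l η b i w| :=
    (measurable_norm.comp (meas_dd H N ε l η b i)).ennreal_ofReal
  have st2 := shift_pos hB hH (u := 0) (s := (i : ℝ) / N) (F := fun w => ENNReal.ofReal |dd H N ε l η b i w|)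
    (S := S) (T := T) le_rfl hi' mF mS mT
    (fun w y => by simp only [hS]; rw [ah_congr (blk_add (rsh_after hN hi' le_rfl w y))])
    (fun w y => by simp only [hT]; rw [ZZ_inv (rsh_after hN hi' hle w y)])
    (fun w v hv => by
      have e : ∀ y, dd H N ε l η b i (rsh 0 ((i : ℝ) / N) w y) =
          dd H N ε l η b i (fun r => w r + y) := fun y => dd_congr (rsh_after hN hi' le_rfl w y)
      simp_rw [e]
      refine abs_dd_le hH.1 hN hε l hη hb i w c1p ?_
      rw [sub_zero] at hv
      exact hc1.trans_le hv)
  refine st2.trans (le_of_eq ?_)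
  rw [← lintegral_const_mul' _ _ (by finiteness)]
  refine lintegral_congr fun ω => ?_
  simp only [hS, hT]
  ring

end P19

end

section



/-! ### Second moment of the sum -/

section P20
variable {Ω : Type*} [MeasurableSpace Ω] {P : Measure Ω} [IsProbabilityMeasure P]
variable {H : ℝ} {B : ℝ → Ω → ℝ}

lemma uu_le (hH : 0 < H) {N : ℕ} (hN : 0 < N) {ε : ℝ} (hε : 0 < ε) (l : ℝ) (i : ℕ) (w : ℝ → ℝ) :
    uu H N ε l i w ≤ ENNReal.ofReal (ε ^ (1 / H - 1)) *
      (2 * (ENNReal.ofReal (2 / ((1 - tq H) * (ε * (N : ℝ) ^ H))) * Mx (tq H) (blk H N i w)) ^ Qq H) := by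
  have hN' : (0 : ℝ) < N := by exact_mod_cast hN
  have hp : (0 : ℝ) < (N : ℝ) ^ H := by positivity
  unfold uu
  gcongr
  unfold blkD
  rw [Up_affine (c := (N : ℝ) ^ H) (d := w (i / N)) (inv_pos.2 hN') hp]
  have := Up_le_Mx (w := blk H N i w) (tq_pos H) (tq_lt hH) (Qq_spec hH)
    (show (N : ℝ) ^ H * (l - w (i / N)) < (N : ℝ) ^ H * (l + ε - w (i / N)) by gcongr; linarith)
  have e : (N : ℝ) ^ H * (l + ε - w (i / N)) - (N : ℝ) ^ H * (l - w (i / N)) = ε * (N : ℝ) ^ H := by ring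
  rw [e] at this
  exact this

lemma dd_sq (hB : IsFBM H P B) (hH : H ∈ Ioo (0 : ℝ) (1 / 2)) {b : ℝ} (hb : 0 ≤ b) :
    ∃ C : ℝ≥0∞, C < ⊤ ∧ ∀ (N : ℕ) (η θ ε : ℝ), 0 < N → 0 < η → 0 < θ → θ ≤ 1 → (N : ℝ)⁻¹ ≤ η ^ 3 →
      (N : ℝ) ^ (-(1 - 2 * H)) ≤ θ ^ (2 * Qq H) * η → 0 < ε → ε * (N : ℝ) ^ H = θ → ∀ (l : ℝ) (i : ℕ),
      ∫⁻ ω, ENNReal.ofReal (dd H N ε l η b i (fun r => B r ω) ^ 2) ∂P ≤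
        C * ENNReal.ofReal η * ENNReal.ofReal (N : ℝ)⁻¹ := by
  have t1 : 0 < 1 - tq H := by have := tq_lt hH.1; linarith
  set Mm := ∫⁻ ω, Mx (tq H) (fun r => B r ω) ^ (2 * Qq H) ∂P with hMm
  have hMm' : Mm < ⊤ := Mx_moment hB hH.1 _
  set K : ℝ := 4 * (2 / (1 - tq H)) ^ (2 * Qq H) with hK
  refine ⟨2 * (ENNReal.ofReal K * Mm) + 2 * ENNReal.ofReal (b ^ 2), by finiteness, ?_⟩
  intro N η θ ε hN hη hθ hθ1 hN1 hN2 hε hεθ l i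
  have hN' : (0 : ℝ) < N := by exact_mod_cast hN
  set R : ℝ := ε ^ (1 / H - 1) * 2 * (2 / ((1 - tq H) * θ)) ^ Qq H with hR
  have hR0 : 0 ≤ R := by positivity
  have hεv : ε = θ * (N : ℝ) ^ (-H) := by rw [← hεθ, Real.rpow_neg hN'.le]; field_simp
  have hH1 : 0 ≤ 1 / H - 1 := by
    have := hH.2; have := hH.1
    rw [sub_nonneg, le_div_iff₀ hH.1]; linarith
  have hpow : ε ^ (1 / H - 1) ≤ (N : ℝ) ^ (-(1 - H)) := by
    rw [hεv, Real.mul_rpow hθ.le (by positivity), ← Real.rpow_mul hN'.le]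
    have e : -H * (1 / H - 1) = -(1 - H) := by have := hH.1.ne'; field_simp
    rw [e]
    calc _ ≤ 1 * (N : ℝ) ^ (-(1 - H)) := by gcongr; exact Real.rpow_le_one hθ.le hθ1 hH1
      _ = _ := one_mul _
  have hR2 : R ^ 2 ≤ K * η * (N : ℝ)⁻¹ := by
    have e1 : R ^ 2 = (ε ^ (1 / H - 1)) ^ 2 * K * (θ ^ (2 * Qq H))⁻¹ := by
      rw [hR, hK, mul_pow, mul_pow, ← pow_mul, mul_comm (Qq H) 2, div_mul_eq_div_div, div_pow, div_pow]
      field_simp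
      try norm_num
    have e2 : ((N : ℝ) ^ (-(1 - H))) ^ 2 = (N : ℝ) ^ (-(1 - 2 * H)) * (N : ℝ)⁻¹ := by
      rw [← Real.rpow_natCast, ← Real.rpow_mul hN'.le, ← Real.rpow_neg_one, ← Real.rpow_add hN']
      congr 1; push_cast; ring
    rw [e1]
    calc (ε ^ (1 / H - 1)) ^ 2 * K * (θ ^ (2 * Qq H))⁻¹ ≤ ((N : ℝ) ^ (-(1 - H))) ^ 2 * K * (θ ^ (2 * Qq H))⁻¹ := by
          gcongr
      _ = (N : ℝ) ^ (-(1 - 2 * H)) * (K * (N : ℝ)⁻¹ * (θ ^ (2 * Qq H))⁻¹) := by rw [e2]; ring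
      _ ≤ (θ ^ (2 * Qq H) * η) * (K * (N : ℝ)⁻¹ * (θ ^ (2 * Qq H))⁻¹) := by gcongr
      _ = _ := by field_simp
  have hT2 : (b * (N : ℝ)⁻¹ * η⁻¹) ^ 2 ≤ b ^ 2 * η * (N : ℝ)⁻¹ := by
    have : (b * (N : ℝ)⁻¹ * η⁻¹) ^ 2 = b ^ 2 * (N : ℝ)⁻¹ * (N : ℝ)⁻¹ * (η⁻¹) ^ 2 := by ring
    rw [this]
    calc _ ≤ b ^ 2 * (N : ℝ)⁻¹ * η ^ 3 * (η⁻¹) ^ 2 := by gcongr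
      _ = _ := by field_simp
  have pt : ∀ w, ENNReal.ofReal (dd H N ε l η b i w ^ 2) ≤
      2 * (ENNReal.ofReal (R ^ 2) * Mx (tq H) (blk H N i w) ^ (2 * Qq H)) +
        2 * ENNReal.ofReal ((b * (N : ℝ)⁻¹ * η⁻¹) ^ 2) := by
    intro w
    have h1 : uu H N ε l i w ^ 2 ≤ ENNReal.ofReal (R ^ 2) * Mx (tq H) (blk H N i w) ^ (2 * Qq H) := by
      have := uu_le hH.1 hN hε l i w
      rw [hεθ] at this
      refine (pow_le_pow_left₀ bot_le this 2).trans (le_of_eq ?_)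
      · · have : ENNReal.ofReal (R ^ 2) = (ENNReal.ofReal (ε ^ (1 / H - 1)) * 2 *
              ENNReal.ofReal (2 / ((1 - tq H) * θ)) ^ Qq H) ^ 2 := by
            rw [ENNReal.ofReal_pow hR0, hR, ENNReal.ofReal_mul (by positivity), ENNReal.ofReal_mul (by positivity),
              ENNReal.ofReal_pow (by positivity)]
            simp
          rw [this, mul_pow]; ring
    have h2 : dd H N ε l η b i w ^ 2 ≤ 2 * ((uu H N ε l i w).toReal ^ 2 + (b * (N : ℝ)⁻¹ * η⁻¹) ^ 2) := by
      unfold dd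
      have h3 : b * (N : ℝ)⁻¹ * tent η (w (i / N) - l) ≤ b * (N : ℝ)⁻¹ * η⁻¹ := by
        gcongr; exact tent_le hη _
      have h4 : 0 ≤ b * (N : ℝ)⁻¹ * tent η (w (i / N) - l) := by
        have := tent_nonneg η (w (i / N) - l); positivity
      have h5 : (b * (N : ℝ)⁻¹ * tent η (w (i / N) - l)) ^ 2 ≤ (b * (N : ℝ)⁻¹ * η⁻¹) ^ 2 := by gcongr
      nlinarith [sq_nonneg ((uu H N ε l i w).toReal + b * (N : ℝ)⁻¹ * tent η (w (i / N) - l))]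
    refine (ENNReal.ofReal_le_ofReal h2).trans ?_
    rw [ENNReal.ofReal_mul (by norm_num), ENNReal.ofReal_add (by positivity) (by positivity), mul_add,
      ENNReal.ofReal_ofNat, ENNReal.ofReal_pow ENNReal.toReal_nonneg]
    gcongr
    refine le_trans ?_ h1
    gcongr
    exact ENNReal.ofReal_toReal_le
  have m4 : ∫⁻ ω, Mx (tq H) (blk H N i (fun r => B r ω)) ^ (2 * Qq H) ∂P = Mm :=
    blk_lint hB hN i (Φ := fun w => Mx (tq H) w ^ (2 * Qq H)) ((meas_Mx_pi _).pow_const _)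
  calc _ ≤ _ := lintegral_mono fun ω => pt _
    _ = 2 * (ENNReal.ofReal (R ^ 2) * Mm) + 2 * ENNReal.ofReal ((b * (N : ℝ)⁻¹ * η⁻¹) ^ 2) := by
        rw [lintegral_add_right _ measurable_const, lintegral_const_mul' _ _ (by simp),
          lintegral_const_mul' _ _ (by simp), m4]; simp
    _ ≤ 2 * (ENNReal.ofReal (K * η * (N : ℝ)⁻¹) * Mm) + 2 * ENNReal.ofReal (b ^ 2 * η * (N : ℝ)⁻¹) := by gcongr
    _ = _ := by
        have hK0 : 0 ≤ K := by positivity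
        rw [ENNReal.ofReal_mul (p := K * η) (by positivity), ENNReal.ofReal_mul (p := K) (by positivity),
          ENNReal.ofReal_mul (p := b ^ 2 * η) (by positivity), ENNReal.ofReal_mul (p := b ^ 2) (by positivity)]
        ring

lemma sum_shift (h : ℕ → ℝ≥0∞) (m N : ℕ) :
    ∑ j ∈ Finset.range N, (if m + 1 ≤ j then h (j - m) else 0) ≤ ∑ k ∈ Finset.range N, h (k + 1) := by
  rw [← Finset.sum_filter]
  have inj : Set.InjOn (fun j => j - (m + 1)) ((Finset.range N).filter (fun j => m + 1 ≤ j) : Finset ℕ) := by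
    intro x hx y hy hxy
    simp only [Finset.coe_filter, Finset.mem_range, Set.mem_setOf_eq] at hx hy hxy
    omega
  have e : ∑ j ∈ (Finset.range N).filter (fun j => m + 1 ≤ j), h (j - m) =
      ∑ k ∈ ((Finset.range N).filter (fun j => m + 1 ≤ j)).image (fun j => j - (m + 1)), h (k + 1) := by
    rw [Finset.sum_image inj]
    refine Finset.sum_congr rfl fun j hj => ?_
    simp only [Finset.mem_filter, Finset.mem_range] at hj
    congr 1; omega
  rw [e]
  refine Finset.sum_le_sum_of_subset ?_
  intro k hk
  simp only [Finset.mem_image, Finset.mem_filter, Finset.mem_range] at hk ⊢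
  obtain ⟨j, hj, rfl⟩ := hk
  omega

lemma sum_pow_le {α : ℝ} (h0 : 0 < α) (h1 : α < 1) (N : ℕ) :
    ∑ k ∈ Finset.range N, ((k : ℝ) + 1) ^ (-α) ≤ (1 - α)⁻¹ * (N : ℝ) ^ (1 - α) := by
  have hβ : 0 < 1 - α := by linarith
  induction N with
  | zero => simp [Real.zero_rpow hβ.ne']
  | succ N ih =>
    rw [Finset.sum_range_succ]
    have hN : (0 : ℝ) < (N : ℝ) + 1 := by positivity
    have hb := rpow_one_add_le_one_add_mul_self (s := -((N : ℝ) + 1)⁻¹) (p := 1 - α)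
      (by rw [neg_le_neg_iff]; exact inv_le_one_of_one_le₀ (by linarith [(Nat.cast_nonneg N : (0:ℝ) ≤ N)])) hβ.le (by linarith)
    have e1 : (N : ℝ) = (N + 1) * (1 + -((N : ℝ) + 1)⁻¹) := by field_simp; ring
    have e0 : 0 ≤ 1 + -((N : ℝ) + 1)⁻¹ := by
      have : (1 + -((N : ℝ) + 1)⁻¹) = N / (N + 1) := by field_simp; ring
      rw [this]; positivity
    have e2 : (N : ℝ) ^ (1 - α) ≤ ((N : ℝ) + 1) ^ (1 - α) * (1 + (1 - α) * -((N : ℝ) + 1)⁻¹) := by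
      conv_lhs => rw [e1]
      rw [Real.mul_rpow hN.le e0]
      gcongr
    have e3 : ((N : ℝ) + 1) ^ (1 - α) * ((N : ℝ) + 1)⁻¹ = ((N : ℝ) + 1) ^ (-α) := by
      rw [← Real.rpow_neg_one, ← Real.rpow_add hN]; congr 1; ring
    have e4 : (N : ℝ) ^ (1 - α) ≤ ((N : ℝ) + 1) ^ (1 - α) - (1 - α) * ((N : ℝ) + 1) ^ (-α) := by
      rw [← e3]; linarith
    calc _ ≤ (1 - α)⁻¹ * (((N : ℝ) + 1) ^ (1 - α) - (1 - α) * ((N : ℝ) + 1) ^ (-α)) + ((N : ℝ) + 1) ^ (-α) := by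
          have := mul_le_mul_of_nonneg_left e4 (inv_nonneg.2 hβ.le)
          linarith
      _ = _ := by push_cast; field_simp; ring

lemma sum_pow_e {α : ℝ} (h0 : 0 < α) (h1 : α < 1) {N : ℕ} (hN : 0 < N) :
    ∑ k ∈ Finset.range N, ENNReal.ofReal ((N : ℝ)⁻¹ * (((k + 1 : ℕ) : ℝ) / N) ^ (-α)) ≤ ENNReal.ofReal (1 - α)⁻¹ := by
  have hN' : (0 : ℝ) < N := by exact_mod_cast hN
  rw [← ENNReal.ofReal_sum_of_nonneg (fun k _ => by positivity)]
  refine ENNReal.ofReal_le_ofReal ?_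
  have e : ∀ k : ℕ, (N : ℝ)⁻¹ * (((k + 1 : ℕ) : ℝ) / N) ^ (-α) = (N : ℝ) ^ (-(1 - α)) * ((k : ℝ) + 1) ^ (-α) := by
    intro k
    rw [Real.div_rpow (by positivity) hN'.le, div_eq_mul_inv, ← Real.rpow_neg hN'.le]
    push_cast
    rw [show -(1 - α) = -1 + - -α by ring, Real.rpow_add hN', Real.rpow_neg_one]
    ring
  simp_rw [e]
  rw [← Finset.mul_sum]
  calc _ ≤ (N : ℝ) ^ (-(1 - α)) * ((1 - α)⁻¹ * (N : ℝ) ^ (1 - α)) := by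
        gcongr; exact sum_pow_le h0 h1 N
    _ = (1 - α)⁻¹ * ((N : ℝ) ^ (-(1 - α)) * (N : ℝ) ^ (1 - α)) := by ring
    _ = _ := by rw [← Real.rpow_add hN']; simp

end P20

end

section



/-! ### Summation -/

section P21
variable {Ω : Type*} [MeasurableSpace Ω] {P : Measure Ω} [IsProbabilityMeasure P]
variable {H : ℝ} {B : ℝ → Ω → ℝ}

lemma L2_mul {f g : Ω → ℝ} (mf : Measurable f) (mg : Measurable g)
    (hf : ∫⁻ ω, ENNReal.ofReal (f ω ^ 2) ∂P ≠ ⊤) (hg : ∫⁻ ω, ENNReal.ofReal (g ω ^ 2) ∂P ≠ ⊤) :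
    Integrable (fun ω => f ω * g ω) P ∧
    ENNReal.ofReal |∫ ω, f ω * g ω ∂P| ≤ ∫⁻ ω, ENNReal.ofReal (f ω ^ 2) ∂P + ∫⁻ ω, ENNReal.ofReal (g ω ^ 2) ∂P := by
  have key : ∫⁻ ω, ‖f ω * g ω‖ₑ ∂P ≤ ∫⁻ ω, ENNReal.ofReal (f ω ^ 2) ∂P + ∫⁻ ω, ENNReal.ofReal (g ω ^ 2) ∂P := by
    rw [← lintegral_add_left (mf.pow_const 2).ennreal_ofReal]
    refine lintegral_mono fun ω => ?_
    rw [← ofReal_norm_eq_enorm, ← ENNReal.ofReal_add (by positivity) (by positivity), Real.norm_eq_abs]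
    refine ENNReal.ofReal_le_ofReal ?_
    rw [abs_le]
    constructor <;> nlinarith [sq_nonneg (f ω + g ω), sq_nonneg (f ω - g ω)]
  refine ⟨⟨(mf.mul mg).aestronglyMeasurable, key.trans_lt (ENNReal.add_lt_top.2 ⟨hf.lt_top, hg.lt_top⟩)⟩, ?_⟩
  rw [← Real.norm_eq_abs, ofReal_norm_eq_enorm]
  exact (enorm_integral_le_lintegral_enorm _).trans key

lemma sq_sum {d : ℕ → Ω → ℝ} (md : ∀ i, Measurable (d i))
    (h : ∀ i, ∫⁻ ω, ENNReal.ofReal (d i ω ^ 2) ∂P ≠ ⊤) (N : ℕ) :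
    ∫⁻ ω, ENNReal.ofReal ((∑ i ∈ Finset.range N, d i ω) ^ 2) ∂P ≤
      ∑ i ∈ Finset.range N, ∑ j ∈ Finset.range N, ENNReal.ofReal |∫ ω, d i ω * d j ω ∂P| := by
  have e : ∀ ω, (∑ i ∈ Finset.range N, d i ω) ^ 2 =
      ∑ i ∈ Finset.range N, ∑ j ∈ Finset.range N, d i ω * d j ω := fun ω => by
    rw [sq, Finset.sum_mul_sum]
  have I : ∀ i j, Integrable (fun ω => d i ω * d j ω) P := fun i j => (L2_mul (md i) (md j) (h i) (h j)).1
  have I1 : Integrable (fun ω => (∑ i ∈ Finset.range N, d i ω) ^ 2) P := by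
    simp_rw [e]
    exact integrable_finsetSum _ fun i _ => integrable_finsetSum _ fun j _ => I i j
  rw [← ofReal_integral_eq_lintegral_ofReal I1 (Eventually.of_forall fun ω => sq_nonneg _)]
  simp_rw [e]
  rw [integral_finsetSum _ fun i _ => integrable_finsetSum _ fun j _ => I i j]
  simp_rw [integral_finsetSum (Finset.range N) fun j _ => I _ j]
  refine (ENNReal.ofReal_le_ofReal (Finset.sum_le_sum fun i _ => Finset.sum_le_sum fun j _ => le_abs_self _)).trans ?_
  rw [ENNReal.ofReal_sum_of_nonneg (fun i _ => Finset.sum_nonneg fun j _ => abs_nonneg _)]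
  refine Finset.sum_le_sum fun i _ => ?_
  rw [ENNReal.ofReal_sum_of_nonneg (fun j _ => abs_nonneg _)]

lemma far_sum {N : ℕ} (hN : 0 < N) (hH : H ∈ Ioo (0 : ℝ) (1 / 2)) (e : ℕ → ℕ → ℝ≥0∞) {M G : ℝ≥0∞}
    (hsym : ∀ i j, e i j = e j i)
    (h1 : ∀ i j, e i j ≤ M * ENNReal.ofReal (N : ℝ)⁻¹)
    (h2 : ∀ i j, 1 ≤ i → i + 2 ≤ j → j < N → e i j ≤ G * (ENNReal.ofReal ((N : ℝ)⁻¹ * ((i : ℝ) / N) ^ (-H)) *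
      ENNReal.ofReal ((N : ℝ)⁻¹ * (((j - (i + 1) : ℕ) : ℝ) / N) ^ (-(2 * H))))) :
    ∑ i ∈ Finset.range N, ∑ j ∈ Finset.range N, e i j ≤
      5 * M + 2 * (G * (ENNReal.ofReal (1 - H)⁻¹ * ENNReal.ofReal (1 - 2 * H)⁻¹)) := by
  have hN' : (0 : ℝ) < N := by exact_mod_cast hN
  set f1 : ℕ → ℝ≥0∞ := fun k => ENNReal.ofReal ((N : ℝ)⁻¹ * ((k : ℝ) / N) ^ (-H)) with hf1
  set f2 : ℕ → ℝ≥0∞ := fun k => ENNReal.ofReal ((N : ℝ)⁻¹ * ((k : ℝ) / N) ^ (-(2 * H))) with hf2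
  set g : ℕ → ℕ → ℝ≥0∞ := fun i j => (if 0 + 1 ≤ i then f1 (i - 0) else 0) *
    (if (i + 1) + 1 ≤ j then f2 (j - (i + 1)) else 0) with hg
  set nr : ℕ → ℕ → ℝ≥0∞ := fun i j => (if j ≤ i + 1 ∧ i ≤ j + 1 then (1 : ℝ≥0∞) else 0) +
    (if j ≤ 0 + 0 ∧ 0 ≤ j + 0 then (1 : ℝ≥0∞) else 0) + (if i ≤ 0 + 0 ∧ 0 ≤ i + 0 then (1 : ℝ≥0∞) else 0) with hnr
  have pt : ∀ i ∈ Finset.range N, ∀ j ∈ Finset.range N,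
      e i j ≤ M * ENNReal.ofReal (N : ℝ)⁻¹ * nr i j + G * g i j + G * g j i := by
    intro i hi j hj
    rw [Finset.mem_range] at hi hj
    have near : 1 ≤ nr i j → e i j ≤ M * ENNReal.ofReal (N : ℝ)⁻¹ * nr i j + G * g i j + G * g j i := by
      intro hn
      calc e i j ≤ M * ENNReal.ofReal (N : ℝ)⁻¹ * 1 := by rw [mul_one]; exact h1 i j
        _ ≤ M * ENNReal.ofReal (N : ℝ)⁻¹ * nr i j := by gcongr
        _ ≤ _ := by rw [add_assoc]; exact le_self_add
    by_cases c1 : j ≤ i + 1 ∧ i ≤ j + 1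
    · apply near; simp only [hnr]; rw [if_pos c1, add_assoc]; exact le_self_add
    by_cases c2 : j ≤ 0 + 0 ∧ 0 ≤ j + 0
    · apply near; simp only [hnr]; rw [if_pos c2, add_right_comm]; exact le_add_self
    by_cases c3 : i ≤ 0 + 0 ∧ 0 ≤ i + 0
    · apply near; simp only [hnr]; rw [if_pos c3]; exact le_add_self
    rcases le_or_gt (i + 2) j with h | h
    · refine le_trans ?_ (le_trans le_add_self le_self_add : G * g i j ≤ _)
      simp only [hg]
      rw [if_pos (by omega), if_pos (by omega)]
      exact h2 i j (by omega) h hj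
    · refine le_trans ?_ (le_add_self : G * g j i ≤ _)
      simp only [hg]
      rw [if_pos (by omega), if_pos (by omega), hsym]
      exact h2 j i (by omega) (by omega) hi
  have sg : ∑ i ∈ Finset.range N, ∑ j ∈ Finset.range N, g i j ≤
      ENNReal.ofReal (1 - H)⁻¹ * ENNReal.ofReal (1 - 2 * H)⁻¹ := by
    have s2 : ∀ i, ∑ j ∈ Finset.range N, (if (i + 1) + 1 ≤ j then f2 (j - (i + 1)) else 0) ≤ ENNReal.ofReal (1 - 2 * H)⁻¹ :=
      fun i => (sum_shift f2 (i + 1) N).trans (sum_pow_e (by linarith [hH.1]) (by linarith [hH.2]) hN)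
    calc _ = ∑ i ∈ Finset.range N, (if 0 + 1 ≤ i then f1 (i - 0) else 0) *
          ∑ j ∈ Finset.range N, (if (i + 1) + 1 ≤ j then f2 (j - (i + 1)) else 0) := by
          refine Finset.sum_congr rfl fun i _ => ?_
          rw [Finset.mul_sum]
      _ ≤ ∑ i ∈ Finset.range N, (if 0 + 1 ≤ i then f1 (i - 0) else 0) * ENNReal.ofReal (1 - 2 * H)⁻¹ := by
          gcongr with i _; exact s2 i
      _ ≤ _ := by
          rw [← Finset.sum_mul]
          gcongr
          exact (sum_shift f1 0 N).trans (sum_pow_e (by linarith [hH.1]) (by linarith [hH.2]) hN)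
  have sn : ∑ i ∈ Finset.range N, ∑ j ∈ Finset.range N, nr i j ≤ 5 * ENNReal.ofReal N := by
    have n0 : ∑ j ∈ Finset.range N, (if j ≤ 0 + 0 ∧ 0 ≤ j + 0 then (1 : ℝ≥0∞) else 0) ≤ 1 := by
      refine (near_count N 0 0).trans ?_; simp
    calc _ ≤ ∑ i ∈ Finset.range N, (3 + 1 + ∑ j ∈ Finset.range N, (if i ≤ 0 + 0 ∧ 0 ≤ i + 0 then (1 : ℝ≥0∞) else 0)) := by
          refine Finset.sum_le_sum fun i _ => ?_
          simp only [hnr]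
          rw [Finset.sum_add_distrib, Finset.sum_add_distrib]
          gcongr
          refine (near_count N 1 i).trans ?_; norm_num
      _ = ∑ i ∈ Finset.range N, (3 + 1) + ∑ j ∈ Finset.range N, ∑ i ∈ Finset.range N, (if i ≤ 0 + 0 ∧ 0 ≤ i + 0 then (1 : ℝ≥0∞) else 0) := by
          rw [Finset.sum_add_distrib, Finset.sum_comm (f := fun i j => if i ≤ 0 + 0 ∧ 0 ≤ i + 0 then (1 : ℝ≥0∞) else 0)]
      _ ≤ ∑ i ∈ Finset.range N, (3 + 1) + ∑ j ∈ Finset.range N, 1 := by gcongr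
      _ = _ := by
          rw [← Finset.sum_add_distrib, Finset.sum_const, Finset.card_range, nsmul_eq_mul, ENNReal.ofReal_natCast]
          norm_num; ring
  calc _ ≤ ∑ i ∈ Finset.range N, ∑ j ∈ Finset.range N,
        (M * ENNReal.ofReal (N : ℝ)⁻¹ * nr i j + G * g i j + G * g j i) :=
        Finset.sum_le_sum fun i hi => Finset.sum_le_sum fun j hj => pt i hi j hj
    _ = M * ENNReal.ofReal (N : ℝ)⁻¹ * ∑ i ∈ Finset.range N, ∑ j ∈ Finset.range N, nr i j +
        G * (∑ i ∈ Finset.range N, ∑ j ∈ Finset.range N, g i j) + G * ∑ i ∈ Finset.range N, ∑ j ∈ Finset.range N, g j i := by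
        simp_rw [Finset.sum_add_distrib, Finset.mul_sum]
    _ ≤ M * ENNReal.ofReal (N : ℝ)⁻¹ * (5 * ENNReal.ofReal N) +
        G * (ENNReal.ofReal (1 - H)⁻¹ * ENNReal.ofReal (1 - 2 * H)⁻¹) +
        G * (ENNReal.ofReal (1 - H)⁻¹ * ENNReal.ofReal (1 - 2 * H)⁻¹) := by
        gcongr
        rw [Finset.sum_comm]; exact sg
    _ = _ := by
        have : M * ENNReal.ofReal (N : ℝ)⁻¹ * (5 * ENNReal.ofReal N) = 5 * M * (ENNReal.ofReal (N : ℝ)⁻¹ * ENNReal.ofReal N) := by ring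
        rw [this, ← ENNReal.ofReal_mul (by positivity), inv_mul_cancel₀ hN'.ne', ENNReal.ofReal_one, mul_one]
        ring

lemma main_sq (hB : IsFBM H P B) (hH : H ∈ Ioo (0 : ℝ) (1 / 2)) {b : ℝ} (hb : 0 ≤ b) {CL : ℝ≥0∞} (hCL : CL < ⊤) :
    ∃ C : ℝ≥0∞, C < ⊤ ∧ ∀ (N : ℕ) (η θ ε : ℝ), 0 < N → 0 < η → η ≤ 1 → 0 < θ → θ ≤ 1 → (N : ℝ)⁻¹ ≤ η ^ 3 →
      ((N : ℝ) ^ H)⁻¹ ≤ η →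
      (N : ℝ) ^ (-(1 - 2 * H)) ≤ θ ^ (2 * Qq H) * η → 0 < ε → ε * (N : ℝ) ^ H = θ →
      ∫⁻ ω, ENNReal.ofReal (((ah H θ (fun r => B r ω)).toReal - b) ^ 2) ∂P ≤ CL * ENNReal.ofReal (η ^ 2) →
      ∀ l : ℝ, ∫⁻ ω, ENNReal.ofReal ((∑ i ∈ Finset.range N, dd H N ε l η b i (fun r => B r ω)) ^ 2) ∂P ≤
        C * ENNReal.ofReal η := by
  obtain ⟨M4, hM4, h4⟩ := ah_moment4 hB hH
  obtain ⟨CX, hCX, hX⟩ := XZ_est hB hH hb hM4 hCL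
  obtain ⟨CD, hCD, hD⟩ := dd_sq hB hH hb
  have hs := shc_pos hB hH
  set q := shc hB with hq
  set K : ℝ := q ^ (-(1 / 2) : ℝ) * (q ^ (-(1 / 2) : ℝ) + q⁻¹) with hK
  have hK0 : 0 ≤ K := by positivity
  refine ⟨5 * (2 * CD) + 2 * (ENNReal.ofReal K * CX * (ENNReal.ofReal (1 - H)⁻¹ * ENNReal.ofReal (1 - 2 * H)⁻¹)),
    by finiteness, ?_⟩
  intro N η θ ε hN hη hη1 hθ hθ1 hN1 hN3 hN2 hε hεθ hL l
  have hN' : (0 : ℝ) < N := by exact_mod_cast hN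
  have D := hD N η θ ε hN hη hθ hθ1 hN1 hN2 hε hεθ l
  have X := hX N η θ hN hη hη1 hN3 (h4 θ hθ hθ1) hL
  have md : ∀ i, Measurable fun ω => dd H N ε l η b i (fun r => B r ω) := fun i =>
    (meas_dd H N ε l η b i).comp (meas_path hB)
  have ft : ∀ i, ∫⁻ ω, ENNReal.ofReal (dd H N ε l η b i (fun r => B r ω) ^ 2) ∂P ≠ ⊤ := fun i =>
    ((D i).trans_lt (by finiteness)).ne
  refine (sq_sum md ft N).trans ?_
  refine (far_sum hN hH (M := 2 * CD * ENNReal.ofReal η) (G := ENNReal.ofReal K * CX * ENNReal.ofReal η)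
    (fun i j => ENNReal.ofReal |∫ ω, dd H N ε l η b i (fun r => B r ω) * dd H N ε l η b j (fun r => B r ω) ∂P|)
    (fun i j => by simp_rw [mul_comm]) ?_ ?_).trans (le_of_eq (by ring))
  · intro i j
    refine (L2_mul (md i) (md j) (ft i) (ft j)).2.trans ((add_le_add (D i) (D j)).trans (le_of_eq (by ring)))
  · intro i j hi hij hj
    have h := far_dd hB hH hN hε l hη hb hi hij (L2_mul (md i) (md j) (ft i) (ft j)).1 rfl rfl
    refine h.trans ?_
    rw [hεθ]
    have hi0 : (0 : ℝ) < (i : ℝ) / N := by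
      have : (0 : ℝ) < i := by exact_mod_cast hi
      positivity
    set y : ℝ := ((j - (i + 1) : ℕ) : ℝ) / N with hy
    have ey : (j : ℝ) / N - ((i + 1 : ℕ) : ℝ) / N = y := by
      rw [hy, Nat.cast_sub (by omega), sub_div]
    rw [ey]
    have y0 : 0 < y := by
      have : (0 : ℝ) < ((j - (i + 1) : ℕ) : ℝ) := by exact_mod_cast (by omega : 0 < j - (i + 1))
      positivity
    have y1 : y ≤ 1 := by
      rw [hy, div_le_one hN']
      exact_mod_cast (by omega : j - (i + 1) ≤ N)
    have e1 : (q * ((i : ℝ) / N) ^ (2 * H)) ^ (-(1 / 2) : ℝ) = q ^ (-(1 / 2) : ℝ) * ((i : ℝ) / N) ^ (-H) := by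
      rw [Real.mul_rpow hs.le (by positivity), ← Real.rpow_mul hi0.le]
      congr 2; ring
    have e2 : (q * y ^ (2 * H)) ^ (-(1 / 2) : ℝ) + (q * y ^ (2 * H))⁻¹ ≤
        (q ^ (-(1 / 2) : ℝ) + q⁻¹) * y ^ (-(2 * H)) := by
      have a1 : (q * y ^ (2 * H)) ^ (-(1 / 2) : ℝ) = q ^ (-(1 / 2) : ℝ) * y ^ (-H) := by
        rw [Real.mul_rpow hs.le (by positivity), ← Real.rpow_mul y0.le]
        congr 2; ring
      have a2 : (q * y ^ (2 * H))⁻¹ = q⁻¹ * y ^ (-(2 * H)) := by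
        rw [mul_inv, Real.rpow_neg y0.le]
      have a3 : y ^ (-H) ≤ y ^ (-(2 * H)) := Real.rpow_le_rpow_of_exponent_ge y0 y1 (by linarith [hH.1])
      rw [a1, a2, add_mul]
      gcongr
    rw [e1]
    calc _ ≤ ENNReal.ofReal (q ^ (-(1 / 2) : ℝ) * ((i : ℝ) / N) ^ (-H)) * ENNReal.ofReal (N : ℝ)⁻¹ *
          (ENNReal.ofReal ((q ^ (-(1 / 2) : ℝ) + q⁻¹) * y ^ (-(2 * H))) * ENNReal.ofReal (N : ℝ)⁻¹) *
          (CX * ENNReal.ofReal η) := by gcongr; exact X i j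
      _ = _ := by
        rw [hK, ENNReal.ofReal_mul (p := q ^ (-(1 / 2) : ℝ)) (by positivity), ENNReal.ofReal_mul (p := q ^ (-(1 / 2) : ℝ)) (by positivity),
          ENNReal.ofReal_mul (p := q ^ (-(1 / 2) : ℝ) + q⁻¹) (by positivity),
          ENNReal.ofReal_mul (p := (N : ℝ)⁻¹) (by positivity), ENNReal.ofReal_mul (p := (N : ℝ)⁻¹) (by positivity)]
        ring

end P21

end

section



/-! ### Boundary terms and Riemann sums -/
section P22
variable {Ω : Type*} [MeasurableSpace Ω] {P : Measure Ω} [IsProbabilityMeasure P]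
variable {H : ℝ} {B : ℝ → Ω → ℝ}

lemma bd_one (hB : IsFBM H P B) (hH : H ∈ Ioo (0 : ℝ) (1 / 2)) {s : ℝ} (hs : 0 < s) (l ε : ℝ) :
    ∫⁻ ω, (Ioo l (l + ε)).indicator (1 : ℝ → ℝ≥0∞) (B s ω) ∂P ≤
      ENNReal.ofReal (shc hB ^ (-(1 / 2) : ℝ)) * ENNReal.ofReal (s ^ (-H)) * ENNReal.ofReal ε := by
  have hq := shc_pos hB hH
  have mF : Measurable fun w : ℝ → ℝ => (Ioo l (l + ε)).indicator (1 : ℝ → ℝ≥0∞) (w s) :=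
    (measurable_one.indicator measurableSet_Ioo).comp (measurable_pi_apply s)
  have h := shift_pos hB hH le_rfl hs (F := fun w => (Ioo l (l + ε)).indicator (1 : ℝ → ℝ≥0∞) (w s))
    (S := fun _ => ENNReal.ofReal ((shc hB * (s - 0) ^ (2 * H)) ^ (-(1 / 2) : ℝ)) * ENNReal.ofReal ε)
    (T := fun _ => 1) mF measurable_const measurable_const (fun _ _ => rfl) (fun _ _ => rfl) (by
      intro w v hv
      refine (conv_pos (by have : 0 < (s - 0) ^ (2 * H) := Real.rpow_pos_of_pos (by linarith) _
                           positivity) hv).trans ?_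
      refine mul_le_mul_right (le_of_eq ?_) _
      have e : ∀ y, rsh 0 s w y s = w s + y := by
        intro y; unfold rsh; rw [ramp_ge hs le_rfl]; ring
      simp only [e]
      rw [lintegral_add_left_eq_self (fun y => (Ioo l (l + ε)).indicator (1 : ℝ → ℝ≥0∞) y) (w s),
        lintegral_indicator_one measurableSet_Ioo, Real.volume_Ioo]
      congr 1; ring)
  simp only [mul_one, lintegral_const, measure_univ] at h
  refine h.trans (le_of_eq ?_)
  congr 1
  rw [← ENNReal.ofReal_mul (by positivity), _root_.sub_zero, Real.mul_rpow hq.le (by positivity), ← Real.rpow_mul hs.le]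
  congr 3; ring

lemma bd_sum (hB : IsFBM H P B) (hH : H ∈ Ioo (0 : ℝ) (1 / 2)) :
    ∃ C : ℝ≥0∞, C < ⊤ ∧ ∀ (N : ℕ) (η θ ε l : ℝ), 0 < N → 0 < η → η ≤ 1 → 0 < θ → θ ≤ η → 0 < ε → ε * (N : ℝ) ^ H = θ →
      ∫⁻ ω, ENNReal.ofReal (ε ^ (1 / H - 1)) *
        ∑ i ∈ Finset.range N, (Ioo l (l + ε)).indicator (1 : ℝ → ℝ≥0∞) (B (i / N) ω) ∂P ≤ C * ENNReal.ofReal η := by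
  have hq := shc_pos hB hH
  set K := ENNReal.ofReal (shc hB ^ (-(1 / 2) : ℝ)) with hK
  refine ⟨1 + K * ENNReal.ofReal (1 - H)⁻¹, by finiteness, ?_⟩
  intro N η θ ε l hN hη hη1 hθ hθη hε hεθ
  have hN' : (0 : ℝ) < N := by exact_mod_cast hN
  have h0 : 0 < H := hH.1
  have h1 : H < 1 := by linarith [hH.2]
  have hNH : 1 ≤ (N : ℝ) ^ H := Real.one_le_rpow (by exact_mod_cast hN) h0.le
  have hεθ' : ε ≤ θ := by rw [← hεθ]; nlinarith
  have hex : 1 ≤ 1 / H - 1 := by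
    have : 2 ≤ 1 / H := by rw [le_div_iff₀ h0]; linarith [hH.2]
    linarith
  have a1 : ε ^ (1 / H - 1) ≤ η := by
    calc ε ^ (1 / H - 1) ≤ ε ^ (1 : ℝ) := Real.rpow_le_rpow_of_exponent_ge hε (by linarith) hex
      _ = ε := Real.rpow_one _
      _ ≤ η := by linarith
  have a2 : ε ^ (1 / H - 1) * ε * N ≤ η := by
    have e1 : ε ^ (1 / H - 1) * ε * N = θ ^ (1 / H) := by
      rw [← hεθ, Real.mul_rpow hε.le (by positivity), ← Real.rpow_mul hN'.le, mul_one_div_cancel h0.ne', Real.rpow_one]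
      congr 1
      rw [← Real.rpow_add_one hε.ne']; congr 1; ring
    rw [e1]
    calc θ ^ (1 / H) ≤ θ ^ (1 : ℝ) := Real.rpow_le_rpow_of_exponent_ge hθ (by linarith) (by linarith)
      _ = θ := Real.rpow_one _
      _ ≤ η := hθη
  have mI : ∀ i : ℕ, Measurable fun ω => (Ioo l (l + ε)).indicator (1 : ℝ → ℝ≥0∞) (B (i / N) ω) := fun i =>
    (measurable_one.indicator measurableSet_Ioo).comp (fbm_meas hB _)
  rw [lintegral_const_mul' _ _ ENNReal.ofReal_ne_top, lintegral_finsetSum _ (fun i _ => mI i)]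
  set g : ℕ → ℝ≥0∞ := fun k => K * ENNReal.ofReal (((k : ℝ) / N) ^ (-H)) * ENNReal.ofReal ε with hg
  have b1 : ∀ i ∈ Finset.range N, ∫⁻ ω, (Ioo l (l + ε)).indicator (1 : ℝ → ℝ≥0∞) (B (i / N) ω) ∂P ≤
      (if i = 0 then 1 else 0) + (if 0 + 1 ≤ i then g (i - 0) else 0) := by
    intro i _
    rcases Nat.eq_zero_or_pos i with rfl | hi
    · simp only [if_true]
      refine le_trans ?_ le_self_add
      calc _ ≤ ∫⁻ ω, (1 : ℝ≥0∞) ∂P := lintegral_mono fun ω => by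
            refine Set.indicator_le' (fun _ _ => le_rfl) (fun _ _ => bot_le) _
        _ = 1 := by simp
    · rw [if_neg hi.ne', if_pos (by omega), zero_add, Nat.sub_zero]
      exact bd_one hB hH (by positivity) l ε
  have b2 : ∑ k ∈ Finset.range N, g (k + 1) ≤ K * ENNReal.ofReal (ε * N) * ENNReal.ofReal (1 - H)⁻¹ := by
    refine le_trans (le_of_eq ?_) (mul_le_mul_right (sum_pow_e h0 h1 hN) _)
    rw [Finset.mul_sum]
    refine Finset.sum_congr rfl fun k _ => ?_
    simp only [hg]
    rw [mul_assoc K, mul_assoc K, ← ENNReal.ofReal_mul (p := (((k + 1 : ℕ) : ℝ) / N) ^ (-H)) (by positivity),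
      ← ENNReal.ofReal_mul (p := ε * N) (by positivity)]
    congr 2; field_simp
  calc _ ≤ ENNReal.ofReal (ε ^ (1 / H - 1)) * (1 + K * ENNReal.ofReal (ε * N) * ENNReal.ofReal (1 - H)⁻¹) := by
        refine mul_le_mul_right ?_ _
        refine (Finset.sum_le_sum b1).trans ?_
        rw [Finset.sum_add_distrib]
        refine add_le_add ?_ ((sum_shift g 0 N).trans b2)
        rw [Finset.sum_ite_eq' (Finset.range N) 0]; split_ifs <;> simp
    _ = ENNReal.ofReal (ε ^ (1 / H - 1)) + K * ENNReal.ofReal (1 - H)⁻¹ * ENNReal.ofReal (ε ^ (1 / H - 1) * ε * N) := by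
        rw [mul_assoc (ε ^ (1 / H - 1)), ENNReal.ofReal_mul (p := ε ^ (1 / H - 1)) (by positivity)]; ring
    _ ≤ ENNReal.ofReal η + K * ENNReal.ofReal (1 - H)⁻¹ * ENNReal.ofReal η := by gcongr
    _ = _ := by ring

lemma osc_full {N : ℕ} (hN : 0 < N) {i : ℕ} {w : ℝ → ℝ} (hw : Continuous w)
    (hM : Mx (tq H) (blk H N i w) ≠ ⊤) (hH : 0 < H) :
    ∀ r ∈ Icc ((i : ℝ) / N) (((i + 1 : ℕ) : ℝ) / N), |w r - w (i / N)| ≤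
      ((N : ℝ) ^ H)⁻¹ * (2 / (1 - tq H)) * (Mx (tq H) (blk H N i w)).toReal := by
  intro r hr
  have hN' : (0 : ℝ) < N := by exact_mod_cast hN
  have hcl : IsClosed {p : ℝ | |w p - w (i / N)| ≤
      ((N : ℝ) ^ H)⁻¹ * (2 / (1 - tq H)) * (Mx (tq H) (blk H N i w)).toReal} :=
    isClosed_le (by fun_prop) (by fun_prop)
  have hsub : blkD N i ⊆ {p : ℝ | |w p - w (i / N)| ≤
      ((N : ℝ) ^ H)⁻¹ * (2 / (1 - tq H)) * (Mx (tq H) (blk H N i w)).toReal} := osc_blk hN hM hH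
  have hc := closure_minimal hsub hcl
  refine hc ?_
  have e : r = (N : ℝ)⁻¹ * ((N : ℝ) * r - i) + i / N := by field_simp; ring
  rw [e]
  have hx : (N : ℝ) * r - i ∈ closure dya := by
    refine dya_dense ⟨?_, ?_⟩
    · have := hr.1; rw [div_le_iff₀ hN'] at this; linarith
    · have := hr.2; rw [le_div_iff₀ hN'] at this; push_cast at this; linarith
  exact image_closure_subset_closure_image (f := fun r => (N : ℝ)⁻¹ * r + i / N) (by fun_prop) ⟨_, hx, rfl⟩

lemma blk_meas_pi' (H : ℝ) (N i : ℕ) : Measurable fun w : ℝ → ℝ => blk H N i w :=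
  measurable_pi_lambda _ fun p => by unfold blk; fun_prop

lemma riem_path {N : ℕ} (hN : 0 < N) {w : ℝ → ℝ} (hw : Continuous w)
    (hM : ∀ i < N, Mx (tq H) (blk H N i w) ≠ ⊤) (hH : 0 < H) {η : ℝ} (hη : 0 < η) (l : ℝ) :
    |(N : ℝ)⁻¹ * ∑ i ∈ Finset.range N, tent η (w (i / N) - l) - ∫ r in (0 : ℝ)..1, tent η (w r - l)| ≤
      ∑ i ∈ Finset.range N, (N : ℝ)⁻¹ * ((η ^ 2)⁻¹ * (((N : ℝ) ^ H)⁻¹ * (2 / (1 - tq H)) *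
        (Mx (tq H) (blk H N i w)).toReal)) := by
  have hN' : (0 : ℝ) < N := by exact_mod_cast hN
  have hc : Continuous fun r => tent η (w r - l) := (tent_cont η).comp (by fun_prop)
  have hi : ∀ a b : ℝ, IntervalIntegrable (fun r => tent η (w r - l)) volume a b := fun a b =>
    hc.intervalIntegrable a b
  have e1 : ∫ r in (0 : ℝ)..1, tent η (w r - l) =
      ∑ i ∈ Finset.range N, ∫ r in ((i : ℝ) / N)..(((i + 1 : ℕ) : ℝ) / N), tent η (w r - l) := by
    rw [intervalIntegral.sum_integral_adjacent_intervals (a := fun i : ℕ => (i : ℝ) / N) (fun k _ => hi _ _)]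
    congr 1
    · simp
    · field_simp
  have len : ∀ i : ℕ, ((i + 1 : ℕ) : ℝ) / N - (i : ℝ) / N = (N : ℝ)⁻¹ := by
    intro i; push_cast; field_simp; ring
  rw [e1, Finset.mul_sum, ← Finset.sum_sub_distrib]
  refine (Finset.abs_sum_le_sum_abs _ _).trans (Finset.sum_le_sum fun i hiN => ?_)
  have e2 : (N : ℝ)⁻¹ * tent η (w (i / N) - l) =
      ∫ r in ((i : ℝ) / N)..(((i + 1 : ℕ) : ℝ) / N), tent η (w (i / N) - l) := by
    rw [intervalIntegral.integral_const, len, smul_eq_mul]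
  rw [e2, ← intervalIntegral.integral_sub (by simp) (hi _ _)]
  have hle : (i : ℝ) / N ≤ ((i + 1 : ℕ) : ℝ) / N := by
    have := len i; have : 0 < (N : ℝ)⁻¹ := by positivity
    linarith
  have hb := intervalIntegral.norm_integral_le_of_norm_le_const (a := (i : ℝ) / N) (b := ((i + 1 : ℕ) : ℝ) / N)
    (f := fun r => tent η (w (i / N) - l) - tent η (w r - l))
    (C := (η ^ 2)⁻¹ * (((N : ℝ) ^ H)⁻¹ * (2 / (1 - tq H)) * (Mx (tq H) (blk H N i w)).toReal)) (by
      intro r hr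
      rw [uIoc_of_le hle] at hr
      rw [Real.norm_eq_abs]
      refine (tent_lip hη _ _).trans ?_
      refine mul_le_mul_of_nonneg_left ?_ (by positivity)
      have := osc_full hN hw (hM i (Finset.mem_range.1 hiN)) hH r ⟨hr.1.le, hr.2⟩
      rw [abs_sub_comm] at this
      refine le_trans (le_of_eq ?_) this
      congr 1; ring)
  rw [len, abs_of_pos (by positivity), Real.norm_eq_abs] at hb
  linarith

lemma Mx_blk_ae (hB : IsFBM H P B) (hH : 0 < H) {N : ℕ} (hN : 0 < N) (i : ℕ) :
    ∀ᵐ ω ∂P, Mx (tq H) (blk H N i (fun r => B r ω)) < ⊤ := by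
  refine ae_lt_top ((meas_Mx_pi (tq H)).comp ((blk_meas_pi' H N i).comp (meas_path hB))) ?_
  have := blk_lint hB hN i (meas_Mx_pi (tq H))
  rw [this]
  have := Mx_moment hB hH 1
  simp only [pow_one] at this
  exact this.ne

lemma riem_est (hB : IsFBM H P B) (hH : 0 < H) :
    ∃ C : ℝ≥0∞, C < ⊤ ∧ ∀ (N : ℕ) (η l : ℝ), 0 < N → 0 < η → ((N : ℝ) ^ H)⁻¹ ≤ η ^ 3 →
      ∫⁻ ω, ENNReal.ofReal |(N : ℝ)⁻¹ * ∑ i ∈ Finset.range N, tent η (B (i / N) ω - l) -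
        ∫ r in (0 : ℝ)..1, tent η (B r ω - l)| ∂P ≤ C * ENNReal.ofReal η := by
  have hM := Mx_moment hB hH 1
  simp only [pow_one] at hM
  have hq : 0 < 1 - tq H := by have := tq_lt hH; linarith
  set M1 := ∫⁻ ω, Mx (tq H) (fun r => B r ω) ∂P with hM1
  refine ⟨ENNReal.ofReal (2 / (1 - tq H)) * M1, by finiteness, ?_⟩
  intro N η l hN hη hNη
  have hN' : (0 : ℝ) < N := by exact_mod_cast hN
  set K : ℝ := (η ^ 2)⁻¹ * (((N : ℝ) ^ H)⁻¹ * (2 / (1 - tq H))) with hK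
  have hK0 : 0 ≤ K := by positivity
  have mm : ∀ i : ℕ, Measurable fun ω => Mx (tq H) (blk H N i (fun r => B r ω)) := fun i =>
    (meas_Mx_pi (tq H)).comp ((blk_meas_pi' H N i).comp (meas_path hB))
  have hae : ∀ᵐ ω ∂P, ∀ i, Mx (tq H) (blk H N i (fun r => B r ω)) < ⊤ :=
    ae_all_iff.2 fun i => Mx_blk_ae hB hH hN i
  calc _ ≤ ∫⁻ ω, ENNReal.ofReal K * (ENNReal.ofReal (N : ℝ)⁻¹ * ∑ i ∈ Finset.range N, Mx (tq H) (blk H N i (fun r => B r ω))) ∂P := by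
        refine lintegral_mono_ae ?_
        filter_upwards [hae] with ω hω
        refine (ENNReal.ofReal_le_ofReal (riem_path hN (hB.1 ω) (fun i _ => (hω i).ne) hH hη l)).trans (le_of_eq ?_)
        rw [ENNReal.ofReal_sum_of_nonneg (fun i _ => by positivity), Finset.mul_sum, Finset.mul_sum]
        refine Finset.sum_congr rfl fun i _ => ?_
        conv_rhs => rw [← ENNReal.ofReal_toReal (hω i).ne]
        rw [← ENNReal.ofReal_mul (by positivity), ← ENNReal.ofReal_mul (by positivity)]
        congr 1; rw [hK]; ring
    _ = ENNReal.ofReal K * M1 := by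
        have ms : Measurable fun ω => ∑ i ∈ Finset.range N, Mx (tq H) (blk H N i (fun r => B r ω)) :=
          Finset.measurable_sum _ fun i _ => mm i
        rw [lintegral_const_mul' _ _ ENNReal.ofReal_ne_top, lintegral_const_mul' _ _ ENNReal.ofReal_ne_top,
          lintegral_finsetSum _ (fun i _ => mm i), Finset.sum_congr rfl (fun i _ => blk_lint hB hN i (meas_Mx_pi (tq H))),
          avg_const hN]
    _ ≤ ENNReal.ofReal (2 / (1 - tq H) * η) * M1 := by
        gcongr
        rw [hK]
        have : (η ^ 2)⁻¹ * (((N : ℝ) ^ H)⁻¹ * (2 / (1 - tq H))) ≤ (η ^ 2)⁻¹ * (η ^ 3 * (2 / (1 - tq H))) := by gcongr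
        refine this.trans (le_of_eq ?_)
        field_simp
    _ = _ := by rw [ENNReal.ofReal_mul (by positivity)]; ring

end P22

end

section



/-! ### Choice of parameters -/
section P23
variable {Ω : Type*} [MeasurableSpace Ω] {P : Measure Ω} [IsProbabilityMeasure P]
variable {H : ℝ} {B : ℝ → Ω → ℝ}

/-- the widths of the test functions -/
def et (k : ℕ) : ℝ := ((k : ℝ) + 1) ^ (-2 : ℝ)
/-- the widths of the upcrossed intervals -/
def ee (γ : ℝ) (k : ℕ) : ℝ := ((k : ℝ) + 1) ^ (-γ)

lemma et_pos (k : ℕ) : 0 < et k := by unfold et; positivity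

lemma ee_pos (γ : ℝ) (k : ℕ) : 0 < ee γ k := by unfold ee; positivity

lemma nat_pow_cast (k m : ℕ) : (((k + 1) ^ m : ℕ) : ℝ) = ((k : ℝ) + 1) ^ (m : ℝ) := by
  rw [Nat.cast_pow, Real.rpow_natCast]; push_cast; rfl

lemma three_est (hB : IsFBM H P B) (hH : H ∈ Ioo (0 : ℝ) (1 / 2)) :
    ∃ (γ : ℝ) (C : ℝ≥0∞) (N : ℕ → ℕ), 0 < γ ∧ C < ⊤ ∧ (∀ k, 0 < N k) ∧ ∀ k l,
      (∫⁻ ω, ENNReal.ofReal ((∑ i ∈ Finset.range (N k), dd H (N k) (ee γ k) l (et k) (bR H P B) i (fun r => B r ω)) ^ 2) ∂P ≤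
        C * ENNReal.ofReal (et k)) ∧
      (∫⁻ ω, ENNReal.ofReal (ee γ k ^ (1 / H - 1)) *
        ∑ i ∈ Finset.range (N k), (Ioo l (l + ee γ k)).indicator (1 : ℝ → ℝ≥0∞) (B (i / N k) ω) ∂P ≤
        C * ENNReal.ofReal (et k)) ∧
      (∫⁻ ω, ENNReal.ofReal |(N k : ℝ)⁻¹ * ∑ i ∈ Finset.range (N k), tent (et k) (B (i / N k) ω - l) -
        ∫ r in (0 : ℝ)..1, tent (et k) (B r ω - l)| ∂P ≤ C * ENNReal.ofReal (et k)) := by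
  obtain ⟨CL, hCL, hL⟩ := LLN hB hH
  obtain ⟨C1, hC1, h1⟩ := main_sq hB hH (bR_nonneg (H := H) (P := P) (B := B)) hCL
  obtain ⟨C2, hC2, h2⟩ := bd_sum hB hH
  obtain ⟨C3, hC3, h3⟩ := riem_est hB hH.1
  have h0 := hH.1
  have hH2 : 0 < 1 - 2 * H := by linarith [hH.2]
  obtain ⟨K, hK⟩ := exists_nat_ge (1 + 6 / (64 * H) + (2 * Qq H * (4 + 64 * H) + 2) / (64 * (1 - 2 * H)))
  have p1 : 0 < 6 / (64 * H) := by positivity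
  have p2 : 0 < (2 * Qq H * (4 + 64 * H) + 2) / (64 * (1 - 2 * H)) := by positivity
  have k1 : (1 : ℝ) ≤ K := by linarith
  have k2 : 6 ≤ 64 * K * H := by
    have : 6 / (64 * H) ≤ K := by linarith
    rw [div_le_iff₀ (by positivity)] at this; linarith
  have k3 : 2 * Qq H * (4 + 64 * H) + 2 ≤ 64 * K * (1 - 2 * H) := by
    have : (2 * Qq H * (4 + 64 * H) + 2) / (64 * (1 - 2 * H)) ≤ K := by linarith
    rw [div_le_iff₀ (by positivity)] at this; linarith
  refine ⟨4 + 64 * H + 64 * K * H, C1 + C2 + C3, fun k => (k + 1) ^ (64 * K), by positivity, by finiteness,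
    fun k => by positivity, ?_⟩
  intro k l
  simp only
  have hκ : (0 : ℝ) < (k : ℝ) + 1 := by positivity
  have hκ1 : (1 : ℝ) ≤ (k : ℝ) + 1 := le_add_of_nonneg_left (Nat.cast_nonneg k)
  set κ : ℝ := (k : ℝ) + 1 with hκd
  have mono : ∀ a b : ℝ, b ≤ a → κ ^ (-a) ≤ κ ^ (-b) := fun a b h =>
    Real.rpow_le_rpow_of_exponent_le hκ1 (by linarith)
  have hNc : (((k + 1) ^ (64 * K) : ℕ) : ℝ) = κ ^ (64 * K : ℝ) := by
    rw [nat_pow_cast, hκd]; congr 1; push_cast; rfl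
  have hN : 0 < (k + 1) ^ (64 * K) := pow_pos (Nat.succ_pos k) _
  obtain ⟨n, hn0, hnc⟩ : ∃ n : ℕ, 0 < n ∧ (n : ℝ) = κ ^ (64 : ℝ) :=
    ⟨(k + 1) ^ 64, pow_pos (Nat.succ_pos k) _, by rw [nat_pow_cast, hκd]; norm_num⟩
  generalize (k + 1) ^ (64 * K) = N at hNc hN ⊢
  have hη : 0 < et k := et_pos k
  have hη' : et k = κ ^ (-2 : ℝ) := by rw [et]
  have hη1 : et k ≤ 1 := by rw [hη']; exact Real.rpow_le_one_of_one_le_of_nonpos hκ1 (by norm_num)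
  set θ : ℝ := κ ^ (-(4 + 64 * H)) with hθd
  have hθ : 0 < θ := Real.rpow_pos_of_pos hκ _
  have hθη : θ ≤ et k := by rw [hη', hθd]; exact mono _ _ (by linarith)
  have hNH : (N : ℝ) ^ H = κ ^ (64 * K * H) := by rw [hNc, ← Real.rpow_mul hκ.le]
  have he : 0 < ee (4 + 64 * H + 64 * K * H) k := ee_pos _ k
  have hee : ee (4 + 64 * H + 64 * K * H) k = κ ^ (-(4 + 64 * H + 64 * K * H)) := by rw [ee]
  have heN : ee (4 + 64 * H + 64 * K * H) k * (N : ℝ) ^ H = θ := by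
    rw [hNH, hee, hθd, ← Real.rpow_add hκ]; congr 1; ring
  have c3 : et k ^ 3 = κ ^ (-6 : ℝ) := by
    rw [hη', ← Real.rpow_natCast, ← Real.rpow_mul hκ.le]; norm_num
  have n1 : (N : ℝ)⁻¹ ≤ et k ^ 3 := by
    rw [c3, hNc, ← Real.rpow_neg hκ.le]; exact mono _ _ (by linarith)
  have n2 : ((N : ℝ) ^ H)⁻¹ ≤ et k ^ 3 := by
    rw [c3, hNH, ← Real.rpow_neg hκ.le]; exact mono _ _ (by linarith)
  have n2' : ((N : ℝ) ^ H)⁻¹ ≤ et k := n2.trans (by rw [c3, hη']; exact mono _ _ (by norm_num))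
  have n3 : (N : ℝ) ^ (-(1 - 2 * H)) ≤ θ ^ (2 * Qq H) * et k := by
    have : θ ^ (2 * Qq H) * et k = κ ^ (-(2 * Qq H * (4 + 64 * H) + 2)) := by
      rw [hη', hθd, ← Real.rpow_natCast, ← Real.rpow_mul hκ.le, ← Real.rpow_add hκ]; congr 1; push_cast; ring
    rw [this, hNc, ← Real.rpow_mul hκ.le]
    have : 64 * (K : ℝ) * -(1 - 2 * H) = -(64 * K * (1 - 2 * H)) := by ring
    rw [this]; exact mono _ _ k3
  have hLL := hL n (et k ^ 2) hn0 (pow_pos hη 2) (pow_le_one₀ hη.le hη1) (by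
      rw [hnc, hη', ← Real.rpow_natCast, ← Real.rpow_natCast, ← Real.rpow_mul hκ.le, ← Real.rpow_mul hκ.le,
        ← Real.rpow_neg hκ.le]; norm_num) θ hθ (by
      rw [hnc, hη', hθd, ← Real.rpow_mul hκ.le, ← Real.rpow_natCast, ← Real.rpow_mul hκ.le, ← Real.rpow_add hκ]
      congr 1; push_cast; ring)
  refine ⟨(h1 N (et k) θ _ hN hη hη1 hθ (hθη.trans hη1) n1 n2' n3 he heN hLL l).trans ?_,
    (h2 N (et k) θ _ l hN hη hη1 hθ hθη he heN).trans ?_, (h3 N (et k) l hN hη n2).trans ?_⟩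
  · exact mul_le_mul_left ((le_self_add).trans le_self_add) _
  · exact mul_le_mul_left ((le_add_self).trans le_self_add) _
  · exact mul_le_mul_left le_add_self _

lemma et_sum : ∑' k, ENNReal.ofReal (et k) ≠ ⊤ := by
  have h : Summable fun k : ℕ => et k := by
    have := (summable_nat_add_iff 1).2 (Real.summable_nat_rpow.2 (show (-2 : ℝ) < -1 by norm_num))
    refine this.congr fun k => ?_
    unfold et; push_cast; rfl
  exact h.tsum_ofReal_ne_top

lemma et_tendsto : Tendsto et atTop (𝓝 0) := by
  have h := et_sum
  have h2 : Summable fun k : ℕ => et k := by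
    have := (summable_nat_add_iff 1).2 (Real.summable_nat_rpow.2 (show (-2 : ℝ) < -1 by norm_num))
    refine this.congr fun k => ?_
    unfold et; push_cast; rfl
  exact h2.tendsto_atTop_zero

lemma ae_tendsto_of_sum {X : ℕ → Ω → ℝ≥0∞} (mX : ∀ k, AEMeasurable (X k) P) {C : ℝ≥0∞} (hC : C < ⊤)
    (h : ∀ k, ∫⁻ ω, X k ω ∂P ≤ C * ENNReal.ofReal (et k)) : ∀ᵐ ω ∂P, Tendsto (fun k => X k ω) atTop (𝓝 0) := by
  have h1 : ∫⁻ ω, ∑' k, X k ω ∂P ≠ ⊤ := by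
    rw [lintegral_tsum mX]
    refine ne_top_of_le_ne_top ?_ (ENNReal.tsum_le_tsum h)
    rw [ENNReal.tsum_mul_left]
    exact ENNReal.mul_ne_top hC.ne et_sum
  filter_upwards [ae_lt_top' (AEMeasurable.ennreal_tsum mX) h1] with ω hω
  exact ENNReal.tendsto_atTop_zero_of_tsum_ne_top hω.ne

end P23

end

section



/-! ### Almost sure convergence along the discrete scales -/
section P24
variable {Ω : Type*} [MeasurableSpace Ω] {P : Measure Ω} [IsProbabilityMeasure P]
variable {H : ℝ} {B : ℝ → Ω → ℝ}

lemma tent_conv {g : ℝ → ℝ} (hg : Continuous g) {a : ℝ} {l : ℕ → ℝ} (hl : Tendsto l atTop (𝓝 a)) :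
    Tendsto (fun k => ∫ y, tent (et k) (y - l k) * g y) atTop (𝓝 (g a)) := by
  rw [Metric.tendsto_atTop']
  intro δ hδ
  obtain ⟨ρ, hρ, hgρ⟩ := Metric.continuous_iff.1 hg a (δ / 2) (by positivity)
  have h1 := (Metric.tendsto_atTop'.1 hl (ρ / 2) (by positivity))
  have h2 := (Metric.tendsto_atTop'.1 et_tendsto (ρ / 2) (by positivity))
  obtain ⟨n1, h1⟩ := h1
  obtain ⟨n2, h2⟩ := h2
  refine ⟨max n1 n2, fun k hk => ?_⟩
  have h1 := h1 k ((le_max_left _ _).trans_lt hk)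
  have h2 := h2 k ((le_max_right _ _).trans_lt hk)
  have hη := et_pos k
  rw [Real.dist_eq] at h1 h2 ⊢
  rw [_root_.sub_zero, abs_of_pos hη] at h2
  have it : Integrable (fun y => tent (et k) (y - l k)) := (tent_int_le hη).comp_sub_right (l k)
  have iti : ∫ y, tent (et k) (y - l k) = 1 := by
    rw [integral_sub_right_eq_self (fun y => tent (et k) y), tent_int hη]
  have ct : Continuous fun y => tent (et k) (y - l k) := (tent_cont _).comp (by fun_prop)
  have supp : HasCompactSupport fun y => tent (et k) (y - l k) := by
    refine HasCompactSupport.of_support_subset_isCompact (isCompact_Icc (a := l k - et k) (b := l k + et k)) ?_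
    intro y hy
    have := abs_le.1 (tent_supp hη _ hy)
    exact ⟨by linarith, by linarith⟩
  have ig : Integrable (fun y => tent (et k) (y - l k) * g y) :=
    (ct.mul hg).integrable_of_hasCompactSupport supp.mul_right
  have e : (∫ y, tent (et k) (y - l k) * g y) - g a = ∫ y, tent (et k) (y - l k) * (g y - g a) := by
    have : ∀ y, tent (et k) (y - l k) * (g y - g a) = tent (et k) (y - l k) * g y - tent (et k) (y - l k) * g a :=
      fun y => by ring
    simp_rw [this]
    rw [integral_sub ig (it.mul_const _), integral_mul_const, iti, one_mul]
  rw [e]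
  have hb := norm_integral_le_of_norm_le (f := fun y => tent (et k) (y - l k) * (g y - g a)) (it.mul_const (δ / 2))
    (Eventually.of_forall fun y => by
      rw [norm_mul, Real.norm_eq_abs, Real.norm_eq_abs, abs_of_nonneg (tent_nonneg _ _)]
      by_cases hy : tent (et k) (y - l k) = 0
      · simp [hy]
      · refine mul_le_mul_of_nonneg_left ?_ (tent_nonneg _ _)
        have h3 := tent_supp hη _ hy
        have h4 : |y - a| < ρ := by
          have : y - a = (y - l k) + (l k - a) := by ring
          rw [this]
          refine (abs_add_le _ _).trans_lt ?_
          linarith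
        have := hgρ y (by rw [Real.dist_eq]; exact h4)
        rw [Real.dist_eq] at this
        exact this.le)
  rw [integral_mul_const, iti, Real.norm_eq_abs] at hb
  linarith

lemma meas_tent_int (hB : IsFBM H P B) (η l : ℝ) :
    Measurable fun ω => ∫ r in (0 : ℝ)..1, tent η (B r ω - l) := by
  have h1 : Measurable (Function.uncurry B) := measurable_uncurry_of_continuous_of_measurable hB.1 hB.2.2.1
  have h2 : Measurable (Function.uncurry fun (ω : Ω) (r : ℝ) => tent η (B r ω - l)) :=
    (tent_cont η).measurable.comp ((h1.comp measurable_swap).sub_const l)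
  simp_rw [intervalIntegral.integral_of_le zero_le_one]
  exact (h2.stronglyMeasurable.integral_prod_right (ν := volume.restrict (Ioc (0 : ℝ) 1))).measurable

lemma grid_conv (hB : IsFBM H P B) (hH : H ∈ Ioo (0 : ℝ) (1 / 2)) {γ : ℝ} {C : ℝ≥0∞} {N : ℕ → ℕ} (hC : C < ⊤)
    (hN : ∀ k, 0 < N k)
    (hest : ∀ k l,
      (∫⁻ ω, ENNReal.ofReal ((∑ i ∈ Finset.range (N k), dd H (N k) (ee γ k) l (et k) (bR H P B) i (fun r => B r ω)) ^ 2) ∂P ≤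
        C * ENNReal.ofReal (et k)) ∧
      (∫⁻ ω, ENNReal.ofReal (ee γ k ^ (1 / H - 1)) *
        ∑ i ∈ Finset.range (N k), (Ioo l (l + ee γ k)).indicator (1 : ℝ → ℝ≥0∞) (B (i / N k) ω) ∂P ≤
        C * ENNReal.ofReal (et k)) ∧
      (∫⁻ ω, ENNReal.ofReal |(N k : ℝ)⁻¹ * ∑ i ∈ Finset.range (N k), tent (et k) (B (i / N k) ω - l) -
        ∫ r in (0 : ℝ)..1, tent (et k) (B r ω - l)| ∂P ≤ C * ENNReal.ofReal (et k)))
    {L : ℝ → Ω → ℝ} (hLc : ∀ ω, Continuous fun y => L y ω)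
    (hLo : ∀ᵐ ω ∂P, ∀ f : ℝ → ℝ, Continuous f → ∫ r in (0 : ℝ)..1, f (B r ω) = ∫ y, f y * L y ω)
    {a : ℝ} {l : ℕ → ℝ} (hl : Tendsto l atTop (𝓝 a)) :
    ∀ᵐ ω ∂P, Tendsto (fun k => ENNReal.ofReal (ee γ k ^ (1 / H - 1)) *
      Up (gridD (N k)) (l k) (l k + ee γ k) (fun r => B r ω)) atTop (𝓝 (ENNReal.ofReal (bR H P B * L a ω))) := by
  have mp := meas_path hB
  have mB := fbm_meas hB
  have A1 := ae_tendsto_of_sum (P := P) (C := C)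
    (X := fun k ω => ENNReal.ofReal ((∑ i ∈ Finset.range (N k), dd H (N k) (ee γ k) (l k) (et k) (bR H P B) i (fun r => B r ω)) ^ 2))
    (fun k => (((Finset.measurable_sum _ fun i _ => (meas_dd H (N k) (ee γ k) (l k) (et k) (bR H P B) i).comp mp).pow_const 2).ennreal_ofReal).aemeasurable)
    hC (fun k => (hest k (l k)).1)
  have A2 := ae_tendsto_of_sum (P := P) (C := C)
    (X := fun k ω => ENNReal.ofReal (ee γ k ^ (1 / H - 1)) *
        ∑ i ∈ Finset.range (N k), (Ioo (l k) (l k + ee γ k)).indicator (1 : ℝ → ℝ≥0∞) (B (i / N k) ω))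
    (fun k => by
      have m1 : ∀ i : ℕ, Measurable fun ω => (Ioo (l k) (l k + ee γ k)).indicator (1 : ℝ → ℝ≥0∞) (B (i / N k) ω) :=
        fun i => (measurable_one.indicator measurableSet_Ioo).comp (mB ((i : ℝ) / N k))
      have m2 : Measurable fun ω => ∑ i ∈ Finset.range (N k), (Ioo (l k) (l k + ee γ k)).indicator (1 : ℝ → ℝ≥0∞) (B (i / N k) ω) :=
        Finset.measurable_sum _ fun i _ => m1 i
      exact (m2.const_mul _).aemeasurable)
    hC (fun k => (hest k (l k)).2.1)
  have A3 := ae_tendsto_of_sum (P := P) (C := C)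
    (X := fun k ω => ENNReal.ofReal |(N k : ℝ)⁻¹ * ∑ i ∈ Finset.range (N k), tent (et k) (B (i / N k) ω - l k) -
        ∫ r in (0 : ℝ)..1, tent (et k) (B r ω - l k)|)
    (fun k => by
      have m1 := meas_tent_int hB (et k) (l k)
      have m3 : ∀ i : ℕ, Measurable fun ω => tent (et k) (B (i / N k) ω - l k) := fun i =>
        (tent_cont _).measurable.comp ((mB ((i : ℝ) / N k)).sub_const _)
      have m4 : Measurable fun ω => ∑ i ∈ Finset.range (N k), tent (et k) (B (i / N k) ω - l k) :=
        Finset.measurable_sum _ fun i _ => m3 i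
      have m2 : Measurable fun ω => (N k : ℝ)⁻¹ * ∑ i ∈ Finset.range (N k), tent (et k) (B (i / N k) ω - l k) :=
        m4.const_mul _
      exact (((m2.sub m1).abs).ennreal_ofReal).aemeasurable)
    hC (fun k => (hest k (l k)).2.2)
  have A4 : ∀ᵐ ω ∂P, ∀ k i, Mx (tq H) (blk H (N k) i (fun r => B r ω)) < ⊤ :=
    ae_all_iff.2 fun k => ae_all_iff.2 fun i => Mx_blk_ae hB hH.1 (hN k) i
  filter_upwards [A1, A2, A3, A4, hLo] with ω a1 a2 a3 a4 hL
  have huu : ∀ k i, uu H (N k) (ee γ k) (l k) i (fun r => B r ω) ≠ ⊤ := fun k i => by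
    refine ne_top_of_le_ne_top ?_ (uu_le hH.1 (hN k) (ee_pos γ k) (l k) i _)
    have := (a4 k i).ne
    finiteness
  have c3 : Tendsto (fun k => (N k : ℝ)⁻¹ * ∑ i ∈ Finset.range (N k), tent (et k) (B (i / N k) ω - l k) -
        ∫ r in (0 : ℝ)..1, tent (et k) (B r ω - l k)) atTop (𝓝 0) := by
    rw [tendsto_zero_iff_abs_tendsto_zero]
    have := (ENNReal.tendsto_toReal ENNReal.zero_ne_top).comp a3
    refine this.congr fun k => ?_
    simp
  have c4 : Tendsto (fun k => ∫ r in (0 : ℝ)..1, tent (et k) (B r ω - l k)) atTop (𝓝 (L a ω)) := by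
    refine (tent_conv (hLc ω) hl).congr fun k => ?_
    exact (hL (fun y => tent (et k) (y - l k)) ((tent_cont _).comp (by fun_prop))).symm
  have c1 : Tendsto (fun k => ∑ i ∈ Finset.range (N k), dd H (N k) (ee γ k) (l k) (et k) (bR H P B) i (fun r => B r ω))
      atTop (𝓝 0) := by
    have := (ENNReal.tendsto_toReal ENNReal.zero_ne_top).comp a1
    have h2 : Tendsto (fun k => (∑ i ∈ Finset.range (N k), dd H (N k) (ee γ k) (l k) (et k) (bR H P B) i (fun r => B r ω)) ^ 2)
      atTop (𝓝 0) := by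
      refine this.congr fun k => ?_
      simp only [Function.comp_apply]
      rw [ENNReal.toReal_ofReal (sq_nonneg _)]
    have h3 := h2.sqrt
    rw [Real.sqrt_zero] at h3
    rw [tendsto_zero_iff_abs_tendsto_zero]
    refine h3.congr fun k => ?_
    rw [Real.sqrt_sq_eq_abs]; rfl
  set A : ℕ → ℝ≥0∞ := fun k => ∑ i ∈ Finset.range (N k), uu H (N k) (ee γ k) (l k) i (fun r => B r ω) with hA
  have hAe : ∀ k, A k = ENNReal.ofReal (ee γ k ^ (1 / H - 1)) * ∑ i ∈ Finset.range (N k), Up (blkD (N k) i) (l k) (l k + ee γ k) (fun r => B r ω) := by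
    intro k
    simp only [hA]
    rw [Finset.mul_sum]; rfl
  have cA : Tendsto A atTop (𝓝 (ENNReal.ofReal (bR H P B * L a ω))) := by
    have h := (c1.add ((c3.add c4).const_mul (bR H P B)))
    rw [zero_add, zero_add] at h
    refine (ENNReal.tendsto_ofReal h).congr fun k => ?_
    have : A k = ENNReal.ofReal (A k).toReal := (ENNReal.ofReal_toReal (ENNReal.sum_ne_top.2 fun i _ => huu k i)).symm
    rw [this]
    congr 1
    simp only [hA]
    rw [ENNReal.toReal_sum fun i _ => huu k i]
    unfold dd
    rw [Finset.sum_sub_distrib, ← Finset.mul_sum]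
    ring
  have cB : Tendsto (fun k => A k + ENNReal.ofReal (ee γ k ^ (1 / H - 1)) *
        ∑ i ∈ Finset.range (N k), (Ioo (l k) (l k + ee γ k)).indicator (1 : ℝ → ℝ≥0∞) (B (i / N k) ω)) atTop
        (𝓝 (ENNReal.ofReal (bR H P B * L a ω))) := by
    have := cA.add a2
    rwa [add_zero] at this
  refine tendsto_of_tendsto_of_tendsto_of_le_of_le cA cB (fun k => ?_) (fun k => ?_)
  · simp only
    rw [hAe]
    exact mul_le_mul_right (Up_grid (hN k) _ _ _).1 _
  · simp only
    rw [hAe, ← mul_add]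
    exact mul_le_mul_right (Up_grid (hN k) _ _ _).2 _

end P24

end

section



/-! ### Bracketing -/
section P25
variable {Ω : Type*} [MeasurableSpace Ω] {P : Measure Ω} [IsProbabilityMeasure P]
variable {H : ℝ} {B : ℝ → Ω → ℝ}

lemma ee_anti {γ : ℝ} (hγ : 0 < γ) (k : ℕ) : ee γ (k + 1) < ee γ k := by
  unfold ee
  exact Real.rpow_lt_rpow_of_neg (by positivity) (by push_cast; linarith) (by linarith)

lemma ee_tendsto {γ : ℝ} (hγ : 0 < γ) : Tendsto (ee γ) atTop (𝓝 0) := by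
  have h : Tendsto (fun k : ℕ => (k : ℝ) + 1) atTop atTop :=
    tendsto_atTop_add_const_right _ _ tendsto_natCast_atTop_atTop
  exact (tendsto_rpow_neg_atTop hγ).comp h

lemma ee_ratio (γ p : ℝ) (m : ℕ) : Tendsto (fun k => (ee γ k / ee γ (k + m)) ^ p) atTop (𝓝 1) := by
  have h1 : Tendsto (fun k : ℕ => 1 + (m : ℝ) * ((k : ℝ) + 1)⁻¹) atTop (𝓝 1) := by
    have h : Tendsto (fun k : ℕ => (k : ℝ) + 1) atTop atTop :=
      tendsto_atTop_add_const_right _ _ tendsto_natCast_atTop_atTop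
    have := (h.inv_tendsto_atTop.const_mul (m : ℝ)).const_add 1
    simpa using this
  have h2 := (h1.rpow_const (p := γ) (Or.inl one_ne_zero)).rpow_const (p := p) (Or.inl (by simp))
  simp only [Real.one_rpow] at h2
  refine h2.congr fun k => ?_
  congr 1
  unfold ee
  have h0 : (0 : ℝ) < (k : ℝ) + 1 := by positivity
  have h3 : (0 : ℝ) < ((k + m : ℕ) : ℝ) + 1 := by positivity
  rw [Real.rpow_neg h0.le, Real.rpow_neg h3.le, inv_div_inv, ← Real.div_rpow h3.le h0.le]
  congr 1
  push_cast; field_simp; ring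

/-- the scale index attached to `x` -/
def kk (γ x : ℝ) : ℕ := ⌊x ^ (-(1 / γ))⌋₊ - 1

lemma kk_spec {γ x : ℝ} (hγ : 0 < γ) (hx : 0 < x) (hx1 : x ≤ 1) : ee γ (kk γ x + 1) ≤ x ∧ x ≤ ee γ (kk γ x) := by
  have h1 : 1 ≤ x ^ (-(1 / γ)) := Real.one_le_rpow_of_pos_of_le_one_of_nonpos hx hx1 (by
    have : 0 < 1 / γ := by positivity
    linarith)
  have h2 : 1 ≤ ⌊x ^ (-(1 / γ))⌋₊ := by rw [Nat.one_le_floor_iff]; exact h1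
  have h3 : kk γ x + 1 = ⌊x ^ (-(1 / γ))⌋₊ := by unfold kk; omega
  have h3' : (kk γ x : ℝ) + 1 = (⌊x ^ (-(1 / γ))⌋₊ : ℝ) := by exact_mod_cast h3
  have e : x = (x ^ (-(1 / γ))) ^ (-γ) := by
    rw [← Real.rpow_mul hx.le]
    have : -(1 / γ) * -γ = 1 := by field_simp
    rw [this, Real.rpow_one]
  constructor
  · unfold ee
    rw [h3]
    conv_rhs => rw [e]
    exact Real.rpow_le_rpow_of_nonpos (by positivity) (Nat.lt_floor_add_one _).le (by linarith)
  · unfold ee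
    rw [h3']
    conv_lhs => rw [e]
    exact Real.rpow_le_rpow_of_nonpos (by positivity) (Nat.floor_le (by positivity)) (by linarith)

lemma kk_tendsto {γ : ℝ} (hγ : 0 < γ) : Tendsto (kk γ) (𝓝[>] 0) atTop := by
  have h1 : Tendsto (fun x : ℝ => x ^ (-(1 / γ))) (𝓝[>] 0) atTop := tendsto_rpow_neg_nhdsGT_zero (by
    have : 0 < 1 / γ := by positivity
    linarith)
  have h2 := tendsto_nat_floor_atTop.comp h1
  exact (tendsto_sub_atTop_nat 1).comp h2

/-- bracketing of the continuous-scale upcrossing numbers -/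
lemma bracket {w : ℝ → ℝ} (hw : Continuous w) {γ p a : ℝ} (hγ : 0 < γ) (hp : 0 ≤ p) {N : ℕ → ℕ} (hN : ∀ k, 0 < N k)
    {lam : ℝ≥0∞}
    (h1 : Tendsto (fun k => ENNReal.ofReal (ee γ k ^ p) * Up (gridD (N k)) a (a + ee γ k) w) atTop (𝓝 lam))
    (h2 : Tendsto (fun k => ENNReal.ofReal (ee γ k ^ p) *
      Up (gridD (N k)) (a + (ee γ (k - 1) - ee γ k) / 2) (a + (ee γ (k - 1) - ee γ k) / 2 + ee γ k) w) atTop (𝓝 lam)) :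
    Tendsto (fun x => ENNReal.ofReal (x ^ p) * Up (Icc 0 1) a (a + x) w) (𝓝[>] 0) (𝓝 lam) := by
  have r1 : Tendsto (fun k => ENNReal.ofReal ((ee γ k / ee γ (k + 1)) ^ p)⁻¹) atTop (𝓝 1) := by
    have := ENNReal.tendsto_ofReal ((ee_ratio γ p 1).inv₀ one_ne_zero)
    simpa using this
  have r2 : Tendsto (fun k => ENNReal.ofReal ((ee γ k / ee γ (k + 2)) ^ p)) atTop (𝓝 1) := by
    have := ENNReal.tendsto_ofReal (ee_ratio γ p 2)
    simpa using this
  have f1 := (ENNReal.Tendsto.mul r1 (Or.inl one_ne_zero) h1 (Or.inr ENNReal.one_ne_top)).comp (kk_tendsto hγ)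
  have f2 := (ENNReal.Tendsto.mul r2 (Or.inl one_ne_zero) (h2.comp (tendsto_add_atTop_nat 2))
    (Or.inr ENNReal.one_ne_top)).comp (kk_tendsto hγ)
  rw [one_mul] at f1 f2
  have hev : ∀ᶠ x : ℝ in 𝓝[>] 0, 0 < x ∧ x ≤ 1 := by
    filter_upwards [Ioc_mem_nhdsGT (zero_lt_one' ℝ)] with x hx using hx
  refine tendsto_of_tendsto_of_tendsto_of_le_of_le' f1 f2 ?_ ?_
  · filter_upwards [hev] with x hx
    obtain ⟨k1, k2⟩ := kk_spec hγ hx.1 hx.2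
    simp only [Function.comp_apply]
    generalize kk γ x = k at *
    have e0 := ee_pos γ k
    have e1 := ee_pos γ (k + 1)
    rw [← mul_assoc, ← ENNReal.ofReal_mul (by positivity)]
    refine mul_le_mul' (ENNReal.ofReal_le_ofReal ?_) ?_
    · have : ((ee γ k / ee γ (k + 1)) ^ p)⁻¹ * ee γ k ^ p = ee γ (k + 1) ^ p := by
        rw [Real.div_rpow e0.le e1.le]
        have := Real.rpow_pos_of_pos e0 p
        field_simp
      rw [this]
      exact Real.rpow_le_rpow e1.le k1 hp
    · exact Up_mono (gridD_sub (hN k)) (fun _ _ h => h) (fun _ _ h => by linarith)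
  · filter_upwards [hev] with x hx
    obtain ⟨k1, k2⟩ := kk_spec hγ hx.1 hx.2
    simp only [Function.comp_apply]
    generalize kk γ x = k at *
    have e0 := ee_pos γ k
    have e2 := ee_pos γ (k + 2)
    have e12 := ee_anti hγ (k + 1)
    have hk : k + 2 - 1 = k + 1 := rfl
    rw [hk, ← mul_assoc, ← ENNReal.ofReal_mul (by positivity)]
    refine mul_le_mul' (ENNReal.ofReal_le_ofReal ?_) ?_
    · have : (ee γ k / ee γ (k + 2)) ^ p * ee γ (k + 2) ^ p = ee γ k ^ p := by
        rw [Real.div_rpow e0.le e2.le]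
        have := Real.rpow_pos_of_pos e2 p
        field_simp
      rw [this]
      exact Real.rpow_le_rpow hx.1.le k2 hp
    · refine (Up_mono_lev (α' := a) (β' := a + ee γ (k + 1)) le_rfl (by linarith)).trans ?_
      have := Up_Icc_le_dense (D := gridD (N (k + 2))) (gridD_dense (hN _)) hw (α := a) (β := a + ee γ (k + 1))
        (by linarith [ee_pos γ (k + 1)]) (η := (ee γ (k + 1) - ee γ (k + 2)) / 2) (by
          have : ee γ (k + 1 + 1) = ee γ (k + 2) := rfl
          linarith)
      refine this.trans (le_of_eq ?_)
      congr 1; ring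

lemma main_one (hB : IsFBM H P B) (hH : H ∈ Ioo (0 : ℝ) (1 / 2))
    {L : ℝ → Ω → ℝ} (hLc : ∀ ω, Continuous fun y => L y ω)
    (hLo : ∀ᵐ ω ∂P, ∀ f : ℝ → ℝ, Continuous f → ∫ r in (0 : ℝ)..1, f (B r ω) = ∫ y, f y * L y ω) (a : ℝ) :
    ∀ᵐ ω ∂P, 0 ≤ L a ω ∧ Tendsto (fun x => x ^ (1 / H - 1) * upR x (fun r => B r ω - a) 0 1) (𝓝[>] 0)
      (𝓝 (bR H P B * L a ω)) := by
  obtain ⟨γ, C, N, hγ, hC, hN, hest⟩ := three_est hB hH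
  have hl : Tendsto (fun k => a + (ee γ (k - 1) - ee γ k) / 2) atTop (𝓝 a) := by
    have h1 := (ee_tendsto hγ).comp (tendsto_sub_atTop_nat 1)
    have := ((h1.sub (ee_tendsto hγ)).div_const 2).const_add a
    simpa using this
  have hex : 0 ≤ 1 / H - 1 := by
    have h0 := hH.1
    have : 2 ≤ 1 / H := by rw [le_div_iff₀ h0]; linarith [hH.2]
    linarith
  filter_upwards [grid_conv hB hH hC hN hest hLc hLo (a := a) (l := fun _ => a) tendsto_const_nhds,
    grid_conv hB hH hC hN hest hLc hLo (a := a) hl, hLo] with ω h1 h2 h3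
  have hL0 : 0 ≤ L a ω := by
    have := tent_conv (hLc ω) (a := a) (l := fun _ => a) tendsto_const_nhds
    refine ge_of_tendsto' this fun k => ?_
    rw [← h3 (fun y => tent (et k) (y - a)) ((tent_cont _).comp (by fun_prop))]
    exact intervalIntegral.integral_nonneg zero_le_one fun r _ => tent_nonneg _ _
  refine ⟨hL0, ?_⟩
  have h := bracket (hB.1 ω) hγ hex hN h1 h2
  have h' := (ENNReal.tendsto_toReal ENNReal.ofReal_ne_top).comp h
  rw [ENNReal.toReal_ofReal (mul_nonneg bR_nonneg hL0)] at h'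
  refine h'.congr' ?_
  filter_upwards [self_mem_nhdsWithin] with x hx
  have hx : 0 < x := hx
  simp only [Function.comp_apply]
  rw [ENNReal.toReal_mul, ENNReal.toReal_ofReal (by positivity)]
  congr 1
  unfold upR
  rw [← Up_eq_upE (w := fun r => B r ω - a) ((hB.1 ω).sub continuous_const) hx]
  have := Up_shift (D := Icc 0 1) (α := 0) (β := x) (w := fun r => B r ω) (-a)
  simp only [← sub_eq_add_neg] at this
  rw [this]
  congr 2 <;> ring

end P25

end

section



/-! ### Reduction to the unit time interval -/
section P26
variable {Ω : Type*} [MeasurableSpace Ω] {P : Measure Ω} [IsProbabilityMeasure P]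
variable {H : ℝ} {B : ℝ → Ω → ℝ}

/-- the rescaled process -/
def scB (H c : ℝ) (B : ℝ → Ω → ℝ) (r : ℝ) (ω : Ω) : ℝ := c⁻¹ ^ H * B (c * r) ω

lemma scB_fbm (hB : IsFBM H P B) {c : ℝ} (hc : 0 < c) : IsFBM H P (scB H c B) := by
  obtain ⟨h1, h2, h3, h4, aH, h5, h6⟩ := hB
  refine ⟨fun ω => ?_, fun ω => ?_, fun t => ?_, fun n t d => ?_, aH, h5, fun s t => ?_⟩
  · unfold scB
    exact ((h1 ω).comp (continuous_const.mul continuous_id)).const_mul _ |>.congr fun _ => rfl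
  · simp [scB, h2]
  · exact (h3 _).const_mul _
  · obtain ⟨v, hv⟩ := h4 n (fun i => c * t i) (fun i => d i * c⁻¹ ^ H)
    refine ⟨v, ?_⟩
    rw [← hv]
    congr 1
    funext ω
    refine Finset.sum_congr rfl fun i _ => ?_
    simp only [scB]; ring
  · have e : ∀ ω, (scB H c B t ω - scB H c B s ω) ^ 2 = (c⁻¹ ^ H) ^ 2 * (B (c * t) ω - B (c * s) ω) ^ 2 := by
      intro ω; simp only [scB]; ring
    simp_rw [e]
    rw [integral_const_mul, h6, ← mul_sub, abs_mul, abs_of_pos hc, Real.mul_rpow hc.le (abs_nonneg _)]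
    have : (c⁻¹ ^ H) ^ 2 * c ^ (2 * H) = 1 := by
      have e2 : (c⁻¹ ^ H) ^ 2 = (c ^ (2 * H))⁻¹ := by
        rw [← Real.rpow_natCast, ← Real.rpow_mul (by positivity), Real.inv_rpow hc.le]
        congr 2; push_cast; ring
      rw [e2]; exact inv_mul_cancel₀ (Real.rpow_pos_of_pos hc _).ne'
    linear_combination aH * |t - s| ^ (2 * H) * this

lemma scB_bR (hB : IsFBM H P B) {c : ℝ} (hc : 0 < c) : bR H P (scB H c B) = bR H P B := by
  unfold bR bE
  congr 1
  refine iSup_congr fun θ => iSup_congr fun _ => ?_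
  unfold gE
  have h := fbm_law_block hB 0 hc
  have e : (fun ω r => c⁻¹ ^ H * (B (0 + c * r) ω - B 0 ω)) = fun (ω : Ω) r => scB H c B r ω := by
    funext ω r; simp [scB, hB.2.1 ω]
  rw [e] at h
  exact law_lintegral (fbm_meas (scB_fbm hB hc)) (fbm_meas hB) h (meas_ah_pi H θ)

lemma cH_half (hB : IsFBM H P B) (hH : 0 < H) : cH P B / 2 = bR H P B := by
  unfold cH bR
  rw [cHe_eq hB hH, ENNReal.toReal_mul]; simp

lemma upR_scale {w : ℝ → ℝ} (hw : Continuous w) {c s x a : ℝ} (hc : 0 < c) (hs : 0 < s) (hx : 0 < x) :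
    upR x (fun r => w r - a) 0 c = upR (s * x) (fun r => s * w (c * r) - s * a) 0 1 := by
  unfold upR
  rw [← Up_eq_upE (w := fun r => w r - a) (by fun_prop) hx,
    ← Up_eq_upE (w := fun r => s * w (c * r) - s * a) (by fun_prop) (by positivity)]
  have h := Up_affine (D := Icc 0 1) (α := 0) (β := x) (w := fun r => w r - a) (b := 0) (d := 0) hc hs
  have im : (fun r => c * r + 0) '' Icc (0 : ℝ) 1 = Icc 0 c := by
    ext y
    simp only [mem_image, mem_Icc]
    constructor
    · rintro ⟨r, ⟨h0, h1⟩, rfl⟩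
      exact ⟨by positivity, by nlinarith⟩
    · rintro ⟨h0, h1⟩
      exact ⟨y / c, ⟨by positivity, by rw [div_le_one hc]; exact h1⟩, by field_simp; ring⟩
  rw [im] at h
  rw [h]
  congr 1
  simp only [_root_.sub_zero, mul_zero, add_zero]
  congr 1
  funext r; ring

lemma main_thm (hB : IsFBM H P B) (hH : H ∈ Ioo (0 : ℝ) (1 / 2))
    (L : ℝ → ℝ → Ω → ℝ)
    (hLcont : ∀ ω, Continuous fun p : ℝ × ℝ => L p.1 p.2 ω)
    (hLocc : ∀ᵐ ω ∂P, ∀ t : ℝ, 0 ≤ t → ∀ f : ℝ → ℝ, Continuous f →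
        ∫ r in (0 : ℝ)..t, f (B r ω) = ∫ a : ℝ, f a * L t a ω)
    (a t : ℝ) (ht : 0 < t) (ε : ℕ → ℝ) (hεpos : ∀ n, 0 < ε n)
    (hε0 : Tendsto ε atTop (𝓝 0)) :
    ∀ᵐ ω ∂P, Tendsto
      (fun n => ε n ^ (1 / H - 1) * upR (ε n) (fun r => B r ω - a) 0 t)
      atTop (𝓝 (cH P B / 2 * L t a ω)) := by
  have h0 := hH.1
  set s : ℝ := t⁻¹ ^ H with hs
  have hs0 : 0 < s := by positivity
  have hLc : ∀ ω, Continuous fun y => t⁻¹ * s⁻¹ * L t (s⁻¹ * y) ω := fun ω =>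
    ((hLcont ω).comp (g := fun p : ℝ × ℝ => L p.1 p.2 ω) (f := fun y : ℝ => (t, s⁻¹ * y)) (by fun_prop)).const_mul _
      |>.congr fun _ => rfl
  have hLo : ∀ᵐ ω ∂P, ∀ f : ℝ → ℝ, Continuous f →
      ∫ r in (0 : ℝ)..1, f (scB H t B r ω) = ∫ y, f y * (t⁻¹ * s⁻¹ * L t (s⁻¹ * y) ω) := by
    filter_upwards [hLocc] with ω hω f hf
    have h := hω t ht.le (fun y => f (s * y)) (by fun_prop)
    have e1 : ∫ r in (0 : ℝ)..1, f (scB H t B r ω) = t⁻¹ * ∫ r in (0 : ℝ)..t, f (s * B r ω) := by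
      have := intervalIntegral.integral_comp_mul_left (a := 0) (b := 1) (fun r => f (s * B r ω)) ht.ne'
      simp only [mul_zero, mul_one, smul_eq_mul] at this
      exact this
    have e2 : ∫ y, f (s * y) * L t y ω = s⁻¹ * ∫ y, f y * L t (s⁻¹ * y) ω := by
      have := Measure.integral_comp_mul_left (fun y => f y * L t (s⁻¹ * y) ω) s
      rw [abs_of_pos (by positivity), smul_eq_mul] at this
      rw [← this]
      refine integral_congr_ae (Eventually.of_forall fun y => ?_)
      simp only
      rw [← mul_assoc, inv_mul_cancel₀ hs0.ne', one_mul]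
    rw [e1, h, e2, ← mul_assoc, ← integral_const_mul]
    refine integral_congr_ae (Eventually.of_forall fun y => ?_)
    simp only; ring
  filter_upwards [main_one (scB_fbm hB ht) hH hLc hLo (s * a)] with ω hω
  have h := hω.2
  rw [scB_bR hB ht] at h
  have hε : Tendsto (fun n => s * ε n) atTop (𝓝[>] 0) := by
    refine tendsto_nhdsWithin_iff.2 ⟨?_, Eventually.of_forall fun n => mul_pos hs0 (hεpos n)⟩
    have := hε0.const_mul s
    rwa [mul_zero] at this
  have h2 := (h.comp hε).const_mul ((s ^ (1 / H - 1))⁻¹)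
  rw [cH_half hB h0]
  have hsp : s ^ (1 / H - 1) * s = t⁻¹ := by
    rw [← Real.rpow_add_one hs0.ne', hs, ← Real.rpow_mul (by positivity)]
    have : H * (1 / H - 1 + 1) = 1 := by field_simp; ring
    rw [this, Real.rpow_one]
  have hsp0 : 0 < s ^ (1 / H - 1) := by positivity
  have elim : (s ^ (1 / H - 1))⁻¹ * (bR H P B * (t⁻¹ * s⁻¹ * L t (s⁻¹ * (s * a)) ω)) = bR H P B * L t a ω := by
    rw [← mul_assoc s⁻¹ s, inv_mul_cancel₀ hs0.ne', one_mul, ← hsp]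
    field_simp
  rw [elim] at h2
  refine h2.congr fun n => ?_
  simp only [Function.comp_apply]
  rw [upR_scale (hB.1 ω) ht hs0 (hεpos n), Real.mul_rpow hs0.le (hεpos n).le]
  have : (fun r => scB H t B r ω - s * a) = fun r => s * B (t * r) ω - s * a := rfl
  rw [this]
  field_simp

end P26

end

/-- **Local time via level crossings.** For `H < 1/2`, `a ∈ ℝ`, `t ∈ (0,∞)` and any
positive sequence `ε_n → 0`, almost surely
`ε_n^{1/H-1} U_{0,t}(ε_n, B^H - a) → (c_H/2) L_t^H(a)`. -/
theorem local_time_via_level_crossings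
    {Ω : Type*} [MeasurableSpace Ω] (P : Measure Ω) [IsProbabilityMeasure P]
    (H : ℝ) (hH : H ∈ Set.Ioo (0 : ℝ) (1 / 2)) (B : ℝ → Ω → ℝ) (hB : IsFBM H P B)
    (L : ℝ → ℝ → Ω → ℝ)
    (hLcont : ∀ ω, Continuous fun p : ℝ × ℝ => L p.1 p.2 ω)
    (hLocc : ∀ᵐ ω ∂P, ∀ t : ℝ, 0 ≤ t → ∀ f : ℝ → ℝ, Continuous f →
        ∫ r in (0 : ℝ)..t, f (B r ω) = ∫ a : ℝ, f a * L t a ω)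
    (a t : ℝ) (ht : 0 < t) (ε : ℕ → ℝ) (hεpos : ∀ n, 0 < ε n)
    (hε0 : Tendsto ε atTop (𝓝 0)) :
    ∀ᵐ ω ∂P, Tendsto
      (fun n => ε n ^ (1 / H - 1) * upR (ε n) (fun r => B r ω - a) 0 t)
      atTop (𝓝 (cH P B / 2 * L t a ω)) := by
  exact main_thm hB hH L hLcont hLocc a t ht ε hεpos hε0

end
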